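/- Let π ∈ ℤ[i] be a primary prime with p = π·π̄ ≡ 1 (mod 8). Then there exists a rational integer a_π such that the coefficient α_π of the elliptic Gauss sum satisfies: if p ≡ 1 (mod 16), α_π = a_π·i√2, a_π·√2, a_π·ζ₈, a_π·i·ζ₈ according as χ_π(1+i) = 1, −1, i, −i; and if p ≡ 9 (mod 16), α_π = a_π·i·ζ₈, a_π·ζ₈, a_π·i√2, a_π·√2 according as χ_π(1+i) = 1, −1, i, −i. In particular |α_π|² = 2·a_π² if χ_π(2) = 1 and |α_π|² = a_π² if χ_π(2) = −1. -/

import Mathlib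

open Complex BigOperators

noncomputable section

/-- The ring of Gaussian integers `ℤ[i]`, realized as a subring of `ℂ`. -/
def O4 : Subring ℂ := Subring.closure {Complex.I}

/-- `ζ₈ = e^{2πi/8}`, a primitive eighth root of unity. -/
def zeta8 : ℂ := Complex.exp (2 * Real.pi * Complex.I / 8)

/-- The ring `ℤ[ζ₈]`, realized as a subring of `ℂ`. -/
def O8 : Subring ℂ := Subring.closure {zeta8}

/-- The congruence `a ≡ b (mod c)` in `ℤ[i]`. -/
def GCong (a b c : ℂ) : Prop := ∃ d ∈ O4, a - b = c * d

/-- `a` and `b` are coprime in `ℤ[i]`. -/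
def GCoprime (a b : ℂ) : Prop := ∃ u ∈ O4, ∃ v ∈ O4, u * a + v * b = 1

/-- The real period `ϖ = 2∫₀¹ (1−x⁴)^{−1/2} dx`. -/
def varpi : ℝ := 2 * ∫ x in (0:ℝ)..(1:ℝ), (1 - x ^ 4) ^ (-(1:ℝ)/2)

/-- The points of the period lattice `ϖ·ℤ[i]`. -/
def ω4 (m : ℤ × ℤ) : ℂ := (varpi : ℂ) * ((m.1 : ℂ) + (m.2 : ℂ) * Complex.I)

/-- The Weierstrass `℘`-function of the period lattice `ϖ·ℤ[i]`
(so that `℘′² = 4℘³ − 4℘`). -/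
def wp4 (u : ℂ) : ℂ :=
  (u ^ 2)⁻¹ + ∑' m : ℤ × ℤ, if m = 0 then 0 else (((u - ω4 m) ^ 2)⁻¹ - ((ω4 m) ^ 2)⁻¹)

/-- The derivative `℘′` of the Weierstrass `℘`-function of `ϖ·ℤ[i]`. -/
def wp4' (u : ℂ) : ℂ := ∑' m : ℤ × ℤ, (-2) * ((u - ω4 m) ^ 3)⁻¹

/-- The Weierstrass `ζ`-function of the period lattice `ϖ·ℤ[i]`. -/
def wzeta4 (u : ℂ) : ℂ :=
  u⁻¹ + ∑' m : ℤ × ℤ, if m = 0 then 0 else ((u - ω4 m)⁻¹ + (ω4 m)⁻¹ + u * ((ω4 m) ^ 2)⁻¹)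

/-- The non-analytic doubly periodic function `Z(u) = ζ(ϖu) − (π/ϖ)·ū`. -/
def Z4 (u : ℂ) : ℂ :=
  wzeta4 ((varpi : ℂ) * u) - ((Real.pi / varpi : ℝ) : ℂ) * (starRingEnd ℂ) u

/-- The lemniscatic sine `φ(u) = sl((1−i)ϖu) = −2(1−i)·℘(ϖu)/℘′(ϖu)`,
of period lattice `ℤ[i]`. -/
def phi4 (u : ℂ) : ℂ :=
  -2 * (1 - Complex.I) * wp4 ((varpi : ℂ) * u) / wp4' ((varpi : ℂ) * u)

/-- The lemniscatic cosine `ψ(u) = cl((1−i)ϖu) = (℘(ϖu)+i)/(℘(ϖu)−i)`,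
of period lattice `ℤ[i]`. -/
def psi4 (u : ℂ) : ℂ :=
  (wp4 ((varpi : ℂ) * u) + Complex.I) / (wp4 ((varpi : ℂ) * u) - Complex.I)

/-- A residue class character modulo `β` on `ℤ[i]`. -/
structure IsResChar4 (β : ℂ) (χ : ℂ → ℂ) : Prop where
  periodic : ∀ a ∈ O4, ∀ b ∈ O4, GCong a b β → χ a = χ b
  map_mul : ∀ a ∈ O4, ∀ b ∈ O4, χ (a * b) = χ a * χ b
  map_one : χ 1 = 1
  vanish : ∀ a ∈ O4, ¬ GCoprime a β → χ a = 0

/-- The quartic residue character `χ_π = (·/π)₄` modulo a prime `π` with `p = π·π̄`: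
`χ_π(ν)⁴ = 1` and `χ_π(ν) ≡ ν^{(p−1)/4} (mod π)`. -/
structure IsQuarticChar (π : ℂ) (p : ℕ) (χ : ℂ → ℂ) : Prop where
  resChar : IsResChar4 π χ
  quart : ∀ ν ∈ O4, GCoprime ν π → χ ν ^ 4 = 1
  euler : ∀ ν ∈ O4, GCoprime ν π → GCong (χ ν) (ν ^ ((p - 1) / 4)) π

/-- The elliptic Gauss sum `G_π(χ, f) = (1/4)·Σ_{ν ∈ (ℤ[i]/(π))^×} χ(ν)·f(ν/π)`,
computed via the integer representatives `1, …, p−1` of `(ℤ[i]/(π))^× ≅ (ℤ/p)^×`. -/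
def EGS4 (p : ℕ) (χ f : ℂ → ℂ) (π : ℂ) : ℂ :=
  (1/4 : ℂ) * ∑ r ∈ Finset.Icc 1 (p - 1), χ (r : ℂ) * f ((r : ℂ) / π)

/-- `S` is a quarter set of `(ℤ[i]/(π))^×`, i.e. `(ℤ[i]/(π))^× = S ∪ −S ∪ iS ∪ −iS`. -/
def IsQuarterSet (π : ℂ) (S : Finset ℂ) : Prop :=
  (∀ ν ∈ S, ν ∈ O4 ∧ GCoprime ν π) ∧
  (∀ a ∈ O4, GCoprime a π →
    ∃ ν ∈ S, ∃ ε ∈ ({1, -1, Complex.I, -Complex.I} : Set ℂ), GCong a (ε * ν) π) ∧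
  (∀ ν ∈ S, ∀ μ ∈ S, ∀ ε ∈ ({1, -1, Complex.I, -Complex.I} : Set ℂ),
    ∀ ε' ∈ ({1, -1, Complex.I, -Complex.I} : Set ℂ),
      GCong (ε * ν) (ε' * μ) π → ν = μ ∧ ε = ε')

/-- `γ(S)`: if `p ≡ 5 (mod 8)`, the fourth root of unity with
`γ(S) ≡ ∏_{ν∈S} ν (mod π)`; if `p ≡ 1 (mod 8)`, the fourth root of `−1` with
`γ(S) ≡ ∏_{ν∈S} ν (mod Π)` for a fixed prime `Π` of `ℤ[ζ₈]` with `π = Π·Π′`. -/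
def IsGamma4 (π : ℂ) (p : ℕ) (S : Finset ℂ) (γ : ℂ) : Prop :=
  (p % 8 = 5 → γ ^ 4 = 1 ∧ GCong γ (∏ ν ∈ S, ν) π) ∧
  (p % 8 = 1 → γ ^ 4 = -1 ∧
    ∃ P : O8, Prime P ∧ (∃ Q : O8, π = (P : ℂ) * (Q : ℂ)) ∧
      ∃ d ∈ O8, γ - ∏ ν ∈ S, ν = (P : ℂ) * d)

/-- `L` is the value at `s = 1` of the analytic continuation of the Hecke `L`-series
`L(s, χ̃) = Σ_𝔞 χ̃(𝔞)·N𝔞^{−s} = (1/4)·Σ_{ν ∈ ℤ[i]} χ₁(ν)·ν̄·|ν|^{−2s}` attached to the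
weight-one Hecke character `χ̃((ν)) = χ₁(ν)·ν̄` of `ℚ(i)`. -/
def IsLValue4 (χ₁ : ℂ → ℂ) (L : ℂ) : Prop :=
  ∃ F : ℂ → ℂ, DifferentiableOn ℂ F {s : ℂ | 0 < s.re} ∧
    (∀ s : ℂ, 3/2 < s.re →
      F s = (1/4 : ℂ) *
        ∑' ν : O4, χ₁ (ν : ℂ) * (starRingEnd ℂ) (ν : ℂ) *
          ((Complex.normSq (ν : ℂ) : ℂ) ^ (-s))) ∧
    F 1 = L

/-- `T` is a complete residue system modulo `β` in `ℤ[i]`. -/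
def IsCRS4 (β : ℂ) (T : Finset ℂ) : Prop :=
  (∀ a ∈ T, a ∈ O4) ∧ (∀ a ∈ T, ∀ b ∈ T, GCong a b β → a = b) ∧
  (∀ z ∈ O4, ∃ a ∈ T, GCong z a β)

/-- `e^{2πi·Re(z)}`. -/
def eRe4 (z : ℂ) : ℂ := Complex.exp (2 * Real.pi * Complex.I * (z.re : ℂ))

/-- `χ₀`: the character mod `(1+i)³` giving the natural isomorphism
`(ℤ[i]/(1+i)³)^× ≅ W`, i.e. `χ₀(ν) = ε` for `ν ≡ ε (mod (1+i)³)`, `ε ∈ W = {±1, ±i}`. -/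
def IsChi0₄ (χ₀ : ℂ → ℂ) : Prop :=
  IsResChar4 ((1 + Complex.I) ^ 3) χ₀ ∧
    ∀ ε ∈ ({1, -1, Complex.I, -Complex.I} : Set ℂ), χ₀ ε = ε

/-- `χ₀′`: the character mod `(1+i)² = 2i` giving `(ℤ[i]/(2))^× ≅ {±1}`, i.e.
`χ₀′(ν) = δ²` for `ν ≡ δ (mod (1+i)²)`, `δ ∈ {1, i}`. -/
def IsChi0'₄ (χ₀' : ℂ → ℂ) : Prop :=
  IsResChar4 2 χ₀' ∧ χ₀' Complex.I = -1

/-- The classical quartic Gauss sum `G₄(π) = Σ_{r=1}^{p−1} (r/π)₄·e^{2πir/p}`. -/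
def G4sum (p : ℕ) (χ : ℂ → ℂ) : ℂ :=
  ∑ r ∈ Finset.Icc 1 (p - 1), χ (r : ℂ) * Complex.exp (2 * Real.pi * Complex.I * (r : ℂ) / (p : ℂ))

set_option linter.unusedSectionVars false

section
open Filter Topology Set

/-- A function that is multiplied by constants under `z ↦ z + 1` and `z ↦ z + i` is multiplied
by the corresponding powers under translation by a Gaussian integer. -/
theorem norm_translate {g : ℂ → ℂ} {c₁ c₂ : ℂ} (hc₁ : ‖c₁‖ = 1) (hc₂ : ‖c₂‖ = 1)
    (h₁ : ∀ z, g (z + 1) = c₁ * g z) (h₂ : ∀ z, g (z + I) = c₂ * g z) (m n : ℤ) (z : ℂ) :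
    ‖g (z + m + n * I)‖ = ‖g z‖ := by
  have a₁ : ∀ (m : ℤ) z, ‖g (z + m)‖ = ‖g z‖ := by
    intro m
    induction m using Int.induction_on with
    | zero => simp
    | succ i ih =>
      intro z
      have := h₁ (z + i)
      rw [← ih z]
      push_cast at *
      rw [← add_assoc, this, norm_mul, hc₁, one_mul]
    | pred i ih =>
      intro z
      have := h₁ (z + ((-i - 1 : ℤ) : ℂ))
      rw [← ih z]
      push_cast at *
      rw [show z + (-(i : ℂ) - 1) + 1 = z + -i by ring] at this
      rw [this, norm_mul, hc₁, one_mul]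
  have a₂ : ∀ (n : ℤ) z, ‖g (z + n * I)‖ = ‖g z‖ := by
    intro m
    induction m using Int.induction_on with
    | zero => simp
    | succ i ih =>
      intro z
      have := h₂ (z + i * I)
      rw [← ih z]
      push_cast at *
      rw [show z + (i + 1) * I = z + i * I + I by ring, this, norm_mul, hc₂, one_mul]
    | pred i ih =>
      intro z
      have := h₂ (z + ((-i - 1 : ℤ) : ℂ) * I)
      rw [← ih z]
      push_cast at *
      rw [show z + (-(i : ℂ) - 1) * I + I = z + -i * I by ring] at this
      rw [this, norm_mul, hc₂, one_mul]
  rw [a₂, a₁]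

theorem meromorphicOrderAt_sub_self (z : ℂ) : meromorphicOrderAt (fun w : ℂ => w - z) z = 1 := by
  simp

theorem liouville_const {f : ℂ → ℂ} {c₁ c₂ : ℂ} (hf : ∀ z, MeromorphicAt f z)
    (hc₁ : ‖c₁‖ = 1) (hc₂ : ‖c₂‖ = 1)
    (h₁ : ∀ z, f (z + 1) = c₁ * f z) (h₂ : ∀ z, f (z + I) = c₂ * f z)
    (hlim : ∀ z, Tendsto (fun w => (w - z) * f w) (𝓝[≠] z) (𝓝 0)) :
    ∃ C, (∀ z, ∀ᶠ w in 𝓝[≠] z, f w = C) ∧ c₁ * C = C ∧ c₂ * C = C := by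
  have hord : ∀ z, 0 ≤ meromorphicOrderAt f z := by
    intro z
    have hs : MeromorphicAt (fun w : ℂ => w - z) z := by fun_prop
    have h := (tendsto_zero_iff_meromorphicOrderAt_pos (hs.mul (hf z))).1 (hlim z)
    rw [meromorphicOrderAt_mul hs (hf z)] at h
    rw [meromorphicOrderAt_sub_self] at h
    cases hh : meromorphicOrderAt f z with
    | top => simp
    | coe a =>
      rw [hh] at h
      have : (0 : WithTop ℤ) < ((1 + a : ℤ) : WithTop ℤ) := by simpa using h
      have h2 : (0 : ℤ) < 1 + a := by exact_mod_cast this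
      exact_mod_cast (by omega : (0 : ℤ) ≤ a)
  have hfm : MeromorphicOn f univ := fun z _ => hf z
  set g := toMeromorphicNFOn f univ with hg
  have hga : ∀ z, AnalyticAt ℂ g z := by
    intro z
    have := (meromorphicNFOn_toMeromorphicNFOn f univ) (mem_univ z)
    rw [← this.meromorphicOrderAt_nonneg_iff_analyticAt,
      meromorphicOrderAt_toMeromorphicNFOn hfm (mem_univ z)]
    exact hord z
  have hgf : ∀ z, ∀ᶠ w in 𝓝[≠] z, f w = g w := fun z =>
    (hfm.toMeromorphicNFOn_eq_self_on_nhdsNE (mem_univ z)).symm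
  have htr : ∀ (a c : ℂ), (∀ z, f (z + a) = c * f z) → ∀ z, g (z + a) = c * g z := by
    intro a c h z
    have e : ∀ᶠ w in 𝓝[≠] z, g (w + a) = c * g w := by
      have : Tendsto (fun w : ℂ => w + a) (𝓝[≠] z) (𝓝[≠] (z + a)) := by
        refine tendsto_nhdsWithin_iff.2 ⟨?_, ?_⟩
        · exact ((continuous_id.add continuous_const).tendsto z).mono_left nhdsWithin_le_nhds
        · filter_upwards [self_mem_nhdsWithin] with w hw
          simpa using hw
      filter_upwards [hgf z, this.eventually (hgf (z + a))] with w hw hw'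
      rw [← hw', ← hw, h]
    have t1 : Tendsto (fun w => g (w + a)) (𝓝[≠] z) (𝓝 (g (z + a))) := by
      have : ContinuousAt (fun w => g (w + a)) z :=
        ContinuousAt.comp (f := fun w : ℂ => w + a) (hga (z + a)).continuousAt (by fun_prop)
      exact this.tendsto.mono_left nhdsWithin_le_nhds
    have t2 : Tendsto (fun w => c * g w) (𝓝[≠] z) (𝓝 (c * g z)) :=
      ((hga z).continuousAt.const_mul c).tendsto.mono_left nhdsWithin_le_nhds
    exact tendsto_nhds_unique (t1.congr' e) t2
  have g₁ := htr 1 c₁ h₁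
  have g₂ := htr I c₂ h₂
  have hdiff : Differentiable ℂ g := fun z => (hga z).differentiableAt
  have hK : IsCompact ((Icc (0 : ℝ) 1) ×ℂ (Icc (0 : ℝ) 1)) := isCompact_Icc.reProdIm isCompact_Icc
  obtain ⟨B, hB⟩ := hK.exists_bound_of_continuousOn hdiff.continuous.continuousOn
  have hbd : Bornology.IsBounded (range g) := by
    refine isBounded_iff_forall_norm_le.2 ⟨B, ?_⟩
    rintro _ ⟨z, rfl⟩
    have := norm_translate hc₁ hc₂ g₁ g₂ (-⌊z.re⌋) (-⌊z.im⌋) z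
    rw [← this]
    refine hB _ ?_
    rw [mem_reProdIm]
    simp only [add_re, intCast_re, mul_re, I_re, mul_zero, intCast_im, I_im, mul_one, sub_self,
      add_im, mul_im, add_zero, Int.cast_neg, neg_re, neg_im, neg_zero]
    refine ⟨⟨?_, ?_⟩, ?_, ?_⟩
    · linarith [Int.floor_le z.re]
    · linarith [Int.lt_floor_add_one z.re]
    · linarith [Int.floor_le z.im]
    · linarith [Int.lt_floor_add_one z.im]
  have hconst : ∀ z, g z = g 0 := fun z => hdiff.apply_eq_apply_of_bounded hbd z 0
  refine ⟨g 0, fun z => ?_, ?_, ?_⟩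
  · filter_upwards [hgf z] with w hw
    rw [hw, hconst]
  · rw [← g₁ 0, hconst]
  · rw [← g₂ 0, hconst]

/-- Uniqueness principle: two functions with the same nontrivial multipliers whose difference
has no poles agree wherever both are continuous. -/
theorem liouville_eq {f h : ℂ → ℂ} {c₁ c₂ : ℂ} (hf : ∀ z, MeromorphicAt f z)
    (hh : ∀ z, MeromorphicAt h z) (hc₁ : ‖c₁‖ = 1) (hc₂ : ‖c₂‖ = 1) (hne : c₁ ≠ 1 ∨ c₂ ≠ 1)
    (f₁ : ∀ z, f (z + 1) = c₁ * f z) (f₂ : ∀ z, f (z + I) = c₂ * f z)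
    (h₁ : ∀ z, h (z + 1) = c₁ * h z) (h₂ : ∀ z, h (z + I) = c₂ * h z)
    (hlim : ∀ z, ∃ r, Tendsto (fun w => (w - z) * f w) (𝓝[≠] z) (𝓝 r) ∧
      Tendsto (fun w => (w - z) * h w) (𝓝[≠] z) (𝓝 r))
    {z : ℂ} (cf : ContinuousAt f z) (ch : ContinuousAt h z) : f z = h z := by
  obtain ⟨C, hC, e₁, e₂⟩ := liouville_const (f := fun z => f z - h z) (c₁ := c₁) (c₂ := c₂)
    (fun z => (hf z).sub (hh z)) hc₁ hc₂ (fun z => by rw [f₁, h₁]; ring)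
    (fun z => by rw [f₂, h₂]; ring) (fun z => by
      obtain ⟨r, hr, hr'⟩ := hlim z
      simpa [mul_sub] using hr.sub hr')
  have C0 : C = 0 := by
    by_contra hC0
    rcases hne with h | h
    · exact h (mul_right_cancel₀ hC0 (by rw [e₁, one_mul]))
    · exact h (mul_right_cancel₀ hC0 (by rw [e₂, one_mul]))
  have t : Tendsto (fun w => f w - h w) (𝓝[≠] z) (𝓝 (f z - h z)) :=
    (cf.sub ch).tendsto.mono_left nhdsWithin_le_nhds
  have t2 : Tendsto (fun w => f w - h w) (𝓝[≠] z) (𝓝 0) :=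
    tendsto_const_nhds.congr' ((hC z).mono fun w hw => (hw.trans C0).symm)
  exact sub_eq_zero.1 (tendsto_nhds_unique t t2)

end

section
open Filter Topology Set

/-- The summand `e^{2πβz}/cosh(πz)`. -/
def sechExp (β : ℝ) (z : ℂ) : ℂ := exp (2 * Real.pi * β * z) / cosh (Real.pi * z)

/-- The elliptic function of the second kind `Σ_m c^m e^{2πβ(z-m-1/2)}/cosh(π(z-m-1/2))`. -/
def sechSum (c : ℂ) (β : ℝ) (z : ℂ) : ℂ := ∑' m : ℤ, c ^ m * sechExp β (z - m - 1 / 2)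

theorem norm_sechExp_le {β : ℝ} {z : ℂ} (hz : 1 / 2 ≤ |z.re|) :
    ‖sechExp β z‖ ≤ 4 * Real.exp (-(Real.pi * (1 - 2 * |β|)) * |z.re|) := by
  have hpi := Real.pi_gt_three
  have key : Real.exp (Real.pi * |z.re|) / 4 ≤ ‖cosh (Real.pi * z)‖ := by
    have h1 : 1 ≤ Real.pi * |z.re| := by nlinarith
    have h2 : (2 : ℝ) ≤ Real.exp (Real.pi * |z.re|) := by
      linarith [Real.add_one_le_exp (Real.pi * |z.re|)]
    have h4 : Real.exp (-(Real.pi * |z.re|)) ≤ 1 / 2 := by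
      rw [Real.exp_neg]
      rw [inv_le_comm₀ (Real.exp_pos _) (by norm_num)]
      simpa using h2
    have h3 : cosh (Real.pi * z) = (exp (Real.pi * z) + exp (-(Real.pi * z))) / 2 := rfl
    have r1 : ‖exp (Real.pi * z)‖ = Real.exp (Real.pi * z.re) := by
      rw [norm_exp]; simp
    have r2 : ‖exp (-(Real.pi * z))‖ = Real.exp (-(Real.pi * z.re)) := by
      rw [norm_exp]; simp
    rw [h3, norm_div, Complex.norm_two]
    rcases le_total 0 z.re with h | h
    · rw [abs_of_nonneg h] at *
      have := norm_sub_le_norm_add (exp (Real.pi * z)) (exp (-(Real.pi * z)))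
      rw [r1, r2] at this
      linarith
    · rw [abs_of_nonpos h] at *
      have := norm_sub_le_norm_add (exp (-(Real.pi * z))) (exp (Real.pi * z))
      rw [r1, r2, add_comm (exp _)] at this
      rw [mul_neg] at *
      rw [neg_neg] at h4
      linarith
  rw [sechExp, norm_div, norm_exp]
  have e1 : (2 * Real.pi * β * z : ℂ).re = 2 * Real.pi * β * z.re := by
    rw [show (2 * Real.pi * β : ℂ) = ((2 * Real.pi * β : ℝ) : ℂ) by push_cast; ring, re_ofReal_mul]
  rw [e1, div_le_iff₀ (lt_of_lt_of_le (by positivity) key)]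
  have e2 : 2 * Real.pi * β * z.re ≤ 2 * Real.pi * |β| * |z.re| := by
    have := le_abs_self (β * z.re)
    rw [abs_mul] at this
    nlinarith
  calc Real.exp (2 * Real.pi * β * z.re) ≤ Real.exp (2 * Real.pi * |β| * |z.re|) :=
        Real.exp_le_exp.2 e2
    _ = 4 * Real.exp (-(Real.pi * (1 - 2 * |β|)) * |z.re|) * (Real.exp (Real.pi * |z.re|) / 4) := by
        rw [show 2 * Real.pi * |β| * |z.re| =
          -(Real.pi * (1 - 2 * |β|)) * |z.re| + Real.pi * |z.re| by ring, Real.exp_add]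
        ring
    _ ≤ _ := by gcongr

theorem summable_exp_neg_abs {δ : ℝ} (hδ : 0 < δ) :
    Summable fun m : ℤ => Real.exp (-δ * |(m : ℝ)|) := by
  have h : Summable fun n : ℕ => Real.exp (-δ * (n : ℝ)) := by
    have := Real.summable_exp_nat_mul_iff.2 (neg_lt_zero.2 hδ)
    simpa [mul_comm] using this
  refine Summable.of_nat_of_neg ?_ ?_ <;> simpa using h

theorem norm_sechSum_term_le {c : ℂ} (hc : ‖c‖ = 1) {β : ℝ} (hβ : |β| < 1 / 2) {R : ℝ} {z : ℂ}
    (hz : |z.re| < R) {m : ℤ} (hm : R + 1 ≤ |(m : ℝ)|) :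
    ‖c ^ m * sechExp β (z - m - 1 / 2)‖ ≤
      4 * Real.exp ((Real.pi * (1 - 2 * |β|)) * (R + 1 / 2)) *
        Real.exp (-(Real.pi * (1 - 2 * |β|)) * |(m : ℝ)|) := by
  have hre : (z - m - 1 / 2 : ℂ).re = z.re - m - 1 / 2 := by simp
  have h1 : |(m : ℝ)| - R - 1 / 2 ≤ |(z - m - 1 / 2 : ℂ).re| := by
    rw [hre]
    cases abs_cases (z.re - m - 1 / 2) <;> cases abs_cases z.re <;> cases abs_cases (m : ℝ) <;>
      linarith
  have hδ : 0 < Real.pi * (1 - 2 * |β|) := mul_pos Real.pi_pos (by linarith)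
  rw [norm_mul, norm_zpow, hc, one_zpow, one_mul]
  refine (norm_sechExp_le (by linarith)).trans ?_
  rw [mul_assoc, ← Real.exp_add]
  gcongr
  nlinarith

theorem summable_sechSum {c : ℂ} (hc : ‖c‖ = 1) {β : ℝ} (hβ : |β| < 1 / 2) (z : ℂ) :
    Summable fun m : ℤ => c ^ m * sechExp β (z - m - 1 / 2) := by
  have hδ : 0 < Real.pi * (1 - 2 * |β|) := mul_pos Real.pi_pos (by linarith)
  refine Summable.of_norm_bounded_eventually
    (g := fun m : ℤ => 4 * Real.exp ((Real.pi * (1 - 2 * |β|)) * ((|z.re| + 1) + 1 / 2)) *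
        Real.exp (-(Real.pi * (1 - 2 * |β|)) * |(m : ℝ)|))
    ((summable_exp_neg_abs hδ).mul_left _) ?_
  have : {m : ℤ | ¬ (|z.re| + 1 + 1 ≤ |(m : ℝ)|)}.Finite := by
    refine (Set.finite_Icc (-⌈|z.re| + 2⌉) ⌈|z.re| + 2⌉).subset ?_
    intro m hm
    simp only [not_le, mem_ofPred_eq] at hm
    have h2 := abs_lt.1 (show |(m : ℝ)| < |z.re| + 2 by linarith)
    have h3 := Int.le_ceil (|z.re| + 2)
    constructor
    · have : (-(⌈|z.re| + 2⌉ : ℤ) : ℝ) ≤ m := by linarith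
      exact_mod_cast this
    · have : (m : ℝ) ≤ (⌈|z.re| + 2⌉ : ℤ) := by linarith
      exact_mod_cast this
  refine (this.subset ?_)
  intro m hm h
  exact hm (norm_sechSum_term_le hc hβ (by linarith) h)

theorem analyticAt_sechExp {β : ℝ} {z : ℂ} (hz : cosh (Real.pi * z) ≠ 0) :
    AnalyticAt ℂ (sechExp β) z := by
  unfold sechExp
  refine AnalyticAt.div ?_ ?_ hz
  · fun_prop
  · exact (Complex.differentiable_cosh.comp (by fun_prop)).analyticAt z

theorem cosh_pi_mul_ne_zero {z : ℂ} (hz : z.re ≠ 0) : cosh (Real.pi * z) ≠ 0 := by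
  intro h
  have h3 : (exp (Real.pi * z) + exp (-(Real.pi * z))) / 2 = 0 := h
  have h4 : exp (Real.pi * z) = -exp (-(Real.pi * z)) := by linear_combination 2 * h3
  have h5 := congrArg norm h4
  rw [norm_neg, norm_exp, norm_exp, Real.exp_eq_exp] at h5
  simp at h5
  have := Real.pi_pos
  apply hz
  nlinarith

theorem sechSum_split {c : ℂ} (hc : ‖c‖ = 1) {β : ℝ} (hβ : |β| < 1 / 2) (z : ℂ) (F : Finset ℤ)
    (hF : ∀ m ∉ F, cosh (Real.pi * (z - m - 1 / 2)) ≠ 0) :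
    ∃ A : ℂ → ℂ, AnalyticAt ℂ A z ∧
      ∀ w, sechSum c β w = ∑ m ∈ F, c ^ m * sechExp β (w - m - 1 / 2) + A w := by
  have hδ : 0 < Real.pi * (1 - 2 * |β|) := mul_pos Real.pi_pos (by linarith)
  obtain ⟨N, hN⟩ := exists_nat_ge (|z.re| + 1 + 1)
  set G := F ∪ Finset.Icc (-(N : ℤ)) N with hG
  set T : ℂ → ℂ := fun w => ∑' m : ℤ, if m ∈ G then 0 else c ^ m * sechExp β (w - m - 1 / 2)
    with hT
  have hTan : AnalyticAt ℂ T z := by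
    set U : Set ℂ := {w | |w.re| < |z.re| + 1}
    have hU : IsOpen U := isOpen_lt (by fun_prop) (by fun_prop)
    have hlarge : ∀ m ∉ G, |z.re| + 1 + 1 ≤ |(m : ℝ)| := by
      intro m hm
      rw [hG, Finset.mem_union, Finset.mem_Icc, not_or, not_and_or] at hm
      have : (N : ℤ) ≤ |m| := by
        rcases hm.2 with h | h
        · rw [abs_of_neg] <;> omega
        · rw [abs_of_pos] <;> omega
      have : (N : ℝ) ≤ |(m : ℝ)| := by exact_mod_cast this
      linarith
    have : DifferentiableOn ℂ T U := by
      refine differentiableOn_tsum_of_summable_norm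
        (u := fun m : ℤ => 4 * Real.exp ((Real.pi * (1 - 2 * |β|)) * ((|z.re| + 1) + 1 / 2)) *
        Real.exp (-(Real.pi * (1 - 2 * |β|)) * |(m : ℝ)|))
        ((summable_exp_neg_abs hδ).mul_left _) ?_ hU ?_
      · intro m
        by_cases hm : m ∈ G
        · simp [hm]
        · simp only [hm, if_false]
          intro w hw
          have hw' : |w.re| < |z.re| + 1 := hw
          have h2 := hlarge m hm
          have : cosh (Real.pi * (w - m - 1 / 2)) ≠ 0 := by
            refine cosh_pi_mul_ne_zero ?_
            intro h0
            have h3 : w.re - m - 1 / 2 = 0 := by simpa using h0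
            cases abs_cases (m : ℝ) <;> cases abs_cases w.re <;> linarith
          have h5 := (analyticAt_sechExp (β := β) this).differentiableAt
          exact ((h5.comp w (by fun_prop : DifferentiableAt ℂ (fun w : ℂ => w - m - 1 / 2) w)).const_mul _).differentiableWithinAt
      · intro m w hw
        by_cases hm : m ∈ G
        · simp only [hm, if_true, norm_zero]; positivity
        · simp only [hm, if_false]
          exact norm_sechSum_term_le hc hβ hw (hlarge m hm)
    exact this.analyticAt (hU.mem_nhds (by show |z.re| < |z.re| + 1; linarith))
  refine ⟨fun w => ∑ m ∈ G \ F, c ^ m * sechExp β (w - m - 1 / 2) + T w, ?_, ?_⟩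
  · refine AnalyticAt.fun_add ?_ hTan
    refine Finset.analyticAt_fun_sum _ fun m hm => ?_
    have h5 := analyticAt_sechExp (β := β) (hF m (Finset.mem_sdiff.1 hm).2)
    exact analyticAt_const.mul (h5.fun_comp (f := fun w : ℂ => w - m - 1 / 2) (by fun_prop))
  · intro w
    have hs := summable_sechSum hc hβ w
    rw [← add_assoc, add_comm (∑ m ∈ F, _), Finset.sum_sdiff Finset.subset_union_left, sechSum]
    have h1 : HasSum (fun m : ℤ => if m ∈ G then c ^ m * sechExp β (w - m - 1 / 2) else 0)
        (∑ m ∈ G, c ^ m * sechExp β (w - m - 1 / 2)) := by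
      have := hasSum_sum_of_ne_finset_zero (L := .unconditional ℤ)
        (f := fun m : ℤ => if m ∈ G then c ^ m * sechExp β (w - m - 1 / 2) else 0) (s := G)
        (by intro b hb; simp [hb])
      rwa [Finset.sum_congr rfl (fun m hm => if_pos hm)] at this
    have h2 := hs.hasSum.sub h1
    have h3 : T w = ∑' m : ℤ, c ^ m * sechExp β (w - m - 1 / 2)
        - ∑ m ∈ G, c ^ m * sechExp β (w - m - 1 / 2) := by
      rw [hT, ← h2.tsum_eq]
      refine tsum_congr fun m => ?_
      split_ifs <;> simp
    rw [h3]; ring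

theorem meromorphicAt_sechExp (β : ℝ) (z : ℂ) : MeromorphicAt (sechExp β) z := by
  unfold sechExp
  refine MeromorphicAt.div ?_ ?_
  · exact AnalyticAt.meromorphicAt (by fun_prop)
  · exact ((Complex.differentiable_cosh.comp (by fun_prop)).analyticAt z).meromorphicAt

theorem meromorphicAt_sechSum {c : ℂ} (hc : ‖c‖ = 1) {β : ℝ} (hβ : |β| < 1 / 2) (z : ℂ) :
    MeromorphicAt (sechSum c β) z := by
  obtain ⟨N, hN⟩ := exists_nat_ge (|z.re| + 1)
  obtain ⟨A, hA, h⟩ := sechSum_split hc hβ z (Finset.Icc (-(N : ℤ)) N) (by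
    intro m hm
    refine cosh_pi_mul_ne_zero ?_
    intro h0
    have h3 : z.re - m - 1 / 2 = 0 := by simpa using h0
    apply hm
    rw [Finset.mem_Icc]
    have h4 := abs_le.1 (show |z.re| ≤ N - 1 by linarith)
    constructor
    · have : (-(N : ℤ) : ℝ) ≤ m := by push_cast; linarith
      exact_mod_cast this
    · have : (m : ℝ) ≤ (N : ℤ) := by push_cast; linarith
      exact_mod_cast this)
  rw [show sechSum c β = _ from funext h]
  refine MeromorphicAt.fun_add ?_ hA.meromorphicAt
  refine MeromorphicAt.fun_sum fun m _ => ?_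
  refine MeromorphicAt.mul (.const _ _) ?_
  exact (meromorphicAt_sechExp β (z - m - 1 / 2)).comp_analyticAt
    (f := sechExp β) (g := fun w : ℂ => w - m - 1 / 2) (by fun_prop)

theorem sechSum_add_one {c : ℂ} (hc : ‖c‖ = 1) (β : ℝ) (z : ℂ) :
    sechSum c β (z + 1) = c * sechSum c β z := by
  have hc0 : c ≠ 0 := by rintro rfl; simp at hc
  rw [sechSum, ← (Equiv.addRight (1 : ℤ)).tsum_eq, sechSum, ← tsum_mul_left]
  congr 1; ext m
  simp only [Equiv.coe_addRight]
  rw [zpow_add_one₀ hc0, show z + 1 - ((m + 1 : ℤ) : ℂ) - 1 / 2 = z - m - 1 / 2 by push_cast; ring]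
  ring

theorem cosh_pi_add_I (z : ℂ) : cosh (Real.pi * (z + I)) = -cosh (Real.pi * z) := by
  rw [mul_add, cosh_add, cosh_mul_I, sinh_mul_I]; simp

theorem sechExp_add_I (β : ℝ) (z : ℂ) :
    sechExp β (z + I) = -exp (2 * Real.pi * I * β) * sechExp β z := by
  rw [sechExp, sechExp, cosh_pi_add_I, mul_add, exp_add]
  rw [show 2 * Real.pi * β * I = 2 * Real.pi * I * (β : ℂ) by ring]
  ring

theorem sechSum_add_I (c : ℂ) (β : ℝ) (z : ℂ) :
    sechSum c β (z + I) = -exp (2 * Real.pi * I * β) * sechSum c β z := by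
  rw [sechSum, sechSum, ← tsum_mul_left]
  congr 1; ext m
  rw [show z + I - m - 1 / 2 = z - m - 1 / 2 + I by ring, sechExp_add_I]
  ring

theorem cosh_pi_mul_eq_zero {z : ℂ} (h : cosh (Real.pi * z) = 0) : ∃ n : ℤ, z = (n + 1 / 2) * I := by
  have h1 : cos (Real.pi * z * I) = 0 := by rw [cos_mul_I, h]
  obtain ⟨k, hk⟩ := Complex.cos_eq_zero_iff.1 h1
  have hpi : (Real.pi : ℂ) ≠ 0 := by exact_mod_cast Real.pi_ne_zero
  refine ⟨-k - 1, ?_⟩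
  have : z * I = (2 * k + 1) / 2 := by
    apply mul_left_cancel₀ hpi
    linear_combination hk
  push_cast
  linear_combination (-I) * this + z * I_sq

theorem analyticAt_sechSum {c : ℂ} (hc : ‖c‖ = 1) {β : ℝ} (hβ : |β| < 1 / 2) {z : ℂ}
    (hz : ∀ m n : ℤ, z ≠ (1 + I) / 2 + m + n * I) : AnalyticAt ℂ (sechSum c β) z := by
  obtain ⟨A, hA, h⟩ := sechSum_split hc hβ z ∅ (by
    intro m _ h0
    obtain ⟨n, hn⟩ := cosh_pi_mul_eq_zero h0
    refine hz m n ?_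
    linear_combination hn)
  rw [show sechSum c β = A from funext fun w => by simpa using h w]
  exact hA

theorem residue_sechExp (β : ℝ) :
    Tendsto (fun w => (w - I / 2) * sechExp β w) (𝓝[≠] (I / 2))
      (𝓝 (exp (Real.pi * I * β) / (Real.pi * I))) := by
  have hpi : (Real.pi : ℂ) ≠ 0 := by exact_mod_cast Real.pi_ne_zero
  have hz : cosh (Real.pi * (I / 2)) = 0 := by
    rw [show (Real.pi * (I / 2) : ℂ) = (Real.pi / 2) * I by ring, cosh_mul_I, Complex.cos_pi_div_two]
  have hd : HasDerivAt (fun w : ℂ => cosh (Real.pi * w)) (Real.pi * I) (I / 2) := by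
    have h1 : HasDerivAt (fun w : ℂ => Real.pi * w) Real.pi (I / 2) := by
      simpa using (hasDerivAt_id (I / 2)).const_mul (Real.pi : ℂ)
    have := (Complex.hasDerivAt_cosh (Real.pi * (I / 2))).comp (I / 2) h1
    rw [show (Real.pi * (I / 2) : ℂ) = (Real.pi / 2) * I by ring, sinh_mul_I, Complex.sin_pi_div_two,
      one_mul, mul_comm] at this
    exact this
  have h2 := hasDerivAt_iff_tendsto_slope.1 hd
  have h3 := h2.inv₀ (mul_ne_zero hpi I_ne_zero)
  have h4 : Tendsto (fun w : ℂ => exp (2 * Real.pi * β * w)) (𝓝[≠] (I / 2))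
      (𝓝 (exp (Real.pi * I * β))) := by
    have : ContinuousAt (fun w : ℂ => exp (2 * Real.pi * β * w)) (I / 2) := by fun_prop
    have := this.tendsto.mono_left (nhdsWithin_le_nhds (s := {I / 2}ᶜ))
    rwa [show (2 * Real.pi * β * (I / 2) : ℂ) = Real.pi * I * β by ring] at this
  refine (h4.mul h3).congr' ?_
  filter_upwards [self_mem_nhdsWithin] with w hw
  rw [slope_def_field, hz, sub_zero, inv_div, sechExp]
  ring

theorem residue_sechSum {c : ℂ} (hc : ‖c‖ = 1) {β : ℝ} (hβ : |β| < 1 / 2) :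
    Tendsto (fun w => (w - (1 + I) / 2) * sechSum c β w) (𝓝[≠] ((1 + I) / 2))
      (𝓝 (exp (Real.pi * I * β) / (Real.pi * I))) := by
  obtain ⟨A, hA, h⟩ := sechSum_split hc hβ ((1 + I) / 2) {0} (by
    intro m hm
    refine cosh_pi_mul_ne_zero ?_
    intro h0
    have h3 : (m : ℝ) = 0 := by simpa using h0
    exact hm (by simpa using h3))
  have h1 : Tendsto (fun w : ℂ => w - 1 / 2) (𝓝[≠] ((1 + I) / 2)) (𝓝[≠] (I / 2)) := by
    refine tendsto_nhdsWithin_iff.2 ⟨?_, ?_⟩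
    · have : ContinuousAt (fun w : ℂ => w - 1 / 2) ((1 + I) / 2) := by fun_prop
      have := this.tendsto.mono_left (nhdsWithin_le_nhds (s := {(1 + I) / 2}ᶜ))
      rwa [show (1 + I) / 2 - 1 / 2 = I / 2 by ring] at this
    · filter_upwards [self_mem_nhdsWithin] with w hw hw'
      apply hw
      simp only [mem_singleton_iff] at *
      linear_combination hw'
  have h2 := (residue_sechExp β).comp h1
  have h3 : Tendsto (fun w => (w - (1 + I) / 2) * A w) (𝓝[≠] ((1 + I) / 2)) (𝓝 0) := by
    have : ContinuousAt (fun w => (w - (1 + I) / 2) * A w) ((1 + I) / 2) :=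
      ContinuousAt.mul (by fun_prop) hA.continuousAt
    have := this.tendsto.mono_left (nhdsWithin_le_nhds (s := {(1 + I) / 2}ᶜ))
    simpa using this
  have h4 := h2.add h3
  rw [add_zero] at h4
  refine h4.congr fun w => ?_
  rw [h]
  simp only [Function.comp, Finset.sum_singleton, zpow_zero, one_mul, Int.cast_zero, sub_zero]
  ring

end

section
open Filter Topology Set

theorem tsum_geometric_csch {b : ℂ} (hb : ‖b‖ = 1) {x : ℂ} (hx : 0 < x.re) :
    ∑' n : ℕ, b ^ n * exp (-(2 * n + 1) * x) = 1 / (exp x - b * exp (-x)) := by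
  have h1 : ∀ n : ℕ, b ^ n * exp (-(2 * n + 1) * x) = exp (-x) * (b * exp (-(2 * x))) ^ n := by
    intro n
    rw [mul_pow, ← exp_nat_mul, show -(2 * (n : ℂ) + 1) * x = -x + n * (-(2 * x)) by ring, exp_add]
    ring
  have h2 : ‖b * exp (-(2 * x))‖ < 1 := by
    rw [norm_mul, hb, one_mul, norm_exp]
    simpa using hx
  simp_rw [h1]
  rw [tsum_mul_left, tsum_geometric_of_norm_lt_one h2]
  have h3 : exp (-x) * exp x = 1 := by rw [← exp_add]; simp
  have h4 : exp (-(2 * x)) = exp (-x) * exp (-x) := by rw [← exp_add]; ring_nf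
  have h5 : 1 - b * exp (-(2 * x)) ≠ 0 := fun h => by
    rw [sub_eq_zero.1 h.symm.symm |>.symm] at h2
    simp at h2
  have h6 : exp x - b * exp (-x) = exp x * (1 - b * exp (-(2 * x))) := by
    rw [h4]; linear_combination b * exp (-x) * h3
  rw [h6, exp_neg, one_div, mul_inv]

theorem norm_exp_double_le {β : ℝ} (hβ : |β| < 1 / 2) {w : ℂ} (hw : |w.re| = |β|) (m n : ℕ) :
    ‖exp (-2 * Real.pi * (m + 1 / 2) * (n + 1 / 2) + 2 * Real.pi * (m + 1 / 2) * w)‖ ≤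
      Real.exp (-(Real.pi * (1 - 2 * |β|)) * m) * Real.exp (-Real.pi * n) := by
  rw [norm_exp, ← Real.exp_add]
  refine Real.exp_le_exp.2 ?_
  have : (-2 * Real.pi * (m + 1 / 2) * (n + 1 / 2) + 2 * Real.pi * (m + 1 / 2) * w : ℂ).re
      = -2 * Real.pi * (m + 1 / 2) * (n + 1 / 2) + 2 * Real.pi * (m + 1 / 2) * w.re := by
    rw [show (-2 * Real.pi * (m + 1 / 2) * (n + 1 / 2) + 2 * Real.pi * (m + 1 / 2) * w : ℂ) =
      ((-2 * Real.pi * (m + 1 / 2) * (n + 1 / 2) : ℝ) : ℂ) + ((2 * Real.pi * (m + 1 / 2) : ℝ) : ℂ) * w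
      by push_cast; ring, add_re, ofReal_re, re_ofReal_mul]
  rw [this]
  have h1 : w.re ≤ |β| := hw ▸ le_abs_self _
  have h2 : 2 * Real.pi * (m + 1 / 2) * w.re ≤ 2 * Real.pi * (m + 1 / 2) * |β| := by gcongr
  have h3 : 0 ≤ Real.pi * ((1 / 2 - |β|) + 2 * m * n) := by
    have : 0 < 1 / 2 - |β| := by linarith
    positivity
  nlinarith

theorem tsum_double_swap {β : ℝ} (hβ : |β| < 1 / 2) {w : ℂ} (hw : |w.re| = |β|) {a b : ℂ}
    (ha : ‖a‖ = 1) (hb : ‖b‖ = 1) :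
    ∑' m : ℕ, a ^ m * ((exp (2 * Real.pi * (m + 1 / 2) * w) -
        a * b * exp (-(2 * Real.pi * (m + 1 / 2) * w))) /
          (exp (Real.pi * (m + 1 / 2)) - b * exp (-(Real.pi * (m + 1 / 2))))) =
    ∑' n : ℕ, b ^ n * (1 / (exp (Real.pi * (n + 1 / 2 - w)) - a * exp (-(Real.pi * (n + 1 / 2 - w))))
      - a * b * (1 / (exp (Real.pi * (n + 1 / 2 + w)) - a * exp (-(Real.pi * (n + 1 / 2 + w)))))) := by
  have hδ : 0 < Real.pi * (1 - 2 * |β|) := mul_pos Real.pi_pos (by linarith)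
  have hre := abs_le.1 hw.le
  set D : ℕ × ℕ → ℂ → ℂ := fun q w => a ^ q.1 * b ^ q.2 *
    exp (-2 * Real.pi * (q.1 + 1 / 2) * (q.2 + 1 / 2) + 2 * Real.pi * (q.1 + 1 / 2) * w) with hD
  have hsum : ∀ w : ℂ, |w.re| = |β| → Summable fun q => D q w := by
    intro w hw
    have s1 : Summable fun n : ℕ => Real.exp (-(Real.pi * (1 - 2 * |β|)) * (n : ℝ)) := by
      have := Real.summable_exp_nat_mul_iff.2 (neg_lt_zero.2 hδ)
      simpa [mul_comm] using this
    have s2 : Summable fun n : ℕ => Real.exp (-Real.pi * (n : ℝ)) := by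
      have := Real.summable_exp_nat_mul_iff.2 (neg_lt_zero.2 Real.pi_pos)
      simpa [mul_comm] using this
    refine Summable.of_norm_bounded (s1.mul_of_nonneg s2 (fun _ => (Real.exp_pos _).le)
      (fun _ => (Real.exp_pos _).le)) fun q => ?_
    rw [hD]
    simp only [norm_mul, norm_pow, ha, hb, one_pow, one_mul]
    exact norm_exp_double_le hβ hw q.1 q.2
  have hS := (hsum w hw).sub ((hsum (-w) (by simpa using hw)).mul_left (a * b))
  have hx : ∀ m : ℕ, 0 < (Real.pi * (m + 1 / 2) : ℂ).re := fun m => by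
    rw [show (Real.pi * (m + 1 / 2) : ℂ) = ((Real.pi * (m + 1 / 2) : ℝ) : ℂ) by push_cast; ring,
      ofReal_re]
    positivity
  have hx1 : ∀ (n : ℕ) (w : ℂ), |w.re| = |β| → 0 < (Real.pi * (n + 1 / 2 - w) : ℂ).re := by
    intro n w hw
    rw [re_ofReal_mul]
    refine mul_pos Real.pi_pos ?_
    have : w.re ≤ |β| := hw ▸ le_abs_self _
    have h3 : (0 : ℝ) ≤ n := n.cast_nonneg
    simp only [sub_re, add_re, natCast_re, div_ofNat_re, one_re]
    linarith
  have r1 : ∀ (m : ℕ) (w : ℂ), ∑' n : ℕ, D (m, n) w = a ^ m * (exp (2 * Real.pi * (m + 1 / 2) * w) /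
      (exp (Real.pi * (m + 1 / 2)) - b * exp (-(Real.pi * (m + 1 / 2))))) := by
    intro m w
    have := tsum_geometric_csch hb (hx m)
    rw [div_eq_mul_one_div (exp (2 * Real.pi * (m + 1 / 2) * w)), ← this, ← tsum_mul_left, ← tsum_mul_left]
    refine tsum_congr fun n => ?_
    simp only [hD]
    rw [exp_add, show -2 * Real.pi * ((m : ℂ) + 1 / 2) * (n + 1 / 2) =
      -(2 * n + 1) * (Real.pi * (m + 1 / 2)) by ring]
    ring
  have r2 : ∀ (n : ℕ) (w : ℂ), |w.re| = |β| → ∑' m : ℕ, D (m, n) w =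
      b ^ n * (1 / (exp (Real.pi * (n + 1 / 2 - w)) - a * exp (-(Real.pi * (n + 1 / 2 - w))))) := by
    intro n w hw
    rw [← tsum_geometric_csch ha (hx1 n w hw), ← tsum_mul_left]
    refine tsum_congr fun m => ?_
    simp only [hD]
    rw [show -2 * Real.pi * ((m : ℂ) + 1 / 2) * (n + 1 / 2) + 2 * Real.pi * (m + 1 / 2) * w =
      -(2 * m + 1) * (Real.pi * (n + 1 / 2 - w)) by ring]
    ring
  have hw' : |(-w).re| = |β| := by simpa using hw
  have e := hS.tsum_comm (f := fun m n => D (m, n) w - a * b * D (m, n) (-w))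
  have t1 := hsum w hw
  have t2 := (hsum (-w) hw').mul_left (a * b)
  calc _ = ∑' (m : ℕ) (n : ℕ), (D (m, n) w - a * b * D (m, n) (-w)) := by
        refine tsum_congr fun m => ?_
        rw [(t1.prod_factor m).tsum_sub (t2.prod_factor m), tsum_mul_left, r1, r1,
          show 2 * Real.pi * ((m : ℂ) + 1 / 2) * -w = -(2 * Real.pi * (m + 1 / 2) * w) by ring]
        ring
    _ = ∑' (n : ℕ) (m : ℕ), (D (m, n) w - a * b * D (m, n) (-w)) := e.symm
    _ = _ := by
        refine tsum_congr fun n => ?_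
        have p1 := t1.prod_symm.prod_factor n
        have p2 := t2.prod_symm.prod_factor n
        simp only [Prod.swap] at p1 p2
        rw [p1.tsum_sub p2, tsum_mul_left, r2 n w hw, r2 n (-w) hw', sub_neg_eq_add]
        ring

theorem tsum_int_eq_tsum_nat {f : ℤ → ℂ} (hf : Summable f) :
    ∑' m : ℤ, f m = ∑' m : ℕ, (f m + f (-(m + 1))) := by
  have h1 : Summable fun m : ℕ => f m := hf.comp_injective Nat.cast_injective
  have h2 : Summable fun m : ℕ => f (-(m + 1)) := hf.comp_injective fun x y h => by simpa using h
  rw [tsum_of_nat_of_neg_add_one h1 h2, h1.tsum_add h2]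

theorem neg_exp_zpow (α : ℂ) (m : ℤ) :
    (-exp (2 * Real.pi * I * α)) ^ m = (-1) ^ m * exp (2 * Real.pi * I * α * m) := by
  rw [neg_eq_neg_one_mul, mul_zpow, ← exp_int_mul, mul_comm (m : ℂ)]

theorem norm_neg_exp (α : ℝ) : ‖-exp (2 * Real.pi * I * α)‖ = 1 := by
  rw [norm_neg, norm_exp]; simp

theorem neg_one_zpow_natneg (m : ℕ) : (-1 : ℂ) ^ (-((m : ℤ) + 1)) = -(-1) ^ m := by
  rw [zpow_neg, zpow_add_one₀ (by norm_num), zpow_natCast, mul_neg_one, inv_neg, ← inv_pow]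
  norm_num

theorem one_div_cosh (z : ℂ) : 1 / cosh z = 2 * (exp z - -1 * exp (-z))⁻¹ := by
  rw [Complex.cosh, one_div_div, div_eq_mul_inv, neg_one_mul, sub_neg_eq_add]

theorem sechSum_zero (α : ℝ) {β : ℝ} (hβ : |β| < 1 / 2) :
    sechSum (-exp (2 * Real.pi * I * α)) β 0 =
      exp (-(Real.pi * I * α)) * sechSum (-1) 0 (I * (α + β * I)) := by
  set w : ℂ := I * (α + β * I) with hwdef
  have hw : |w.re| = |β| := by simp [hwdef]
  have key := tsum_double_swap hβ hw (a := -1) (b := -1) (by simp) (by simp)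
  rw [sechSum, sechSum, tsum_int_eq_tsum_nat (summable_sechSum (norm_neg_exp α) hβ 0),
    tsum_int_eq_tsum_nat (summable_sechSum (by simp) (by simp) w)]
  have e2 : ∑' m : ℕ, ((-1 : ℂ) ^ (m : ℤ) * sechExp 0 (w - (m : ℤ) - 1 / 2) +
      (-1) ^ (-((m : ℤ) + 1)) * sechExp 0 (w - (-((m : ℤ) + 1) : ℤ) - 1 / 2)) =
      2 * ∑' n : ℕ, (-1 : ℂ) ^ n * (1 / (exp (Real.pi * (n + 1 / 2 - w)) - -1 * exp (-(Real.pi * (n + 1 / 2 - w))))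
      - -1 * -1 * (1 / (exp (Real.pi * (n + 1 / 2 + w)) - -1 * exp (-(Real.pi * (n + 1 / 2 + w)))))) := by
    rw [← tsum_mul_left]
    refine tsum_congr fun m => ?_
    rw [neg_one_zpow_natneg, zpow_natCast, sechExp, sechExp]
    simp only [ofReal_zero, mul_zero, zero_mul, exp_zero]
    rw [show w - ((m : ℤ) : ℂ) - 1 / 2 = -(m + 1 / 2 - w) by push_cast; ring, mul_neg, cosh_neg,
      show w - ((-((m : ℤ) + 1) : ℤ) : ℂ) - 1 / 2 = (m + 1 / 2 + w) by push_cast; ring]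
    rw [one_div_cosh, one_div_cosh]
    ring
  rw [e2, ← key, ← tsum_mul_left, ← tsum_mul_left]
  refine tsum_congr fun m => ?_
  rw [neg_exp_zpow, neg_exp_zpow, neg_one_zpow_natneg, zpow_natCast, sechExp, sechExp]
  rw [show (0 : ℂ) - ((m : ℤ) : ℂ) - 1 / 2 = -(m + 1 / 2) by push_cast; ring, mul_neg (Real.pi : ℂ),
    cosh_neg, show (0 : ℂ) - ((-((m : ℤ) + 1) : ℤ) : ℂ) - 1 / 2 = (m + 1 / 2) by push_cast; ring]
  have x1 : exp (2 * Real.pi * I * α * (m : ℤ)) * exp (2 * Real.pi * β * -(m + 1 / 2)) =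
      exp (-(Real.pi * I * α)) * exp (2 * Real.pi * (m + 1 / 2) * w) := by
    rw [← exp_add, ← exp_add, hwdef]
    congr 1
    push_cast
    linear_combination (-2 * Real.pi * (m + 1 / 2) * (β : ℂ)) * I_sq
  have x2 : exp (2 * Real.pi * I * α * ((-((m : ℤ) + 1) : ℤ) : ℂ)) * exp (2 * Real.pi * β * (m + 1 / 2)) =
      exp (-(Real.pi * I * α)) * exp (-(2 * Real.pi * (m + 1 / 2) * w)) := by
    rw [← exp_add, ← exp_add, hwdef]
    congr 1
    push_cast
    linear_combination (2 * Real.pi * (m + 1 / 2) * (β : ℂ)) * I_sq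
  simp only [Complex.cosh]
  simp only [neg_mul, one_mul, sub_neg_eq_add, neg_neg, div_div_eq_mul_div, div_eq_mul_inv _ (_ + _)]
  linear_combination (2 * (exp (Real.pi * (m + 1 / 2)) + exp (-(Real.pi * (m + 1 / 2))))⁻¹ * (-1) ^ m) * x1 -
    (2 * (exp (Real.pi * (m + 1 / 2)) + exp (-(Real.pi * (m + 1 / 2))))⁻¹ * (-1) ^ m) * x2

theorem one_div_sinh (z : ℂ) : 1 / sinh z = 2 * (exp z - 1 * exp (-z))⁻¹ := by
  rw [Complex.sinh, one_div_div, div_eq_mul_inv, one_mul]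

theorem sechSum_neg_half_I (α : ℝ) {β : ℝ} (hβ : |β| < 1 / 2) :
    sechSum (-exp (2 * Real.pi * I * α)) β (-(I / 2)) =
      -I * exp (-(Real.pi * I * β)) * exp (-(Real.pi * I * α)) * sechSum 1 0 (I * (α + β * I)) := by
  set w : ℂ := I * (α + β * I) with hwdef
  have hw : |w.re| = |β| := by simp [hwdef]
  have key := tsum_double_swap hβ hw (a := -1) (b := 1) (by simp) (by simp)
  rw [sechSum, sechSum, tsum_int_eq_tsum_nat (summable_sechSum (norm_neg_exp α) hβ _),
    tsum_int_eq_tsum_nat (summable_sechSum (by simp) (by simp) w)]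
  have e2 : ∑' m : ℕ, ((1 : ℂ) ^ (m : ℤ) * sechExp 0 (w - (m : ℤ) - 1 / 2) +
      1 ^ (-((m : ℤ) + 1)) * sechExp 0 (w - (-((m : ℤ) + 1) : ℤ) - 1 / 2)) =
      2 * ∑' n : ℕ, (1 : ℂ) ^ n * (1 / (exp (Real.pi * (n + 1 / 2 - w)) - -1 * exp (-(Real.pi * (n + 1 / 2 - w))))
      - -1 * 1 * (1 / (exp (Real.pi * (n + 1 / 2 + w)) - -1 * exp (-(Real.pi * (n + 1 / 2 + w)))))) := by
    rw [← tsum_mul_left]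
    refine tsum_congr fun m => ?_
    rw [one_zpow, one_zpow, one_pow, sechExp, sechExp]
    simp only [ofReal_zero, mul_zero, zero_mul, exp_zero]
    rw [show w - ((m : ℤ) : ℂ) - 1 / 2 = -(m + 1 / 2 - w) by push_cast; ring, mul_neg, cosh_neg,
      show w - ((-((m : ℤ) + 1) : ℤ) : ℂ) - 1 / 2 = (m + 1 / 2 + w) by push_cast; ring]
    rw [one_div_cosh, one_div_cosh]
    ring
  rw [e2, ← key, ← tsum_mul_left, ← tsum_mul_left]
  refine tsum_congr fun m => ?_
  rw [neg_exp_zpow, neg_exp_zpow, neg_one_zpow_natneg, zpow_natCast, sechExp, sechExp]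
  have c1 : cosh (Real.pi * (-(I / 2) - ((m : ℤ) : ℂ) - 1 / 2)) = I * sinh (Real.pi * (m + 1 / 2)) := by
    rw [show Real.pi * (-(I / 2) - ((m : ℤ) : ℂ) - 1 / 2) =
      -(Real.pi * (m + 1 / 2) + Real.pi / 2 * I) by push_cast; ring, cosh_neg, cosh_add, cosh_mul_I,
      sinh_mul_I, Complex.cos_pi_div_two, Complex.sin_pi_div_two]
    ring
  have c2 : cosh (Real.pi * (-(I / 2) - ((-((m : ℤ) + 1) : ℤ) : ℂ) - 1 / 2)) =
      -(I * sinh (Real.pi * (m + 1 / 2))) := by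
    rw [show Real.pi * (-(I / 2) - ((-((m : ℤ) + 1) : ℤ) : ℂ) - 1 / 2) =
      Real.pi * (m + 1 / 2) - Real.pi / 2 * I by push_cast; ring, cosh_sub, cosh_mul_I,
      sinh_mul_I, Complex.cos_pi_div_two, Complex.sin_pi_div_two]
    ring
  rw [c1, c2]
  have x1 : exp (2 * Real.pi * I * α * (m : ℤ)) * exp (2 * Real.pi * β * (-(I / 2) - ((m : ℤ) : ℂ) - 1 / 2)) =
      exp (-(Real.pi * I * β)) * exp (-(Real.pi * I * α)) * exp (2 * Real.pi * (m + 1 / 2) * w) := by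
    rw [← exp_add, ← exp_add, ← exp_add, hwdef]
    congr 1
    push_cast
    linear_combination (-2 * Real.pi * (m + 1 / 2) * (β : ℂ)) * I_sq
  have x2 : exp (2 * Real.pi * I * α * ((-((m : ℤ) + 1) : ℤ) : ℂ)) *
      exp (2 * Real.pi * β * (-(I / 2) - ((-((m : ℤ) + 1) : ℤ) : ℂ) - 1 / 2)) =
      exp (-(Real.pi * I * β)) * exp (-(Real.pi * I * α)) * exp (-(2 * Real.pi * (m + 1 / 2) * w)) := by
    rw [← exp_add, ← exp_add, ← exp_add, hwdef]
    congr 1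
    push_cast
    linear_combination (2 * Real.pi * (m + 1 / 2) * (β : ℂ)) * I_sq
  have hs : 1 / (I * sinh (Real.pi * (m + 1 / 2))) =
      -I * (2 * (exp (Real.pi * (m + 1 / 2)) - 1 * exp (-(Real.pi * (m + 1 / 2))))⁻¹) := by
    rw [← one_div_sinh, ← inv_I, one_div, mul_inv, ← one_div (sinh _)]
  rw [div_eq_mul_one_div, div_eq_mul_one_div (exp (2 * Real.pi * β * _)) (-_), div_neg, hs]
  linear_combination (-I * 2 * (exp (Real.pi * (m + 1 / 2)) - 1 * exp (-(Real.pi * (m + 1 / 2))))⁻¹ * (-1) ^ m) * (x1 + x2)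

end

section
open Filter Topology Set

theorem tendsto_add_const_punctured (a z : ℂ) :
    Tendsto (fun w : ℂ => w + a) (𝓝[≠] z) (𝓝[≠] (z + a)) := by
  refine tendsto_nhdsWithin_iff.2 ⟨?_, ?_⟩
  · exact ((continuous_id.add continuous_const).tendsto z).mono_left nhdsWithin_le_nhds
  · filter_upwards [self_mem_nhdsWithin] with w hw
    simpa using hw

theorem tendsto_mul_const_punctured {a : ℂ} (ha : a ≠ 0) (z : ℂ) :
    Tendsto (fun w : ℂ => a * w) (𝓝[≠] z) (𝓝[≠] (a * z)) := by
  refine tendsto_nhdsWithin_iff.2 ⟨?_, ?_⟩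
  · exact ((continuous_const.mul continuous_id).tendsto z).mono_left nhdsWithin_le_nhds
  · filter_upwards [self_mem_nhdsWithin] with w hw
    simpa [ha] using hw

/-- Powers of the multipliers under translation by a Gaussian integer. -/
theorem translate_mul {g : ℂ → ℂ} {c₁ c₂ : ℂ} (hc₁ : c₁ ≠ 0) (hc₂ : c₂ ≠ 0)
    (h₁ : ∀ z, g (z + 1) = c₁ * g z) (h₂ : ∀ z, g (z + I) = c₂ * g z) (m n : ℤ) (z : ℂ) :
    g (z + m + n * I) = c₁ ^ m * c₂ ^ n * g z := by
  have a₁ : ∀ (m : ℤ) z, g (z + m) = c₁ ^ m * g z := by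
    intro m
    induction m using Int.induction_on with
    | zero => simp
    | succ i ih =>
      intro z
      have := h₁ (z + i)
      have h := ih z
      push_cast at *
      rw [← add_assoc, this, h, zpow_add_one₀ hc₁]; ring
    | pred i ih =>
      intro z
      have := h₁ (z + ((-i - 1 : ℤ) : ℂ))
      have h := ih z
      push_cast at *
      rw [show z + (-(i : ℂ) - 1) + 1 = z + -i by ring, h] at this
      rw [zpow_sub_one₀ hc₁]
      field_simp
      linear_combination -this
  have a₂ : ∀ (n : ℤ) z, g (z + n * I) = c₂ ^ n * g z := by
    intro m
    induction m using Int.induction_on with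
    | zero => simp
    | succ i ih =>
      intro z
      have := h₂ (z + i * I)
      have h := ih z
      push_cast at *
      rw [show z + (i + 1) * I = z + i * I + I by ring, this, h, zpow_add_one₀ hc₂]; ring
    | pred i ih =>
      intro z
      have := h₂ (z + ((-i - 1 : ℤ) : ℂ) * I)
      have h := ih z
      push_cast at *
      rw [show z + (-(i : ℂ) - 1) * I + I = z + -i * I by ring, h] at this
      rw [zpow_sub_one₀ hc₂]
      field_simp
      linear_combination -this
  rw [a₂, a₁]; ring

theorem tendsto_residue_translate {g : ℂ → ℂ} {c₁ c₂ : ℂ} (hc₁ : c₁ ≠ 0) (hc₂ : c₂ ≠ 0)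
    (h₁ : ∀ z, g (z + 1) = c₁ * g z) (h₂ : ∀ z, g (z + I) = c₂ * g z) (m n : ℤ) {z r : ℂ}
    (h : Tendsto (fun w => (w - z) * g w) (𝓝[≠] z) (𝓝 r)) :
    Tendsto (fun w => (w - (z + m + n * I)) * g w) (𝓝[≠] (z + m + n * I))
      (𝓝 (c₁ ^ m * c₂ ^ n * r)) := by
  have t := tendsto_add_const_punctured (-(m + n * I)) (z + m + n * I)
  rw [show z + m + n * I + -(m + n * I) = z by ring] at t
  refine ((h.comp t).const_mul (c₁ ^ m * c₂ ^ n)).congr fun w => ?_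
  have := translate_mul hc₁ hc₂ h₁ h₂ m n (w + -(m + n * I))
  rw [show w + -(m + n * I) + m + n * I = w by ring] at this
  simp only [Function.comp]
  rw [this]; ring

theorem tendsto_sub_mul_zero {g : ℂ → ℂ} {z : ℂ} (h : ContinuousAt g z) :
    Tendsto (fun w => (w - z) * g w) (𝓝[≠] z) (𝓝 0) := by
  have : ContinuousAt (fun w => (w - z) * g w) z := ContinuousAt.mul (by fun_prop) h
  have := this.tendsto.mono_left (nhdsWithin_le_nhds (s := {z}ᶜ))
  simpa using this

theorem norm_one_ne_zero' {c : ℂ} (h : ‖c‖ = 1) : c ≠ 0 := by rintro rfl; simp at h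

/-- `liouville_const`, with the pole condition needed only up to translation. -/
theorem liouville_const' {f : ℂ → ℂ} {c₁ c₂ : ℂ} (hf : ∀ z, MeromorphicAt f z)
    (hc₁ : ‖c₁‖ = 1) (hc₂ : ‖c₂‖ = 1)
    (h₁ : ∀ z, f (z + 1) = c₁ * f z) (h₂ : ∀ z, f (z + I) = c₂ * f z)
    (hlim : ∀ z, ∃ m n : ℤ, ∃ z', z = z' + m + n * I ∧
      Tendsto (fun w => (w - z') * f w) (𝓝[≠] z') (𝓝 0)) :
    ∃ C, (∀ z, ∀ᶠ w in 𝓝[≠] z, f w = C) ∧ c₁ * C = C ∧ c₂ * C = C := by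
  refine liouville_const hf hc₁ hc₂ h₁ h₂ fun z => ?_
  obtain ⟨m, n, z', rfl, h⟩ := hlim z
  simpa using tendsto_residue_translate (norm_one_ne_zero' hc₁) (norm_one_ne_zero' hc₂) h₁ h₂ m n h

theorem liouville_eq' {f h : ℂ → ℂ} {c₁ c₂ : ℂ} (hf : ∀ z, MeromorphicAt f z)
    (hh : ∀ z, MeromorphicAt h z) (hc₁ : ‖c₁‖ = 1) (hc₂ : ‖c₂‖ = 1) (hne : c₁ ≠ 1 ∨ c₂ ≠ 1)
    (f₁ : ∀ z, f (z + 1) = c₁ * f z) (f₂ : ∀ z, f (z + I) = c₂ * f z)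
    (h₁ : ∀ z, h (z + 1) = c₁ * h z) (h₂ : ∀ z, h (z + I) = c₂ * h z)
    (hlim : ∀ z, ∃ m n : ℤ, ∃ z', z = z' + m + n * I ∧
      ∃ r, Tendsto (fun w => (w - z') * f w) (𝓝[≠] z') (𝓝 r) ∧
      Tendsto (fun w => (w - z') * h w) (𝓝[≠] z') (𝓝 r))
    {z : ℂ} (cf : ContinuousAt f z) (ch : ContinuousAt h z) : f z = h z := by
  refine liouville_eq hf hh hc₁ hc₂ hne f₁ f₂ h₁ h₂ (fun z => ?_) cf ch
  obtain ⟨m, n, z', rfl, r, ha, hb⟩ := hlim z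
  exact ⟨_, tendsto_residue_translate (norm_one_ne_zero' hc₁) (norm_one_ne_zero' hc₂) f₁ f₂ m n ha,
    tendsto_residue_translate (norm_one_ne_zero' hc₁) (norm_one_ne_zero' hc₂) h₁ h₂ m n hb⟩

theorem exists_analyticAt_of_residue {f : ℂ → ℂ} {z r : ℂ} (hf : MeromorphicAt f z)
    (h : Tendsto (fun w => (w - z) * f w) (𝓝[≠] z) (𝓝 r)) :
    ∃ A, AnalyticAt ℂ A z ∧ ∀ᶠ w in 𝓝[≠] z, f w = r * (w - z)⁻¹ + A w := by
  have hs : MeromorphicAt (fun w : ℂ => w - z) z := by fun_prop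
  set g : ℂ → ℂ := fun w => f w - r * (w - z)⁻¹ with hg
  have hgm : MeromorphicAt g z := hf.fun_sub ((MeromorphicAt.const r z).fun_mul hs.fun_inv)
  have hlim : Tendsto (fun w => (w - z) * g w) (𝓝[≠] z) (𝓝 0) := by
    have := h.sub_const r
    rw [sub_self] at this
    refine this.congr' ?_
    filter_upwards [self_mem_nhdsWithin] with w hw
    have : w - z ≠ 0 := sub_ne_zero.2 hw
    rw [hg]; field_simp
  have hord : 0 ≤ meromorphicOrderAt g z := by
    have h := (tendsto_zero_iff_meromorphicOrderAt_pos (hs.mul hgm)).1 hlim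
    rw [meromorphicOrderAt_mul hs hgm, meromorphicOrderAt_sub_self] at h
    cases hh : meromorphicOrderAt g z with
    | top => simp
    | coe a =>
      rw [hh] at h
      have : (0 : WithTop ℤ) < ((1 + a : ℤ) : WithTop ℤ) := by simpa using h
      have h2 : (0 : ℤ) < 1 + a := by exact_mod_cast this
      exact_mod_cast (by omega : (0 : ℤ) ≤ a)
  refine ⟨toMeromorphicNFAt g z, ?_, ?_⟩
  · rw [← (meromorphicNFAt_toMeromorphicNFAt (f := g) (x := z)).meromorphicOrderAt_nonneg_iff_analyticAt,
      ← meromorphicOrderAt_congr hgm.eq_nhdsNE_toMeromorphicNFAt]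
    exact hord
  · filter_upwards [hgm.eq_nhdsNE_toMeromorphicNFAt] with w hw
    rw [← hw, hg]; ring

theorem tendsto_sq_mul_deriv {f : ℂ → ℂ} {z r : ℂ} (hf : MeromorphicAt f z)
    (h : Tendsto (fun w => (w - z) * f w) (𝓝[≠] z) (𝓝 r)) :
    Tendsto (fun w => (w - z) ^ 2 * deriv f w) (𝓝[≠] z) (𝓝 (-r)) := by
  obtain ⟨A, hA, hAf⟩ := exists_analyticAt_of_residue hf h
  have h1 : Tendsto (fun w => -r + (w - z) ^ 2 * deriv A w) (𝓝[≠] z) (𝓝 (-r)) := by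
    have : ContinuousAt (fun w => -r + (w - z) ^ 2 * deriv A w) z :=
      ContinuousAt.add (by fun_prop) (ContinuousAt.mul (by fun_prop) hA.deriv.continuousAt)
    have := this.tendsto.mono_left (nhdsWithin_le_nhds (s := {z}ᶜ))
    simpa using this
  refine h1.congr' ?_
  have e1 := eventually_eventually_nhdsWithin.2 hAf
  filter_upwards [self_mem_nhdsWithin, e1, nhdsWithin_le_nhds hA.eventually_analyticAt]
    with w hw hw2 hw3
  have hw' : w - z ≠ 0 := sub_ne_zero.2 hw
  have hw4 : f =ᶠ[𝓝 w] fun w => r * (w - z)⁻¹ + A w := by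
    rwa [IsOpen.nhdsWithin_eq isOpen_compl_singleton hw] at hw2
  have d : HasDerivAt (fun w => r * (w - z)⁻¹ + A w) (r * (-1 / (w - z) ^ 2) + deriv A w) w :=
    (((hasDerivAt_id w).sub_const z).fun_inv hw' |>.const_mul r).fun_add hw3.differentiableAt.hasDerivAt
  rw [hw4.deriv_eq, d.deriv]
  field_simp

/-- A function with a rotational symmetry at `0` whose pole order is small enough has no pole. -/
theorem tendsto_mul_zero_of_symm {f : ℂ → ℂ} (hf : MeromorphicAt f 0) {c d : ℂ} (hc : c ≠ 0)
    (hsym : ∀ᶠ x in 𝓝[≠] (0 : ℂ), f (c * x) = d * f x) {N : ℕ}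
    (hN : Tendsto (fun x => x ^ N * f x) (𝓝[≠] 0) (𝓝 0))
    (hcd : ∀ n : ℤ, c ^ n = d → -N < n → 0 ≤ n) :
    Tendsto (fun x => x * f x) (𝓝[≠] 0) (𝓝 0) := by
  have hid : MeromorphicAt (fun w : ℂ => w) 0 := by fun_prop
  have hid1 : meromorphicOrderAt (fun w : ℂ => w) 0 = 1 := by
    simpa using meromorphicOrderAt_sub_self 0
  have key : 0 ≤ meromorphicOrderAt f 0 := by
    cases hn : meromorphicOrderAt f 0 with
    | top => simp
    | coe n =>
      have h1 := (tendsto_zero_iff_meromorphicOrderAt_pos ((hid.pow N).mul hf)).1 hN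
      rw [meromorphicOrderAt_mul (hid.pow N) hf, meromorphicOrderAt_pow hid, hid1, hn] at h1
      have h1 : -(N : ℤ) < n := by
        have : (0 : WithTop ℤ) < ((N + n : ℤ) : WithTop ℤ) := by simpa using h1
        have h2 : (0 : ℤ) < N + n := by exact_mod_cast this
        omega
      obtain ⟨g, hg, hg0, hfg⟩ := (meromorphicOrderAt_eq_int_iff hf).1 hn
      have t := tendsto_mul_const_punctured hc 0
      rw [mul_zero] at t
      have e : ∀ᶠ x in 𝓝[≠] (0 : ℂ), c ^ n * g (c * x) = d * g x := by
        filter_upwards [hsym, hfg, t.eventually hfg, self_mem_nhdsWithin] with x h1 h2 h3 h4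
        have h4 : x ≠ 0 := h4
        rw [h3, h2] at h1
        simp only [sub_zero, smul_eq_mul, mul_zpow] at h1
        have : x ^ n ≠ 0 := zpow_ne_zero n h4
        apply mul_left_cancel₀ this
        linear_combination h1
      have l1 : Tendsto (fun x => c ^ n * g (c * x)) (𝓝[≠] 0) (𝓝 (c ^ n * g 0)) := by
        have : ContinuousAt (fun x => g (c * x)) 0 :=
          ContinuousAt.comp (f := fun x : ℂ => c * x) (by simpa using hg.continuousAt) (by fun_prop)
        have := this.tendsto.mono_left (nhdsWithin_le_nhds (s := {0}ᶜ))
        simpa using this.const_mul (c ^ n)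
      have l2 : Tendsto (fun x => d * g x) (𝓝[≠] 0) (𝓝 (d * g 0)) :=
        (hg.continuousAt.tendsto.mono_left nhdsWithin_le_nhds).const_mul d
      have := tendsto_nhds_unique (l1.congr' e) l2
      exact_mod_cast hcd n (mul_right_cancel₀ hg0 this) h1
  have : MeromorphicAt (fun x : ℂ => x * f x) 0 := hid.mul hf
  refine (tendsto_zero_iff_meromorphicOrderAt_pos this).2 ?_
  have e : meromorphicOrderAt (fun x : ℂ => x * f x) 0 = 1 + meromorphicOrderAt f 0 := by
    have := meromorphicOrderAt_mul hid hf
    rw [hid1] at this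
    exact this
  rw [e]
  cases hn : meromorphicOrderAt f 0 with
  | top => simp
  | coe n =>
    rw [hn] at key
    have h2 : (0 : ℤ) ≤ n := by exact_mod_cast key
    exact_mod_cast (by omega : (0 : ℤ) < 1 + n)

end

section
open Filter Topology Set

/-- Membership in the lattice `ℤ[i]`. -/
def IsLat (z : ℂ) : Prop := ∃ m n : ℤ, z = m + n * I

/-- Membership in the shifted lattice `(1+i)/2 + ℤ[i]`. -/
def IsPole (z : ℂ) : Prop := IsLat (z - (1 + I) / 2)

theorem IsLat.add {z w : ℂ} (hz : IsLat z) (hw : IsLat w) : IsLat (z + w) := by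
  obtain ⟨a, b, rfl⟩ := hz
  obtain ⟨c, d, rfl⟩ := hw
  exact ⟨a + c, b + d, by push_cast; ring⟩

theorem IsLat.neg {z : ℂ} (hz : IsLat z) : IsLat (-z) := by
  obtain ⟨a, b, rfl⟩ := hz
  exact ⟨-a, -b, by push_cast; ring⟩

theorem IsLat.sub {z w : ℂ} (hz : IsLat z) (hw : IsLat w) : IsLat (z - w) := by
  rw [sub_eq_add_neg]; exact hz.add hw.neg

theorem IsLat.mul {z w : ℂ} (hz : IsLat z) (hw : IsLat w) : IsLat (z * w) := by
  obtain ⟨a, b, rfl⟩ := hz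
  obtain ⟨c, d, rfl⟩ := hw
  exact ⟨a * c - b * d, a * d + b * c, by push_cast; linear_combination (-(b : ℂ) * d) * (-I_sq)⟩

theorem isLat_int (m : ℤ) : IsLat m := ⟨m, 0, by simp⟩
theorem isLat_zero : IsLat 0 := ⟨0, 0, by simp⟩
theorem isLat_one : IsLat 1 := ⟨1, 0, by simp⟩
theorem isLat_I : IsLat I := ⟨0, 1, by simp⟩

theorem IsPole.add_lat {z w : ℂ} (hz : IsPole z) (hw : IsLat w) : IsPole (z + w) := by
  have := IsLat.add hz hw
  rwa [show z - (1 + I) / 2 + w = z + w - (1 + I) / 2 by ring] at this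

theorem isPole_I_mul {z : ℂ} (hz : IsPole z) : IsPole (I * z) := by
  have := (isLat_I.mul hz).sub isLat_one
  rwa [show I * (z - (1 + I) / 2) - 1 = I * z - (1 + I) / 2 by linear_combination (-1 / 2 : ℂ) * I_sq]
    at this

theorem isPole_I_mul_iff {z : ℂ} : IsPole (I * z) ↔ IsPole z := by
  refine ⟨fun h => ?_, isPole_I_mul⟩
  have := isPole_I_mul (isPole_I_mul (isPole_I_mul h))
  rwa [show I * (I * (I * (I * z))) = z by linear_combination (z * (I ^ 2 - 1)) * I_sq] at this

theorem isLat_I_mul_iff {z : ℂ} : IsLat (I * z) ↔ IsLat z := by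
  refine ⟨fun h => ?_, isLat_I.mul⟩
  have := isLat_I.mul (isLat_I.mul (isLat_I.mul h))
  rwa [show I * (I * (I * (I * z))) = z by linear_combination (z * (I ^ 2 - 1)) * I_sq] at this

theorem isPole_neg_iff {z : ℂ} : IsPole (-z) ↔ IsPole z := by
  rw [← isPole_I_mul_iff (z := z), ← isPole_I_mul_iff (z := I * z),
    show I * (I * z) = -z by linear_combination z * I_sq]

theorem isPole_iff_exists {z : ℂ} : IsPole z ↔ ∃ m n : ℤ, z = (1 + I) / 2 + m + n * I := by
  constructor
  · rintro ⟨m, n, h⟩; exact ⟨m, n, by linear_combination h⟩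
  · rintro ⟨m, n, h⟩; exact ⟨m, n, by linear_combination h⟩

theorem isPole_add_half_iff {z : ℂ} : IsPole (z + (1 + I) / 2) ↔ IsLat z := by
  rw [IsPole, add_sub_cancel_right]

theorem isPole_mul_one_add_I {z : ℂ} (h : IsPole z) : IsLat ((1 + I) * z) := by
  have := ((isLat_one.add isLat_I).mul h).add isLat_I
  rwa [show (1 + I) * (z - (1 + I) / 2) + I = (1 + I) * z by linear_combination (-1 / 2 : ℂ) * I_sq]
    at this

theorem IsLat.im_re {z : ℂ} (h : IsLat z) : ∃ m n : ℤ, z.re = m ∧ z.im = n := by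
  obtain ⟨m, n, rfl⟩ := h
  exact ⟨m, n, by simp, by simp⟩

theorem IsLat.not_isPole {z : ℂ} (h : IsLat z) : ¬ IsPole z := by
  intro hp
  obtain ⟨m, n, h1, h2⟩ := (h.sub hp).im_re
  have h3 : (1 / 2 : ℝ) = m := by simpa using h1
  have h4 : (1 : ℝ) = ((2 * m : ℤ) : ℝ) := by push_cast; linarith
  have : (1 : ℤ) = 2 * m := by exact_mod_cast h4
  omega

/-- The basic sech-series, proportional to the lemniscate sine. -/
abbrev SN : ℂ → ℂ := sechSum (-1) 0

theorem SN_add_one (z : ℂ) : SN (z + 1) = -1 * SN z := sechSum_add_one (by simp) 0 z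

theorem SN_add_I (z : ℂ) : SN (z + I) = -1 * SN z := by
  simpa using sechSum_add_I (-1) 0 z

theorem meromorphicAt_SN (z : ℂ) : MeromorphicAt SN z :=
  meromorphicAt_sechSum (by simp) (by simp) z

theorem analyticAt_SN {z : ℂ} (hz : ¬ IsPole z) : AnalyticAt ℂ SN z :=
  analyticAt_sechSum (by simp) (by simp) fun m n h => hz (isPole_iff_exists.2 ⟨m, n, h⟩)

theorem residue_SN : Tendsto (fun w => (w - (1 + I) / 2) * SN w) (𝓝[≠] ((1 + I) / 2))
    (𝓝 (1 / (Real.pi * I))) := by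
  simpa using residue_sechSum (c := -1) (β := 0) (by simp) (by simp)

theorem SN_conj (z : ℂ) : SN ((starRingEnd ℂ) z) = (starRingEnd ℂ) (SN z) := by
  rw [SN, sechSum, sechSum, conj_tsum]
  refine tsum_congr fun m => ?_
  simp only [sechExp, map_mul, map_zpow₀, map_neg, map_one, map_div₀, ← cosh_conj, map_sub,
    conj_ofReal, ← exp_conj, map_intCast, map_ofNat]

theorem SN_I_mul {z : ℂ} (hz : ¬ IsPole z) : SN (I * z) = I * SN z := by
  have hm : ∀ z, MeromorphicAt (fun z => SN (I * z)) z := fun z =>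
    (meromorphicAt_SN (I * z)).comp_analyticAt (f := SN) (g := fun w : ℂ => I * w) (by fun_prop)
  have ca : ∀ z, ¬ IsPole z → ContinuousAt (fun z => SN (I * z)) z := fun z hz =>
    ContinuousAt.comp (f := fun w : ℂ => I * w)
      (analyticAt_SN (by rwa [isPole_I_mul_iff])).continuousAt (by fun_prop)
  refine liouville_eq' (f := fun z => SN (I * z)) (h := fun z => I * SN z) (c₁ := -1) (c₂ := -1)
    hm (fun z => (MeromorphicAt.const I z).fun_mul (meromorphicAt_SN z)) (by simp) (by simp)
    (Or.inl (by norm_num)) ?_ ?_ ?_ ?_ ?_ (ca z hz) ((analyticAt_SN hz).continuousAt.const_mul I)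
  · intro z
    rw [mul_add, mul_one, SN_add_I]
  · intro z
    have := SN_add_one (I * z - 1)
    rw [sub_add_cancel] at this
    rw [mul_add, I_mul_I, ← sub_eq_add_neg, this]; ring
  · intro z; rw [SN_add_one]; ring
  · intro z; rw [SN_add_I]; ring
  · intro z
    by_cases hz : IsPole z
    · obtain ⟨m, n, rfl⟩ := isPole_iff_exists.1 hz
      refine ⟨m, n, _, rfl, I * (1 / (Real.pi * I)), ?_, ?_⟩
      · have t := tendsto_mul_const_punctured I_ne_zero ((1 + I) / 2)
        have t2 := tendsto_add_const_punctured 1 (I * ((1 + I) / 2))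
        rw [show I * ((1 + I) / 2) + 1 = (1 + I) / 2 by linear_combination (1 / 2 : ℂ) * I_sq] at t2
        refine ((residue_SN.comp (t2.comp t)).const_mul I).congr fun w => ?_
        simp only [Function.comp]
        rw [SN_add_one]
        linear_combination (SN (I * w) * ((1 / 2 : ℂ) - w)) * I_sq
      · refine (residue_SN.const_mul I).congr fun w => ?_
        ring
    · refine ⟨0, 0, z, by simp, 0, tendsto_sub_mul_zero (ca z hz),
        tendsto_sub_mul_zero ((analyticAt_SN hz).continuousAt.const_mul I)⟩

theorem SN_zero : SN 0 = 0 := by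
  have := SN_I_mul (isLat_zero.not_isPole)
  rw [mul_zero] at this
  have h2 : (1 - I) * SN 0 = 0 := by linear_combination this
  rcases mul_eq_zero.1 h2 with h | h
  · have := congrArg re h; simp at this
  · exact h

theorem SN_neg {z : ℂ} (hz : ¬ IsPole z) : SN (-z) = -SN z := by
  have h1 := SN_I_mul hz
  have h2 := SN_I_mul (z := I * z) (by rwa [isPole_I_mul_iff])
  rw [h1, show I * (I * z) = -z by linear_combination z * I_sq] at h2
  rw [h2]; linear_combination SN z * I_sq

theorem SN_translate (m n : ℤ) (z : ℂ) : SN (z + m + n * I) = (-1) ^ m * (-1) ^ n * SN z :=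
  translate_mul (by simp) (by simp) SN_add_one SN_add_I m n z

theorem SN_eq_zero_of_isLat {z : ℂ} (hz : IsLat z) : SN z = 0 := by
  obtain ⟨m, n, rfl⟩ := hz
  have := SN_translate m n 0
  rwa [SN_zero, zero_add, mul_zero] at this

theorem exists_SN_shift_mul : ∃ C : ℂ, C ≠ 0 ∧
    C = 1 / (Real.pi * I) * deriv SN 0 ∧
    ∀ z, ¬ IsPole z → ¬ IsLat z → SN (z + (1 + I) / 2) * SN z = C := by
  have hm : ∀ z, MeromorphicAt (fun z => SN (z + (1 + I) / 2)) z := fun z =>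
    (meromorphicAt_SN (z + (1 + I) / 2)).comp_analyticAt (f := SN)
      (g := fun w : ℂ => w + (1 + I) / 2) (by fun_prop)
  have ca : ∀ z, ¬ IsLat z → ContinuousAt (fun z => SN (z + (1 + I) / 2)) z := fun z hz =>
    ContinuousAt.comp (f := fun w : ℂ => w + (1 + I) / 2)
      (analyticAt_SN (by rwa [isPole_add_half_iff])).continuousAt (by fun_prop)
  have lim0 : Tendsto (fun w => w * SN (w + (1 + I) / 2)) (𝓝[≠] 0) (𝓝 (1 / (Real.pi * I))) := by
    have t := tendsto_add_const_punctured ((1 + I) / 2) 0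
    rw [zero_add] at t
    refine (residue_SN.comp t).congr fun w => ?_
    simp only [Function.comp]
    ring
  have lim1 : Tendsto SN (𝓝[≠] 0) (𝓝 0) := by
    have := (analyticAt_SN isLat_zero.not_isPole).continuousAt.tendsto
    rw [SN_zero] at this
    exact this.mono_left nhdsWithin_le_nhds
  have hpi : (1 / (Real.pi * I) : ℂ) ≠ 0 :=
    one_div_ne_zero (mul_ne_zero (by exact_mod_cast Real.pi_ne_zero) I_ne_zero)
  obtain ⟨C, hC, -, -⟩ := liouville_const' (f := fun z => SN (z + (1 + I) / 2) * SN z) (c₁ := 1)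
    (c₂ := 1) (fun z => (hm z).fun_mul (meromorphicAt_SN z)) (by simp) (by simp)
    (fun z => by rw [show z + 1 + (1 + I) / 2 = z + (1 + I) / 2 + 1 by ring, SN_add_one, SN_add_one]; ring)
    (fun z => by rw [show z + I + (1 + I) / 2 = z + (1 + I) / 2 + I by ring, SN_add_I, SN_add_I]; ring)
    (fun z => by
      by_cases hz : IsPole z
      · obtain ⟨m, n, rfl⟩ := isPole_iff_exists.1 hz
        refine ⟨m, n, _, rfl, ?_⟩
        have l2 : Tendsto (fun w => SN (w + (1 + I) / 2)) (𝓝[≠] ((1 + I) / 2)) (𝓝 0) := by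
          have h2 : IsLat ((1 + I) / 2 + (1 + I) / 2) := by
            rw [add_halves]; exact isLat_one.add isLat_I
          have h := (ca ((1 + I) / 2) fun h => h.not_isPole (by rw [IsPole, sub_self]; exact isLat_zero)).tendsto
          rw [SN_eq_zero_of_isLat h2] at h
          exact h.mono_left nhdsWithin_le_nhds
        have := residue_SN.mul l2
        rw [mul_zero] at this
        exact this.congr fun w => by ring
      · by_cases hz2 : IsLat z
        · obtain ⟨m, n, rfl⟩ := hz2
          refine ⟨m, n, 0, by ring, ?_⟩
          have := lim0.mul lim1
          rw [mul_zero] at this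
          exact this.congr fun w => by ring
        · exact ⟨0, 0, z, by simp, tendsto_sub_mul_zero
            ((ca z hz2).mul (analyticAt_SN hz).continuousAt)⟩)
  have hval : ∀ z, ¬ IsPole z → ¬ IsLat z → SN (z + (1 + I) / 2) * SN z = C := by
    intro z hz hz2
    have t := ((ca z hz2).mul (analyticAt_SN hz).continuousAt).tendsto.mono_left
      (nhdsWithin_le_nhds (s := {z}ᶜ))
    exact tendsto_nhds_unique t (tendsto_const_nhds.congr' ((hC z).mono fun w hw => hw.symm))
  have hCd : C = 1 / (Real.pi * I) * deriv SN 0 := by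
    have hd := (analyticAt_SN isLat_zero.not_isPole).differentiableAt.hasDerivAt
    have hs := hasDerivAt_iff_tendsto_slope.1 hd
    have := lim0.mul hs
    refine tendsto_nhds_unique (tendsto_const_nhds.congr' ?_) this
    filter_upwards [hC 0, self_mem_nhdsWithin] with w hw hw0
    have hw0 : w ≠ 0 := hw0
    rw [← hw, slope_def_field, SN_zero]
    field_simp
    ring
  refine ⟨C, ?_, hCd, hval⟩
  intro h0
  have hid : MeromorphicAt (fun w : ℂ => w) 0 := by fun_prop
  have top0 : meromorphicOrderAt SN ((1 + I) / 2) ≠ ⊤ := by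
    intro h
    have e := meromorphicOrderAt_eq_top_iff.1 h
    have := tendsto_nhds_unique (residue_SN.congr' (e.mono fun w hw => by rw [hw, mul_zero]))
      tendsto_const_nhds
    exact hpi this
  have hSm : MeromorphicOn SN univ := fun z _ => meromorphicAt_SN z
  have top1 : meromorphicOrderAt SN 0 ≠ ⊤ :=
    hSm.meromorphicOrderAt_ne_top_of_isPreconnected isPreconnected_univ (mem_univ _) (mem_univ _) top0
  have e1 := (meromorphicOrderAt_ne_top_iff_eventually_ne_zero (meromorphicAt_SN 0)).1 top1
  have e2 : ∀ᶠ w in 𝓝[≠] (0 : ℂ), w * SN (w + (1 + I) / 2) ≠ 0 := lim0.eventually_ne hpi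
  obtain ⟨w, h1, h2, h3⟩ := ((hC 0).and (e1.and e2)).exists
  rw [h0] at h1
  rcases mul_eq_zero.1 h1 with h | h
  · exact h3 (by rw [h, mul_zero])
  · exact h2 h

theorem SN_ne_zero {z : ℂ} (hz : ¬ IsPole z) (hz2 : ¬ IsLat z) : SN z ≠ 0 := by
  obtain ⟨C, hC, -, h⟩ := exists_SN_shift_mul
  intro h0
  exact hC (by rw [← h z hz hz2, h0, mul_zero])

theorem deriv_SN_zero_ne : deriv SN 0 ≠ 0 := by
  obtain ⟨C, hC, h, -⟩ := exists_SN_shift_mul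
  intro h0
  exact hC (by rw [h, h0, mul_zero])

theorem deriv_SN_add_one (z : ℂ) : deriv SN (z + 1) = -1 * deriv SN z := by
  rw [← deriv_comp_add_const, show (fun x => SN (x + 1)) = fun x => -1 * SN x from funext SN_add_one]
  exact deriv_const_mul_field _

theorem deriv_SN_add_I (z : ℂ) : deriv SN (z + I) = -1 * deriv SN z := by
  rw [← deriv_comp_add_const, show (fun x => SN (x + I)) = fun x => -1 * SN x from funext SN_add_I]
  exact deriv_const_mul_field _

theorem isClosed_isLat : IsClosed {z | IsLat z} := by
  have h := Int.isClosedEmbedding_coe_real.isClosed_range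
  have : {z | IsLat z} = (re ⁻¹' range ((↑) : ℤ → ℝ)) ∩ (im ⁻¹' range ((↑) : ℤ → ℝ)) := by
    ext z
    constructor
    · intro hz
      obtain ⟨m, n, h1, h2⟩ := IsLat.im_re hz
      exact ⟨⟨m, h1.symm⟩, ⟨n, h2.symm⟩⟩
    · rintro ⟨⟨m, h1⟩, ⟨n, h2⟩⟩
      exact ⟨m, n, by apply Complex.ext <;> simp [h1, h2]⟩
  rw [this]
  exact (h.preimage continuous_re).inter (h.preimage continuous_im)

theorem isOpen_not_isLat : IsOpen {z | ¬ IsLat z} := isClosed_isLat.isOpen_compl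

theorem isOpen_not_isPole : IsOpen {z | ¬ IsPole z} :=
  isOpen_not_isLat.preimage (continuous_id.sub continuous_const)

theorem countable_isLat : {z | IsLat z}.Countable := by
  refine (countable_range fun q : ℤ × ℤ => (q.1 : ℂ) + q.2 * I).mono ?_
  rintro z ⟨m, n, rfl⟩
  exact ⟨(m, n), rfl⟩

theorem eventually_not_isLat (z : ℂ) : ∀ᶠ w in 𝓝[≠] z, ¬ IsLat w := by
  by_cases hz : IsLat z
  · have : ∀ᶠ w in 𝓝[≠] z, w ∈ Metric.ball z 1 :=
      nhdsWithin_le_nhds (Metric.ball_mem_nhds z one_pos)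
    filter_upwards [this, self_mem_nhdsWithin] with w hw hne hl
    obtain ⟨m, n, h1, h2⟩ := (hl.sub hz).im_re
    have hd : ‖w - z‖ < 1 := by simpa [dist_eq_norm] using hw
    have h3 := (abs_re_le_norm (w - z)).trans_lt hd
    have h4 := (abs_im_le_norm (w - z)).trans_lt hd
    rw [h1] at h3
    rw [h2] at h4
    have h3 : |m| < 1 := by exact_mod_cast h3
    have h4 : |n| < 1 := by exact_mod_cast h4
    rw [Int.abs_lt_one_iff] at h3 h4
    subst h3 h4
    apply hne
    have : w - z = 0 := Complex.ext (by simpa using h1) (by simpa using h2)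
    exact sub_eq_zero.1 this
  · exact nhdsWithin_le_nhds (isOpen_not_isLat.mem_nhds hz)

theorem eventually_not_isPole (z : ℂ) : ∀ᶠ w in 𝓝[≠] z, ¬ IsPole w := by
  have t := tendsto_add_const_punctured (-((1 + I) / 2)) z
  exact t.eventually (eventually_not_isLat _)

theorem deriv_SN_I_mul {z : ℂ} (hz : ¬ IsPole z) : deriv SN (I * z) = deriv SN z := by
  have e : (fun w => SN (I * w)) =ᶠ[𝓝 z] fun w => I * SN w := by
    filter_upwards [isOpen_not_isPole.mem_nhds hz] with w hw using SN_I_mul hw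
  have h := e.deriv_eq
  rw [deriv_const_mul_field, deriv_comp_mul_left, smul_eq_mul] at h
  exact mul_left_cancel₀ I_ne_zero h

theorem deriv_SN_sq {z : ℂ} (hz : ¬ IsPole z) :
    deriv SN z ^ 2 + Real.pi ^ 2 * SN z ^ 4 = deriv SN 0 ^ 2 := by
  set F : ℂ → ℂ := fun z => deriv SN z ^ 2 + Real.pi ^ 2 * SN z ^ 4 with hF
  have hFm : ∀ z, MeromorphicAt F z := fun z =>
    ((meromorphicAt_SN z).deriv.fun_pow 2).fun_add
      ((MeromorphicAt.const _ z).fun_mul ((meromorphicAt_SN z).fun_pow 4))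
  have hFc : ∀ z, ¬ IsPole z → ContinuousAt F z := fun z hz =>
    ((analyticAt_SN hz).deriv.continuousAt.pow 2).add
      ((analyticAt_SN hz).continuousAt.pow 4 |>.const_mul _)
  set z₀ : ℂ := (1 + I) / 2 with hz₀
  have hIz₀ : I * z₀ = z₀ - 1 := by rw [hz₀]; linear_combination (1 / 2 : ℂ) * I_sq
  have F1 : ∀ z, F (z + 1) = 1 * F z := fun z => by
    simp only [hF, SN_add_one, deriv_SN_add_one]; ring
  have F2 : ∀ z, F (z + I) = 1 * F z := fun z => by
    simp only [hF, SN_add_I, deriv_SN_add_I]; ring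
  have ts := tendsto_add_const_punctured z₀ 0
  rw [zero_add] at ts
  have hpole : Tendsto (fun x => x * F (x + z₀)) (𝓝[≠] 0) (𝓝 0) := by
    refine tendsto_mul_zero_of_symm (f := fun x => F (x + z₀)) (c := I) (d := 1) (N := 4)
      ((hFm (0 + z₀)).comp_analyticAt (f := F) (g := fun w : ℂ => w + z₀) (by fun_prop))
      I_ne_zero ?_ ?_ ?_
    · filter_upwards [ts.eventually (eventually_not_isPole z₀)] with x hx
      have := F1 (I * x + z₀ - 1)
      rw [sub_add_cancel, add_sub_assoc, ← hIz₀, ← mul_add] at this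
      rw [this]
      simp only [hF, SN_I_mul hx, deriv_SN_I_mul hx]
      linear_combination (Real.pi ^ 2 * SN (x + z₀) ^ 4) * I_pow_four
    · have h1 := ((tendsto_sq_mul_deriv (meromorphicAt_SN _) residue_SN).pow 2).add
        ((residue_SN.pow 4).const_mul (Real.pi ^ 2 : ℂ))
      have hp : (Real.pi : ℂ) ≠ 0 := by exact_mod_cast Real.pi_ne_zero
      have hv : (-(1 / (Real.pi * I)) : ℂ) ^ 2 + Real.pi ^ 2 * (1 / (Real.pi * I)) ^ 4 = 0 := by
        field_simp
        linear_combination I_sq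
      rw [hv] at h1
      refine (h1.comp ts).congr fun w => ?_
      simp only [Function.comp, hF, hz₀]
      ring
    · intro n hn hlt
      by_contra hneg
      push Not at hneg
      have h4 : n = -1 ∨ n = -2 ∨ n = -3 := by push_cast at hlt; omega
      rcases h4 with rfl | rfl | rfl
      · have := congrArg re hn; simp at this
      · have := congrArg re hn; norm_num [zpow_neg, zpow_ofNat] at this
      · have := congrArg re hn
        rw [show (-3 : ℤ) = -(3 : ℕ) by norm_num, zpow_neg, zpow_natCast, I_pow_three] at this
        simp at this
  obtain ⟨C, hC, -, -⟩ := liouville_const' hFm (by simp) (by simp) F1 F2 (fun z => by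
    by_cases hz : IsPole z
    · obtain ⟨m, n, rfl⟩ := isPole_iff_exists.1 hz
      refine ⟨m, n, _, rfl, ?_⟩
      have t := tendsto_add_const_punctured (-z₀) z₀
      rw [add_neg_cancel] at t
      refine (hpole.comp t).congr fun w => ?_
      simp [Function.comp, sub_eq_add_neg, hz₀]
    · exact ⟨0, 0, z, by simp, tendsto_sub_mul_zero (hFc z hz)⟩)
  have hval : ∀ z, ¬ IsPole z → F z = C := fun z hz =>
    tendsto_nhds_unique ((hFc z hz).tendsto.mono_left (nhdsWithin_le_nhds (s := {z}ᶜ)))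
      (tendsto_const_nhds.congr' ((hC z).mono fun w hw => hw.symm))
  have h0 := hval 0 isLat_zero.not_isPole
  have h1 := hval z hz
  simp only [hF, SN_zero] at h0 h1
  rw [h1, ← h0]; ring

end

section
open Filter Topology Set

/-- The derivative of the sech-series at the origin, a real number. -/
def slC : ℝ := (deriv SN 0).re

theorem isPole_conj {z : ℂ} (h : IsPole z) : IsPole ((starRingEnd ℂ) z) := by
  obtain ⟨m, n, rfl⟩ := isPole_iff_exists.1 h
  refine isPole_iff_exists.2 ⟨m, -n - 1, ?_⟩
  simp only [map_add, map_div₀, map_one, conj_I, map_ofNat, map_intCast, map_mul]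
  push_cast; ring

theorem isPole_conj_iff {z : ℂ} : IsPole ((starRingEnd ℂ) z) ↔ IsPole z :=
  ⟨fun h => by simpa using isPole_conj h, isPole_conj⟩

theorem isLat_conj {z : ℂ} (h : IsLat z) : IsLat ((starRingEnd ℂ) z) := by
  obtain ⟨m, n, rfl⟩ := h
  exact ⟨m, -n, by simp⟩

theorem isPole_not_im_int {z : ℂ} (h : IsPole z) (n : ℤ) : z.im ≠ n := by
  obtain ⟨a, b, h1, h2⟩ := IsLat.im_re h
  intro h3
  have h4 : (n : ℝ) - 1 / 2 = b := by rw [← h2, ← h3]; simp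
  have h5 : ((2 * n - 1 : ℤ) : ℝ) = ((2 * b : ℤ) : ℝ) := by push_cast; linarith
  have : 2 * n - 1 = 2 * b := by exact_mod_cast h5
  omega

theorem not_isPole_ofReal (x : ℝ) : ¬ IsPole (x : ℂ) := fun h =>
  isPole_not_im_int h 0 (by simp)

theorem deriv_SN_conj (z : ℂ) : deriv SN ((starRingEnd ℂ) z) = (starRingEnd ℂ) (deriv SN z) := by
  have e : (starRingEnd ℂ) ∘ SN ∘ (starRingEnd ℂ) = SN := by
    funext w; simp [SN_conj]
  have h := congrFun (deriv_conj_conj (𝕜 := ℂ) (f := SN)) ((starRingEnd ℂ) z)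
  rw [e] at h
  simpa using h

theorem ofReal_slC : (slC : ℂ) = deriv SN 0 := by
  have h := deriv_SN_conj 0
  rw [map_zero] at h
  exact (conj_eq_iff_re.1 h.symm)

theorem slC_ne_zero : slC ≠ 0 := by
  intro h
  apply deriv_SN_zero_ne
  rw [← ofReal_slC, h, ofReal_zero]

theorem not_isLat_half : ¬ IsLat (1 / 2 : ℂ) := by
  intro h
  obtain ⟨m, n, h1, h2⟩ := h.im_re
  have h3 : (1 / 2 : ℝ) = m := by simpa using h1
  have h5 : ((1 : ℤ) : ℝ) = ((2 * m : ℤ) : ℝ) := by push_cast; linarith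
  have : (1 : ℤ) = 2 * m := by exact_mod_cast h5
  omega

theorem not_isPole_half : ¬ IsPole (1 / 2 : ℂ) := by
  have := not_isPole_ofReal (1 / 2)
  simpa using this

theorem SN_half_sq : SN (1 / 2) ^ 2 = slC / Real.pi := by
  obtain ⟨C, -, hC, h⟩ := exists_SN_shift_mul
  have h1 := h (-(1 / 2)) (by rw [isPole_neg_iff]; exact not_isPole_half)
    (fun h => not_isLat_half (by simpa using h.neg))
  rw [show (-(1 / 2) + (1 + I) / 2 : ℂ) = I * (1 / 2) by ring, SN_I_mul not_isPole_half,
    SN_neg not_isPole_half, hC, ← ofReal_slC] at h1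
  have hp : (Real.pi : ℂ) ≠ 0 := by exact_mod_cast Real.pi_ne_zero
  have := I_ne_zero
  field_simp at h1 ⊢
  linear_combination h1 + SN (1 / 2) ^ 2 * Real.pi * I_sq

theorem slC_pos : 0 < slC := by
  have hr : ((SN (1 / 2)).re : ℂ) = SN (1 / 2) := by
    have h := SN_conj (1 / 2)
    simp only [map_div₀, map_one, map_ofNat] at h
    exact conj_eq_iff_re.1 h.symm
  have h := SN_half_sq
  rw [← hr] at h
  have h' : (SN (1 / 2)).re ^ 2 = slC / Real.pi := by exact_mod_cast h
  have h2 : 0 ≤ slC / Real.pi := h' ▸ sq_nonneg _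
  have h3 : 0 ≤ slC := by
    have := mul_nonneg h2 Real.pi_pos.le
    rwa [div_mul_cancel₀ _ Real.pi_ne_zero] at this
  exact lt_of_le_of_ne h3 slC_ne_zero.symm

/-- The half period of the lemniscate sine, identified with `ϖ` in `slM_eq_varpi`. -/
def slM : ℝ := Real.sqrt (Real.pi * slC)

theorem slM_pos : 0 < slM := Real.sqrt_pos.2 (mul_pos Real.pi_pos slC_pos)

theorem slM_ne : (slM : ℂ) ≠ 0 := by exact_mod_cast slM_pos.ne'

theorem slC_ne : (slC : ℂ) ≠ 0 := by exact_mod_cast slC_pos.ne'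

theorem slM_sq : (slM : ℂ) ^ 2 = Real.pi * slC := by
  have := Real.sq_sqrt (mul_pos Real.pi_pos slC_pos).le
  exact_mod_cast this

/-- The lemniscate sine of argument `ϖ z`. -/
def sl (z : ℂ) : ℂ := slM / slC * SN z

/-- The normalized derivative of the lemniscate sine. -/
def cl (z : ℂ) : ℂ := deriv sl z / slM

theorem deriv_sl (z : ℂ) : deriv sl z = slM / slC * deriv SN z := deriv_const_mul_field _

theorem cl_eq (z : ℂ) : cl z = deriv SN z / slC := by
  have := slM_ne
  rw [cl, deriv_sl]; field_simp

theorem sl_add_one (z : ℂ) : sl (z + 1) = - sl z := by rw [sl, SN_add_one, sl]; ring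
theorem sl_add_I (z : ℂ) : sl (z + I) = - sl z := by rw [sl, SN_add_I, sl]; ring
theorem cl_add_one (z : ℂ) : cl (z + 1) = - cl z := by rw [cl_eq, deriv_SN_add_one, cl_eq]; ring
theorem cl_add_I (z : ℂ) : cl (z + I) = - cl z := by rw [cl_eq, deriv_SN_add_I, cl_eq]; ring
theorem sl_zero : sl 0 = 0 := by rw [sl, SN_zero, mul_zero]
theorem cl_zero : cl 0 = 1 := by rw [cl_eq, ← ofReal_slC, div_self slC_ne]

theorem sl_translate (m n : ℤ) (z : ℂ) : sl (z + m + n * I) = (-1) ^ m * (-1) ^ n * sl z := by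
  rw [sl, SN_translate, sl]; ring

theorem cl_translate (m n : ℤ) (z : ℂ) : cl (z + m + n * I) = (-1) ^ m * (-1) ^ n * cl z :=
  translate_mul (by simp) (by simp) (fun z => by rw [cl_add_one]; ring)
    (fun z => by rw [cl_add_I]; ring) m n z

theorem sl_I_mul {z : ℂ} (hz : ¬ IsPole z) : sl (I * z) = I * sl z := by
  rw [sl, SN_I_mul hz, sl]; ring

theorem cl_I_mul {z : ℂ} (hz : ¬ IsPole z) : cl (I * z) = cl z := by
  rw [cl_eq, deriv_SN_I_mul hz, cl_eq]

theorem sl_neg {z : ℂ} (hz : ¬ IsPole z) : sl (-z) = - sl z := by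
  rw [sl, SN_neg hz, sl]; ring

theorem cl_neg {z : ℂ} (hz : ¬ IsPole z) : cl (-z) = cl z := by
  rw [show -z = I * (I * z) by linear_combination (-z) * I_sq,
    cl_I_mul (by rwa [isPole_I_mul_iff]), cl_I_mul hz]

theorem sl_conj (z : ℂ) : sl ((starRingEnd ℂ) z) = (starRingEnd ℂ) (sl z) := by
  simp [sl, SN_conj]

theorem cl_conj (z : ℂ) : cl ((starRingEnd ℂ) z) = (starRingEnd ℂ) (cl z) := by
  simp [cl_eq, deriv_SN_conj]

theorem sl_eq_zero_of_isLat {z : ℂ} (hz : IsLat z) : sl z = 0 := by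
  rw [sl, SN_eq_zero_of_isLat hz, mul_zero]

theorem sl_ne_zero {z : ℂ} (hz : ¬ IsPole z) (hz2 : ¬ IsLat z) : sl z ≠ 0 :=
  mul_ne_zero (div_ne_zero slM_ne slC_ne) (SN_ne_zero hz hz2)

theorem analyticAt_sl {z : ℂ} (hz : ¬ IsPole z) : AnalyticAt ℂ sl z :=
  analyticAt_const.mul (analyticAt_SN hz)

theorem analyticAt_cl {z : ℂ} (hz : ¬ IsPole z) : AnalyticAt ℂ cl z := by
  have := (analyticAt_sl hz).deriv.mul (analyticAt_const (v := (slM : ℂ)⁻¹))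
  exact this

theorem meromorphicAt_sl (z : ℂ) : MeromorphicAt sl z :=
  (MeromorphicAt.const _ z).mul (meromorphicAt_SN z)

theorem meromorphicAt_cl (z : ℂ) : MeromorphicAt cl z := by
  have := (meromorphicAt_sl z).deriv.mul (MeromorphicAt.const (slM : ℂ)⁻¹ z)
  exact this

theorem hasDerivAt_sl {z : ℂ} (hz : ¬ IsPole z) : HasDerivAt sl (slM * cl z) z := by
  have := (analyticAt_sl hz).differentiableAt.hasDerivAt
  rwa [cl, mul_div_cancel₀ _ slM_ne]

theorem cl_sq {z : ℂ} (hz : ¬ IsPole z) : cl z ^ 2 = 1 - sl z ^ 4 := by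
  have h := deriv_SN_sq hz
  rw [← ofReal_slC] at h
  have h1 := slC_ne
  rw [cl_eq, sl]
  have h4 : (slM : ℂ) ^ 4 = Real.pi ^ 2 * slC ^ 2 := by
    rw [show 4 = 2 * 2 from rfl, pow_mul, slM_sq]; ring
  rw [mul_pow, div_pow, div_pow, h4]
  field_simp
  linear_combination h

theorem eventually_cl_ne_zero (z : ℂ) : ∀ᶠ w in 𝓝[≠] z, cl w ≠ 0 := by
  have h0 := isLat_zero.not_isPole
  have hc : MeromorphicOn cl univ := fun z _ => meromorphicAt_cl z
  have top0 : meromorphicOrderAt cl 0 ≠ ⊤ := by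
    rw [meromorphicOrderAt_ne_top_iff_eventually_ne_zero (meromorphicAt_cl 0)]
    exact nhdsWithin_le_nhds ((analyticAt_cl h0).continuousAt.eventually_ne
      (by rw [cl_zero]; exact one_ne_zero))
  have top1 : meromorphicOrderAt cl z ≠ ⊤ :=
    hc.meromorphicOrderAt_ne_top_of_isPreconnected isPreconnected_univ (mem_univ _) (mem_univ _) top0
  exact (meromorphicOrderAt_ne_top_iff_eventually_ne_zero (meromorphicAt_cl z)).1 top1

theorem hasDerivAt_cl {z : ℂ} (hz : ¬ IsPole z) : HasDerivAt cl (-2 * slM * sl z ^ 3) z := by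
  set G : ℂ → ℂ := fun w => deriv cl w + 2 * slM * sl w ^ 3 with hG
  have hGc : ContinuousAt G z :=
    (analyticAt_cl hz).deriv.continuousAt.add ((analyticAt_sl hz).continuousAt.pow 3 |>.const_mul _)
  have hop := isOpen_not_isPole
  have h1 : ∀ᶠ w in 𝓝[≠] z, G w = 0 := by
    filter_upwards [eventually_cl_ne_zero z, nhdsWithin_le_nhds (hop.mem_nhds hz)] with w hw hw2
    have e : (fun u => cl u ^ 2) =ᶠ[𝓝 w] fun u => 1 - sl u ^ 4 := by
      filter_upwards [hop.mem_nhds hw2] with u hu using cl_sq hu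
    have d1 := (((analyticAt_cl hw2).differentiableAt.hasDerivAt).pow 2).deriv
    have d2 := (((hasDerivAt_sl hw2).pow 4).const_sub 1).deriv
    have d3 := e.deriv_eq
    have d1' : deriv (fun u => cl u ^ 2) w = _ := d1
    have d2' : deriv (fun u => 1 - sl u ^ 4) w = _ := d2
    rw [d1', d2'] at d3
    norm_num at d3
    have : 2 * cl w * G w = 0 := by
      simp only [hG]; linear_combination d3
    simpa [hw] using this
  have h2 : G z = 0 := tendsto_nhds_unique (hGc.tendsto.mono_left (nhdsWithin_le_nhds (s := {z}ᶜ)))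
      (tendsto_const_nhds.congr' (h1.mono fun w hw => hw.symm))
  have := (analyticAt_cl hz).differentiableAt.hasDerivAt
  rwa [show deriv cl z = -2 * slM * sl z ^ 3 by simp only [hG] at h2; linear_combination h2] at this

theorem sl_add {a b : ℂ} (ha : ¬ IsPole a) (hb : ¬ IsPole b) (hab : ¬ IsPole (a + b)) :
    sl a * cl b + cl a * sl b = sl (a + b) * (1 + sl a ^ 2 * sl b ^ 2) := by
  set w := a + b with hw
  set X : ℂ → ℂ := fun x => sl x * cl (w - x) + cl x * sl (w - x) with hX
  set Y : ℂ → ℂ := fun x => 1 + sl x ^ 2 * sl (w - x) ^ 2 with hY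
  set U : Set ℂ := {x | ¬ IsPole x} ∩ {x | ¬ IsPole (w - x)} with hU
  have hUo : IsOpen U := isOpen_not_isPole.inter
    (isOpen_not_isPole.preimage (continuous_const.sub continuous_id))
  have hcount : (Uᶜ).Countable := by
    have h1 : {x | IsPole x}.Countable :=
      countable_isLat.preimage_of_injOn (f := fun z : ℂ => z - (1 + I) / 2)
        (fun x _ y _ h => sub_left_injective h)
    have h2 : {x | IsPole (w - x)}.Countable :=
      h1.preimage_of_injOn (f := fun z : ℂ => w - z) (fun x _ y _ h => sub_right_injective h)
    refine (h1.union h2).mono ?_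
    intro x hx
    simp only [hU, mem_compl_iff, mem_inter_iff, mem_ofPred_eq, not_and_or, not_not] at hx
    exact hx
  have hUc : IsPreconnected U := by
    have := hcount.isPathConnected_compl_of_one_lt_rank (by rw [Complex.rank_real_complex]; norm_num)
    rw [compl_compl] at this
    exact this.isConnected.isPreconnected
  have d : ∀ x ∈ U, HasDerivAt (fun x => sl (w - x)) (-(slM * cl (w - x))) x ∧
      HasDerivAt (fun x => cl (w - x)) (2 * slM * sl (w - x) ^ 3) x := by
    intro x hx
    refine ⟨?_, ?_⟩
    · simpa using (hasDerivAt_sl hx.2).comp_const_sub w x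
    · exact ((hasDerivAt_cl hx.2).comp_const_sub w x).congr_deriv (by ring)
  set W : ℂ → ℂ := fun x => X x - sl w * Y x with hW
  have dX : ∀ x ∈ U, HasDerivAt X (2 * slM * (sl x * sl (w - x) ^ 3 - sl x ^ 3 * sl (w - x))) x := by
    intro x hx
    have := ((hasDerivAt_sl hx.1).mul (d x hx).2).add ((hasDerivAt_cl hx.1).mul (d x hx).1)
    exact HasDerivAt.congr_deriv (f := X) this (by ring)
  have dY : ∀ x ∈ U, HasDerivAt Y (2 * slM * sl x * sl (w - x) *
      (cl x * sl (w - x) - sl x * cl (w - x))) x := by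
    intro x hx
    have := (((hasDerivAt_sl hx.1).pow 2).mul ((d x hx).1.pow 2)).const_add 1
    exact HasDerivAt.congr_deriv (f := Y) this (by norm_num; ring)
  have dW : ∀ x ∈ U, HasDerivAt W (2 * slM * (sl x * sl (w - x) ^ 3 - sl x ^ 3 * sl (w - x)) -
      sl w * (2 * slM * sl x * sl (w - x) * (cl x * sl (w - x) - sl x * cl (w - x)))) x :=
    fun x hx => (dX x hx).sub ((dY x hx).const_mul _)
  have h0U : (0 : ℂ) ∈ U := ⟨isLat_zero.not_isPole, by simpa using hab⟩
  have haU : a ∈ U := ⟨ha, by simpa [hw] using hb⟩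
  have hY0 : Y 0 = 1 := by simp [hY, sl_zero]
  have hW0 : W 0 = 0 := by simp [hW, hX, hY0, sl_zero, cl_zero]
  obtain ⟨r, hr, hball⟩ := Metric.mem_nhds_iff.1 (Filter.inter_mem (hUo.mem_nhds h0U)
    ((dY 0 h0U).continuousAt.eventually_ne (by rw [hY0]; exact one_ne_zero)))
  have hD : ∀ x ∈ Metric.ball (0 : ℂ) r, HasDerivAt (fun x => W x / Y x) 0 x := by
    intro x hx
    obtain ⟨hxU, hxY⟩ := hball hx
    have hxY : Y x ≠ 0 := hxY
    have := (dW x hxU).div (dY x hxU) hxY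
    refine HasDerivAt.congr_deriv (f := fun x => W x / Y x) this ?_
    rw [div_eq_zero_iff]
    left
    have e1 := cl_sq hxU.1
    have e2 := cl_sq hxU.2
    simp only [hW, hX, hY]
    linear_combination (2 * slM * sl x * sl (w - x)) * (- sl (w - x) ^ 2 * e1 + sl x ^ 2 * e2)
  have hzero : ∀ x ∈ Metric.ball (0 : ℂ) r, W x = 0 := by
    intro x hx
    have := Metric.isOpen_ball.is_const_of_deriv_eq_zero (𝕜 := ℂ)
      (convex_ball (0 : ℂ) r).isPreconnected
      (fun x hx => (hD x hx).differentiableAt.differentiableWithinAt)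
      (fun x hx => (hD x hx).deriv) hx (Metric.mem_ball_self hr)
    simp only [hW0, zero_div] at this
    exact (div_eq_zero_iff.1 this).resolve_right (hball hx).2
  have han : AnalyticOnNhd ℂ W U := fun x hx =>
    (DifferentiableOn.analyticAt (s := U) (fun y hy =>
      (dW y hy).differentiableAt.differentiableWithinAt) (hUo.mem_nhds hx))
  have := han.eqOn_zero_of_preconnected_of_eventuallyEq_zero hUc h0U
    (by filter_upwards [Metric.ball_mem_nhds (0 : ℂ) hr] with x hx using hzero x hx) haU
  simp only [hW, hX, hY, Pi.zero_apply] at this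
  rw [show w - a = b by rw [hw]; ring] at this
  linear_combination this

theorem cl_add {a b : ℂ} (ha : ¬ IsPole a) (hb : ¬ IsPole b) (hab : ¬ IsPole (a + b)) :
    cl (a + b) * (1 + sl a ^ 2 * sl b ^ 2) ^ 2 =
      cl a * cl b * (1 - sl a ^ 2 * sl b ^ 2) - 2 * sl a * sl b * (sl a ^ 2 + sl b ^ 2) := by
  have hop := isOpen_not_isPole
  have e : (fun x => sl x * cl b + cl x * sl b) =ᶠ[𝓝 a]
      fun x => sl (x + b) * (1 + sl x ^ 2 * sl b ^ 2) := by
    have : ∀ᶠ x in 𝓝 a, ¬ IsPole (x + b) :=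
      (hop.preimage (continuous_id.add continuous_const)).mem_nhds hab
    filter_upwards [hop.mem_nhds ha, this] with x h1 h2 using sl_add h1 hb h2
  have d1 := (((hasDerivAt_sl ha).mul_const (cl b)).add ((hasDerivAt_cl ha).mul_const (sl b))).deriv
  have d2 := (((hasDerivAt_sl hab).comp_add_const a b).mul
    ((((hasDerivAt_sl ha).pow 2).mul_const (sl b ^ 2)).const_add 1)).deriv
  have d3 := e.deriv_eq
  have d1' : deriv (fun x => sl x * cl b + cl x * sl b) a = _ := d1
  have d2' : deriv (fun x => sl (x + b) * (1 + sl x ^ 2 * sl b ^ 2)) a = _ := d2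
  rw [d1', d2'] at d3
  norm_num at d3
  have h1 := sl_add ha hb hab
  have e1 := cl_sq ha
  have hM := slM_ne
  have d4 : cl a * cl b - 2 * sl a ^ 3 * sl b = cl (a + b) * (1 + sl a ^ 2 * sl b ^ 2) +
      sl (a + b) * (2 * sl a * cl a * sl b ^ 2) := by
    apply mul_left_cancel₀ hM
    linear_combination d3
  linear_combination (-(1 + sl a ^ 2 * sl b ^ 2)) * d4 + 2 * sl a * cl a * sl b ^ 2 * h1
    - 2 * sl a * sl b ^ 3 * e1

theorem sl_two_mul {a : ℂ} (ha : ¬ IsPole a) (h2 : ¬ IsPole (2 * a)) :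
    sl (2 * a) * (1 + sl a ^ 4) = 2 * sl a * cl a := by
  have := sl_add ha ha (by rwa [← two_mul])
  rw [← two_mul] at this
  linear_combination -this

end

section
open Filter Topology Set

theorem not_isLat_ofReal {x : ℝ} (h0 : 0 < x) (h1 : x < 1) : ¬ IsLat (x : ℂ) := by
  intro h
  obtain ⟨m, n, h2, h3⟩ := h.im_re
  rw [ofReal_re] at h2
  rw [h2] at h0 h1
  have h0 : 0 < m := by exact_mod_cast h0
  have h1 : m < 1 := by exact_mod_cast h1
  omega

/-- The real restriction of `sl`. -/
def slR (x : ℝ) : ℝ := (sl x).re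

/-- The real restriction of `cl`. -/
def clR (x : ℝ) : ℝ := (cl x).re

theorem ofReal_slR (x : ℝ) : (slR x : ℂ) = sl x := by
  have h := sl_conj x
  rw [conj_ofReal] at h
  exact conj_eq_iff_re.1 h.symm

theorem ofReal_clR (x : ℝ) : (clR x : ℂ) = cl x := by
  have h := cl_conj x
  rw [conj_ofReal] at h
  exact conj_eq_iff_re.1 h.symm

theorem hasDerivAt_slR (x : ℝ) : HasDerivAt slR (slM * clR x) x := by
  have := (hasDerivAt_sl (not_isPole_ofReal x)).real_of_complex
  rw [show (slM * cl x : ℂ).re = slM * clR x by simp [clR]] at this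
  exact this

theorem clR_sq (x : ℝ) : clR x ^ 2 = 1 - slR x ^ 4 := by
  have := cl_sq (not_isPole_ofReal x)
  rw [← ofReal_slR, ← ofReal_clR] at this
  exact_mod_cast this

theorem continuous_clR : Continuous clR := by
  rw [continuous_iff_continuousAt]
  intro x
  have := (hasDerivAt_cl (not_isPole_ofReal x)).real_of_complex
  exact this.continuousAt

theorem clR_ne_zero {x : ℝ} (h0 : 0 ≤ x) (h1 : x < 1 / 2) : clR x ≠ 0 := by
  intro h
  rcases h0.eq_or_lt with rfl | h0
  · have : clR 0 = 1 := by
      have := ofReal_clR 0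
      rw [ofReal_zero, cl_zero] at this
      exact_mod_cast this
    rw [this] at h
    exact one_ne_zero h
  have hs := clR_sq x
  rw [h] at hs
  have e := sl_two_mul (not_isPole_ofReal x) (by exact_mod_cast not_isPole_ofReal (2 * x))
  rw [← ofReal_clR, h, ← ofReal_slR x] at e
  have hs' : (slR x : ℂ) ^ 4 = 1 := by exact_mod_cast (by linarith : slR x ^ 4 = 1)
  rw [hs'] at e
  have hne := sl_ne_zero (z := 2 * x) (by exact_mod_cast not_isPole_ofReal (2 * x))
    (by exact_mod_cast not_isLat_ofReal (x := 2 * x) (by linarith) (by linarith))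
  apply hne
  have : sl (2 * x) * (1 + 1) = 0 := by rw [e]; simp
  norm_num at this
  exact this

theorem clR_pos {x : ℝ} (h0 : 0 ≤ x) (h1 : x < 1 / 2) : 0 < clR x := by
  have hz : clR 0 = 1 := by
    have := ofReal_clR 0
    rw [ofReal_zero, cl_zero] at this
    exact_mod_cast this
  by_contra hneg
  push Not at hneg
  obtain ⟨y, hy, hy2⟩ := intermediate_value_Icc' h0 continuous_clR.continuousOn
    (show (0 : ℝ) ∈ Icc (clR x) (clR 0) from ⟨hneg, by rw [hz]; exact zero_le_one⟩)
  exact clR_ne_zero hy.1 (hy.2.trans_lt h1) hy2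

theorem continuous_slR : Continuous slR :=
  continuous_iff_continuousAt.2 fun x => (hasDerivAt_slR x).continuousAt

theorem strictMonoOn_slR : StrictMonoOn slR (Icc 0 (1 / 2)) := by
  refine strictMonoOn_of_deriv_pos (convex_Icc _ _) continuous_slR.continuousOn ?_
  intro x hx
  rw [interior_Icc] at hx
  rw [(hasDerivAt_slR x).deriv]
  exact mul_pos slM_pos (clR_pos hx.1.le hx.2)

theorem slR_zero : slR 0 = 0 := by
  have := ofReal_slR 0
  rw [ofReal_zero, sl_zero] at this
  exact_mod_cast this

theorem sl_half_sq : sl (1 / 2) ^ 2 = 1 := by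
  have hp : (Real.pi : ℂ) ≠ 0 := by exact_mod_cast Real.pi_ne_zero
  have := slC_ne
  rw [sl, mul_pow, SN_half_sq, div_pow, slM_sq]
  field_simp

theorem slR_half : slR (1 / 2) = 1 := by
  have h1 : 0 < slR (1 / 2) := by
    rw [← slR_zero]
    exact strictMonoOn_slR ⟨le_rfl, by norm_num⟩ ⟨by norm_num, le_rfl⟩ (by norm_num)
  have h2 := sl_half_sq
  have h3 := ofReal_slR (1 / 2)
  push_cast at h3
  rw [← h3] at h2
  have h2 : slR (1 / 2) ^ 2 = 1 := by exact_mod_cast h2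
  nlinarith

theorem sl_half : sl (1 / 2) = 1 := by
  have h3 := ofReal_slR (1 / 2)
  push_cast at h3
  rw [← h3, slR_half, ofReal_one]

theorem cl_half : cl (1 / 2) = 0 := by
  have := cl_sq not_isPole_half
  rw [sl_half] at this
  simpa using this

theorem slM_eq_varpi : slM = varpi := by
  have him : slR '' (Ioo 0 (1 / 2)) = Ioo 0 1 := by
    apply Subset.antisymm
    · rintro _ ⟨x, hx, rfl⟩
      refine ⟨?_, ?_⟩
      · rw [← slR_zero]
        exact strictMonoOn_slR ⟨le_rfl, by norm_num⟩ ⟨hx.1.le, hx.2.le⟩ hx.1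
      · rw [← slR_half]
        exact strictMonoOn_slR ⟨hx.1.le, hx.2.le⟩ ⟨by norm_num, le_rfl⟩ hx.2
    · have := intermediate_value_Ioo (by norm_num : (0 : ℝ) ≤ 1 / 2) continuous_slR.continuousOn
      rwa [slR_zero, slR_half] at this
  have h := MeasureTheory.integral_image_eq_integral_abs_deriv_smul (s := Ioo (0 : ℝ) (1 / 2))
    measurableSet_Ioo (fun x _ => (hasDerivAt_slR x).hasDerivWithinAt)
    (strictMonoOn_slR.injOn.mono Ioo_subset_Icc_self) fun x => (1 - x ^ 4) ^ (-(1 : ℝ) / 2)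
  rw [him] at h
  rw [varpi, intervalIntegral.integral_of_le zero_le_one,
    MeasureTheory.integral_Ioc_eq_integral_Ioo, h,
    MeasureTheory.setIntegral_congr_fun measurableSet_Ioo (g := fun _ => slM)]
  · rw [MeasureTheory.setIntegral_const]
    simp
  · intro x hx
    have hc := clR_pos hx.1.le hx.2
    simp only
    rw [← clR_sq, smul_eq_mul, abs_of_pos (mul_pos slM_pos hc), ← Real.rpow_natCast,
      ← Real.rpow_mul hc.le, show ((2 : ℕ) : ℝ) * (-(1 : ℝ) / 2) = -1 by norm_num,
      Real.rpow_neg_one, mul_assoc, mul_inv_cancel₀ hc.ne', mul_one]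

theorem varpi_ne_zero : (varpi : ℂ) ≠ 0 := by rw [← slM_eq_varpi]; exact slM_ne

/-- The period pair `(ϖ, ϖ i)`. -/
def lemnL : PeriodPair where
  ω₁ := varpi
  ω₂ := varpi * I
  indep := by
    rw [LinearIndependent.pair_iff]
    intro a b h
    have h1 : (varpi : ℂ) * (a + b * I) = 0 := by
      simp only [real_smul] at h; linear_combination h
    have h2 := (mul_eq_zero.1 h1).resolve_left varpi_ne_zero
    exact ⟨by simpa using congrArg re h2, by simpa using congrArg im h2⟩

theorem mem_lemnL_iff {z : ℂ} : varpi * z ∈ lemnL.lattice ↔ IsLat z := by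
  rw [PeriodPair.mem_lattice]
  refine exists_congr fun m => exists_congr fun n => ?_
  have h : (m * lemnL.ω₁ + n * lemnL.ω₂ : ℂ) = varpi * (m + n * I) := by
    simp only [lemnL]; ring
  rw [h]
  exact ⟨fun h => (mul_left_cancel₀ varpi_ne_zero h).symm, fun h => by rw [h]⟩

theorem coe_latticeEquiv_symm (x : ℤ × ℤ) : ((lemnL.latticeEquivProd.symm x : lemnL.lattice) : ℂ) = ω4 x := by
  rw [PeriodPair.latticeEquiv_symm_apply, ω4]
  simp only [lemnL]; ring

theorem wp4_eq (u : ℂ) : wp4 u = PeriodPair.weierstrassP lemnL u := by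
  have hs := (lemnL.hasSum_weierstrassP u)
  have hs2 := (lemnL.latticeEquivProd.symm.toEquiv.hasSum_iff).2 hs
  have h := hs2.summable.tsum_eq_add_tsum_ite 0
  rw [hs2.tsum_eq] at h
  rw [h, wp4]
  simp [coe_latticeEquiv_symm, ← one_div]

theorem wp4'_eq (u : ℂ) : wp4' u = PeriodPair.derivWeierstrassP lemnL u := by
  have hs := (lemnL.hasSum_derivWeierstrassP u)
  have hs2 := (lemnL.latticeEquivProd.symm.toEquiv.hasSum_iff).2 hs
  rw [← hs2.tsum_eq, wp4']
  refine tsum_congr fun m => ?_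
  simp [coe_latticeEquiv_symm, div_eq_mul_inv]

end

section
open Filter Topology Set

theorem sl_shift_mul {z : ℂ} (hz : ¬ IsPole z) (hz2 : ¬ IsLat z) :
    sl (z + (1 + I) / 2) * sl z = -I := by
  obtain ⟨C, -, hC, h⟩ := exists_SN_shift_mul
  have h1 := h z hz hz2
  rw [hC, ← ofReal_slC] at h1
  have hp : (Real.pi : ℂ) ≠ 0 := by exact_mod_cast Real.pi_ne_zero
  have h2 := slC_ne
  have : sl (z + (1 + I) / 2) * sl z = slM ^ 2 / slC ^ 2 * (SN (z + (1 + I) / 2) * SN z) := by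
    rw [sl, sl]; ring
  rw [this, h1, slM_sq]
  have := I_ne_zero
  field_simp
  rw [I_sq]; norm_num

theorem wp4_I_mul (u : ℂ) : wp4 (I * u) = - wp4 u := by
  let e : ℤ × ℤ ≃ ℤ × ℤ :=
    { toFun := fun m => (-m.2, m.1), invFun := fun m => (m.2, -m.1)
      left_inv := fun m => by simp, right_inv := fun m => by simp }
  have he : ∀ m, ω4 (e m) = I * ω4 m := by
    intro m
    simp only [ω4, e, Equiv.coe_fn_mk]
    push_cast
    linear_combination (-(varpi : ℂ) * m.2) * I_sq
  have h0 : ∀ m, e m = 0 ↔ m = 0 := by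
    intro m
    simp only [e, Equiv.coe_fn_mk, Prod.ext_iff, Prod.fst_zero, Prod.snd_zero]
    omega
  have key : ∀ x : ℂ, ((I * x) ^ 2)⁻¹ = - (x ^ 2)⁻¹ := by
    intro x; rw [mul_pow, I_sq, mul_inv]; norm_num
  rw [wp4, wp4, ← e.tsum_eq, key, neg_add, ← tsum_neg]
  congr 1
  refine tsum_congr fun m => ?_
  simp only [h0, he, ← mul_sub, key]
  split_ifs
  · simp
  · ring

theorem wp4_add_lat (z : ℂ) {l : ℂ} (hl : IsLat l) : wp4 (varpi * (z + l)) = wp4 (varpi * z) := by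
  rw [wp4_eq, wp4_eq, mul_add]
  exact lemnL.weierstrassP_add_coe _ ⟨_, mem_lemnL_iff.2 hl⟩

theorem meromorphicAt_wp4 (z : ℂ) : MeromorphicAt (fun z => wp4 (varpi * z)) z := by
  have h : MeromorphicAt (PeriodPair.weierstrassP lemnL) (varpi * z) := lemnL.meromorphic_weierstrassP _
  simp only [wp4_eq]
  exact h.comp_analyticAt (g := fun w : ℂ => varpi * w) (by fun_prop)

theorem analyticAt_wp4 {z : ℂ} (hz : ¬ IsLat z) : AnalyticAt ℂ (fun z => wp4 (varpi * z)) z := by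
  simp only [wp4_eq]
  exact (lemnL.analyticOnNhd_weierstrassP (varpi * z)
    (fun h => hz (mem_lemnL_iff.1 h))).comp_of_eq (by fun_prop) rfl

theorem hasDerivAt_wp4 {z : ℂ} (hz : ¬ IsLat z) :
    HasDerivAt (fun z => wp4 (varpi * z)) (varpi * wp4' (varpi * z)) z := by
  simp only [wp4_eq, wp4'_eq]
  have h := (lemnL.analyticOnNhd_weierstrassP (varpi * z)
    (fun h => hz (mem_lemnL_iff.1 h))).differentiableAt.hasDerivAt
  rw [PeriodPair.deriv_weierstrassP] at h
  have h2 : HasDerivAt (fun z : ℂ => (varpi : ℂ) * z) varpi z := by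
    simpa using (hasDerivAt_id z).const_mul (varpi : ℂ)
  exact (h.comp z h2).congr_deriv (by ring)

theorem tendsto_sq_mul_wp4 : Tendsto (fun x => x ^ 2 * wp4 (varpi * x)) (𝓝[≠] 0)
    (𝓝 (((varpi : ℂ) ^ 2)⁻¹)) := by
  have hc : ContinuousAt (fun z : ℂ => lemnL.weierstrassPExcept 0 (varpi * z)) 0 := by
    have : ContinuousAt (lemnL.weierstrassPExcept 0) (varpi * 0) := by
      rw [mul_zero]
      exact (lemnL.analyticAt_weierstrassPExcept 0).continuousAt
    exact ContinuousAt.comp (f := fun w : ℂ => (varpi : ℂ) * w) this (by fun_prop)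
  have h1 : ContinuousAt (fun z : ℂ => ((varpi : ℂ) ^ 2)⁻¹ +
      z ^ 2 * lemnL.weierstrassPExcept 0 (varpi * z)) 0 :=
    ContinuousAt.add (by fun_prop) (ContinuousAt.mul (by fun_prop) hc)
  have h2 := h1.tendsto.mono_left (nhdsWithin_le_nhds (s := {0}ᶜ))
  simp only [ne_eq, OfNat.ofNat_ne_zero, not_false_eq_true, zero_pow, zero_mul, add_zero] at h2
  refine h2.congr' ?_
  filter_upwards [self_mem_nhdsWithin] with x hx
  have hx : x ≠ 0 := hx
  have := varpi_ne_zero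
  rw [wp4_eq]
  have := lemnL.weierstrassPExcept_def 0 (varpi * x)
  simp only [ZeroMemClass.coe_zero, sub_zero] at this
  rw [this]
  norm_num
  field_simp
  ring

theorem tendsto_sq_div_sl : Tendsto (fun x => x ^ 2 * (sl x ^ 2)⁻¹) (𝓝[≠] 0)
    (𝓝 (((varpi : ℂ) ^ 2)⁻¹)) := by
  have hd := hasDerivAt_sl isLat_zero.not_isPole
  rw [cl_zero, mul_one, slM_eq_varpi] at hd
  have hs := ((hasDerivAt_iff_tendsto_slope.1 hd).inv₀ varpi_ne_zero).pow 2
  rw [inv_pow] at hs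
  refine hs.congr fun x => ?_
  rw [slope_def_field, sl_zero, sub_zero, sub_zero, inv_div, div_pow, div_eq_mul_inv]

theorem wp4_eq_sl {z : ℂ} (hz : ¬ IsPole z) (hz2 : ¬ IsLat z) :
    wp4 (varpi * z) = (sl z ^ 2)⁻¹ := by
  set D : ℂ → ℂ := fun z => wp4 (varpi * z) - (sl z ^ 2)⁻¹ with hD
  have hDm : ∀ z, MeromorphicAt D z := fun z =>
    (meromorphicAt_wp4 z).fun_sub ((meromorphicAt_sl z).fun_pow 2).fun_inv
  have D1 : ∀ z, D (z + 1) = 1 * D z := fun z => by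
    simp only [hD, wp4_add_lat z isLat_one, sl_add_one]; ring
  have D2 : ∀ z, D (z + I) = 1 * D z := fun z => by
    simp only [hD, wp4_add_lat z isLat_I, sl_add_I]; ring
  have hDc : ∀ z, ¬ IsPole z → ¬ IsLat z → ContinuousAt D z := fun z h1 h2 =>
    (analyticAt_wp4 h2).continuousAt.sub (((analyticAt_sl h1).continuousAt.pow 2).inv₀
      (pow_ne_zero _ (sl_ne_zero h1 h2)))
  have hsym : ∀ x, ¬ IsPole x → D (I * x) = -1 * D x := by
    intro x hx
    simp only [hD, mul_left_comm (varpi : ℂ) I, wp4_I_mul, sl_I_mul hx, mul_pow, I_sq]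
    rw [neg_one_mul (sl x ^ 2), inv_neg]; ring
  have h0 : Tendsto (fun x => x * D x) (𝓝[≠] 0) (𝓝 0) := by
    refine tendsto_mul_zero_of_symm (c := I) (d := -1) (N := 2) (hDm 0) I_ne_zero ?_ ?_ ?_
    · filter_upwards [eventually_not_isPole 0] with x hx using hsym x hx
    · have := tendsto_sq_mul_wp4.sub tendsto_sq_div_sl
      rw [sub_self] at this
      refine this.congr fun x => ?_
      simp only [hD]; ring
    · intro n hn hlt
      by_contra hneg
      have : n = -1 := by push_cast at hlt; omega
      subst this
      have := congrArg re hn; simp at this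
  have hp : ∀ z, IsPole z → Tendsto (fun w => (w - z) * D w) (𝓝[≠] z) (𝓝 0) := by
    intro z hz
    have hl : ¬ IsLat z := fun h => h.not_isPole hz
    have c1 : ContinuousAt (fun w => wp4 (varpi * w) + sl (w + (1 + I) / 2) ^ 2) z := by
      refine (analyticAt_wp4 hl).continuousAt.add (ContinuousAt.pow ?_ 2)
      exact ContinuousAt.comp (f := fun w : ℂ => w + (1 + I) / 2)
        (analyticAt_sl (by rwa [isPole_add_half_iff])).continuousAt (by fun_prop)
    refine (tendsto_sub_mul_zero c1).congr' ?_
    filter_upwards [eventually_not_isPole z, eventually_not_isLat z] with w h1 h2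
    have e := sl_shift_mul h1 h2
    have hs := sl_ne_zero h1 h2
    simp only [hD]
    congr 1
    rw [show sl (w + (1 + I) / 2) = -I / sl w by rw [← e]; field_simp, div_pow, neg_sq, I_sq]
    ring
  obtain ⟨C, hC, -, -⟩ := liouville_const' hDm (by simp) (by simp) D1 D2 (fun z => by
    by_cases hz : IsPole z
    · exact ⟨0, 0, z, by simp, hp z hz⟩
    · by_cases hz2 : IsLat z
      · obtain ⟨m, n, rfl⟩ := hz2
        exact ⟨m, n, 0, by simp, by simpa using h0⟩
      · exact ⟨0, 0, z, by simp, tendsto_sub_mul_zero (hDc z hz hz2)⟩)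
  have hval : ∀ z, ¬ IsPole z → ¬ IsLat z → D z = C := fun z hz hz2 =>
    tendsto_nhds_unique ((hDc z hz hz2).tendsto.mono_left (nhdsWithin_le_nhds (s := {z}ᶜ)))
      (tendsto_const_nhds.congr' ((hC z).mono fun w hw => hw.symm))
  have e1 := hval z hz hz2
  have e2 := hval (I * z) (by rwa [isPole_I_mul_iff]) (by rwa [isLat_I_mul_iff])
  rw [hsym z hz, e1] at e2
  have : C = 0 := by linear_combination (-1 / 2 : ℂ) * e2
  rw [this] at e1
  exact sub_eq_zero.1 e1

theorem wp4'_eq_sl {z : ℂ} (hz : ¬ IsPole z) (hz2 : ¬ IsLat z) :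
    wp4' (varpi * z) = -2 * cl z / sl z ^ 3 := by
  have hs := sl_ne_zero hz hz2
  have e : (fun z => wp4 (varpi * z)) =ᶠ[𝓝 z] fun z => (sl z ^ 2)⁻¹ := by
    filter_upwards [isOpen_not_isPole.mem_nhds hz, isOpen_not_isLat.mem_nhds hz2] with w h1 h2
      using wp4_eq_sl h1 h2
  have d1 := e.deriv_eq
  have d2 := (((hasDerivAt_sl hz).pow 2).inv (pow_ne_zero 2 hs)).deriv
  have d2' : deriv (fun z => (sl z ^ 2)⁻¹) z = _ := d2
  rw [(hasDerivAt_wp4 hz2).deriv, d2', slM_eq_varpi] at d1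
  apply mul_left_cancel₀ varpi_ne_zero
  rw [d1]
  norm_num
  field_simp

/-- The lemniscatic sine `φ`. -/
def phi (u : ℂ) : ℂ := sl ((1 - I) * u)

/-- The lemniscatic cosine `ψ`. -/
def psi (u : ℂ) : ℂ := sl ((1 - I) * u + 1 / 2)

/-- The normalized derivative of `φ`. -/
def phid (u : ℂ) : ℂ := cl ((1 - I) * u)

theorem isLat_one_sub_I : IsLat (1 - I) := isLat_one.sub isLat_I
theorem isLat_two : IsLat 2 := by simpa using isLat_int 2

theorem not_isPole_of_four {u : ℂ} (h : ¬ IsLat (4 * u)) : ¬ IsPole u := by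
  intro hp
  have := (isLat_two.mul isLat_one_sub_I).mul (isPole_mul_one_add_I hp)
  rw [show 2 * (1 - I) * ((1 + I) * u) = 4 * u by linear_combination (-2 * u) * I_sq] at this
  exact h this

theorem not_isPole_two_of_four {u : ℂ} (h : ¬ IsLat (4 * u)) : ¬ IsPole (2 * u) := by
  intro hp
  have := isLat_one_sub_I.mul (isPole_mul_one_add_I hp)
  rw [show (1 - I) * ((1 + I) * (2 * u)) = 4 * u by linear_combination (-2 * u) * I_sq] at this
  exact h this

theorem not_isPole_sub_of_four {u : ℂ} (h : ¬ IsLat (4 * u)) : ¬ IsPole ((1 - I) * u) := by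
  intro hp
  have := isLat_two.mul (isPole_mul_one_add_I hp)
  rw [show 2 * ((1 + I) * ((1 - I) * u)) = 4 * u by linear_combination (-2 * u) * I_sq] at this
  exact h this

theorem not_isPole_sub_half_of_four {u : ℂ} (h : ¬ IsLat (4 * u)) :
    ¬ IsPole ((1 - I) * u + 1 / 2) := by
  intro hp
  have := (isLat_two.mul (isPole_mul_one_add_I hp)).sub (isLat_one.add isLat_I)
  rw [show 2 * ((1 + I) * ((1 - I) * u + 1 / 2)) - (1 + I) = 4 * u by
    linear_combination (-2 * u) * I_sq] at this
  exact h this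

theorem cl_ne_zero_of_four {u : ℂ} (h : ¬ IsLat (4 * u)) : cl u ≠ 0 := by
  intro h0
  have hp := not_isPole_of_four h
  have e := sl_two_mul hp (not_isPole_two_of_four h)
  have e2 := cl_sq hp
  rw [h0] at e e2
  rw [show sl u ^ 4 = 1 by linear_combination e2, mul_zero, mul_eq_zero] at e
  norm_num at e
  refine sl_ne_zero (not_isPole_two_of_four h) (fun hl => h ?_) e
  have := isLat_two.mul hl
  rwa [← mul_assoc, show (2 * 2 : ℂ) = 4 by norm_num] at this

theorem one_add_sl_four_ne {u : ℂ} (h : ¬ IsLat (4 * u)) : 1 + sl u ^ 4 ≠ 0 := by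
  intro h0
  have hp := not_isPole_of_four h
  have e := sl_two_mul hp (not_isPole_two_of_four h)
  rw [h0, mul_zero] at e
  have hl : ¬ IsLat u := fun hl => h (by simpa using (isLat_int 4).mul hl)
  exact mul_ne_zero (mul_ne_zero two_ne_zero (sl_ne_zero hp hl)) (cl_ne_zero_of_four h) e.symm

theorem sl_one_sub_I_mul {u : ℂ} (h : ¬ IsPole u) (h2 : ¬ IsPole ((1 - I) * u)) :
    sl ((1 - I) * u) * cl u ^ 2 = (1 - I) * sl u * cl u := by
  have hI : ¬ IsPole (-(I * u)) := by rwa [isPole_neg_iff, isPole_I_mul_iff]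
  have e := sl_add h hI (by rwa [show u + -(I * u) = (1 - I) * u by ring])
  rw [sl_neg (by rwa [isPole_I_mul_iff]), cl_neg (by rwa [isPole_I_mul_iff]), sl_I_mul h,
    cl_I_mul h, show u + -(I * u) = (1 - I) * u by ring] at e
  rw [cl_sq h]
  linear_combination -e - sl ((1 - I) * u) * sl u ^ 4 * I_sq

theorem cl_one_sub_I_mul {u : ℂ} (h : ¬ IsPole u) (h2 : ¬ IsPole ((1 - I) * u))
    (h3 : cl u ≠ 0) : cl ((1 - I) * u) * cl u ^ 2 = 1 + sl u ^ 4 := by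
  have hI : ¬ IsPole (-(I * u)) := by rwa [isPole_neg_iff, isPole_I_mul_iff]
  have e := cl_add h hI (by rwa [show u + -(I * u) = (1 - I) * u by ring])
  rw [sl_neg (by rwa [isPole_I_mul_iff]), cl_neg (by rwa [isPole_I_mul_iff]), sl_I_mul h,
    cl_I_mul h, show u + -(I * u) = (1 - I) * u by ring] at e
  rw [show (-(I * sl u)) ^ 2 = -sl u ^ 2 by linear_combination (sl u ^ 2) * I_sq] at e
  have e2 := cl_sq h
  rw [show (1 + sl u ^ 2 * -sl u ^ 2) = cl u ^ 2 by rw [e2]; ring] at e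
  apply mul_left_cancel₀ (pow_ne_zero 2 h3)
  linear_combination e

theorem sl_add_half {z : ℂ} (h : ¬ IsPole z) (h2 : ¬ IsPole (z + 1 / 2)) :
    sl (z + 1 / 2) * (1 + sl z ^ 2) = cl z := by
  have e := sl_add h not_isPole_half h2
  rw [sl_half, cl_half] at e
  linear_combination -e

theorem phi4_eq {u : ℂ} (h : ¬ IsLat (4 * u)) : phi4 u = phi u := by
  have hl : ¬ IsLat u := fun hl => h (by simpa using (isLat_int 4).mul hl)
  have hp := not_isPole_of_four h
  have hs := sl_ne_zero hp hl
  have hc := cl_ne_zero_of_four h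
  have e := sl_one_sub_I_mul hp (not_isPole_sub_of_four h)
  rw [phi4, wp4_eq_sl hp hl, wp4'_eq_sl hp hl, phi]
  apply mul_right_cancel₀ (pow_ne_zero 2 hc)
  rw [e]
  field_simp

theorem psi4_eq {u : ℂ} (h : ¬ IsLat (4 * u)) : psi4 u = psi u := by
  have hl : ¬ IsLat u := fun hl => h (by simpa using (isLat_int 4).mul hl)
  have hp := not_isPole_of_four h
  have hs := sl_ne_zero hp hl
  have hc := cl_ne_zero_of_four h
  have hp2 := not_isPole_sub_of_four h
  have e := sl_one_sub_I_mul hp hp2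
  have e2 := cl_one_sub_I_mul hp hp2 hc
  have e3 := sl_add_half hp2 (not_isPole_sub_half_of_four h)
  have h4 := one_add_sl_four_ne h
  have e4 := cl_sq hp
  have hm : 1 - I * sl u ^ 2 ≠ 0 := by
    intro h0; apply h4
    linear_combination (1 + I * sl u ^ 2) * h0 + sl u ^ 4 * I_sq
  have e1 : sl ((1 - I) * u) * cl u = (1 - I) * sl u := by
    apply mul_right_cancel₀ hc; linear_combination e
  rw [psi4, wp4_eq_sl hp hl, psi]
  have e5 : sl ((1 - I) * u + 1 / 2) * (1 - I * sl u ^ 2) ^ 2 = 1 + sl u ^ 4 := by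
    rw [← e2, ← e3]
    linear_combination (-sl ((1 - I) * u + 1 / 2)) * (e4 + (sl ((1 - I) * u) * cl u + (1 - I) * sl u) * e1
      + (-sl u ^ 4 + sl u ^ 2) * I_sq)
  have e6 : sl ((1 - I) * u + 1 / 2) * (1 - I * sl u ^ 2) = 1 + I * sl u ^ 2 := by
    apply mul_right_cancel₀ hm
    linear_combination e5 + sl u ^ 4 * I_sq
  have hm2 : (sl u ^ 2)⁻¹ - I ≠ 0 := by
    intro h0; apply hm
    have : (sl u ^ 2)⁻¹ * sl u ^ 2 = 1 := inv_mul_cancel₀ (pow_ne_zero 2 hs)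
    linear_combination sl u ^ 2 * h0 - this
  rw [div_eq_iff hm2]
  have : (sl u ^ 2)⁻¹ * sl u ^ 2 = 1 := inv_mul_cancel₀ (pow_ne_zero 2 hs)
  linear_combination (-(sl u ^ 2)⁻¹) * e6 + (-I + -I * sl ((1 - I) * u + 1 / 2)) * this

end

section
open Filter Topology Set

/-- A primary prime `π = 1 - 2(1-i)d` of `ℤ[i]` of prime norm `p ≡ 1 (mod 8)`, with an integer `j`
such that `j ≡ i (mod π)`. -/
structure PrimaryPrime (p : ℕ) (π d : ℂ) (j : ℤ) : Prop where
  prime : p.Prime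
  mod8 : p % 8 = 1
  lat : IsLat π
  latd : IsLat d
  eq : π = 1 - 2 * (1 - I) * d
  norm : (p : ℂ) = π * (starRingEnd ℂ) π
  cong : ∃ e, IsLat e ∧ (j : ℂ) - I = π * e

/-- Reduction `ℤ[i] → ℤ[i]/π = 𝔽_p`, `i ↦ j`. -/
def red (p : ℕ) (j : ℤ) (z : ℂ) : ZMod p := ((⌊z.re⌋ + ⌊z.im⌋ * j : ℤ) : ZMod p)

section red
variable {p : ℕ} {π d : ℂ} {j : ℤ}

theorem red_mk (m n : ℤ) : red p j (m + n * I) = (m : ZMod p) + n * j := by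
  simp [red]

theorem red_int (m : ℤ) : red p j m = (m : ZMod p) := by
  simpa using red_mk (p := p) (j := j) m 0

theorem red_nat (m : ℕ) : red p j m = (m : ZMod p) := by
  simpa using red_int (p := p) (j := j) m

theorem red_one : red p j 1 = 1 := by simpa using red_int (p := p) (j := j) 1
theorem red_zero : red p j 0 = 0 := by simpa using red_int (p := p) (j := j) 0
theorem red_two : red p j 2 = 2 := by simpa using red_int (p := p) (j := j) 2
theorem red_I : red p j I = j := by simpa using red_mk (p := p) (j := j) 0 1

theorem red_add {z w : ℂ} (hz : IsLat z) (hw : IsLat w) :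
    red p j (z + w) = red p j z + red p j w := by
  obtain ⟨a, b, rfl⟩ := hz
  obtain ⟨c, e, rfl⟩ := hw
  rw [show (a + b * I + (c + e * I) : ℂ) = ((a + c : ℤ) : ℂ) + ((b + e : ℤ) : ℂ) * I by
    push_cast; ring, red_mk, red_mk, red_mk]
  push_cast; ring

theorem red_neg {z : ℂ} (hz : IsLat z) : red p j (-z) = -red p j z := by
  have := red_add (p := p) (j := j) hz.neg hz
  rw [neg_add_cancel, red_zero] at this
  exact eq_neg_of_add_eq_zero_left this.symm

theorem red_sub {z w : ℂ} (hz : IsLat z) (hw : IsLat w) :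
    red p j (z - w) = red p j z - red p j w := by
  rw [sub_eq_add_neg, red_add hz hw.neg, red_neg hw, sub_eq_add_neg]

theorem IsLat.pow {z : ℂ} (hz : IsLat z) (n : ℕ) : IsLat (z ^ n) := by
  induction n with
  | zero => simpa using isLat_one
  | succ n ih => rw [pow_succ]; exact ih.mul hz

theorem isLat_nat (n : ℕ) : IsLat n := by simpa using isLat_int n

namespace PrimaryPrime

theorem lat_conj (H : PrimaryPrime p π d j) : IsLat ((starRingEnd ℂ) π) := isLat_conj H.lat

theorem p_ne (H : PrimaryPrime p π d j) : (p : ℂ) ≠ 0 := by exact_mod_cast H.prime.ne_zero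

theorem ne (H : PrimaryPrime p π d j) : π ≠ 0 := fun h => H.p_ne (by rw [H.norm, h, zero_mul])

theorem sq_j (H : PrimaryPrime p π d j) : (j : ZMod p) ^ 2 = -1 := by
  obtain ⟨e, he, h⟩ := H.cong
  obtain ⟨a, b, hab⟩ := he
  have h2 : ((j ^ 2 + 1 : ℤ) : ℂ) = ((p * (a ^ 2 + b ^ 2) : ℤ) : ℂ) := by
    have h3 : (j : ℂ) + I = (starRingEnd ℂ) π * (starRingEnd ℂ) e := by
      rw [← map_mul, ← h]; simp
    have h4 : e * (starRingEnd ℂ) e = a ^ 2 + b ^ 2 := by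
      rw [hab]; simp only [map_add, map_mul, map_intCast, conj_I]; linear_combination (-(b : ℂ) ^ 2) * I_sq
    push_cast
    rw [H.norm]
    linear_combination ((j : ℂ) + I) * h + π * e * h3 + π * (starRingEnd ℂ) π * h4 + I_sq
  have h5 : j ^ 2 + 1 = p * (a ^ 2 + b ^ 2) := by exact_mod_cast h2
  have h6 := congrArg (fun x : ℤ => (x : ZMod p)) h5
  push_cast at h6
  simp only [CharP.cast_eq_zero, zero_mul] at h6
  exact eq_neg_of_add_eq_zero_left h6

theorem red_mul (H : PrimaryPrime p π d j) {z w : ℂ} (hz : IsLat z) (hw : IsLat w) :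
    red p j (z * w) = red p j z * red p j w := by
  obtain ⟨a, b, rfl⟩ := hz
  obtain ⟨c, e, rfl⟩ := hw
  rw [show ((a + b * I) * (c + e * I) : ℂ) = ((a * c - b * e : ℤ) : ℂ) + ((a * e + b * c : ℤ) : ℂ) * I by
    push_cast; linear_combination (b * e : ℂ) * I_sq, red_mk, red_mk, red_mk]
  push_cast
  linear_combination (-(b : ZMod p) * e) * H.sq_j

theorem red_pow (H : PrimaryPrime p π d j) {z : ℂ} (hz : IsLat z) (n : ℕ) :
    red p j (z ^ n) = red p j z ^ n := by
  induction n with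
  | zero => simp [red_one]
  | succ n ih => rw [pow_succ, H.red_mul (hz.pow n) hz, ih, pow_succ]

theorem red_pi (H : PrimaryPrime p π d j) : red p j π = 0 := by
  obtain ⟨e, ⟨e1, e2, he⟩, h⟩ := H.cong
  obtain ⟨a, b, hab⟩ := H.lat
  have hn := H.norm
  have hm : (j : ℂ) - I = ((a * e1 - b * e2 : ℤ) : ℂ) + ((a * e2 + b * e1 : ℤ) : ℂ) * I := by
    rw [h, hab, he]; push_cast; linear_combination (b * e2 : ℂ) * I_sq
  have h1 : j = a * e1 - b * e2 := by
    have := congrArg re hm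
    simp at this
    exact_mod_cast this
  have h2 : -1 = a * e2 + b * e1 := by
    have := congrArg im hm
    simp at this
    exact_mod_cast this
  have h3 : (p : ℤ) = a ^ 2 + b ^ 2 := by
    rw [hab] at hn
    have : (p : ℂ) = ((a ^ 2 + b ^ 2 : ℤ) : ℂ) := by
      rw [hn]; simp only [map_add, map_mul, map_intCast, conj_I]; push_cast
      linear_combination (-(b : ℂ) ^ 2) * I_sq
    exact_mod_cast this
  have h4 : a + b * j = -p * e2 := by
    rw [h3, h1]; linear_combination (-a) * h2
  rw [hab, red_mk]
  have := congrArg (fun x : ℤ => (x : ZMod p)) h4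
  push_cast at this
  rw [this]; simp

theorem red_eq_zero_iff (H : PrimaryPrime p π d j) {z : ℂ} (hz : IsLat z) :
    red p j z = 0 ↔ ∃ l, IsLat l ∧ z = π * l := by
  constructor
  · intro h
    obtain ⟨m, n, rfl⟩ := hz
    obtain ⟨e, he, hje⟩ := H.cong
    rw [red_mk] at h
    have h' : ((m + n * j : ℤ) : ZMod p) = 0 := by push_cast; exact h
    obtain ⟨t, ht⟩ := (ZMod.intCast_zmod_eq_zero_iff_dvd _ _).1 h'
    refine ⟨(starRingEnd ℂ) π * t - n * e, (H.lat_conj.mul (isLat_int t)).sub ((isLat_int n).mul he), ?_⟩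
    have ht' : (m : ℂ) + n * j = p * t := by exact_mod_cast ht
    linear_combination ht' - n * hje + t * H.norm
  · rintro ⟨l, hl, rfl⟩
    rw [H.red_mul H.lat hl, H.red_pi, zero_mul]

theorem isLat_div_iff (H : PrimaryPrime p π d j) {z : ℂ} (hz : IsLat z) :
    IsLat (z / π) ↔ red p j z = 0 := by
  rw [H.red_eq_zero_iff hz]
  constructor
  · intro h; exact ⟨_, h, by rw [mul_div_cancel₀ _ H.ne]⟩
  · rintro ⟨l, hl, rfl⟩; rwa [mul_div_cancel_left₀ _ H.ne]

theorem red_eq_iff (H : PrimaryPrime p π d j) {z w : ℂ} (hz : IsLat z) (hw : IsLat w) :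
    red p j z = red p j w ↔ IsLat ((z - w) / π) := by
  rw [H.isLat_div_iff (hz.sub hw), red_sub hz hw, sub_eq_zero]

theorem two_ne (H : PrimaryPrime p π d j) : (2 : ZMod p) ≠ 0 := by
  intro h
  have h' : ((2 : ℕ) : ZMod p) = 0 := by exact_mod_cast h
  rw [ZMod.natCast_eq_zero_iff] at h'
  have := Nat.le_of_dvd two_pos h'
  have h1 := H.mod8
  have h2 := H.prime.two_le
  omega

theorem j_ne (H : PrimaryPrime p π d j) [Fact p.Prime] : (j : ZMod p) ≠ 0 := by
  intro h
  have := H.sq_j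
  rw [h] at this
  norm_num at this

theorem red_one_sub_I_mul (H : PrimaryPrime p π d j) : 2 * (1 - (j : ZMod p)) * red p j d = 1 := by
  have h := H.red_pi
  have l2 := isLat_two.mul isLat_one_sub_I
  rw [H.eq, red_sub isLat_one (l2.mul H.latd), red_one, H.red_mul l2 H.latd,
    H.red_mul isLat_two isLat_one_sub_I, red_two, red_sub isLat_one isLat_I, red_one, red_I] at h
  linear_combination -h

theorem red_conj_ne (H : PrimaryPrime p π d j) [Fact p.Prime] : red p j ((starRingEnd ℂ) π) ≠ 0 := by
  have hs : red p j ((starRingEnd ℂ) π) = red p j (π + (starRingEnd ℂ) π) := by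
    rw [red_add H.lat H.lat_conj, H.red_pi, zero_add]
  obtain ⟨a, b, hab⟩ := H.lat
  have h2 : π + (starRingEnd ℂ) π = ((2 * a : ℤ) : ℂ) := by
    rw [hab]; simp only [map_add, map_mul, map_intCast, conj_I]; push_cast; ring
  rw [hs, h2, red_int]
  push_cast
  refine mul_ne_zero H.two_ne fun h0 => ?_
  have hb : (b : ZMod p) = 0 := by
    have := H.red_pi
    rw [hab, red_mk, h0, zero_add] at this
    exact (mul_eq_zero.1 this).resolve_right H.j_ne
  obtain ⟨s, hs⟩ := (ZMod.intCast_zmod_eq_zero_iff_dvd _ _).1 h0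
  obtain ⟨t, ht⟩ := (ZMod.intCast_zmod_eq_zero_iff_dvd _ _).1 hb
  have hn := H.norm
  have : (p : ℂ) = ((p * (p * (s ^ 2 + t ^ 2)) : ℤ) : ℂ) := by
    rw [hn, hab, hs, ht]
    simp only [map_add, map_mul, map_intCast, conj_I]; push_cast
    linear_combination (-(p : ℂ) ^ 2 * t ^ 2) * I_sq
  have h3 : (p : ℤ) * 1 = p * (p * (s ^ 2 + t ^ 2)) := by rw [mul_one]; exact_mod_cast this
  have h4 := mul_left_cancel₀ (by exact_mod_cast H.prime.ne_zero) h3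
  exact H.prime.one_lt.ne' (by exact_mod_cast Int.eq_one_of_dvd_one (by positivity) ⟨_, h4⟩)

end PrimaryPrime
end red

/-- Values of an elliptic function at the `π`-torsion points, indexed by `𝔽_p`. -/
def tor {p : ℕ} (π : ℂ) (F : ℂ → ℂ) (a : ZMod p) : ℂ := F ((a.val : ℂ) / π)

section tor
variable {p : ℕ} {π d : ℂ} {j : ℤ}

theorem red_val [NeZero p] (a : ZMod p) : red p j (a.val : ℂ) = a := by
  rw [red_nat, ZMod.natCast_val, ZMod.cast_id]

theorem PrimaryPrime.tor_red (H : PrimaryPrime p π d j) [NeZero p] {F : ℂ → ℂ}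
    (hF : ∀ u l, IsLat l → F (u + l) = F u) {ν : ℂ} (hν : IsLat ν) :
    tor π F (red p j ν) = F (ν / π) := by
  have : IsLat ((ν - ((red p j ν).val : ℂ)) / π) := by
    rw [← H.red_eq_iff hν (isLat_nat _), red_val]
  rw [tor, ← hF _ _ this]
  congr 1; ring

theorem lat_mul_parity {l : ℂ} (hl : IsLat l) : ∃ m n : ℤ, (1 - I) * l = m + n * I ∧
    ((-1 : ℂ) ^ m * (-1) ^ n = 1) := by
  obtain ⟨a, b, rfl⟩ := hl
  refine ⟨a + b, b - a, by push_cast; linear_combination (-(b : ℂ)) * I_sq, ?_⟩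
  rw [← zpow_add₀ (by norm_num)]
  exact Even.neg_one_zpow ⟨b, by ring⟩

theorem sl_add_lat_even (z : ℂ) {l : ℂ} (hl : IsLat l) : sl (z + (1 - I) * l) = sl z := by
  obtain ⟨m, n, h, h1⟩ := lat_mul_parity hl
  rw [h, ← add_assoc, sl_translate, h1, one_mul]

theorem cl_add_lat_even (z : ℂ) {l : ℂ} (hl : IsLat l) : cl (z + (1 - I) * l) = cl z := by
  obtain ⟨m, n, h, h1⟩ := lat_mul_parity hl
  rw [h, ← add_assoc, cl_translate, h1, one_mul]

theorem phi_add_lat (u l : ℂ) (hl : IsLat l) : phi (u + l) = phi u := by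
  rw [phi, mul_add, sl_add_lat_even _ hl, phi]

theorem phid_add_lat (u l : ℂ) (hl : IsLat l) : phid (u + l) = phid u := by
  rw [phid, mul_add, cl_add_lat_even _ hl, phid]

theorem psi_add_lat (u l : ℂ) (hl : IsLat l) : psi (u + l) = psi u := by
  rw [psi, mul_add, add_right_comm, sl_add_lat_even _ hl, psi]

theorem eq_zero_of_lat_mul {p : ℕ} {π d : ℂ} {j : ℤ} (H : PrimaryPrime p π d j) [Fact p.Prime]
    {ν c : ℂ} (hν : IsLat ν) (hc : IsLat c) (hc0 : red p j c ≠ 0) (h : IsLat (c * (ν / π))) :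
    red p j ν = 0 := by
  rw [← mul_div_assoc, H.isLat_div_iff (hc.mul hν), H.red_mul hc hν] at h
  exact (mul_eq_zero.1 h).resolve_left hc0

theorem PrimaryPrime.four_ne (H : PrimaryPrime p π d j) [Fact p.Prime] : red p j 4 ≠ 0 := by
  have : red p j 4 = 4 := by simpa using red_int (p := p) (j := j) 4
  rw [this, show (4 : ZMod p) = 2 * 2 by norm_num]
  exact mul_ne_zero H.two_ne H.two_ne

theorem PrimaryPrime.one_sub_j_ne (H : PrimaryPrime p π d j) [Fact p.Prime] : (1 - (j : ZMod p)) ≠ 0 := by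
  intro h
  have := H.red_one_sub_I_mul
  rw [h] at this
  simp at this

theorem PrimaryPrime.red_two_mul_one_sub_I (H : PrimaryPrime p π d j) [Fact p.Prime] :
    red p j (2 * (1 - I)) ≠ 0 := by
  rw [H.red_mul isLat_two isLat_one_sub_I, red_two, red_sub isLat_one isLat_I, red_one, red_I]
  exact mul_ne_zero H.two_ne H.one_sub_j_ne

/-- The argument `(1-i)ν/π` is never a pole of the lemniscate sine. -/
theorem PrimaryPrime.not_isPole (H : PrimaryPrime p π d j) [Fact p.Prime] {ν : ℂ} (hν : IsLat ν) :
    ¬ IsPole ((1 - I) * (ν / π)) := by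
  intro h
  by_cases h0 : red p j ν = 0
  · exact (isLat_one_sub_I.mul ((H.isLat_div_iff hν).2 h0)).not_isPole h
  · refine not_isPole_sub_of_four (fun h4 => h0 ?_) h
    exact eq_zero_of_lat_mul H hν (by simpa using isLat_int 4) H.four_ne h4

theorem PrimaryPrime.not_isPole_half (H : PrimaryPrime p π d j) [Fact p.Prime] {ν : ℂ} (hν : IsLat ν) :
    ¬ IsPole ((1 - I) * (ν / π) + 1 / 2) := by
  intro h
  by_cases h0 : red p j ν = 0
  · have h1 := isLat_one_sub_I.mul ((H.isLat_div_iff hν).2 h0)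
    have := IsPole.add_lat h h1.neg
    rw [show (1 - I) * (ν / π) + 1 / 2 + -((1 - I) * (ν / π)) = 1 / 2 by ring] at this
    exact _root_.not_isPole_half this
  · refine not_isPole_sub_half_of_four (fun h4 => h0 ?_) h
    exact eq_zero_of_lat_mul H hν (by simpa using isLat_int 4) H.four_ne h4

theorem PrimaryPrime.tor_add (H : PrimaryPrime p π d j) [Fact p.Prime] (a b : ZMod p) :
    tor π phi a * tor π phid b + tor π phid a * tor π phi b =
      tor π phi (a + b) * (1 + tor π phi a ^ 2 * tor π phi b ^ 2) := by
  have e : a + b = red p j ((a.val : ℂ) + b.val) := by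
    rw [red_add (isLat_nat _) (isLat_nat _), red_val, red_val]
  have la := isLat_nat a.val
  have lb := isLat_nat b.val
  rw [e, H.tor_red phi_add_lat (la.add lb)]
  have := sl_add (H.not_isPole la) (H.not_isPole lb)
    (by rw [← mul_add, ← add_div]; exact H.not_isPole (la.add lb))
  rw [← mul_add, ← add_div] at this
  exact this

theorem PrimaryPrime.tord_add (H : PrimaryPrime p π d j) [Fact p.Prime] (a b : ZMod p) :
    tor π phid (a + b) * (1 + tor π phi a ^ 2 * tor π phi b ^ 2) ^ 2 =
      tor π phid a * tor π phid b * (1 - tor π phi a ^ 2 * tor π phi b ^ 2) -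
        2 * tor π phi a * tor π phi b * (tor π phi a ^ 2 + tor π phi b ^ 2) := by
  have e : a + b = red p j ((a.val : ℂ) + b.val) := by
    rw [red_add (isLat_nat _) (isLat_nat _), red_val, red_val]
  have la := isLat_nat a.val
  have lb := isLat_nat b.val
  rw [e, H.tor_red phid_add_lat (la.add lb)]
  have := cl_add (H.not_isPole la) (H.not_isPole lb)
    (by rw [← mul_add, ← add_div]; exact H.not_isPole (la.add lb))
  rw [← mul_add, ← add_div] at this
  exact this

theorem PrimaryPrime.tord_sq (H : PrimaryPrime p π d j) [Fact p.Prime] (a : ZMod p) :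
    tor π phid a ^ 2 = 1 - tor π phi a ^ 4 := cl_sq (H.not_isPole (isLat_nat a.val))

theorem PrimaryPrime.tor_j_mul (H : PrimaryPrime p π d j) [Fact p.Prime] (a : ZMod p) :
    tor π phi ((j : ZMod p) * a) = I * tor π phi a := by
  have la := isLat_nat a.val
  rw [show (j : ZMod p) * a = red p j (I * a.val) by rw [H.red_mul isLat_I la, red_I, red_val],
    H.tor_red phi_add_lat (isLat_I.mul la), phi, tor, phi, ← sl_I_mul (H.not_isPole la)]
  congr 1; ring

theorem PrimaryPrime.tord_j_mul (H : PrimaryPrime p π d j) [Fact p.Prime] (a : ZMod p) :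
    tor π phid ((j : ZMod p) * a) = tor π phid a := by
  have la := isLat_nat a.val
  rw [show (j : ZMod p) * a = red p j (I * a.val) by rw [H.red_mul isLat_I la, red_I, red_val],
    H.tor_red phid_add_lat (isLat_I.mul la), phid, tor, phid, ← cl_I_mul (H.not_isPole la)]
  congr 1; ring

theorem tor_zero : tor π phi (0 : ZMod p) = 0 := by simp [tor, phi, sl_zero]
theorem tord_zero : tor π phid (0 : ZMod p) = 1 := by simp [tor, phid, cl_zero]

theorem PrimaryPrime.tor_ne_zero (H : PrimaryPrime p π d j) [Fact p.Prime] {a : ZMod p} (ha : a ≠ 0) :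
    tor π phi a ≠ 0 := by
  have la := isLat_nat a.val
  refine sl_ne_zero (H.not_isPole la) fun h => ha ?_
  have h2 := isLat_two.mul h
  rw [← mul_assoc] at h2
  have := eq_zero_of_lat_mul H la (isLat_two.mul isLat_one_sub_I) H.red_two_mul_one_sub_I h2
  rwa [red_val] at this

theorem PrimaryPrime.tor_neg (H : PrimaryPrime p π d j) [Fact p.Prime] (a : ZMod p) :
    tor π phi (-a) = -tor π phi a := by
  rw [show -a = (j : ZMod p) * ((j : ZMod p) * a) by linear_combination (-a) * H.sq_j, H.tor_j_mul, H.tor_j_mul]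
  linear_combination tor π phi a * I_sq

theorem PrimaryPrime.tord_neg (H : PrimaryPrime p π d j) [Fact p.Prime] (a : ZMod p) :
    tor π phid (-a) = tor π phid a := by
  rw [show -a = (j : ZMod p) * ((j : ZMod p) * a) by linear_combination (-a) * H.sq_j, H.tord_j_mul, H.tord_j_mul]

theorem PrimaryPrime.tord_ne_zero (H : PrimaryPrime p π d j) [Fact p.Prime] (a : ZMod p) :
    tor π phid a ≠ 0 := by
  intro h
  have h1 := H.tor_add a a
  have h2 := H.tord_sq a
  rw [h] at h1 h2
  have h4 : tor π phi a ^ 4 = 1 := by linear_combination h2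
  have h3 : tor π phi (a + a) = 0 := by
    have : tor π phi (a + a) * 2 = 0 := by linear_combination -h1 - tor π phi (a + a) * h4
    simpa using this
  have ha : a = 0 := by
    by_contra ha
    refine H.tor_ne_zero ?_ h3
    rw [← two_mul]; exact mul_ne_zero H.two_ne ha
  rw [ha, tor_zero] at h4
  norm_num at h4

theorem PrimaryPrime.one_add_ne_zero (H : PrimaryPrime p π d j) [Fact p.Prime] (a b : ZMod p) :
    1 + tor π phi a ^ 2 * tor π phi b ^ 2 ≠ 0 := by
  intro h
  have h1 := H.tor_add a b
  have h2 := H.tor_add a (-b)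
  rw [H.tor_neg, H.tord_neg, neg_sq, h] at h2
  rw [h] at h1
  have h3 : 2 * (tor π phi a * tor π phid b) = 0 := by linear_combination h1 + h2
  have h4 : tor π phi a = 0 := by simpa [H.tord_ne_zero] using h3
  rw [h4] at h
  norm_num at h

theorem PrimaryPrime.torp_mul (H : PrimaryPrime p π d j) [Fact p.Prime] (a : ZMod p) :
    tor π psi a * (1 + tor π phi a ^ 2) = tor π phid a :=
  sl_add_half (H.not_isPole (isLat_nat a.val)) (H.not_isPole_half (isLat_nat a.val))

theorem PrimaryPrime.torp_mul_torp (H : PrimaryPrime p π d j) [Fact p.Prime] (a : ZMod p) :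
    tor π psi a * tor π psi ((j : ZMod p) * a) = 1 := by
  have h1 := H.torp_mul a
  have h2 := H.torp_mul ((j : ZMod p) * a)
  rw [H.tor_j_mul, H.tord_j_mul] at h2
  have h3 := H.tord_sq a
  have h4 := pow_ne_zero 2 (H.tord_ne_zero a)
  apply mul_right_cancel₀ h4
  linear_combination (tor π psi a * tor π psi ((j : ZMod p) * a)) * h3 +
    (tor π psi ((j : ZMod p) * a) * (1 + (I * tor π phi a) ^ 2)) * h1 + tor π phid a * h2 -
    (tor π psi a * tor π psi ((j : ZMod p) * a)) * (1 + tor π phi a ^ 2) * tor π phi a ^ 2 * I_sq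

theorem torp_zero : tor π psi (0 : ZMod p) = 1 := by
  have := sl_half
  simpa [tor, psi] using this
end tor

end

section
open Filter Topology Set

/-- The residue of the lemniscate sine at `(1+i)/2`. -/
def slRes : ℂ := slM / slC / (Real.pi * I)

theorem slRes_ne : slRes ≠ 0 := by
  have h : (Real.pi : ℂ) ≠ 0 := by exact_mod_cast Real.pi_ne_zero
  exact div_ne_zero (div_ne_zero slM_ne slC_ne) (mul_ne_zero h I_ne_zero)

theorem residue_sl : Tendsto (fun w => (w - (1 + I) / 2) * sl w) (𝓝[≠] ((1 + I) / 2)) (𝓝 slRes) := by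
  have h := residue_SN.const_mul (slM / slC : ℂ)
  refine (h.congr fun w => ?_).trans (le_of_eq ?_)
  · rw [sl]; ring
  · rw [slRes]; congr 1; ring

theorem isPole_base : IsPole ((1 + I) / 2) := ⟨0, 0, by simp⟩

/-- The lemniscate sine at the translates by `(1-i)a` of `Z/π`. -/
def slt {p : ℕ} (π Z : ℂ) (a : ZMod p) : ℂ := sl ((Z + (1 - I) * a.val) / π)

namespace PrimaryPrime
variable {p : ℕ} {π d : ℂ} {j : ℤ} [Fact p.Prime]

theorem slt_red (H : PrimaryPrime p π d j) (Z : ℂ) {ν : ℂ} (hν : IsLat ν) : slt π Z (red p j ν) = sl ((Z + (1 - I) * ν) / π) := by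
  have : IsLat ((ν - ((red p j ν).val : ℂ)) / π) := by
    rw [← H.red_eq_iff hν (isLat_nat _), red_val]
  rw [slt, ← sl_add_lat_even _ this]
  congr 1; ring

theorem slt_add_lat (H : PrimaryPrime p π d j) (Z : ℂ) {l : ℂ} (hl : IsLat l) (a : ZMod p) :
    slt π (Z + (1 - I) * l) a = slt π Z (a + red p j l) := by
  have e : a + red p j l = red p j (a.val + l) := by rw [red_add (isLat_nat _) hl, red_val]
  rw [e, H.slt_red Z ((isLat_nat _).add hl), slt]
  congr 1; ring

theorem slt_add_pi (H : PrimaryPrime p π d j) (Z : ℂ) (a : ZMod p) : slt π (Z + π) a = -slt π Z a := by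
  rw [slt, slt, ← sl_add_one]
  congr 1
  field_simp [H.ne]
  ring

theorem slt_add_one (H : PrimaryPrime p π d j) (Z : ℂ) (a : ZMod p) : slt π (Z + 1) a = -slt π Z (a + red p j (2 * d)) := by
  rw [← H.slt_add_lat Z (isLat_two.mul H.latd), ← H.slt_add_pi]
  congr 1
  linear_combination -H.eq

theorem slt_add_I (H : PrimaryPrime p π d j) (Z : ℂ) (a : ZMod p) : slt π (Z + I) a = -slt π Z (a + red p j (2 * d - 1)) := by
  have l := (isLat_two.mul H.latd).sub isLat_one
  rw [← H.slt_add_lat Z l, ← H.slt_add_pi]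
  congr 1
  linear_combination -H.eq

theorem isPole_mul (H : PrimaryPrime p π d j) {x : ℂ} (hx : IsPole x) : IsPole (π * x) := by
  obtain ⟨m, n, hmn⟩ := hx
  have := isPole_base.add_lat ((H.lat.mul ((isLat_int m).add ((isLat_int n).mul isLat_I))).sub (isLat_two.mul H.latd))
  convert this using 1
  linear_combination π * hmn + (1 + I) / 2 * H.eq + d * I_sq

theorem not_isPole_slt (H : PrimaryPrime p π d j) {Z : ℂ} (hZ : ¬ IsPole Z) {ν : ℂ} (hν : IsLat ν) :
    ¬ IsPole ((Z + (1 - I) * ν) / π) := by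
  intro h
  have := (H.isPole_mul h).add_lat (isLat_one_sub_I.mul hν).neg
  rw [mul_div_cancel₀ _ H.ne, add_neg_cancel_right] at this
  exact hZ this

theorem not_isPole_slt_base (H : PrimaryPrime p π d j) {ν : ℂ} (hν : IsLat ν) (h0 : red p j ν ≠ 0) :
    ¬ IsPole ((π * ((1 + I) / 2) + (1 - I) * ν) / π) := by
  intro h
  have h1 : IsLat ((1 - I) * ν / π) := by
    rw [add_div, mul_div_cancel_left₀ _ H.ne, add_comm] at h
    have := h
    rw [isPole_add_half_iff] at this
    exact this
  rw [H.isLat_div_iff (isLat_one_sub_I.mul hν), H.red_mul isLat_one_sub_I hν,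
    red_sub isLat_one isLat_I, red_one, red_I] at h1
  exact (mul_ne_zero H.one_sub_j_ne h0) h1

theorem exists_base_of_isPole (H : PrimaryPrime p π d j) {Z : ℂ} (hZ : IsPole Z) :
    ∃ m n : ℤ, Z = π * ((1 + I) / 2) + m + n * I := by
  obtain ⟨m, n, hmn⟩ := hZ
  obtain ⟨a, b, hab⟩ := isLat_two.mul H.latd
  refine ⟨m + a, n + b, ?_⟩
  push_cast
  linear_combination hmn - (1 + I) / 2 * H.eq - d * I_sq + hab

theorem analyticAt_slt {Z : ℂ} {a : ZMod p} (h : ¬ IsPole ((Z + (1 - I) * a.val) / π)) :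
    AnalyticAt ℂ (fun Z => slt π Z a) Z :=
  (analyticAt_sl h).comp_of_eq (f := fun Z : ℂ => (Z + (1 - I) * a.val) / π) (by fun_prop) rfl

theorem meromorphicAt_slt (Z : ℂ) (a : ZMod p) : MeromorphicAt (fun Z => slt π Z a) Z :=
  (meromorphicAt_sl _).comp_analyticAt (g := fun Z : ℂ => (Z + (1 - I) * a.val) / π) (by fun_prop)

theorem residue_slt_zero (H : PrimaryPrime p π d j) : Tendsto (fun w => (w - π * ((1 + I) / 2)) * slt π w (0 : ZMod p))
    (𝓝[≠] (π * ((1 + I) / 2))) (𝓝 (π * slRes)) := by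
  have h := tendsto_mul_const_punctured (inv_ne_zero H.ne) (π * ((1 + I) / 2))
  rw [inv_mul_cancel_left₀ H.ne] at h
  refine ((residue_sl.comp h).const_mul π).congr fun w => ?_
  simp only [Function.comp, slt, ZMod.val_zero, Nat.cast_zero, mul_zero, add_zero]
  rw [show w / π = π⁻¹ * w by ring]
  have := H.ne
  field_simp

/-- The product of the translates. -/
theorem prod_slt (H : PrimaryPrime p π d j) : ∃ C : ℂ, ∀ Z, ¬ IsPole Z → ∏ a : ZMod p, slt π Z a = C * sl Z := by
  have hodd : Odd (Finset.univ : Finset (ZMod p)).card := by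
    rw [Finset.card_univ, ZMod.card, Nat.odd_iff]; have := H.mod8; omega
  have h1 : ∀ Z, ∏ a : ZMod p, slt π (Z + 1) a = -1 * ∏ a : ZMod p, slt π Z a := by
    intro Z
    simp only [H.slt_add_one]
    rw [Finset.prod_neg, hodd.neg_one_pow]
    congr 1
    exact Equiv.prod_comp (Equiv.addRight (red p j (2 * d))) (fun a => slt π Z a)
  have h2 : ∀ Z, ∏ a : ZMod p, slt π (Z + I) a = -1 * ∏ a : ZMod p, slt π Z a := by
    intro Z
    simp only [H.slt_add_I]
    rw [Finset.prod_neg, hodd.neg_one_pow]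
    congr 1
    exact Equiv.prod_comp (Equiv.addRight (red p j (2 * d - 1))) (fun a => slt π Z a)
  set z0 := π * ((1 + I) / 2) with hz0
  have han : AnalyticAt ℂ (fun Z => ∏ a ∈ Finset.univ.erase (0 : ZMod p), slt π Z a) z0 := by
    refine Finset.analyticAt_fun_prod _ fun a ha => analyticAt_slt ?_
    refine H.not_isPole_slt_base (isLat_nat _) ?_
    rw [red_val]; exact Finset.ne_of_mem_erase ha
  set R := π * slRes * ∏ a ∈ Finset.univ.erase (0 : ZMod p), slt π z0 a with hR
  have hres : Tendsto (fun w => (w - z0) * ∏ a : ZMod p, slt π w a) (𝓝[≠] z0) (𝓝 R) := by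
    refine (H.residue_slt_zero.mul (han.continuousAt.tendsto.mono_left nhdsWithin_le_nhds)).congr fun w => ?_
    rw [← Finset.mul_prod_erase Finset.univ _ (Finset.mem_univ (0 : ZMod p)), mul_assoc]
  obtain ⟨m, n, hmn⟩ := (isLat_two.mul H.latd).neg
  have hz0' : z0 = (1 + I) / 2 + m + n * I := by
    rw [hz0]; linear_combination (1 + I) / 2 * H.eq + d * I_sq + hmn
  have hres2 := tendsto_residue_translate (by norm_num : (-1 : ℂ) ≠ 0) (by norm_num : (-1 : ℂ) ≠ 0)
    (fun z => by rw [sl_add_one]; ring) (fun z => by rw [sl_add_I]; ring) m n residue_sl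
  rw [← hz0'] at hres2
  set R2 := (-1 : ℂ) ^ m * (-1) ^ n * slRes with hR2
  have hR2' : R2 ≠ 0 := mul_ne_zero (mul_ne_zero (zpow_ne_zero _ (by norm_num)) (zpow_ne_zero _ (by norm_num))) slRes_ne
  refine ⟨R / R2, fun Z hZ => ?_⟩
  have hanf : ∀ {Z}, ¬ IsPole Z → AnalyticAt ℂ (fun Z => ∏ a : ZMod p, slt π Z a) Z := fun hZ =>
    Finset.analyticAt_fun_prod _ fun a _ => analyticAt_slt (H.not_isPole_slt hZ (isLat_nat _))
  refine liouville_eq' (f := fun Z => ∏ a : ZMod p, slt π Z a) (h := fun Z => R / R2 * sl Z)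
    (c₁ := -1) (c₂ := -1) ?_ ?_ (by simp) (by simp) (Or.inl (by norm_num)) h1 h2 ?_ ?_ ?_ ?_ ?_
  · intro z
    exact MeromorphicAt.fun_prod fun a _ => meromorphicAt_slt z a
  · exact fun z => (MeromorphicAt.const _ z).mul (meromorphicAt_sl z)
  · intro z; simp only [sl_add_one]; ring
  · intro z; simp only [sl_add_I]; ring
  · intro z
    by_cases hz : IsPole z
    · obtain ⟨m, n, h⟩ := H.exists_base_of_isPole hz
      refine ⟨m, n, z0, h, R, hres, ?_⟩
      refine ((hres2.const_mul (R / R2)).congr fun w => by ring).trans (le_of_eq ?_)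
      rw [div_mul_cancel₀ _ hR2']
    · refine ⟨0, 0, z, by simp, 0, tendsto_sub_mul_zero (hanf hz).continuousAt, ?_⟩
      exact tendsto_sub_mul_zero (g := fun Z => R / R2 * sl Z) (((analyticAt_sl hz).continuousAt).const_mul _)
  · exact (hanf hZ).continuousAt
  · exact ((analyticAt_sl hZ).continuousAt).const_mul _

/-- `∏ φ(r/π) = π` over the nonzero residues, given the normalization of `∏ ψ(r/π)`. -/
theorem prod_tor (H : PrimaryPrime p π d j) (hw : ∏ a : ZMod p, tor π psi a = 1) :
    ∏ a ∈ Finset.univ.erase (0 : ZMod p), tor π phi a = π := by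
  obtain ⟨C, hC⟩ := H.prod_slt
  have hC1 : C = 1 := by
    have h := hC (1 / 2) _root_.not_isPole_half
    rw [sl_half, mul_one] at h
    rw [← h]
    refine Eq.trans ?_ hw
    rw [← Equiv.prod_comp (Equiv.addRight (red p j d)) (fun a => tor π psi a)]
    refine Finset.prod_congr rfl fun a _ => ?_
    have la := isLat_nat a.val
    have e : a + red p j d = red p j (a.val + d) := by rw [red_add la H.latd, red_val]
    change slt π (1 / 2) a = tor π psi (a + red p j d)
    rw [e, H.tor_red psi_add_lat (la.add H.latd), psi, slt]
    congr 1
    have := H.ne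
    field_simp
    linear_combination -H.eq
  have hp0 : ¬ IsPole 0 := isLat_zero.not_isPole
  have h1 : HasDerivAt (fun Z => ∏ a : ZMod p, slt π Z a) (slM : ℂ) 0 := by
    have := hasDerivAt_sl hp0
    rw [cl_zero, mul_one] at this
    refine this.congr_of_eventuallyEq ?_
    filter_upwards [isOpen_not_isPole.mem_nhds hp0] with w hw
    rw [hC w hw, hC1, one_mul]
  have hu : HasDerivAt (fun Z => slt π Z (0 : ZMod p)) (slM / π : ℂ) 0 := by
    have h := hasDerivAt_sl hp0
    rw [cl_zero, mul_one] at h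
    have h2 := HasDerivAt.comp_of_eq (h := fun Z : ℂ => Z / π) (0 : ℂ) h ((hasDerivAt_id _).div_const π) (by simp)
    refine (h2.congr_deriv (by ring)).congr_of_eventuallyEq (Eventually.of_forall fun w => ?_)
    simp [slt]
  have hv : DifferentiableAt ℂ (fun Z => ∏ a ∈ Finset.univ.erase (0 : ZMod p), slt π Z a) 0 :=
    (Finset.analyticAt_fun_prod _ fun a _ => analyticAt_slt (H.not_isPole_slt hp0 (isLat_nat _))).differentiableAt
  have h2 := hu.mul hv.hasDerivAt
  have h3 := h2.unique (h1.congr_of_eventuallyEq (Eventually.of_forall fun w => by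
    simp only [Pi.mul_apply]
    exact Finset.mul_prod_erase Finset.univ (fun a => slt π w a) (Finset.mem_univ (0 : ZMod p))))
  have h0 : slt π 0 (0 : ZMod p) = 0 := by simp [slt, sl_zero]
  have h4 : ∏ a ∈ Finset.univ.erase (0 : ZMod p), slt π 0 a =
      ∏ a ∈ Finset.univ.erase (0 : ZMod p), tor π phi a := by
    refine Finset.prod_congr rfl fun a _ => ?_
    rw [slt, tor, phi]; congr 1; ring
  rw [h0, zero_mul, add_zero, h4] at h3
  have h5 := slM_ne
  have := H.ne
  field_simp at h3
  exact h3
end PrimaryPrime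

end

section
open Filter Topology Set

/-- The finite Fourier transform of the translates of `sl`. -/
def sltSum {p : ℕ} [NeZero p] (π : ℂ) (a : ZMod p) (Z : ℂ) : ℂ :=
  ∑ r : ZMod p, ZMod.stdAddChar (a * r) * slt π Z r

namespace PrimaryPrime
variable {p : ℕ} {π d : ℂ} {j : ℤ} [Fact p.Prime]

theorem sltSum_shift (π : ℂ) (a b : ZMod p) (Z : ℂ) :
    ∑ r : ZMod p, ZMod.stdAddChar (a * r) * slt π Z (r + b) = ZMod.stdAddChar (-(a * b)) * sltSum π a Z := by
  rw [sltSum, ← Equiv.sum_comp (Equiv.addRight b) (fun r => ZMod.stdAddChar (a * r) * slt π Z r), Finset.mul_sum]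
  refine Finset.sum_congr rfl fun r _ => ?_
  change _ = ZMod.stdAddChar (-(a * b)) * (ZMod.stdAddChar (a * (r + b)) * slt π Z (r + b))
  rw [← mul_assoc, ← AddChar.map_add_eq_mul]
  congr 2; ring

theorem sltSum_add_lat (H : PrimaryPrime p π d j) (a : ZMod p) (Z : ℂ) {l : ℂ} (hl : IsLat l) :
    sltSum π a (Z + (1 - I) * l) = ZMod.stdAddChar (-(a * red p j l)) * sltSum π a Z := by
  rw [← sltSum_shift, sltSum]
  exact Finset.sum_congr rfl fun r _ => by rw [H.slt_add_lat Z hl]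

theorem sltSum_add_one (H : PrimaryPrime p π d j) (a : ZMod p) (Z : ℂ) :
    sltSum π a (Z + 1) = -ZMod.stdAddChar (-(a * red p j (2 * d))) * sltSum π a Z := by
  rw [neg_mul, ← sltSum_shift, sltSum, ← Finset.sum_neg_distrib]
  exact Finset.sum_congr rfl fun r _ => by rw [H.slt_add_one]; ring

theorem sltSum_add_I (H : PrimaryPrime p π d j) (a : ZMod p) (Z : ℂ) :
    sltSum π a (Z + I) = -ZMod.stdAddChar (-(a * red p j (2 * d - 1))) * sltSum π a Z := by
  rw [neg_mul, ← sltSum_shift, sltSum, ← Finset.sum_neg_distrib]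
  exact Finset.sum_congr rfl fun r _ => by rw [H.slt_add_I]; ring

theorem analyticAt_sltSum (H : PrimaryPrime p π d j) (a : ZMod p) {Z : ℂ} (hZ : ¬ IsPole Z) :
    AnalyticAt ℂ (sltSum π a) Z :=
  Finset.analyticAt_fun_sum _ fun _ _ =>
    analyticAt_const.mul (analyticAt_slt (H.not_isPole_slt hZ (isLat_nat _)))

theorem residue_sltSum (H : PrimaryPrime p π d j) (a : ZMod p) :
    Tendsto (fun w => (w - π * ((1 + I) / 2)) * sltSum π a w) (𝓝[≠] (π * ((1 + I) / 2))) (𝓝 (π * slRes)) := by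
  set z0 := π * ((1 + I) / 2) with hz0
  have han : AnalyticAt ℂ (fun Z => ∑ r ∈ Finset.univ.erase (0 : ZMod p), ZMod.stdAddChar (a * r) * slt π Z r) z0 := by
    refine Finset.analyticAt_fun_sum _ fun r hr => analyticAt_const.mul (analyticAt_slt ?_)
    refine H.not_isPole_slt_base (isLat_nat _) ?_
    rw [red_val]; exact Finset.ne_of_mem_erase hr
  have h := H.residue_slt_zero.add (tendsto_sub_mul_zero han.continuousAt)
  rw [add_zero] at h
  refine h.congr fun w => ?_
  rw [sltSum, ← Finset.add_sum_erase Finset.univ _ (Finset.mem_univ (0 : ZMod p)), mul_zero,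
    AddChar.map_zero_eq_one]
  ring

theorem red_one_sub_I : red p j (1 - I) = 1 - (j : ZMod p) := by
  rw [red_sub isLat_one isLat_I, red_one, red_I]

theorem red_two_mul_d (H : PrimaryPrime p π d j) : (1 - (j : ZMod p)) * red p j (2 * d) = 1 := by
  rw [H.red_mul isLat_two H.latd, red_two]
  linear_combination H.red_one_sub_I_mul

theorem red_two_mul_d_sub (H : PrimaryPrime p π d j) :
    red p j (2 * d - 1) = j * red p j (2 * d) := by
  rw [red_sub (isLat_two.mul H.latd) isLat_one, red_one]
  linear_combination H.red_two_mul_d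

theorem red_one_add_I_mul_d (H : PrimaryPrime p π d j) : 2 * red p j ((1 + I) * d) = j := by
  rw [H.red_mul (isLat_one.add isLat_I) H.latd, red_add isLat_one isLat_I, red_one, red_I]
  have h := H.red_one_sub_I_mul
  linear_combination j * h + 2 * red p j d * H.sq_j

theorem stdAddChar_neg_int (A : ℤ) :
    ZMod.stdAddChar (-(A : ZMod p)) = cexp (2 * Real.pi * I * ((-A / p : ℝ) : ℂ)) := by
  rw [show (-(A : ZMod p)) = ((-A : ℤ) : ZMod p) by push_cast; rfl, ZMod.stdAddChar_coe]
  congr 1; push_cast; ring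

theorem sltSum_eq_sechSum (H : PrimaryPrime p π d j) (a : ZMod p) {A₀ A₁ : ℤ}
    (h₀ : (A₀ : ZMod p) = a * red p j (2 * d)) (h₁ : (A₁ : ZMod p) = a * red p j (2 * d - 1))
    (hA : |(-A₁ / p : ℝ)| < 1 / 2) {Z : ℂ} (hZ : ¬ IsPole Z) :
    sltSum π a Z = π * (slM / slC) * ZMod.stdAddChar (-(a * red p j ((1 + I) * d))) *
      cexp (-(Real.pi * I * ((-A₁ / p : ℝ) : ℂ))) *
      sechSum (-cexp (2 * Real.pi * I * ((-A₀ / p : ℝ) : ℂ))) (-A₁ / p : ℝ) Z := by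
  set c := -cexp (2 * Real.pi * I * ((-A₀ / p : ℝ) : ℂ)) with hc
  have hcn : ‖c‖ = 1 := norm_neg_exp _
  set c2 := -cexp (2 * Real.pi * I * ((-A₁ / p : ℝ) : ℂ)) with hc2
  have hcn2 : ‖c2‖ = 1 := norm_neg_exp _
  set κ := π * (slM / slC) * ZMod.stdAddChar (-(a * red p j ((1 + I) * d))) *
      cexp (-(Real.pi * I * ((-A₁ / p : ℝ) : ℂ))) with hκ
  have f1 : ∀ z, sltSum π a (z + 1) = c * sltSum π a z := fun z => by
    rw [H.sltSum_add_one, ← h₀, stdAddChar_neg_int]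
  have f2 : ∀ z, sltSum π a (z + I) = c2 * sltSum π a z := fun z => by
    rw [H.sltSum_add_I, ← h₁, stdAddChar_neg_int]
  have hlat : ∀ {z}, (¬ IsPole z) → AnalyticAt ℂ (sechSum c (-A₁ / p : ℝ)) z := fun {z} hz =>
    analyticAt_sechSum hcn hA fun m n h => hz (isPole_iff_exists.2 ⟨m, n, h⟩)
  have hne : c ≠ 1 ∨ c2 ≠ 1 := by
    by_contra! hh
    obtain ⟨e1, e2⟩ := hh
    rw [hc, ← stdAddChar_neg_int] at e1
    have h2 := congrArg (fun x : ℂ => x ^ p) e1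
    have hodd : Odd p := by rw [Nat.odd_iff]; have := H.mod8; omega
    simp only [hodd.neg_pow, one_pow, ← AddChar.map_nsmul_eq_pow, nsmul_eq_mul, CharP.cast_eq_zero,
      zero_mul, AddChar.map_zero_eq_one] at h2
    norm_num at h2
  refine liouville_eq' (f := sltSum π a) (h := fun z => κ * sechSum c (-A₁ / p : ℝ) z) (c₁ := c) (c₂ := c2)
    ?_ ?_ hcn hcn2 hne f1 f2 ?_ ?_ ?_ ?_ ?_
  · exact fun z => MeromorphicAt.fun_sum fun r _ => (MeromorphicAt.const _ z).mul (meromorphicAt_slt z r)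
  · exact fun z => (MeromorphicAt.const _ z).mul (meromorphicAt_sechSum hcn hA z)
  · intro z; simp only [sechSum_add_one hcn]; ring
  · intro z; simp only [sechSum_add_I]; rw [hc2]; ring
  · intro z
    by_cases hz : IsPole z
    · obtain ⟨m, n, h⟩ := isPole_iff_exists.1 hz
      refine ⟨m, n, (1 + I) / 2, h, κ * (cexp (Real.pi * I * ((-A₁ / p : ℝ) : ℂ)) / (Real.pi * I)), ?_, ?_⟩
      · have ht := (H.residue_sltSum a).comp (tendsto_add_const_punctured (-((1 - I) * ((1 + I) * d))) ((1 + I) / 2) |>.trans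
          (le_of_eq (by
            congr 1
            · linear_combination -(1 + I) / 2 * H.eq
            · congr 1
              rw [show (1 + I) / 2 + -((1 - I) * ((1 + I) * d)) = π * ((1 + I) / 2) by
                linear_combination -(1 + I) / 2 * H.eq])))
        have ht2 := ht.const_mul (ZMod.stdAddChar (-(a * red p j ((1 + I) * d))) : ℂ)
        refine (ht2.congr fun w => ?_).trans (le_of_eq ?_)
        · have := H.sltSum_add_lat a (w + -((1 - I) * ((1 + I) * d))) ((isLat_one.add isLat_I).mul H.latd)
          rw [neg_add_cancel_right] at this
          simp only [Function.comp]
          rw [this]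
          have e : w + -((1 - I) * ((1 + I) * d)) - π * ((1 + I) / 2) = w - (1 + I) / 2 := by
            linear_combination -(1 + I) / 2 * H.eq
          rw [e]; ring
        · congr 1
          rw [hκ, slRes, exp_neg]
          have h3 := exp_ne_zero (Real.pi * I * ((-A₁ / p : ℝ) : ℂ))
          have h4 := slC_ne
          field_simp
      · exact ((residue_sechSum hcn hA).const_mul κ).congr fun w => by ring
    · refine ⟨0, 0, z, by simp, 0, tendsto_sub_mul_zero (H.analyticAt_sltSum a hz).continuousAt, ?_⟩
      exact tendsto_sub_mul_zero (g := fun z => κ * sechSum c (-A₁ / p : ℝ) z) ((hlat hz).continuousAt.const_mul _)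
  · exact (H.analyticAt_sltSum a hZ).continuousAt
  · exact (hlat hZ).continuousAt.const_mul _

theorem exists_rep_lt (H : PrimaryPrime p π d j) (x : ZMod p) :
    ∃ A : ℤ, (A : ZMod p) = x ∧ |(-A / p : ℝ)| < 1 / 2 := by
  refine ⟨x.valMinAbs, x.coe_valMinAbs, ?_⟩
  have hp : (0 : ℝ) < p := by exact_mod_cast H.prime.pos
  have h := x.valMinAbs_mem_Ioc
  have h8 := H.mod8
  have h1 : -(p : ℤ) < x.valMinAbs * 2 := h.1
  have h2 : x.valMinAbs * 2 < p := by have := h.2; omega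
  rw [abs_lt, lt_div_iff₀ hp, div_lt_iff₀ hp]
  have h1' : -(p : ℝ) < x.valMinAbs * 2 := by exact_mod_cast h1
  have h2' : (x.valMinAbs * 2 : ℝ) < p := by exact_mod_cast h2
  constructor <;> linarith

theorem exists_rep_parity (H : PrimaryPrime p π d j) (x : ZMod p) (s : ℤ) :
    ∃ A : ℤ, (A : ZMod p) = x ∧ Even (A + s) := by
  rcases Int.even_or_odd ((x.val : ℤ) + s) with h | h
  · exact ⟨x.val, by simp, h⟩
  · refine ⟨x.val + p, by simp, ?_⟩
    have hp : Odd (p : ℤ) := by have := H.mod8; rw [Int.odd_iff]; omega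
    rw [show (x.val : ℤ) + p + s = x.val + s + p by ring]
    exact h.add_odd hp
end PrimaryPrime

end

section
open Filter Topology Set

theorem sechSum_one_zero_eq {z : ℂ} (h1 : ¬ IsPole (z + 1 / 2)) (h2 : ¬ IsPole (z + I / 2)) :
    slM / slC * sechSum 1 0 ((1 + I) * z) = (1 - I) / 2 * (sl (z + 1 / 2) + sl (z + I / 2)) := by
  have n1 : ‖(1 : ℂ)‖ = 1 := norm_one
  have hb : |(0 : ℝ)| < 1 / 2 := by norm_num
  have t1 : ∀ z, sechSum 1 0 (z + 1) = 1 * sechSum 1 0 z := fun z => sechSum_add_one n1 0 z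
  have t2 : ∀ z, sechSum 1 0 (z + I) = -1 * sechSum 1 0 z := fun z => by
    rw [sechSum_add_I]; simp
  have pole : ∀ z, IsPole ((1 + I) * z) → IsPole (z + 1 / 2) ∨ IsPole (z + I / 2) := by
    rintro z ⟨m, n, h⟩
    have hz : z = 1 / 2 + ((m + n) + (n - m) * I) / 2 := by
      have := congrArg (fun x => (1 - I) / 2 * x) h
      linear_combination this + (z / 2 - (n : ℂ) / 2 - 1 / 4) * I_sq
    rcases Int.even_or_odd (m + n) with ⟨k, hk⟩ | ⟨k, hk⟩
    · right
      have hk' : (m : ℂ) + n = k + k := by exact_mod_cast hk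
      exact ⟨k, n - k, by push_cast; linear_combination hz + (1 / 2 - I / 2) * hk'⟩
    · left
      have hk' : (m : ℂ) + n = 2 * k + 1 := by exact_mod_cast hk
      exact ⟨k + 1, n - k - 1, by push_cast; linear_combination hz + (1 / 2 - I / 2) * hk'⟩
  have an : ∀ z, ¬ IsPole (z + 1 / 2) → ¬ IsPole (z + I / 2) →
      AnalyticAt ℂ (fun z => slM / slC * sechSum 1 0 ((1 + I) * z)) z := fun z h1 h2 => by
    refine analyticAt_const.mul ((analyticAt_sechSum n1 hb (z := (1 + I) * z) fun m n h => ?_).comp_of_eq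
      (f := fun z : ℂ => (1 + I) * z) (by fun_prop) rfl)
    rcases pole z (isPole_iff_exists.2 ⟨m, n, h⟩) with h | h
    exacts [h1 h, h2 h]
  have an2 : ∀ z, ¬ IsPole (z + 1 / 2) → AnalyticAt ℂ (fun z => sl (z + 1 / 2)) z := fun z h =>
    (analyticAt_sl h).comp_of_eq (f := fun z : ℂ => z + 1 / 2) (by fun_prop) rfl
  have an3 : ∀ z, ¬ IsPole (z + I / 2) → AnalyticAt ℂ (fun z => sl (z + I / 2)) z := fun z h =>
    (analyticAt_sl h).comp_of_eq (f := fun z : ℂ => z + I / 2) (by fun_prop) rfl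
  have hI1 : (1 + I : ℂ) ≠ 0 := fun h => by have := congrArg re h; simp at this
  have hres := residue_sechSum n1 hb
  simp only [ofReal_zero, mul_zero, exp_zero] at hres
  have key : ∀ {z₀ : ℂ}, Tendsto (fun w => (w - (1 + I) * z₀) * sechSum 1 0 w) (𝓝[≠] ((1 + I) * z₀))
      (𝓝 (1 / (Real.pi * I))) →
      Tendsto (fun w => (w - z₀) * (slM / slC * sechSum 1 0 ((1 + I) * w))) (𝓝[≠] z₀) (𝓝 ((1 - I) / 2 * slRes)) := by
    intro z₀ h
    have h := (h.comp (tendsto_mul_const_punctured hI1 z₀)).const_mul ((slM / slC : ℂ) / (1 + I))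
    refine (h.congr fun w => ?_).trans (le_of_eq ?_)
    · simp only [Function.comp]; field_simp
    · congr 1
      rw [slRes, show (1 - I) / 2 = 1 / (1 + I) by field_simp; linear_combination -I_sq]
      ring
  have keysl : ∀ z₀ c : ℂ, z₀ + c = (1 + I) / 2 →
      Tendsto (fun w => (w - z₀) * sl (w + c)) (𝓝[≠] z₀) (𝓝 slRes) := by
    intro z₀ c hc
    have := tendsto_add_const_punctured c z₀
    rw [hc] at this
    refine (residue_sl.comp this).congr fun w => ?_
    simp only [Function.comp]
    congr 1
    linear_combination hc
  have half : ¬ IsPole (1 / 2 + 1 / 2) := by norm_num; exact isLat_one.not_isPole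
  have halfI : ¬ IsPole (I / 2 + I / 2) := by rw [add_halves]; exact isLat_I.not_isPole
  refine liouville_eq' (f := fun z => slM / slC * sechSum 1 0 ((1 + I) * z))
    (h := fun z => (1 - I) / 2 * (sl (z + 1 / 2) + sl (z + I / 2))) (c₁ := -1) (c₂ := -1)
    ?_ ?_ (by simp) (by simp) (Or.inl (by norm_num)) ?_ ?_ ?_ ?_ ?_
    (an z h1 h2).continuousAt (analyticAt_const.mul ((an2 z h1).add (an3 z h2))).continuousAt
  · exact fun z => (MeromorphicAt.const _ z).mul ((meromorphicAt_sechSum n1 hb _).comp_analyticAt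
      (g := fun z : ℂ => (1 + I) * z) (by fun_prop))
  · exact fun z => (MeromorphicAt.const _ z).mul (((meromorphicAt_sl _).comp_analyticAt
      (g := fun z : ℂ => z + 1 / 2) (by fun_prop)).add ((meromorphicAt_sl _).comp_analyticAt
      (g := fun z : ℂ => z + I / 2) (by fun_prop)))
  · intro z
    rw [show (1 + I) * (z + 1) = (1 + I) * z + 1 + I by ring, t2, t1]; ring
  · intro z
    have := t1 ((1 + I) * (z + I))
    rw [show (1 + I) * (z + I) + 1 = (1 + I) * z + I by linear_combination I_sq, t2] at this
    rw [one_mul] at this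
    rw [← this]; ring
  · intro z
    rw [add_right_comm z 1, add_right_comm z 1, sl_add_one, sl_add_one]; ring
  · intro z
    rw [add_right_comm z I, add_right_comm z I, sl_add_I, sl_add_I]; ring
  · intro z
    by_cases p1 : IsPole (z + 1 / 2)
    · obtain ⟨m, n, hmn⟩ := p1
      refine ⟨m, n, I / 2, by linear_combination hmn, (1 - I) / 2 * slRes, key ?_, ?_⟩
      · have := tendsto_residue_translate (by norm_num : (1 : ℂ) ≠ 0) (by norm_num : (-1 : ℂ) ≠ 0) t1 t2 (-1) 0 hres
        simp only [Int.cast_neg, Int.cast_one, Int.cast_zero, zero_mul, add_zero, one_zpow, zpow_zero, one_mul] at this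
        rwa [show (1 + I) / 2 + -1 = (1 + I) * (I / 2) by linear_combination (-1 / 2 : ℂ) * I_sq] at this
      · have := ((keysl (I / 2) (1 / 2) (by ring)).add (tendsto_sub_mul_zero (an3 _ halfI).continuousAt)).const_mul ((1 - I) / 2)
        rw [add_zero] at this
        exact this.congr fun w => by ring
    by_cases p2 : IsPole (z + I / 2)
    · obtain ⟨m, n, hmn⟩ := p2
      refine ⟨m, n, 1 / 2, by linear_combination hmn, (1 - I) / 2 * slRes, key ?_, ?_⟩
      · rwa [show (1 + I) / 2 = (1 + I) * (1 / 2) by ring] at hres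
      · have := ((keysl (1 / 2) (I / 2) (by ring)).add (tendsto_sub_mul_zero (an2 _ half).continuousAt)).const_mul ((1 - I) / 2)
        rw [add_zero] at this
        exact this.congr fun w => by ring
    · exact ⟨0, 0, z, by simp, 0, tendsto_sub_mul_zero (an z p1 p2).continuousAt,
        tendsto_sub_mul_zero (analyticAt_const.mul ((an2 z p1).add (an3 z p2))).continuousAt⟩

theorem not_isPole_sub_I_half {u : ℂ} (h : ¬ IsPole ((1 - I) * (I * u) + 1 / 2)) :
    ¬ IsPole ((1 - I) * u - I / 2) := by
  rw [← isPole_I_mul_iff]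
  rwa [show I * ((1 - I) * u - I / 2) = (1 - I) * (I * u) + 1 / 2 by linear_combination (-1 / 2 : ℂ) * I_sq]

theorem psi_I_mul {u : ℂ} (h : ¬ IsPole ((1 - I) * (I * u) + 1 / 2)) :
    psi (I * u) = I * sl ((1 - I) * u - I / 2) := by
  rw [← sl_I_mul (not_isPole_sub_I_half h), psi]
  congr 1
  linear_combination (1 / 2 : ℂ) * I_sq

namespace PrimaryPrime
variable {p : ℕ} {π d : ℂ} {j : ℤ} [Fact p.Prime]

theorem one_add_j_mul (H : PrimaryPrime p π d j) : (1 + (j : ZMod p)) * red p j (2 * d) = j := by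
  linear_combination (j : ZMod p) * H.red_two_mul_d + red p j (2 * d) * H.sq_j

theorem exists_pi_mul (H : PrimaryPrime p π d j) (a : ZMod p) {A₀ A₁ : ℤ}
    (h₀ : (A₀ : ZMod p) = a * red p j (2 * d)) (h₁ : (A₁ : ZMod p) = a * red p j (2 * d - 1)) :
    ∃ l, IsLat l ∧ (A₀ + A₁ * I : ℂ) = π * l ∧
      (1 - (j : ZMod p)) * red p j ((starRingEnd ℂ) π) * red p j ((starRingEnd ℂ) l) = 2 * a := by
  have h : red p j (A₀ + A₁ * I) = 0 := by
    rw [red_mk, h₀, h₁, H.red_two_mul_d_sub]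
    linear_combination a * red p j (2 * d) * H.sq_j
  obtain ⟨l, hl, e⟩ := (H.red_eq_zero_iff ⟨A₀, A₁, rfl⟩).1 h
  refine ⟨l, hl, e, ?_⟩
  rw [mul_assoc, ← H.red_mul H.lat_conj (isLat_conj hl), ← map_mul, ← e]
  have : (starRingEnd ℂ) (A₀ + A₁ * I : ℂ) = (A₀ : ℂ) + ((-A₁ : ℤ) : ℂ) * I := by
    simp only [map_add, map_mul, map_intCast, conj_I]; push_cast; ring
  rw [this, red_mk, Int.cast_neg, h₀, h₁, H.red_two_mul_d_sub]
  linear_combination 2 * a * H.red_two_mul_d - (1 - (j : ZMod p)) * a * red p j (2 * d) * H.sq_j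

/-- The finite Fourier transform of `φ` at the `π`-torsion points. -/
theorem tor_dual (H : PrimaryPrime p π d j) (a : ZMod p) :
    ∑ r : ZMod p, ZMod.stdAddChar (a * r) * tor π phi r =
      -π * (starRingEnd ℂ) (tor π phi (a * (red p j ((starRingEnd ℂ) π))⁻¹)) := by
  obtain ⟨A₁, h₁, hA⟩ := H.exists_rep_lt (a * red p j (2 * d - 1))
  obtain ⟨A₀, h₀, B, hB⟩ := H.exists_rep_parity (a * red p j (2 * d)) A₁
  have e0 : ∑ r : ZMod p, ZMod.stdAddChar (a * r) * tor π phi r = sltSum π a 0 := by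
    refine Finset.sum_congr rfl fun r _ => ?_
    rw [tor, phi, slt]
    congr 2; ring
  rw [e0, H.sltSum_eq_sechSum a h₀ h₁ hA isLat_zero.not_isPole, sechSum_zero _ hA]
  have hB' : a * red p j ((1 + I) * d) = (B : ZMod p) := by
    apply mul_left_cancel₀ H.two_ne
    have := congrArg (fun x : ℤ => (x : ZMod p)) hB
    push_cast at this
    rw [h₀, h₁, H.red_two_mul_d_sub] at this
    linear_combination a * H.red_one_add_I_mul_d - a * H.one_add_j_mul + this
  have hexp : ZMod.stdAddChar (-(a * red p j ((1 + I) * d))) * cexp (-(Real.pi * I * ((-A₁ / p : ℝ) : ℂ))) *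
      cexp (-(Real.pi * I * ((-A₀ / p : ℝ) : ℂ))) = 1 := by
    rw [hB', stdAddChar_neg_int, ← exp_add, ← exp_add, ← exp_zero]
    congr 1
    have : (A₀ : ℂ) + A₁ = B + B := by exact_mod_cast hB
    push_cast
    linear_combination Real.pi * I / p * this
  obtain ⟨l, hl, e, hred⟩ := H.exists_pi_mul a h₀ h₁
  have hm : (A₀ + A₁ * I : ℂ) = (1 + I) * (B + (A₁ - B : ℤ) * I) := by
    have : (A₀ : ℂ) + A₁ = B + B := by exact_mod_cast hB
    push_cast
    linear_combination this + (B - A₁ : ℂ) * I_sq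
  set l' : ℂ := (B + (A₁ - B : ℤ) * I) + (1 - I) * ((1 - I) * (d * l)) with hl'
  have ll' : IsLat l' := IsLat.add ⟨_, _, rfl⟩ (isLat_one_sub_I.mul (isLat_one_sub_I.mul (H.latd.mul hl)))
  have el : l = (1 + I) * l' := by
    rw [hl', mul_add, ← hm, e]
    linear_combination -l * H.eq + (1 - I) * d * l * I_sq
  have c1 : (starRingEnd ℂ) (1 + I) = 1 - I := by simp [sub_eq_add_neg]
  have lν : IsLat (-(I * (starRingEnd ℂ) l')) := (isLat_I.mul (isLat_conj ll')).neg
  have hν : a * (red p j ((starRingEnd ℂ) π))⁻¹ = red p j (-(I * (starRingEnd ℂ) l')) := by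
    rw [red_neg (isLat_I.mul (isLat_conj ll')), H.red_mul isLat_I (isLat_conj ll'), red_I]
    rw [el, map_mul, c1, H.red_mul isLat_one_sub_I (isLat_conj ll'), red_one_sub_I] at hred
    have h0 := H.red_conj_ne
    field_simp
    apply mul_left_cancel₀ (mul_ne_zero H.two_ne H.j_ne)
    linear_combination -(j : ZMod p) * hred + (j * red p j ((starRingEnd ℂ) π) * red p j ((starRingEnd ℂ) l')) * H.sq_j
  have e2 : ∀ x, ¬ IsPole x → -π * sl x = π * sl (-x) := fun x h => by rw [sl_neg h]; ring
  have hpole : ¬ IsPole ((starRingEnd ℂ) ((1 - I) * (-(I * (starRingEnd ℂ) l') / π))) := by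
    rw [isPole_conj_iff]; exact H.not_isPole lν
  clear_value l'
  rw [hν, H.tor_red phi_add_lat lν, phi, ← sl_conj, e2 _ hpole, sl]
  · calc _ = π * (slM / slC) * (ZMod.stdAddChar (-(a * red p j ((1 + I) * d))) *
        cexp (-(Real.pi * I * ((-A₁ / p : ℝ) : ℂ))) * cexp (-(Real.pi * I * ((-A₀ / p : ℝ) : ℂ)))) *
        SN (I * (((-A₀ / p : ℝ) : ℂ) + ((-A₁ / p : ℝ) : ℂ) * I)) := by rw [SN]; ring
      _ = _ := by
        rw [hexp, mul_one, mul_assoc]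
        congr 3
        have hc := congrArg (starRingEnd ℂ) c1
        rw [conj_conj] at hc
        simp only [map_mul, map_div₀, map_neg, conj_conj, conj_I, ← hc]
        have h0 := H.ne
        have h1 : (starRingEnd ℂ) π ≠ 0 := by simpa using h0
        push_cast
        rw [H.norm]
        field_simp
        rw [el] at e
        linear_combination -e
end PrimaryPrime

end

section
open Filter Topology Set

theorem conj_one_sub_I : (starRingEnd ℂ) (1 - I) = 1 + I := by simp

namespace PrimaryPrime
variable {p : ℕ} {π d : ℂ} {j : ℤ} [Fact p.Prime]

theorem torp_neg (H : PrimaryPrime p π d j) (a : ZMod p) : tor π psi (-a) = tor π psi a := by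
  have h1 := H.torp_mul_torp a
  have h2 := H.torp_mul_torp ((j : ZMod p) * a)
  rw [show (j : ZMod p) * (j * a) = -a by linear_combination a * H.sq_j] at h2
  linear_combination tor π psi a * h2 - tor π psi (-a) * h1

theorem torp_j_mul (H : PrimaryPrime p π d j) (a : ZMod p) :
    tor π psi ((j : ZMod p) * a) = psi (I * (a.val / π)) := by
  have la := isLat_nat a.val
  rw [show (j : ZMod p) * a = red p j (I * a.val) by rw [H.red_mul isLat_I la, red_I, red_val],
    H.tor_red psi_add_lat (isLat_I.mul la), mul_div_assoc]

/-- The finite Fourier transform of `ψ` at the `π`-torsion points. -/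
theorem torp_dual (H : PrimaryPrime p π d j) (a : ZMod p) {m : ZMod p}
    (hm : (1 - (j : ZMod p)) * red p j ((starRingEnd ℂ) π) * m = 1) :
    ∑ r : ZMod p, ZMod.stdAddChar (a * r) * tor π psi ((j : ZMod p) * r) =
      π * (starRingEnd ℂ) ((1 + I) / 2 * tor π psi (a * m) + (1 - I) / 2 * tor π psi ((j : ZMod p) * (a * m))) := by
  obtain ⟨A₁, h₁, hA⟩ := H.exists_rep_lt (a * red p j (2 * d - 1))
  obtain ⟨A₀, h₀, B, hB⟩ := H.exists_rep_parity (a * red p j (2 * d)) 0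
  have hp : ∀ r : ZMod p, ¬ IsPole ((1 - I) * (I * ((r.val : ℂ) / π)) + 1 / 2) := fun r => by
    have := H.not_isPole_half (isLat_I.mul (isLat_nat r.val))
    rwa [mul_div_assoc] at this
  have e0 : ∑ r : ZMod p, ZMod.stdAddChar (a * r) * tor π psi ((j : ZMod p) * r) =
      I * (ZMod.stdAddChar (-(a * red p j (I * d))) * sltSum π a (-(I / 2))) := by
    rw [← H.sltSum_add_lat a _ (isLat_I.mul H.latd), sltSum, Finset.mul_sum]
    refine Finset.sum_congr rfl fun r _ => ?_
    rw [H.torp_j_mul, psi_I_mul (hp r), slt]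
    have h0 := H.ne
    rw [show (-(I / 2) + (1 - I) * (I * d) + (1 - I) * (r.val : ℂ)) / π =
      (1 - I) * ((r.val : ℂ) / π) - I / 2 by field_simp; linear_combination I * H.eq]
    ring
  have hI2 : ¬ IsPole (-(I / 2)) := fun h => by
    rw [isPole_neg_iff, show I / 2 = I * (1 / 2) by ring, isPole_I_mul_iff] at h
    exact _root_.not_isPole_half h
  have hB' : a * red p j (I * d) + a * red p j ((1 + I) * d) = ((B + A₁ : ℤ) : ZMod p) := by
    apply mul_left_cancel₀ H.two_ne
    have := congrArg (fun x : ℤ => (x : ZMod p)) hB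
    have h2 : red p j (2 * d) = 2 * red p j d := by rw [H.red_mul isLat_two H.latd, red_two]
    push_cast at this ⊢
    rw [h₀] at this
    rw [h₁, H.red_two_mul_d_sub, H.red_mul isLat_I H.latd, red_I]
    linear_combination a * H.red_one_add_I_mul_d - a * H.one_add_j_mul + this - a * j * h2
  have hexp : ZMod.stdAddChar (-(a * red p j (I * d))) * ZMod.stdAddChar (-(a * red p j ((1 + I) * d))) *
      (cexp (-(Real.pi * I * ((-A₁ / p : ℝ) : ℂ))) * cexp (-(Real.pi * I * ((-A₁ / p : ℝ) : ℂ))) *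
      cexp (-(Real.pi * I * ((-A₀ / p : ℝ) : ℂ)))) = 1 := by
    rw [← AddChar.map_add_eq_mul, ← neg_add, hB', stdAddChar_neg_int, ← exp_add, ← exp_add, ← exp_add, ← exp_zero]
    congr 1
    have : (A₀ : ℂ) = B + B := by simpa using congrArg (fun x : ℤ => (x : ℂ)) hB
    push_cast
    linear_combination Real.pi * I / p * this
  obtain ⟨l, hl, e, hred⟩ := H.exists_pi_mul a h₀ h₁
  have h0 := H.ne
  have h1 : (starRingEnd ℂ) π ≠ 0 := by simpa using h0
  have n1 : ‖(1 : ℂ)‖ = 1 := norm_one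
  obtain ⟨b, lb, hS, hb⟩ : ∃ b, IsLat b ∧
      sechSum 1 0 (I * (((-A₀ / p : ℝ) : ℂ) + ((-A₁ / p : ℝ) : ℂ) * I)) =
        sechSum 1 0 ((1 + I) * (-(1 + I) * b / (starRingEnd ℂ) π)) ∧
      red p j ((starRingEnd ℂ) (2 * b)) = red p j ((starRingEnd ℂ) l) := by
    have hA0 : (A₀ : ℂ) = B + B := by simpa using congrArg (fun x : ℤ => (x : ℂ)) hB
    have harg : I * (((-A₀ / p : ℝ) : ℂ) + ((-A₁ / p : ℝ) : ℂ) * I) = -I * l / (starRingEnd ℂ) π := by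
      push_cast
      rw [H.norm]
      field_simp
      linear_combination -e
    rcases Int.even_or_odd A₁ with ⟨k, hk⟩ | ⟨k, hk⟩
    · have hk' : (A₁ : ℂ) = k + k := by exact_mod_cast hk
      have hb : (2 : ℂ) * (B + k * I + (1 - I) * (d * l)) = l := by
        linear_combination l * H.eq - hA0 - I * hk' + e
      refine ⟨B + k * I + (1 - I) * (d * l), IsLat.add ⟨_, _, rfl⟩ (isLat_one_sub_I.mul (H.latd.mul hl)), ?_, ?_⟩
      · rw [harg]
        congr 1
        have hb' : (1 + I) * (1 + I) * (B + k * I + (1 - I) * (d * l)) = I * l := by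
          linear_combination I * hb + (B + k * I + (1 - I) * (d * l)) * I_sq
        field_simp
        linear_combination hb'
      · rw [hb]
    · have hk' : (A₁ : ℂ) = 2 * k + 1 := by exact_mod_cast hk
      have hc : (starRingEnd ℂ) π = 1 - 2 * (1 + I) * (starRingEnd ℂ) d := by
        have := congrArg (starRingEnd ℂ) H.eq
        simpa [Complex.conj_ofNat] using this
      have hb : (2 : ℂ) * (B + k * I + (1 - I) * (d * l) + I * (1 + I) * (starRingEnd ℂ) d) = l - I * (starRingEnd ℂ) π := by
        linear_combination l * H.eq - hA0 - I * hk' + e + I * hc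
      refine ⟨B + k * I + (1 - I) * (d * l) + I * (1 + I) * (starRingEnd ℂ) d,
        (IsLat.add ⟨_, _, rfl⟩ (isLat_one_sub_I.mul (H.latd.mul hl))).add
          ((isLat_I.mul (isLat_one.add isLat_I)).mul (isLat_conj H.latd)), ?_, ?_⟩
      · rw [harg]
        have := sechSum_add_one n1 0 (-I * l / (starRingEnd ℂ) π - 1)
        rw [sub_add_cancel, one_mul] at this
        rw [this]
        congr 1
        have hb' : (1 + I) * (1 + I) * (B + k * I + (1 - I) * (d * l) + I * (1 + I) * (starRingEnd ℂ) d) = I * (l - I * (starRingEnd ℂ) π) := by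
          rw [← hb]
          linear_combination (B + k * I + (1 - I) * (d * l) + I * (1 + I) * (starRingEnd ℂ) d) * I_sq
        field_simp
        linear_combination hb' - (starRingEnd ℂ) π * I_sq
      · rw [hb, map_sub, red_sub (isLat_conj hl) (isLat_conj (isLat_I.mul H.lat_conj)), map_mul, conj_conj, conj_I,
          H.red_mul isLat_I.neg H.lat, H.red_pi]
        ring
  set n : ZMod p := red p j (-(starRingEnd ℂ) b) with hn
  have lcb := (isLat_conj lb).neg
  have hnam : n = -(a * m) := by
    rw [hn, red_neg (isLat_conj lb)]
    rw [map_mul, Complex.conj_ofNat, H.red_mul isLat_two (isLat_conj lb), red_two] at hb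
    rw [← hb] at hred
    congr 1
    apply mul_left_cancel₀ H.two_ne
    linear_combination m * hred - 2 * red p j ((starRingEnd ℂ) b) * hm
  have zc : (starRingEnd ℂ) (-(1 + I) * b / (starRingEnd ℂ) π) = (1 - I) * (-(starRingEnd ℂ) b / π) := by
    simp only [map_mul, map_div₀, map_neg, conj_conj, map_add, map_one, conj_I]
    ring
  have hp1 := H.not_isPole_half lcb
  have hp2 := H.not_isPole_half (isLat_I.mul lcb)
  rw [mul_div_assoc] at hp2
  have hz1 : -(1 + I) * b / (starRingEnd ℂ) π + 1 / 2 = (starRingEnd ℂ) ((1 - I) * (-(starRingEnd ℂ) b / π) + 1 / 2) := by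
    rw [map_add, ← zc, conj_conj]; simp [Complex.conj_ofNat]
  have hz2 : -(1 + I) * b / (starRingEnd ℂ) π + I / 2 = (starRingEnd ℂ) ((1 - I) * (-(starRingEnd ℂ) b / π) - I / 2) := by
    rw [map_sub, ← zc, conj_conj, map_div₀, conj_I, Complex.conj_ofNat]; ring
  have hs := sechSum_one_zero_eq (z := -(1 + I) * b / (starRingEnd ℂ) π)
    (by rw [hz1, isPole_conj_iff]; exact hp1)
    (by rw [hz2, isPole_conj_iff]; exact not_isPole_sub_I_half hp2)
  rw [← hS, hz1, hz2, sl_conj, sl_conj] at hs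
  have w1 : tor π psi (a * m) = sl ((1 - I) * (-(starRingEnd ℂ) b / π) + 1 / 2) := by
    rw [← H.torp_neg, ← hnam, hn, H.tor_red psi_add_lat lcb, psi]
  have w2 : tor π psi ((j : ZMod p) * (a * m)) = I * sl ((1 - I) * (-(starRingEnd ℂ) b / π) - I / 2) := by
    rw [← H.torp_neg, show -((j : ZMod p) * (a * m)) = j * n by rw [hnam]; ring, hn, ← red_I (p := p) (j := j), ← H.red_mul isLat_I lcb,
      H.tor_red psi_add_lat (isLat_I.mul lcb), mul_div_assoc, psi_I_mul hp2]
  rw [e0, H.sltSum_eq_sechSum a h₀ h₁ hA hI2, sechSum_neg_half_I _ hA, w1, w2]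
  simp only [map_add, map_mul, map_div₀, map_one, conj_I, Complex.conj_ofNat, conj_one_sub_I]
  generalize sl ((1 - I) * (-(starRingEnd ℂ) b / π) + 1 / 2) = x1 at *
  generalize sl ((1 - I) * (-(starRingEnd ℂ) b / π) - I / 2) = x2 at *
  linear_combination -(I ^ 2) * π * (slM / slC) * sechSum 1 0 (I * (((-A₀ / p : ℝ) : ℂ) + ((-A₁ / p : ℝ) : ℂ) * I)) * hexp
    - I ^ 2 * π * hs + (-π * (1 - I) / 2 * ((starRingEnd ℂ) x1 + (starRingEnd ℂ) x2) + π / 2 * (starRingEnd ℂ) x2) * I_sq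
end PrimaryPrime

end

section
open Filter Topology Set

/-- A quarter set of `𝔽_p^×` modulo the powers of `j`. -/
structure QuarterSet (p : ℕ) (j : ℤ) (T : Finset (ZMod p)) : Prop where
  ne_zero : ∀ t ∈ T, t ≠ 0
  exists_rep : ∀ a, a ≠ 0 → ∃ t ∈ T, ∃ e < 4, a = (j : ZMod p) ^ e * t
  unique : ∀ s ∈ T, ∀ t ∈ T, ∀ e < 4, ∀ f < 4, (j : ZMod p) ^ e * s = (j : ZMod p) ^ f * t → s = t ∧ e = f

/-- A quartic residue character of `𝔽_p = ℤ[i]/π`. -/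
structure QuarticChar (p : ℕ) (j : ℤ) (X : MulChar (ZMod p) ℂ) : Prop where
  lat : ∀ a, IsLat (X a)
  pow_four : ∀ a, a ≠ 0 → X a ^ 4 = 1
  euler : ∀ a, a ≠ 0 → red p j (X a) = a ^ ((p - 1) / 4)

namespace QuarterSet
variable {p : ℕ} {π d : ℂ} {j : ℤ} [Fact p.Prime] {T : Finset (ZMod p)}

@[to_additive]
theorem prod_eq (hT : QuarterSet p j T) (H : PrimaryPrime p π d j) {M : Type*} [CommMonoid M] (F : ZMod p → M) :
    ∏ a ∈ Finset.univ.erase 0, F a = ∏ t ∈ T, ∏ e ∈ Finset.range 4, F ((j : ZMod p) ^ e * t) := by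
  rw [← Finset.prod_product']
  symm
  refine Finset.prod_bij (fun x _ => (j : ZMod p) ^ x.2 * x.1) ?_ ?_ ?_ ?_
  · intro x hx
    rw [Finset.mem_product] at hx
    simp [hT.ne_zero _ hx.1, H.j_ne]
  · rintro ⟨s, e⟩ hx ⟨t, e'⟩ hy h
    rw [Finset.mem_product, Finset.mem_range] at hx hy
    obtain ⟨h1, h2⟩ := hT.unique s hx.1 t hy.1 e hx.2 e' hy.2 h
    rw [h1, h2]
  · intro a ha
    obtain ⟨t, ht, e, he, h⟩ := hT.exists_rep a (by simpa using ha)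
    exact ⟨(t, e), by simp [ht, he], h.symm⟩
  · intro x _; rfl

theorem card_eq (hT : QuarterSet p j T) (H : PrimaryPrime p π d j) : T.card = (p - 1) / 4 := by
  have := hT.sum_eq H (fun _ => 1)
  simp only [Finset.sum_const, Finset.card_range, smul_eq_mul, mul_one] at this
  rw [Finset.card_erase_of_mem (Finset.mem_univ _), Finset.card_univ, ZMod.card] at this
  omega

/-- Gauss's lemma for quarter sets. -/
theorem exists_gauss (hT : QuarterSet p j T) {u : ZMod p} (hu : u ≠ 0) :
    ∃ E : ℕ, ∀ {M : Type} [CommMonoid M] (c : M) (F : ZMod p → M),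
      (∀ a, F (j * a) = c * F a) → ∏ t ∈ T, F (u * t) = c ^ E * ∏ t ∈ T, F t := by
  have hex : ∀ t : ZMod p, ∃ s : ZMod p, ∃ e : ℕ, t ∈ T → s ∈ T ∧ e < 4 ∧ u * t = (j : ZMod p) ^ e * s := fun t => by
    by_cases ht : t ∈ T
    · obtain ⟨s, hs, e, he, h⟩ := hT.exists_rep (u * t) (mul_ne_zero hu (hT.ne_zero t ht))
      exact ⟨s, e, fun _ => ⟨hs, he, h⟩⟩
    · exact ⟨0, 0, fun h => absurd h ht⟩
  choose σ e hσ using hex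
  have inj : Set.InjOn σ T := fun t ht t' ht' h => by
    obtain ⟨_, h1, h2⟩ := hσ t ht
    obtain ⟨_, h1', h2'⟩ := hσ t' ht'
    refine (hT.unique t ht t' ht' (e t') h1' (e t) h1 ?_).1
    rw [← h] at h2'
    apply mul_left_cancel₀ hu
    linear_combination (j : ZMod p) ^ e t' * h2 - (j : ZMod p) ^ e t * h2'
  have hmap : ∀ t ∈ T, σ t ∈ T := fun t ht => (hσ t ht).1
  refine ⟨∑ t ∈ T, e t, fun {M} _ c F hF => ?_⟩
  have hpow : ∀ (n : ℕ) a, F ((j : ZMod p) ^ n * a) = c ^ n * F a := fun n a => by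
    induction n with
    | zero => simp
    | succ n ih => rw [pow_succ', mul_assoc, hF, ih, pow_succ', mul_assoc]
  rw [← Finset.prod_pow_eq_pow_sum]
  have himg : ∏ t ∈ T, F (σ t) = ∏ t ∈ T, F t := by
    refine Finset.prod_bij (fun t _ => σ t) hmap inj ?_ (fun _ _ => rfl)
    intro b hb
    obtain ⟨a, ha, h⟩ := Finset.surj_on_of_inj_on_of_card_le (fun t (_ : t ∈ T) => σ t) hmap
      (fun a b ha hb h => inj ha hb h) le_rfl b hb
    exact ⟨a, ha, h.symm⟩
  rw [← himg, ← Finset.prod_mul_distrib]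
  exact Finset.prod_congr rfl fun t ht => by rw [(hσ t ht).2.2, hpow]

end QuarterSet

namespace PrimaryPrime
variable {p : ℕ} {π d : ℂ} {j : ℤ} [Fact p.Prime] {T : Finset (ZMod p)} {X : MulChar (ZMod p) ℂ}

theorem eq_of_red_eq (H : PrimaryPrime p π d j) {z w : ℂ} (hz : IsLat z) (hw : IsLat w)
    (hz4 : z ^ 4 = 1) (hw4 : w ^ 4 = 1) (h : red p j z = red p j w) : z = w := by
  by_contra hne
  have h0 : z ^ 3 + (z ^ 2 * w + (z * w ^ 2 + w ^ 3)) = 0 := by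
    apply mul_left_cancel₀ (sub_ne_zero.2 hne)
    linear_combination hz4 - hw4
  have h1 := congrArg (red p j) h0
  rw [red_add (hz.pow 3) (((hz.pow 2).mul hw).add ((hz.mul (hw.pow 2)).add (hw.pow 3))),
    red_add ((hz.pow 2).mul hw) ((hz.mul (hw.pow 2)).add (hw.pow 3)), red_add (hz.mul (hw.pow 2)) (hw.pow 3),
    H.red_mul (hz.pow 2) hw, H.red_mul hz (hw.pow 2), H.red_pow hz, H.red_pow hz, H.red_pow hw, H.red_pow hw, h,
    red_zero] at h1
  have h4 := congrArg (red p j) hw4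
  rw [H.red_pow hw, red_one] at h4
  have : (2 : ZMod p) * 2 = 0 := by
    linear_combination red p j w * h1 - 4 * h4
  exact mul_ne_zero H.two_ne H.two_ne this


theorem gauss (H : PrimaryPrime p π d j) (hT : QuarterSet p j T) (hX : QuarticChar p j X) {u : ZMod p} (hu : u ≠ 0)
    (F : ZMod p → ℂ) (hF : ∀ a, F (j * a) = I * F a) : ∏ t ∈ T, F (u * t) = X u * ∏ t ∈ T, F t := by
  obtain ⟨E, hE⟩ := hT.exists_gauss hu
  rw [hE I F hF]
  congr 1
  have h1 := hE (j : ZMod p) (fun a => a) (fun _ => rfl)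
  rw [Finset.prod_mul_distrib, Finset.prod_const, hT.card_eq H] at h1
  have h2 := mul_right_cancel₀ (Finset.prod_ne_zero_iff.2 hT.ne_zero) h1
  symm
  refine H.eq_of_red_eq (hX.lat u) (isLat_I.pow E) (hX.pow_four u hu) ?_ ?_
  · rw [← pow_mul, mul_comm, pow_mul, I_pow_four, one_pow]
  · rw [hX.euler u hu, H.red_pow isLat_I, red_I, h2]

theorem prod_torp (H : PrimaryPrime p π d j) (hT : QuarterSet p j T) : ∏ a : ZMod p, tor π psi a = 1 := by
  rw [← Finset.mul_prod_erase _ _ (Finset.mem_univ 0), torp_zero, one_mul, hT.prod_eq H]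
  refine Finset.prod_eq_one fun t _ => ?_
  simp only [Finset.prod_range_succ, Finset.prod_range_zero, one_mul, pow_zero]
  have h1 := H.torp_mul_torp t
  have h2 := H.torp_mul_torp ((j : ZMod p) ^ 2 * t)
  rw [← mul_assoc, ← pow_succ'] at h2
  rw [pow_one, h1, one_mul, h2]

theorem even_div_four (H : PrimaryPrime p π d j) : Even ((p - 1) / 4) := by
  have := H.mod8
  exact ⟨(p - 1) / 8, by omega⟩

theorem prod_tor_pow (H : PrimaryPrime p π d j) (hT : QuarterSet p j T) : (∏ t ∈ T, tor π phi t) ^ 4 = π := by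
  refine Eq.trans ?_ (H.prod_tor (H.prod_torp hT))
  rw [hT.prod_eq H]
  have : ∀ t ∈ T, ∏ e ∈ Finset.range 4, tor π phi ((j : ZMod p) ^ e * t) = -1 * tor π phi t ^ 4 := fun t _ => by
    simp only [Finset.prod_range_succ, Finset.prod_range_zero, one_mul, pow_zero, pow_succ, mul_assoc, H.tor_j_mul]
    linear_combination tor π phi t ^ 4 * (I ^ 4 - I ^ 2 + 1) * I_sq
  rw [Finset.prod_congr rfl this, Finset.prod_mul_distrib, Finset.prod_const, hT.card_eq H, H.even_div_four.neg_one_pow,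
    one_mul, Finset.prod_pow]

end PrimaryPrime

end

section
open Filter Topology Set

/-- The elliptic Gauss sum `(1/4)·Σ_r X(r)ψ(r/π)`. -/
def ellSum {p : ℕ} [Fact p.Prime] (π : ℂ) (X : MulChar (ZMod p) ℂ) : ℂ := (1 / 4 : ℂ) * ∑ r : ZMod p, X r * tor π psi r

section
variable (A : ValuationSubring ℂ)

theorem mem_of_pow_mem {x : ℂ} {n : ℕ} (hn : n ≠ 0) (h : x ^ n ∈ A) : x ∈ A := by
  rw [← ValuationSubring.valuation_le_one_iff] at h ⊢
  rw [map_pow] at h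
  exact (pow_le_one_iff hn).1 h

theorem I_mem : I ∈ A := mem_of_pow_mem A (n := 4) (by norm_num) (by rw [I_pow_four]; exact A.one_mem)

theorem IsLat.mem {z : ℂ} (hz : IsLat z) : z ∈ A := by
  obtain ⟨m, n, rfl⟩ := hz
  exact A.add_mem _ _ (intCast_mem A m) (A.mul_mem _ _ (intCast_mem A n) (I_mem A))

end

namespace PrimaryPrime
variable {p : ℕ} {π d : ℂ} {j : ℤ} [Fact p.Prime] {T : Finset (ZMod p)} {X : MulChar (ZMod p) ℂ}

theorem tor_two_mul (H : PrimaryPrime p π d j) (a : ZMod p) :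
    2 * tor π phi a * tor π phid a = tor π phi (2 * a) * (1 + tor π phi a ^ 4) := by
  rw [two_mul a]
  linear_combination H.tor_add a a

theorem valuation_tor_two_mul (H : PrimaryPrime p π d j) (A : ValuationSubring ℂ) {a : ZMod p}
    (h : A.valuation (tor π phi a) < 1) : A.valuation (tor π phi (2 * a)) < 1 := by
  have h1 := congrArg A.valuation (H.tor_two_mul a)
  have h4 : A.valuation (tor π phi a ^ 4) < 1 := by rw [map_pow]; exact pow_lt_one₀ zero_le h (by norm_num)
  have hg := congrArg A.valuation (H.tord_sq a)
  rw [Valuation.map_one_sub_of_lt _ h4, map_pow] at hg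
  have hg1 : A.valuation (tor π phid a) = 1 := (pow_eq_one_iff_of_nonneg zero_le two_ne_zero).1 hg
  rw [map_mul, map_mul, map_mul, Valuation.map_one_add_of_lt _ h4, hg1, mul_one, mul_one] at h1
  rw [← h1]
  exact mul_lt_one_of_nonneg_of_lt_one_right ((A.valuation_le_one_iff _).2 (isLat_two.mem A)) zero_le h

theorem valuation_tor_lt_of_two_mul (H : PrimaryPrime p π d j) (A : ValuationSubring ℂ) {a : ZMod p}
    (h : A.valuation (tor π phi (2 * a)) < 1) : A.valuation (tor π phi a) < 1 := by
  have key : ∀ n : ℕ, A.valuation (tor π phi (2 ^ (n + 1) * a)) < 1 := fun n => by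
    induction n with
    | zero => simpa using h
    | succ n ih =>
      have := H.valuation_tor_two_mul A ih
      rwa [← mul_assoc, ← pow_succ'] at this
  have h1 := key (p - 2)
  rw [show p - 2 + 1 = p - 1 by have := H.prime.two_le; omega, ZMod.pow_card_sub_one_eq_one H.two_ne, one_mul] at h1
  exact h1

theorem tor_mem (H : PrimaryPrime p π d j) (A : ValuationSubring ℂ) (a : ZMod p) : tor π phi a ∈ A := by
  rw [← ValuationSubring.valuation_le_one_iff]
  by_contra! hlt
  refine absurd (H.valuation_tor_lt_of_two_mul A (a := a) ?_) hlt.le.not_gt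
  set s := A.valuation (tor π phi a) with hs
  have h4 : 1 < A.valuation (tor π phi a ^ 4) := by rw [map_pow]; exact one_lt_pow₀ hlt (by norm_num)
  have h41 : A.valuation 1 < A.valuation (tor π phi a ^ 4) := by rwa [map_one]
  have hg := congrArg A.valuation (H.tord_sq a)
  rw [Valuation.map_sub_eq_of_lt_right _ h41, map_pow, map_pow, ← hs,
    show s ^ 4 = (s ^ 2) ^ 2 by rw [← pow_mul]] at hg
  have hg1 : A.valuation (tor π phid a) = s ^ 2 := (pow_left_inj₀ zero_le zero_le two_ne_zero).1 hg
  have h1 := congrArg A.valuation (H.tor_two_mul a)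
  rw [map_mul, map_mul, map_mul, Valuation.map_add_eq_of_lt_right _ h41, hg1, map_pow, ← hs] at h1
  by_contra! h2
  have h3 : s ^ 4 ≤ s ^ 3 := calc
    s ^ 4 ≤ A.valuation (tor π phi (2 * a)) * s ^ 4 := le_mul_of_one_le_left' h2
    _ = A.valuation 2 * s * s ^ 2 := h1.symm
    _ ≤ 1 * s * s ^ 2 := by
      gcongr
      exact (A.valuation_le_one_iff _).2 (isLat_two.mem A)
    _ = s ^ 3 := by rw [one_mul, ← pow_succ']
  exact absurd h3 (pow_lt_pow_right₀ hlt (by norm_num)).not_ge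

theorem tord_mem (H : PrimaryPrime p π d j) (A : ValuationSubring ℂ) (a : ZMod p) : tor π phid a ∈ A := by
  apply mem_of_pow_mem A two_ne_zero
  rw [H.tord_sq]
  exact A.sub_mem A.one_mem (A.pow_mem (H.tor_mem A a) 4)

theorem two_div_sq_mem (H : PrimaryPrime p π d j) (A : ValuationSubring ℂ) (a : ZMod p) :
    2 / tor π phid a ^ 2 ∈ A := by
  have hg0 := H.tord_ne_zero a
  have h2 := (A.valuation_le_one_iff _).2 (isLat_two.mem A)
  have hs := (A.valuation_le_one_iff _).2 (H.tor_mem A a)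
  rw [← ValuationSubring.valuation_le_one_iff]
  by_contra! hlt
  have hv0 : A.valuation (tor π phid a ^ 2) ≠ 0 := (Valuation.ne_zero_iff _).2 (pow_ne_zero 2 hg0)
  have hlt' : A.valuation (tor π phid a ^ 2) < A.valuation 2 := by
    rw [map_div₀] at hlt
    exact (one_lt_div₀ (zero_lt_iff.2 hv0)).1 hlt
  have hgl : A.valuation (tor π phid a) < 1 := by
    have := hlt'.trans_le h2
    rw [map_pow] at this
    exact (pow_lt_one_iff_of_nonneg zero_le two_ne_zero).1 this
  have h1 := congrArg A.valuation (H.tor_two_mul a)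
  rw [show (1 : ℂ) + tor π phi a ^ 4 = 2 - tor π phid a ^ 2 by rw [H.tord_sq]; ring, map_mul, map_mul, map_mul,
    Valuation.map_sub_eq_of_lt_left _ hlt', mul_assoc, mul_comm] at h1
  have hv2 : A.valuation 2 ≠ 0 := (Valuation.ne_zero_iff _).2 two_ne_zero
  have h3 := H.valuation_tor_lt_of_two_mul A (a := a) (by
    rw [← mul_right_cancel₀ hv2 h1]
    exact mul_lt_one_of_nonneg_of_lt_one_right hs zero_le hgl)
  have hg := congrArg A.valuation (H.tord_sq a)
  rw [Valuation.map_one_sub_of_lt _ (by rw [map_pow]; exact pow_lt_one₀ zero_le h3 (by norm_num)), map_pow] at hg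
  rw [(pow_eq_one_iff_of_nonneg zero_le two_ne_zero).1 hg] at hgl
  exact lt_irrefl _ hgl

theorem one_add_I_div_mem (H : PrimaryPrime p π d j) (A : ValuationSubring ℂ) (a : ZMod p) :
    (1 + I) / tor π phid a ∈ A := by
  apply mem_of_pow_mem A two_ne_zero
  rw [show ((1 + I) / tor π phid a) ^ 2 = I * (2 / tor π phid a ^ 2) by
    rw [div_pow, mul_div_assoc']; congr 1; linear_combination I_sq]
  exact A.mul_mem _ _ (I_mem A) (H.two_div_sq_mem A a)

theorem torp_add_torp (H : PrimaryPrime p π d j) (a : ZMod p) :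
    tor π psi a + tor π psi ((j : ZMod p) * a) = 2 / tor π phid a := by
  have h1 := H.torp_mul a
  have h2 := H.torp_mul ((j : ZMod p) * a)
  have h3 := H.torp_mul_torp a
  rw [H.tor_j_mul, H.tord_j_mul] at h2
  rw [eq_div_iff (H.tord_ne_zero a)]
  linear_combination -tor π psi ((j : ZMod p) * a) * h1 - tor π psi a * h2 + 2 * h3 + tor π psi ((j : ZMod p) * a)* tor π psi a * tor π phi a ^ 2 * I_sq

theorem torp_mem (H : PrimaryPrime p π d j) (A : ValuationSubring ℂ) (a : ZMod p) : tor π psi a ∈ A := by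
  by_contra h
  have h1 := H.torp_mul_torp a
  have h0 : tor π psi a ≠ 0 := left_ne_zero_of_mul_eq_one h1
  have h2 : tor π psi ((j : ZMod p) * a) ∈ A := by
    rw [eq_inv_of_mul_eq_one_right h1]
    exact (A.mem_or_inv_mem _).resolve_left h
  apply h
  rw [eq_sub_of_add_eq (H.torp_add_torp a)]
  refine A.sub_mem ?_ h2
  have := A.mul_mem _ _ (isLat_one_sub_I.mem A) (H.one_add_I_div_mem A a)
  rwa [show (1 - I) * ((1 + I) / tor π phid a) = 2 / tor π phid a by
    rw [mul_div_assoc']; congr 1; linear_combination -I_sq] at this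

theorem X_j (H : PrimaryPrime p π d j) (hX : QuarticChar p j X) : X (j : ZMod p) = (-1) ^ ((p - 1) / 8) := by
  refine H.eq_of_red_eq (hX.lat _) (isLat_one.neg.pow _) (hX.pow_four _ H.j_ne) ?_ ?_
  · rw [← pow_mul, mul_comm, pow_mul]; norm_num
  · rw [hX.euler _ H.j_ne, H.red_pow isLat_one.neg, red_neg isLat_one, red_one, ← H.sq_j, ← pow_mul]
    congr 1
    have := H.mod8
    omega

theorem X_j_cases (H : PrimaryPrime p π d j) (hX : QuarticChar p j X) : X (j : ZMod p) = 1 ∨ X (j : ZMod p) = -1 := by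
  rw [H.X_j hX]
  exact neg_one_pow_eq_or ℂ _

theorem ellSum_eq (H : PrimaryPrime p π d j) (hT : QuarterSet p j T) (hX : QuarticChar p j X) :
    ellSum π X = ∑ t ∈ T, X t / tor π phid t +
      (X (j : ZMod p) - 1) / 2 * ∑ t ∈ T, X t * tor π psi ((j : ZMod p) * t) := by
  have hsq : X (j : ZMod p) ^ 2 = 1 := by rcases H.X_j_cases hX with h | h <;> rw [h] <;> norm_num
  rw [ellSum, ← Finset.add_sum_erase _ _ (Finset.mem_univ 0), hT.sum_eq H, MulChar.map_zero, zero_mul, zero_add,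
    Finset.mul_sum, Finset.mul_sum, ← Finset.sum_add_distrib]
  refine Finset.sum_congr rfl fun t ht => ?_
  have h2 : ∀ a : ZMod p, tor π psi ((j : ZMod p) * ((j : ZMod p) * a)) = tor π psi a := fun a => by
    rw [show (j : ZMod p) * ((j : ZMod p) * a) = -a by linear_combination a * H.sq_j, H.torp_neg]
  simp only [Finset.sum_range_succ, Finset.sum_range_zero, zero_add, pow_zero, pow_succ, one_mul, mul_assoc, h2, map_mul, map_one]
  rw [show X t / tor π phid t = X t / 2 * (2 / tor π phid t) by field_simp, ← H.torp_add_torp]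
  linear_combination (1 / 4 * X t * tor π psi t + 1 / 4 * X (j : ZMod p) * X t * tor π psi ((j : ZMod p) * t)) * hsq

theorem sum_inv_tord (H : PrimaryPrime p π d j) (hT : QuarterSet p j T) : ∑ t ∈ T, 1 / tor π phid t = (π - 1) / 4 := by
  have h1 := H.torp_dual 0 (m := ((1 - (j : ZMod p)) * red p j ((starRingEnd ℂ) π))⁻¹)
    (mul_inv_cancel₀ (mul_ne_zero H.one_sub_j_ne H.red_conj_ne))
  simp only [zero_mul, mul_zero, torp_zero, AddChar.map_zero_eq_one, one_mul, mul_one] at h1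
  rw [show (1 + I) / 2 + (1 - I) / 2 = 1 by ring, map_one, mul_one, ← Finset.add_sum_erase _ _ (Finset.mem_univ 0),
    hT.sum_eq H, mul_zero, torp_zero] at h1
  have h2 : ∀ a : ZMod p, tor π psi ((j : ZMod p) * ((j : ZMod p) * a)) = tor π psi a := fun a => by
    rw [show (j : ZMod p) * ((j : ZMod p) * a) = -a by linear_combination a * H.sq_j, H.torp_neg]
  rw [eq_div_iff (by norm_num), ← eq_sub_of_add_eq' h1, Finset.sum_mul]
  refine Finset.sum_congr rfl fun t ht => ?_
  simp only [Finset.sum_range_succ, Finset.sum_range_zero, zero_add, pow_zero, pow_succ, one_mul, mul_assoc, h2]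
  rw [show 1 / tor π phid t * 4 = 2 * (2 / tor π phid t) by ring, ← H.torp_add_torp]
  ring

theorem isLat_sub_one_div (H : PrimaryPrime p π d j) : IsLat ((π - 1) / 4) := by
  obtain ⟨m, n, hd⟩ := H.latd
  have h := H.norm
  rw [H.eq, hd] at h
  have h' : (p : ℤ) = (1 - 2 * (m + n)) ^ 2 + (2 * (m - n)) ^ 2 := by
    have : (p : ℂ) = ((1 - 2 * (m + n)) ^ 2 + (2 * (m - n)) ^ 2 : ℤ) := by
      rw [h, show (1 - 2 * (1 - I) * (m + n * I) : ℂ) = (1 - 2 * (m + n)) + 2 * (m - n) * I by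
        linear_combination 2 * n * I_sq]
      simp only [map_sub, map_mul, map_add, map_one, conj_I, Complex.conj_ofNat, map_intCast]
      push_cast
      linear_combination (-4 * (m - n : ℂ) ^ 2) * I_sq
    exact_mod_cast this
  have hev : Even (m - n) := by
    by_contra ho
    rw [Int.not_even_iff_odd] at ho
    obtain ⟨t, ht⟩ := ho
    have h8 := H.mod8
    have e1 : (p : ℤ) = 16 * (t ^ 2 + t) + 4 + (1 + 4 * ((m + n) ^ 2 - (m + n))) := by
      rw [h', ht]; ring
    have e2 : Even ((m + n) ^ 2 - (m + n)) := by
      rw [sq, ← mul_sub_one]; exact Int.even_mul_pred_self _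
    obtain ⟨u, hu⟩ := e2
    omega
  obtain ⟨t, ht⟩ := hev
  have hm : (m : ℂ) = n + 2 * t := by
    have : m = n + 2 * t := by omega
    exact_mod_cast this
  refine ⟨-(n + t), t, ?_⟩
  rw [H.eq, hd, hm]
  push_cast
  linear_combination (n / 2 : ℂ) * I_sq

theorem one_add_I_dvd {z : ℂ} (hz : z ^ 4 = 1) : ∃ l, IsLat l ∧ z - 1 = (1 + I) * l := by
  have : (z - 1) * ((z + 1) * ((z - I) * (z + I))) = 0 := by linear_combination hz - (z ^ 2 - 1) * I_sq
  rcases mul_eq_zero.1 this with h | h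
  · exact ⟨0, isLat_zero, by rw [h]; ring⟩
  rcases mul_eq_zero.1 h with h | h
  · exact ⟨-(1 - I), isLat_one_sub_I.neg, by linear_combination h - I_sq⟩
  rcases mul_eq_zero.1 h with h | h
  · exact ⟨I, isLat_I, by linear_combination h - I_sq⟩
  · exact ⟨-1, isLat_one.neg, by linear_combination h⟩

theorem ellSum_mem (H : PrimaryPrime p π d j) (hT : QuarterSet p j T) (hX : QuarticChar p j X) (A : ValuationSubring ℂ) :
    ellSum π X ∈ A := by
  rw [H.ellSum_eq hT hX]
  refine A.add_mem _ _ ?_ (A.mul_mem _ _ ?_ ?_)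
  · have : ∑ t ∈ T, X t / tor π phid t = ∑ t ∈ T, (X t - 1) / tor π phid t + ∑ t ∈ T, 1 / tor π phid t := by
      rw [← Finset.sum_add_distrib]
      exact Finset.sum_congr rfl fun t _ => by ring
    rw [this, H.sum_inv_tord hT]
    refine A.add_mem _ _ (sum_mem fun t ht => ?_) (H.isLat_sub_one_div.mem A)
    obtain ⟨l, hl, h⟩ := one_add_I_dvd (hX.pow_four t (hT.ne_zero t ht))
    rw [h, mul_comm, mul_div_assoc]
    exact A.mul_mem _ _ (hl.mem A) (H.one_add_I_div_mem A t)
  · rcases H.X_j_cases hX with h | h <;> rw [h]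
    · simp
    · rw [show ((-1 : ℂ) - 1) / 2 = -1 by norm_num]; exact isLat_one.neg.mem A
  · exact sum_mem fun t _ => A.mul_mem _ _ ((hX.lat t).mem A) (H.torp_mem A _)

end PrimaryPrime

end

section
open Filter Topology Set

theorem sl_sq_mul_sq {a b : ℂ} (ha : ¬ IsPole a) (hb : ¬ IsPole b) (hab : IsPole (a + b)) :
    sl a ^ 2 * sl b ^ 2 = -1 := by
  have hb2 : ¬ IsLat b := fun h => ha (by simpa using hab.add_lat h.neg)
  obtain ⟨m, n, h⟩ := isPole_iff_exists.1 hab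
  rw [show a = (-b + (1 + I) / 2) + m + n * I by linear_combination h, sl_translate, mul_pow]
  have h1 := sl_shift_mul (z := -b) (by rwa [isPole_neg_iff]) (fun h => hb2 (by simpa using h.neg))
  rw [sl_neg hb] at h1
  have h2 : ((-1 : ℂ) ^ m * (-1) ^ n) ^ 2 = 1 := by
    have hsq (m : ℤ) : ((-1 : ℂ) ^ m) ^ 2 = 1 := by
      rw [← zpow_natCast, ← zpow_mul, mul_comm, zpow_mul]; simp
    rw [mul_pow, hsq, hsq, one_mul]
  rw [h2, one_mul, ← mul_pow, ← neg_sq, ← mul_neg, h1]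
  linear_combination I_sq

theorem exists_sl_eq (c : ℂ) : ∃ z, ¬ IsPole z ∧ sl z = c := by
  by_contra! hno
  have hz : ∀ z, ¬ IsPole z → sl z ^ 2 - c ^ 2 ≠ 0 := fun z hz h => by
    rcases sq_eq_sq_iff_eq_or_eq_neg.1 (sub_eq_zero.1 h) with h | h
    · exact hno z hz h
    · refine hno (z + 1) (fun h => hz (by simpa using h.add_lat isLat_one.neg)) ?_
      rw [sl_add_one, h, neg_neg]
  have han : ∀ z, ¬ IsPole z → AnalyticAt ℂ (fun z => (sl z ^ 2 - c ^ 2)⁻¹) z := fun z h =>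
    (((analyticAt_sl h).pow 2).sub analyticAt_const).inv (hz z h)
  have hlim : ∀ z, Tendsto (fun w => (w - z) * (sl w ^ 2 - c ^ 2)⁻¹) (𝓝[≠] z) (𝓝 0) := fun z => by
      by_cases hp : IsPole z
      · have hl : IsLat (z + (1 + I) / 2) := by
          have := hp.add isLat_one |>.add isLat_I
          rwa [show z - (1 + I) / 2 + 1 + I = z + (1 + I) / 2 by ring] at this
        have hs : Tendsto (fun w => sl (w + (1 + I) / 2)) (𝓝[≠] z) (𝓝 0) := by
          have h1 := (analyticAt_sl hl.not_isPole).continuousAt.tendsto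
          rw [sl_eq_zero_of_isLat hl] at h1
          exact (h1.mono_left nhdsWithin_le_nhds).comp (tendsto_add_const_punctured _ _)
        have hlim : Tendsto (fun w => (w - z) * (sl (w + (1 + I) / 2) ^ 2 / (-1 - c ^ 2 * sl (w + (1 + I) / 2) ^ 2)))
            (𝓝[≠] z) (𝓝 0) := by
          have h0 : Tendsto (fun w => w - z) (𝓝[≠] z) (𝓝 0) := by
            have : ContinuousAt (fun w => w - z) z := by fun_prop
            simpa using this.tendsto.mono_left nhdsWithin_le_nhds
          have h2 : Tendsto (fun w => -1 - c ^ 2 * sl (w + (1 + I) / 2) ^ 2) (𝓝[≠] z) (𝓝 (-1 - c ^ 2 * 0 ^ 2)) :=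
            tendsto_const_nhds.sub ((hs.pow 2).const_mul (c ^ 2))
          have h3 := h0.mul ((hs.pow 2).div h2 (by norm_num))
          rwa [zero_mul] at h3
        refine hlim.congr' ?_
        filter_upwards [eventually_not_isPole z, eventually_not_isLat z] with w h1 h2
        have h3 := sl_shift_mul h1 h2
        have h4 := hz w h1
        have h5 : sl (w + (1 + I) / 2) ≠ 0 := fun h => by
          rw [h, zero_mul] at h3; exact I_ne_zero (neg_eq_zero.1 h3.symm)
        congr 1
        refine eq_inv_of_mul_eq_one_left ?_
        rw [div_mul_eq_mul_div, div_eq_one_iff_eq]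
        · linear_combination (sl (w + (1 + I) / 2) * sl w - I) * h3 + I_sq
        · intro h6
          have : sl (w + (1 + I) / 2) ^ 2 * (sl w ^ 2 - c ^ 2) = 0 := by
            linear_combination (sl (w + (1 + I) / 2) * sl w - I) * h3 + I_sq + h6
          exact mul_ne_zero (pow_ne_zero 2 h5) h4 this
      · exact tendsto_sub_mul_zero (han z hp).continuousAt
  have hmer : ∀ z, MeromorphicAt (fun z => (sl z ^ 2 - c ^ 2)⁻¹) z :=
    fun z => (((meromorphicAt_sl z).pow 2).sub (MeromorphicAt.const _ z)).inv
  have hone : ∀ z, (fun z => (sl z ^ 2 - c ^ 2)⁻¹) (z + 1) = 1 * (fun z => (sl z ^ 2 - c ^ 2)⁻¹) z :=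
    fun z => by simp only [sl_add_one, neg_sq, one_mul]
  have hI : ∀ z, (fun z => (sl z ^ 2 - c ^ 2)⁻¹) (z + I) = 1 * (fun z => (sl z ^ 2 - c ^ 2)⁻¹) z :=
    fun z => by simp only [sl_add_I, neg_sq, one_mul]
  obtain ⟨C, hC, -⟩ := liouville_const hmer norm_one norm_one hone hI hlim
  have hval : ∀ z, ¬ IsPole z → (sl z ^ 2 - c ^ 2)⁻¹ = C := fun z h =>
    tendsto_nhds_unique ((han z h).continuousAt.tendsto.mono_left nhdsWithin_le_nhds)
      (tendsto_const_nhds.congr' ((hC z).mono fun _ h => h.symm))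
  have h1 := (hval 0 isLat_zero.not_isPole).trans (hval (1 / 2) _root_.not_isPole_half).symm
  rw [sl_zero, sl_half] at h1
  have := inv_injective h1
  have h2 : (1 : ℂ) = 0 := by linear_combination -this
  exact one_ne_zero h2

theorem exists_sl_cl_eq {c d : ℂ} (h : d ^ 2 = 1 - c ^ 4) : ∃ z, ¬ IsPole z ∧ sl z = c ∧ cl z = d := by
  obtain ⟨z, hz, rfl⟩ := exists_sl_eq c
  have h2 := cl_sq hz
  rw [← h, sq_eq_sq_iff_eq_or_eq_neg] at h2
  rcases h2 with h2 | h2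
  · exact ⟨z, hz, rfl, h2⟩
  · refine ⟨-z + 1, ?_, ?_, ?_⟩
    · intro h
      exact hz (isPole_neg_iff.1 (by simpa using h.add_lat isLat_one.neg))
    · rw [sl_add_one, sl_neg hz, neg_neg]
    · rw [cl_add_one, cl_neg hz, h2, neg_neg]

theorem isLat_sub_div {a b : ℂ} (ha : ¬ IsPole a) (hb : ¬ IsPole b) (hsl : sl a = sl b) (hcl : cl a = cl b)
    (h0 : 1 + sl a ^ 4 ≠ 0) : IsLat ((a - b) / (1 - I)) := by
  have hb' : ¬ IsPole (-b) := by rwa [isPole_neg_iff]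
  have hp : ¬ IsPole (a + -b) := fun h => by
    have h1 := sl_sq_mul_sq ha hb' h
    rw [sl_neg hb, neg_sq, ← hsl] at h1
    exact h0 (by linear_combination h1)
  have h1 := sl_add ha hb' hp
  have h2 := cl_add ha hb' hp
  have h3 := cl_sq ha
  rw [sl_neg hb, cl_neg hb, ← hsl, ← hcl] at h1 h2
  have h5 : sl (a + -b) = 0 := by
    apply mul_right_cancel₀ h0
    linear_combination -h1
  have h6 : cl (a + -b) = 1 := by
    apply mul_right_cancel₀ (pow_ne_zero 2 h0)
    linear_combination h2 + (1 - sl a ^ 4) * h3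
  obtain ⟨m, n, h7⟩ : IsLat (a + -b) := by
    by_contra h
    exact sl_ne_zero hp h h5
  have h8 := cl_translate m n 0
  rw [zero_add, ← h7, h6, cl_zero, mul_one, ← zpow_add₀ (by norm_num)] at h8
  have hev : Even (m + n) := by
    by_contra ho
    rw [(Int.not_even_iff_odd.1 ho).neg_one_zpow] at h8
    norm_num at h8
  obtain ⟨t, ht⟩ := hev
  have hn : (m : ℂ) + n = t + t := by exact_mod_cast ht
  refine ⟨t - n, t, ?_⟩
  have hI : (1 - I) ≠ 0 := fun h => by simpa using congrArg Complex.im h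
  rw [div_eq_iff hI, sub_eq_add_neg, h7]
  push_cast
  linear_combination hn + (t : ℂ) * I_sq

end

section
open Filter Topology Set

namespace PrimaryPrime
variable {p : ℕ} {π d : ℂ} {j : ℤ} [Fact p.Prime] {T : Finset (ZMod p)} {X : MulChar (ZMod p) ℂ}

/-- A conjugation of the coordinates of the `π`-torsion points is a multiplication by a residue. -/
theorem exists_conj_tor (H : PrimaryPrime p π d j) {E : Type*} [Field E] (ι s : E →+* ℂ) {i : E} (hi : ι i = I)
    (hs : s i = I) (F F' : ZMod p → E) (hF : ∀ a, ι (F a) = tor π phi a) (hF' : ∀ a, ι (F' a) = tor π phid a) :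
    ∃ m : ZMod p, m ≠ 0 ∧ ∀ a, s (F a) = tor π phi (m * a) ∧ s (F' a) = tor π phid (m * a) := by
  have hadd : ∀ a b, s (F a) * s (F' b) + s (F' a) * s (F b) = s (F (a + b)) * (1 + s (F a) ^ 2 * s (F b) ^ 2) := fun a b => by
    have : F a * F' b + F' a * F b = F (a + b) * (1 + F a ^ 2 * F b ^ 2) :=
      ι.injective (by simpa [hF, hF'] using H.tor_add a b)
    simpa using congrArg s this
  have hadd' : ∀ a b, s (F' (a + b)) * (1 + s (F a) ^ 2 * s (F b) ^ 2) ^ 2 =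
      s (F' a) * s (F' b) * (1 - s (F a) ^ 2 * s (F b) ^ 2) - 2 * s (F a) * s (F b) * (s (F a) ^ 2 + s (F b) ^ 2) := fun a b => by
    have : F' (a + b) * (1 + F a ^ 2 * F b ^ 2) ^ 2 =
      F' a * F' b * (1 - F a ^ 2 * F b ^ 2) - 2 * F a * F b * (F a ^ 2 + F b ^ 2) :=
      ι.injective (by simpa [hF, hF', map_ofNat] using H.tord_add a b)
    simpa [map_ofNat] using congrArg s this
  have hsq : ∀ a, s (F' a) ^ 2 = 1 - s (F a) ^ 4 := fun a => by
    have : F' a ^ 2 = 1 - F a ^ 4 := ι.injective (by simpa [hF, hF'] using H.tord_sq a)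
    simpa using congrArg s this
  have hj : ∀ a, s (F ((j : ZMod p) * a)) = I * s (F a) := fun a => by
    have : F ((j : ZMod p) * a) = i * F a := ι.injective (by simpa [hF, hi] using H.tor_j_mul a)
    simpa [hs] using congrArg s this
  have hj' : ∀ a, s (F' ((j : ZMod p) * a)) = s (F' a) := fun a => by
    have : F' ((j : ZMod p) * a) = F' a := ι.injective (by simpa [hF'] using H.tord_j_mul a)
    rw [this]
  have hne : ∀ a b, 1 + s (F a) ^ 2 * s (F b) ^ 2 ≠ 0 := fun a b h => by
    have h1 : s (1 + F a ^ 2 * F b ^ 2) = s 0 := by simpa using h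
    have h2 := congrArg ι (s.injective h1)
    exact H.one_add_ne_zero a b (by simpa [hF] using h2)
  have hF0 : F 0 = 0 := ι.injective (by simpa [hF] using tor_zero)
  have hF'0 : F' 0 = 1 := ι.injective (by simpa [hF'] using tord_zero)
  have hF1 : s (F 1) ≠ 0 := fun h => by
    rw [map_eq_zero] at h
    have := hF 1
    rw [h, map_zero] at this
    exact H.tor_ne_zero one_ne_zero this.symm
  obtain ⟨z, hz, hz1, hz2⟩ := exists_sl_cl_eq (hsq 1)
  have key : ∀ n : ℕ, ¬ IsPole (n * z) ∧ sl (n * z) = s (F n) ∧ cl (n * z) = s (F' n) := fun n => by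
    induction n with
    | zero => simp [hF0, hF'0, sl_zero, cl_zero, isLat_zero.not_isPole]
    | succ n ih =>
      obtain ⟨h1, h2, h3⟩ := ih
      have hp : ¬ IsPole (n * z + z) := fun h => by
        have := sl_sq_mul_sq h1 hz h
        rw [h2, hz1] at this
        exact hne n 1 (by rw [this]; ring)
      have e : ((n + 1 : ℕ) : ℂ) * z = n * z + z := by push_cast; ring
      have a1 := sl_add h1 hz hp
      have a2 := cl_add h1 hz hp
      rw [h2, h3, hz1, hz2] at a1 a2
      rw [e, Nat.cast_succ]
      refine ⟨hp, ?_, ?_⟩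
      · exact mul_right_cancel₀ (hne n 1) (a1.symm.trans (hadd n 1))
      · exact mul_right_cancel₀ (pow_ne_zero 2 (hne n 1)) (a2.trans (hadd' n 1).symm)
  have key' : ∀ a : ZMod p, ¬ IsPole (a.val * z) ∧ sl (a.val * z) = s (F a) ∧ cl (a.val * z) = s (F' a) := fun a => by
    simpa using key a.val
  have hI : (1 - I) ≠ 0 := fun h => by simpa using congrArg Complex.im h
  have l1 : IsLat (((p : ℂ) * z - 0) / (1 - I)) := by
    obtain ⟨h1, h2, h3⟩ := key p
    rw [ZMod.natCast_self, hF0, map_zero] at h2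
    rw [ZMod.natCast_self, hF'0, map_one] at h3
    refine isLat_sub_div h1 isLat_zero.not_isPole (by rw [h2, sl_zero]) (by rw [h3, cl_zero]) ?_
    rw [h2]; norm_num
  have l2 : IsLat ((((j : ZMod p).val : ℂ) * z - I * z) / (1 - I)) := by
    obtain ⟨h1, h2, h3⟩ := key' (j : ZMod p)
    have e1 := hj 1
    have e2 := hj' 1
    rw [mul_one] at e1 e2
    refine isLat_sub_div h1 (by rwa [isPole_I_mul_iff]) ?_ ?_ ?_
    · rw [h2, sl_I_mul hz, hz1, e1]
    · rw [h3, cl_I_mul hz, hz2, e2]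
    · rw [h2]
      have := hne (j : ZMod p) (j : ZMod p)
      rwa [← pow_add] at this
  obtain ⟨l, hl, hzl⟩ : ∃ l, IsLat l ∧ z = (1 - I) * (l / π) := by
    rw [sub_zero] at l1
    have hc := isLat_conj l1
    refine ⟨(starRingEnd ℂ) ((starRingEnd ℂ) ((p : ℂ) * z / (1 - I)) / π), isLat_conj ?_, ?_⟩
    · rw [H.isLat_div_iff hc]
      set l := (starRingEnd ℂ) ((p : ℂ) * z / (1 - I)) with hld
      have h3 : red p j ((((j : ZMod p).val : ℂ) + I) * l) = 0 := by
        rw [H.red_eq_zero_iff (((isLat_nat _).add isLat_I).mul hc)]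
        refine ⟨_, H.lat_conj.mul (isLat_conj l2), ?_⟩
        rw [← mul_assoc, ← H.norm, hld]
        simp only [map_div₀, map_mul, map_sub, conj_I, Complex.conj_natCast, map_one]
        ring
      rw [H.red_mul ((isLat_nat _).add isLat_I) hc, red_add (isLat_nat _) isLat_I, red_val, red_I, ← two_mul] at h3
      exact (mul_eq_zero.1 h3).resolve_left (mul_ne_zero H.two_ne H.j_ne)
    · have hπ := H.ne
      have hπ' : (starRingEnd ℂ) π ≠ 0 := (map_ne_zero _).2 hπ
      rw [map_div₀, conj_conj, H.norm]
      field_simp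
  have hm : ∀ a : ZMod p, red p j l * a = red p j (l * a.val) := fun a => by
    rw [H.red_mul hl (isLat_nat _), red_val]
  have key2 : ∀ a, s (F a) = tor π phi (red p j l * a) ∧ s (F' a) = tor π phid (red p j l * a) := fun a => by
    obtain ⟨-, h2, h3⟩ := key' a
    rw [hm, H.tor_red phi_add_lat (hl.mul (isLat_nat _)), H.tor_red phid_add_lat (hl.mul (isLat_nat _)), ← h2, ← h3, phi, phid,
      hzl]
    constructor <;> congr 1 <;> ring
  refine ⟨red p j l, fun h => hF1 ?_, key2⟩
  rw [(key2 1).1, h, zero_mul, tor_zero]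

theorem one_add_sq_ne_zero (H : PrimaryPrime p π d j) (a : ZMod p) : 1 + tor π phi a ^ 2 ≠ 0 := fun h => by
  have := H.torp_mul a
  rw [h, mul_zero] at this
  exact H.tord_ne_zero a this.symm

/-- `b = G/Φ³` is fixed by the conjugations over `ℚ(i)`. -/
theorem ellSum_conj (H : PrimaryPrime p π d j) (hT : QuarterSet p j T) (hX : QuarticChar p j X)
    {E : Type*} [Field E] (ι s : E →+* ℂ) {i : E} (hi : ι i = I)
    (hs : s i = I) (F F' : ZMod p → E) (hF : ∀ a, ι (F a) = tor π phi a) (hF' : ∀ a, ι (F' a) = tor π phid a)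
    {b : E} (hb : ι b = ellSum π X / (∏ t ∈ T, tor π phi t) ^ 3) : s b = ι b := by
  obtain ⟨m, hm0, hm⟩ := H.exists_conj_tor ι s hi hs F F' hF hF'
  have hX' : ∀ a, ∃ x : E, ι x = X a ∧ s x = X a := fun a => by
    obtain ⟨u, v, h⟩ := hX.lat a
    exact ⟨u + v * i, by simp [hi, h], by simp [hs, h]⟩
  choose Y hY hY' using hX'
  have h1 : ∀ a, 1 + F a ^ 2 ≠ 0 := fun a h => H.one_add_sq_ne_zero a (by simpa [hF] using congrArg ι h)
  have hw : ∀ a, tor π psi a = tor π phid a / (1 + tor π phi a ^ 2) := fun a =>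
    eq_div_of_mul_eq (H.one_add_sq_ne_zero a) (H.torp_mul a)
  have hbe : b = ((1 / 4) * ∑ a : ZMod p, Y a * (F' a / (1 + F a ^ 2))) / (∏ t ∈ T, F t) ^ 3 :=
    ι.injective (by rw [hb, ellSum]; simp [hF, hF', hY, hw, map_ofNat])
  have hsb : s b = ((1 / 4) * ∑ a : ZMod p, X a * tor π psi (m * a)) / (∏ t ∈ T, tor π phi (m * t)) ^ 3 := by
    rw [hbe]; simp [hY', hm, hw, map_ofNat]
  rw [hsb, hb, H.gauss hT hX hm0 (tor π phi) H.tor_j_mul, ellSum]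
  have hX4 := hX.pow_four m hm0
  have hXm : X m ≠ 0 := fun h => by rw [h] at hX4; norm_num at hX4
  have hsum : ∑ a : ZMod p, X a * tor π psi a = X m * ∑ a : ZMod p, X a * tor π psi (m * a) := by
    rw [Finset.mul_sum, ← Equiv.sum_comp (Equiv.mulLeft₀ m hm0)]
    exact Finset.sum_congr rfl fun a _ => by simp; ring
  rw [hsum, mul_pow]
  have hΦ : (∏ t ∈ T, tor π phi t) ≠ 0 := Finset.prod_ne_zero_iff.2 fun t ht => H.tor_ne_zero (hT.ne_zero t ht)
  have hX3 : X m ^ 3 ≠ 0 := pow_ne_zero 3 hXm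
  field_simp
  linear_combination (-∑ a : ZMod p, X a * tor π psi (m * a)) * hX4
end PrimaryPrime

end

section
open Filter Topology Set

theorem isIntegral_of_forall_mem {x : ℂ} (h : ∀ A : ValuationSubring ℂ, x ∈ A) : IsIntegral ℤ x := by
  have h1 : x ∈ (integralClosure (Subring.closure (∅ : Set ℂ)) ℂ).toSubring := by
    rw [← iInf_valuationSubring_superset, Subring.mem_iInf]
    exact fun A => h A
  have h2 : IsIntegral (Subring.closure (∅ : Set ℂ)) x := h1
  have : Algebra.IsIntegral ℤ (Subring.closure (∅ : Set ℂ)) := ⟨fun y => by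
    obtain ⟨n, hn⟩ : ∃ n : ℤ, (n : ℂ) = y := by
      have : (y : ℂ) ∈ (⊥ : Subring ℂ) := by
        rw [← Subring.closure_empty]
        exact y.2
      exact Subring.mem_bot.1 this
    have : y = algebraMap ℤ _ n := Subtype.ext (by simpa using hn.symm)
    rw [this]
    exact isIntegral_algebraMap⟩
  exact isIntegral_trans x h2

theorem exists_int_of_forall_mem {r : ℚ} (h : ∀ A : ValuationSubring ℂ, (r : ℂ) ∈ A) : ∃ n : ℤ, r = n := by
  have h1 := isIntegral_of_forall_mem h
  have h2 : IsIntegral ℤ r := by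
    rw [← isIntegral_algebraMap_iff (algebraMap ℚ ℂ).injective]
    exact h1
  obtain ⟨n, hn⟩ := IsIntegrallyClosed.isIntegral_iff.1 h2
  exact ⟨n, hn.symm⟩

theorem isLat_of_forall_mem {z : ℂ} (hz : ∃ r s : ℚ, z = r + s * I) (h : ∀ A : ValuationSubring ℂ, z ∈ A) : IsLat z := by
  obtain ⟨r, s, rfl⟩ := hz
  have hc : ∀ A : ValuationSubring ℂ, (r - s * I : ℂ) ∈ A := fun A => by
    have := h (A.comap (starRingEnd ℂ))
    rw [ValuationSubring.mem_comap] at this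
    simpa [sub_eq_add_neg] using this
  obtain ⟨m, hm⟩ := exists_int_of_forall_mem (r := 2 * r) fun A => by
    have := A.add_mem _ _ (h A) (hc A)
    rw [show (r + s * I + (r - s * I) : ℂ) = (2 * r : ℚ) by push_cast; ring] at this
    exact this
  obtain ⟨n, hn⟩ := exists_int_of_forall_mem (r := 2 * s) fun A => by
    have := A.mul_mem _ _ (isLat_I.neg.mem A) (A.sub_mem (h A) (hc A))
    rw [show (-I * (r + s * I - (r - s * I)) : ℂ) = (2 * s : ℚ) by push_cast; linear_combination -2 * (s : ℂ) * I_sq] at this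
    exact this
  obtain ⟨k, hk⟩ := exists_int_of_forall_mem (r := r ^ 2 + s ^ 2) fun A => by
    have := A.mul_mem _ _ (h A) (hc A)
    rw [show ((r + s * I) * (r - s * I) : ℂ) = (r ^ 2 + s ^ 2 : ℚ) by push_cast; linear_combination -(s : ℂ) ^ 2 * I_sq] at this
    exact this
  have e : m ^ 2 + n ^ 2 = 4 * k := by
    have : (m : ℚ) ^ 2 + n ^ 2 = 4 * k := by rw [← hm, ← hn, ← hk]; ring
    exact_mod_cast this
  have ev : Even m ∧ Even n := by
    rcases Int.even_or_odd m with hm' | hm' <;> rcases Int.even_or_odd n with hn' | hn'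
    · exact ⟨hm', hn'⟩
    all_goals
      obtain ⟨u, rfl⟩ := hm'
      obtain ⟨v, rfl⟩ := hn'
      ring_nf at e
      omega
  obtain ⟨⟨u, rfl⟩, ⟨v, rfl⟩⟩ := ev
  refine ⟨u, v, ?_⟩
  have hu : r = u := by push_cast at hm; linarith
  have hv : s = v := by push_cast at hn; linarith
  rw [hu, hv]; push_cast; ring

/-- The field `ℚ(i)`. -/
abbrev gaussField : IntermediateField ℚ ℂ := IntermediateField.adjoin ℚ {I}

theorem exists_rat_of_mem_gaussField {z : ℂ} (hz : z ∈ gaussField) : ∃ r s : ℚ, z = r + s * I := by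
  induction hz using IntermediateField.adjoin_induction with
  | mem x hx => exact ⟨0, 1, by simpa using hx⟩
  | algebraMap x => exact ⟨x, 0, by simp⟩
  | add x y _ _ hx hy =>
    obtain ⟨a, b, rfl⟩ := hx
    obtain ⟨c, d, rfl⟩ := hy
    exact ⟨a + c, b + d, by push_cast; ring⟩
  | inv x _ hx =>
    obtain ⟨a, b, rfl⟩ := hx
    refine ⟨a / (a ^ 2 + b ^ 2), -b / (a ^ 2 + b ^ 2), ?_⟩
    by_cases h : (a + b * I : ℂ) = 0
    · have ha : (a : ℂ) = 0 := by simpa using congrArg Complex.re h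
      have hb : (b : ℂ) = 0 := by simpa using congrArg Complex.im h
      push_cast
      simp [ha, hb]
    · have h1 : (a + b * I) * (a - b * I) = ((a ^ 2 + b ^ 2 : ℚ) : ℂ) := by push_cast; linear_combination -(b : ℂ) ^ 2 * I_sq
      have h2 : ((a ^ 2 + b ^ 2 : ℚ) : ℂ) ≠ 0 := by
        intro h0
        have h3 : a ^ 2 + b ^ 2 = 0 := by exact_mod_cast h0
        have ha : a = 0 := by nlinarith [sq_nonneg a, sq_nonneg b]
        have hb : b = 0 := by nlinarith [sq_nonneg a, sq_nonneg b]
        exact h (by simp [ha, hb])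
      push_cast at h1 h2 ⊢
      refine inv_eq_of_mul_eq_one_right ?_
      field_simp
      linear_combination h1
  | mul x y _ _ hx hy =>
    obtain ⟨a, b, rfl⟩ := hx
    obtain ⟨c, d, rfl⟩ := hy
    exact ⟨a * c - b * d, a * d + b * c, by push_cast; linear_combination (b * d : ℂ) * I_sq⟩

theorem mem_gaussField_of_fixed {x : ℂ} (hx : x ∈ algebraicClosure gaussField ℂ)
    (h : ∀ s : algebraicClosure gaussField ℂ →+* ℂ,
      (∀ y : gaussField, s (algebraMap _ _ y) = y) → s ⟨x, hx⟩ = x) : x ∈ gaussField := by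
  have : IsGalois gaussField (algebraicClosure gaussField ℂ) := by
    have := IsAlgClosure.normal gaussField (algebraicClosure gaussField ℂ)
    constructor
  have h1 := (InfiniteGalois.mem_range_algebraMap_iff_fixed (k := gaussField)
    (⟨x, hx⟩ : algebraicClosure gaussField ℂ)).2 fun σ => by
      apply Subtype.ext
      have := h ((algebraMap (algebraicClosure gaussField ℂ) ℂ).comp (σ : algebraicClosure gaussField ℂ →+* algebraicClosure gaussField ℂ))
        (fun y => by simp)
      simpa using this
  obtain ⟨y, hy⟩ := h1
  have := congrArg (fun z : algebraicClosure gaussField ℂ => (z : ℂ)) hy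
  rw [← show (y : ℂ) = x from this]
  exact y.2

namespace PrimaryPrime
variable {p : ℕ} {π d : ℂ} {j : ℤ} [Fact p.Prime] {T : Finset (ZMod p)} {X : MulChar (ZMod p) ℂ}

theorem isLat_ellSum_div (H : PrimaryPrime p π d j) (hT : QuarterSet p j T) (hX : QuarticChar p j X) :
    IsLat (ellSum π X / (∏ t ∈ T, tor π phi t) ^ 3) := by
  set Φ := ∏ t ∈ T, tor π phi t with hΦd
  have hΦ4 : Φ ^ 4 = π := H.prod_tor_pow hT
  have hΦ0 : Φ ≠ 0 := fun h => H.ne (by rw [← hΦ4, h]; norm_num)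
  have alg : ∀ x : ℂ, (∀ A : ValuationSubring ℂ, x ∈ A) → x ∈ algebraicClosure gaussField ℂ := fun x hx => by
    rw [mem_algebraicClosure_iff']
    exact (isIntegral_of_forall_mem hx).tower_top
  have hG : ∀ A : ValuationSubring ℂ, ellSum π X ∈ A := H.ellSum_mem hT hX
  have hΦA : ∀ A : ValuationSubring ℂ, Φ ∈ A := fun A => prod_mem fun t _ => H.tor_mem A t
  have hb : ellSum π X / Φ ^ 3 ∈ algebraicClosure gaussField ℂ :=
    div_mem (alg _ hG) (pow_mem (alg _ hΦA) 3)
  have hIm : I ∈ gaussField := IntermediateField.mem_adjoin_simple_self ℚ I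
  have hK : ellSum π X / Φ ^ 3 ∈ gaussField := mem_gaussField_of_fixed hb fun s hs =>
    H.ellSum_conj hT hX (algebraMap (algebraicClosure gaussField ℂ) ℂ) s
      (i := algebraMap gaussField _ ⟨I, hIm⟩) rfl (hs _)
      (fun a => ⟨tor π phi a, alg _ fun A => H.tor_mem A a⟩) (fun a => ⟨tor π phid a, alg _ fun A => H.tord_mem A a⟩)
      (fun _ => rfl) (fun _ => rfl) (b := ⟨_, hb⟩) rfl
  set b := ellSum π X / Φ ^ 3 with hbd
  have hπK : π ∈ gaussField := by
    obtain ⟨m, n, h⟩ := H.lat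
    rw [h]
    exact add_mem (intCast_mem _ _) (mul_mem (intCast_mem _ _) hIm)
  have hc : b * π = ellSum π X * Φ := by
    rw [hbd, ← hΦ4]; field_simp
  have lc : IsLat (b * π) := isLat_of_forall_mem (exists_rat_of_mem_gaussField (mul_mem hK hπK)) fun A => by
    rw [hc]; exact A.mul_mem _ _ (hG A) (hΦA A)
  have hc4 : (b * π) ^ 4 = ellSum π X ^ 4 * π := by rw [hc, mul_pow, hΦ4]
  have lG : IsLat (ellSum π X ^ 4) := isLat_of_forall_mem (exists_rat_of_mem_gaussField (by
    rw [eq_div_of_mul_eq H.ne hc4.symm]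
    exact div_mem (pow_mem (mul_mem hK hπK) 4) hπK)) fun A => A.pow_mem (hG A) 4
  have h0 := congrArg (red p j) hc4
  rw [H.red_pow lc, H.red_mul lG H.lat, H.red_pi, mul_zero] at h0
  have := (H.isLat_div_iff lc).2 (pow_eq_zero_iff (by norm_num) |>.1 h0)
  rwa [mul_div_cancel_right₀ _ H.ne] at this

end PrimaryPrime

end

section
open Filter Topology Set

theorem sum_eval_of_natDegree_lt {p : ℕ} [Fact p.Prime] {P : Polynomial (ZMod p)} (h : P.natDegree < p - 1) :
    ∑ a, P.eval a = 0 := by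
  simp_rw [Polynomial.eval_eq_sum_range]
  rw [Finset.sum_comm]
  refine Finset.sum_eq_zero fun i hi => ?_
  rw [← Finset.mul_sum, FiniteField.sum_pow_lt_card_sub_one, mul_zero]
  rw [ZMod.card]
  exact lt_of_le_of_lt (Nat.lt_succ_iff.1 (Finset.mem_range.1 hi)) h

theorem sum_eval_of_monic {p : ℕ} [Fact p.Prime] {P : Polynomial (ZMod p)} (hP : P.Monic) (h : P.natDegree = p - 1) :
    ∑ a, P.eval a = -1 := by
  have hp := (Fact.out : p.Prime).two_le
  simp_rw [Polynomial.eval_eq_sum_range]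
  rw [Finset.sum_comm, Finset.sum_range_succ, Finset.sum_eq_zero, zero_add, ← Finset.mul_sum, hP.coeff_natDegree, one_mul, h]
  · rw [← Finset.sum_erase_add _ _ (Finset.mem_univ 0), zero_pow (by omega), add_zero,
      Finset.sum_congr rfl fun a ha => ZMod.pow_card_sub_one_eq_one (by simpa using ha)]
    rw [Finset.sum_const, Finset.card_erase_of_mem (Finset.mem_univ _), Finset.card_univ, ZMod.card,
      nsmul_eq_mul, mul_one, Nat.cast_sub (by omega)]
    simp
  · intro i hi
    rw [← Finset.mul_sum, FiniteField.sum_pow_lt_card_sub_one, mul_zero]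
    rw [ZMod.card, ← h]
    exact Finset.mem_range.1 hi

theorem conj_mulChar {p : ℕ} [Fact p.Prime] (X : MulChar (ZMod p) ℂ) (a : ZMod p) :
    (starRingEnd ℂ) (X a) = X⁻¹ a := by
  rw [← MulChar.star_apply', starRingEnd_apply]

theorem isLat_sum {ι : Type*} {s : Finset ι} {f : ι → ℂ} (h : ∀ i ∈ s, IsLat (f i)) : IsLat (∑ i ∈ s, f i) :=
  Finset.sum_induction _ _ (fun _ _ => IsLat.add) isLat_zero h
namespace PrimaryPrime
variable {p : ℕ} {π d : ℂ} {j : ℤ} [Fact p.Prime] {T : Finset (ZMod p)} {X : MulChar (ZMod p) ℂ}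

theorem pow_ne_one (H : PrimaryPrime p π d j) {n : ℕ} (hn : 0 < n) (hn' : n < p - 1) : ∃ a : ZMod p, a ≠ 0 ∧ a ^ n ≠ 1 := by
  by_contra! h
  have h1 := FiniteField.sum_pow_lt_card_sub_one (ZMod p) n (by rwa [ZMod.card])
  rw [← Finset.sum_erase_add _ _ (Finset.mem_univ 0), zero_pow hn.ne', add_zero,
    Finset.sum_congr rfl fun a ha => h a (by simpa using ha)] at h1
  rw [Finset.sum_const, Finset.card_erase_of_mem (Finset.mem_univ _), Finset.card_univ, ZMod.card,
    nsmul_eq_mul, mul_one, Nat.cast_sub H.prime.one_lt.le] at h1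
  simp at h1

theorem X_ne_one (H : PrimaryPrime p π d j) (hX : QuarticChar p j X) : X ≠ 1 := by
  rintro rfl
  have := H.mod8
  have := H.prime.two_le
  obtain ⟨a, ha, h⟩ := H.pow_ne_one (n := (p - 1) / 4) (by omega) (by omega)
  apply h
  rw [← hX.euler a ha, MulChar.one_apply ha.isUnit, red_one]

theorem X_sq_ne_one (H : PrimaryPrime p π d j) (hX : QuarticChar p j X) : X * X ≠ 1 := by
  intro h0
  have := H.mod8
  have := H.prime.two_le
  obtain ⟨a, ha, h⟩ := H.pow_ne_one (n := (p - 1) / 4 * 2) (by omega) (by omega)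
  apply h
  rw [pow_mul, ← hX.euler a ha, ← H.red_pow (hX.lat a), sq, ← MulChar.mul_apply, h0, MulChar.one_apply ha.isUnit, red_one]

theorem red_sum {ι : Type*} {s : Finset ι} {f : ι → ℂ} (h : ∀ i ∈ s, IsLat (f i)) :
    red p j (∑ i ∈ s, f i) = ∑ i ∈ s, red p j (f i) := by
  classical
  induction s using Finset.induction_on with
  | empty => simp [red_zero]
  | insert a s ha ih =>
    rw [Finset.sum_insert ha, Finset.sum_insert ha, red_add (h _ (Finset.mem_insert_self _ _))
      (isLat_sum fun i hi => h i (Finset.mem_insert_of_mem hi)), ih fun i hi => h i (Finset.mem_insert_of_mem hi)]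

theorem red_X (H : PrimaryPrime p π d j) (hX : QuarticChar p j X) (a : ZMod p) :
    red p j (X a) = a ^ ((p - 1) / 4) := by
  have := H.mod8
  have := H.prime.two_le
  by_cases ha : a = 0
  · rw [ha, MulChar.map_zero, red_zero, zero_pow (by omega)]
  · exact hX.euler a ha

theorem exists_jacobiSum_inv (H : PrimaryPrime p π d j) (hX : QuarticChar p j X) :
    ∃ e, e ^ 4 = 1 ∧ jacobiSum X⁻¹ X⁻¹ = (starRingEnd ℂ) π * e := by
  have hm8 := H.mod8
  have hp2 := H.prime.two_le
  have l1 : ∀ a ∈ Finset.univ, IsLat (X a * X (1 - a)) := fun a _ => (hX.lat _).mul (hX.lat _)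
  have hJ : IsLat (jacobiSum X X) := isLat_sum l1
  have h0 : red p j (jacobiSum X X) = 0 := by
    rw [jacobiSum, red_sum l1, ← sum_eval_of_natDegree_lt (P := Polynomial.X ^ ((p - 1) / 4) * (1 - Polynomial.X) ^ ((p - 1) / 4))]
    · refine Finset.sum_congr rfl fun a _ => ?_
      rw [H.red_mul (hX.lat _) (hX.lat _), H.red_X hX, H.red_X hX]
      simp
    · refine lt_of_le_of_lt (b := (p - 1) / 4 + (p - 1) / 4) ?_ (by omega)
      compute_degree
  have he := (H.isLat_div_iff hJ).2 h0
  set e := jacobiSum X X / π with hed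
  have h1 : jacobiSum X X = π * e := by rw [hed, mul_div_cancel₀ _ H.ne]
  have h2 : jacobiSum X⁻¹ X⁻¹ = (starRingEnd ℂ) (jacobiSum X X) := by
    simp only [jacobiSum, map_sum, map_mul, conj_mulChar]
  have h3 := jacobiSum_mul_jacobiSum_inv (by rw [ringChar.eq_zero, ZMod.ringChar_zmod_n]; exact H.prime.ne_zero.symm)
    (H.X_ne_one hX) (H.X_ne_one hX) (H.X_sq_ne_one hX)
  rw [h2, h1, map_mul, ZMod.card, H.norm] at h3
  have h4 : e * (starRingEnd ℂ) e = 1 := by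
    refine mul_left_cancel₀ H.p_ne ?_
    rw [H.norm]
    linear_combination h3
  refine ⟨(starRingEnd ℂ) e, ?_, by rw [h2, h1, map_mul]⟩
  rw [← map_pow]
  obtain ⟨m, n, h5⟩ := he
  have h6 : m ^ 2 + n ^ 2 = 1 := by
    have : ((m ^ 2 + n ^ 2 : ℤ) : ℂ) = 1 := by
      rw [← h4, h5]
      simp only [map_add, map_mul, map_intCast, conj_I]
      push_cast
      linear_combination (n : ℂ) ^ 2 * I_sq
    exact_mod_cast this
  have hm1 : m ≤ 1 := by nlinarith
  have hm2 : -1 ≤ m := by nlinarith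
  have hn1 : n ≤ 1 := by nlinarith
  have hn2 : -1 ≤ n := by nlinarith
  have : e ^ 4 = 1 := by
    rw [h5]
    clear h5 h4 h3 h2 h1 h0 hed
    interval_cases m <;> interval_cases n <;> first
      | (exfalso; revert h6; norm_num; done)
      | (push_cast; ring_nf; try norm_num [I_pow_four])
  rw [this, map_one]

theorem exists_gaussSum_pow (H : PrimaryPrime p π d j) (hX : QuarticChar p j X) :
    ∃ e, e ^ 4 = 1 ∧ gaussSum X⁻¹ ZMod.stdAddChar ^ 4 = π * (starRingEnd ℂ) π ^ 3 * e ^ 2 := by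
  obtain ⟨e, he, h1⟩ := H.exists_jacobiSum_inv hX
  refine ⟨e, he, ?_⟩
  have hsq : X * X ≠ 1 := H.X_sq_ne_one hX
  have h2 := jacobiSum_mul_nontrivial (χ := X⁻¹) (φ := X⁻¹) (by
    rw [← mul_inv, ne_eq, inv_eq_one]; exact hsq) ZMod.stdAddChar
  have h4 : ∀ a, a ≠ 0 → (X a * X a) * (X a * X a) = 1 := fun a ha => by
    linear_combination hX.pow_four a ha
  have h3 : gaussSum (X⁻¹ * X⁻¹) (ZMod.stdAddChar : AddChar (ZMod p) ℂ) ^ 2 = p := by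
    rw [gaussSum_sq]
    · have : (X⁻¹ * X⁻¹) (-1) = 1 := by
        rw [← H.sq_j, sq, map_mul, MulChar.mul_apply]
        simp only [← conj_mulChar]
        rcases H.X_j_cases hX with h | h <;> simp [h]
      rw [this, one_mul, ZMod.card]
    · rw [← mul_inv, ne_eq, inv_eq_one]; exact hsq
    · intro a
      by_cases ha : a = 0
      · left; rw [ha, MulChar.map_zero]
      · right
        rw [← mul_inv, ← conj_mulChar, MulChar.mul_apply]
        have := h4 a ha
        rcases mul_self_eq_one_iff.1 this with h | h <;> simp [h]
    · exact ZMod.isPrimitive_stdAddChar p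
  have h5 := congrArg (· ^ 2) h2
  simp only [mul_pow] at h5
  rw [h3, h1] at h5
  rw [H.norm] at h5
  linear_combination -h5

/-- The functional equation of the elliptic Gauss sum. -/
theorem ellSum_dual (H : PrimaryPrime p π d j) (hX : QuarticChar p j X) {m : ZMod p}
    (hm : (1 - (j : ZMod p)) * red p j ((starRingEnd ℂ) π) * m = 1) :
    gaussSum X⁻¹ ZMod.stdAddChar * X j * ellSum π X =
      π * X m * (starRingEnd ℂ) ((1 + I) / 2 + (1 - I) / 2 * X j) * (starRingEnd ℂ) (ellSum π X) := by
  have hj1 : X⁻¹ (j : ZMod p) = X j := by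
    rw [← conj_mulChar]; rcases H.X_j_cases hX with h | h <;> simp [h]
  have hm0 : m ≠ 0 := by rintro rfl; simp at hm
  have inv_mul : ∀ a, a ≠ 0 → X⁻¹ a * X a = 1 := fun a ha => by
    rw [← MulChar.mul_apply, inv_mul_cancel, MulChar.one_apply ha.isUnit]
  have h1 : ∀ r : ZMod p, ∑ a, X⁻¹ a * ZMod.stdAddChar (a * r) = X r * gaussSum X⁻¹ ZMod.stdAddChar := fun r => by
    by_cases hr : r = 0
    · subst hr
      simp only [mul_zero, AddChar.map_zero_eq_one, mul_one, MulChar.map_zero, zero_mul]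
      exact MulChar.sum_eq_zero_of_ne_one (inv_ne_one.2 (H.X_ne_one hX))
    · rw [gaussSum, ← Equiv.sum_comp (Equiv.mulRight₀ r hr) (fun a => X⁻¹ a * ZMod.stdAddChar a), Finset.mul_sum]
      refine Finset.sum_congr rfl fun a _ => ?_
      rw [Equiv.mulRight₀_apply, map_mul X⁻¹]
      linear_combination -(X⁻¹ a * ZMod.stdAddChar (a * r)) * inv_mul r hr
  have h2 : ∀ u : ZMod p, u ≠ 0 → ∑ a, X a * tor π psi (u * a) = X⁻¹ u * (4 * ellSum π X) := fun u hu => by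
    rw [ellSum, ← Equiv.sum_comp (Equiv.mulLeft₀ u hu) (fun a => X a * tor π psi a)]
    simp_rw [Equiv.mulLeft₀_apply, map_mul, Finset.mul_sum]
    refine Finset.sum_congr rfl fun a _ => ?_
    linear_combination -(X a * tor π psi (u * a)) * inv_mul u hu
  have h3 : ∑ a, X⁻¹ a * ∑ r : ZMod p, ZMod.stdAddChar (a * r) * tor π psi ((j : ZMod p) * r) =
      gaussSum X⁻¹ ZMod.stdAddChar * X j * (4 * ellSum π X) := by
    simp_rw [Finset.mul_sum]
    rw [Finset.sum_comm]
    simp_rw [← mul_assoc, ← Finset.sum_mul, h1]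
    have h5 := h2 _ H.j_ne
    rw [hj1] at h5
    rw [show gaussSum X⁻¹ ZMod.stdAddChar * X j * 4 * ellSum π X =
      gaussSum X⁻¹ ZMod.stdAddChar * (X j * (4 * ellSum π X)) by ring, ← h5, Finset.mul_sum]
    exact Finset.sum_congr rfl fun r _ => by ring
  have h4 : ∑ a, X⁻¹ a * (π * (starRingEnd ℂ) ((1 + I) / 2 * tor π psi (a * m) +
      (1 - I) / 2 * tor π psi ((j : ZMod p) * (a * m)))) =
      π * (starRingEnd ℂ) ((1 + I) / 2 * ∑ a, X a * tor π psi (m * a) + (1 - I) / 2 * ∑ a, X a * tor π psi ((j : ZMod p) * m * a)) := by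
    simp_rw [Finset.mul_sum]
    rw [← Finset.sum_add_distrib, map_sum, Finset.mul_sum]
    refine Finset.sum_congr rfl fun a _ => ?_
    rw [← conj_mulChar, show (j : ZMod p) * m * a = j * (a * m) by ring, mul_comm m a]
    simp only [map_add, map_mul]
    ring
  simp_rw [H.torp_dual _ hm] at h3
  rw [h4, h2 m hm0, h2 _ (mul_ne_zero H.j_ne hm0), map_mul X⁻¹, hj1] at h3
  simp only [map_add, map_mul, ← conj_mulChar, conj_conj, Complex.conj_ofNat] at h3 ⊢
  linear_combination -h3 / 4

end PrimaryPrime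

end

section
open Filter Topology Set

theorem sign_revPerm_even (l : ℕ) : Equiv.Perm.sign (Fin.revPerm : Equiv.Perm (Fin (2 * l))) = (-1) ^ l := by
  have h2 : (Fin.revPerm : Equiv.Perm (Fin (2 * l))) ^ 2 = 1 := by
    ext i; simp [sq]
  have h3 := (Equiv.Perm.pow_prime_eq_one_iff (p := 2)).1 h2
  have h4 := Multiset.eq_replicate_card.2 h3
  have h5 : (Fin.revPerm : Equiv.Perm (Fin (2 * l))).support = Finset.univ := by
    ext i
    simp only [Equiv.Perm.mem_support, Fin.revPerm_apply, Finset.mem_univ, iff_true, ne_eq, Fin.ext_iff, Fin.val_rev]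
    have := i.2
    omega
  have h6 := Equiv.Perm.sum_cycleType (Fin.revPerm : Equiv.Perm (Fin (2 * l)))
  rw [h5, Finset.card_univ, Fintype.card_fin] at h6
  rw [Equiv.Perm.sign_of_cycleType, h6]
  rw [h4, Multiset.sum_replicate, smul_eq_mul] at h6
  rw [show Multiset.card (Equiv.Perm.cycleType (Fin.revPerm : Equiv.Perm (Fin (2 * l)))) = l by omega, pow_add, pow_mul]
  simp

open Polynomial in
theorem exists_monic_of_recurrence {ι F : Type*} [Field F] {z : ι → F} {u : ℕ → ι → F} {c : ℕ → F} {N : ℕ}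
    (h1 : ∀ t, u 1 t = z t * u 0 t) (h2 : ∀ n, n + 2 ≤ N → ∀ t, u (n + 2) t = z t * u (n + 1) t + c n * u n t) (n : ℕ)
    (hn : 2 * n + 1 ≤ N) :
    ∃ q r : F[X], q.Monic ∧ q.natDegree = n ∧ r.Monic ∧ r.natDegree = n ∧
      ∀ t, u (2 * n) t = q.eval (z t ^ 2) * u 0 t ∧ u (2 * n + 1) t = z t * r.eval (z t ^ 2) * u 0 t := by
  have step : ∀ {n : ℕ} {a b : F[X]} {e : F}, a.Monic → a.natDegree = n → b.natDegree < n → (a + C e * b).Monic ∧ (a + C e * b).natDegree = n := by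
    intro n a b e ha hn hb
    have h : (C e * b).natDegree < a.natDegree := lt_of_le_of_lt (natDegree_C_mul_le _ _) (by omega)
    exact ⟨ha.add_of_left (degree_lt_degree h), by rw [natDegree_add_eq_left_of_natDegree_lt h, hn]⟩
  induction n with
  | zero => exact ⟨1, 1, monic_one, natDegree_one, monic_one, natDegree_one, fun t => by simp [h1]⟩
  | succ n ih =>
    obtain ⟨q, r, hq, hqn, hr, hrn, h⟩ := ih (by omega)
    obtain ⟨a1, a2⟩ := step (n := n + 1) (a := X * r) (b := q) (e := c (2 * n)) (monic_X.mul hr)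
      (by rw [natDegree_X_mul hr.ne_zero, hrn]) (by omega)
    obtain ⟨b1, b2⟩ := step (n := n + 1) (b := r) (e := c (2 * n + 1)) a1 a2 (by omega)
    refine ⟨_, _, a1, a2, b1, b2, fun t => ?_⟩
    have e1 : u (2 * (n + 1)) t = (X * r + C (c (2 * n)) * q).eval (z t ^ 2) * u 0 t := by
      rw [show 2 * (n + 1) = 2 * n + 2 by ring, h2 _ (by omega), (h t).1, (h t).2]
      simp only [eval_add, eval_mul, eval_X, eval_C]
      ring
    refine ⟨e1, ?_⟩
    rw [show 2 * (n + 1) + 1 = (2 * n + 1) + 2 by ring, h2 _ (by omega), show 2 * n + 1 + 1 = 2 * (n + 1) by ring, e1, (h t).2, eval_add (p := X * r + C (c (2 * n)) * q)]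
    simp only [eval_mul, eval_C]
    ring

theorem prod_eq_of_monic {F : Type*} [Field F] {l : ℕ} {y a b : Fin (2 * l) → F} (hy : Function.Injective y)
    {V : Fin (2 * l) → Fin (2 * l) → F} {α β : Fin (2 * l) → F} {q r : Fin (2 * l) → Polynomial F}
    (hq : ∀ n, (q n).Monic) (hqn : ∀ n, (q n).natDegree = n) (hr : ∀ n, (r n).Monic) (hrn : ∀ n, (r n).natDegree = n)
    (hV : ∀ n t, α n * V n t = (q n).eval (y t) * a t)
    (hV' : ∀ n t, β n * V (Fin.rev n) t = (r n).eval (y t) * b t) :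
    (∏ n, α n) * ∏ t, b t = (-1) ^ l * (∏ n, β n) * ∏ t, a t := by
  have h0 := Matrix.det_vandermonde_ne_zero_iff.2 hy
  have e1 := Matrix.det_eval_matrixOfPolynomials_eq_det_vandermonde y q hqn hq
  have e2 := Matrix.det_eval_matrixOfPolynomials_eq_det_vandermonde y r hrn hr
  set M : Matrix (Fin (2 * l)) (Fin (2 * l)) F := Matrix.of fun t n => V n t with hM
  have d1 : (∏ n, α n) * M.det = (∏ t, a t) * (Matrix.vandermonde y).det := by
    rw [e1, ← Matrix.det_mul_row, ← Matrix.det_mul_column]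
    congr 1
    ext t n
    simp only [hM, Matrix.of_apply, hV, mul_comm]
  have d2 : (∏ n, β n) * (M.submatrix id Fin.revPerm).det = (∏ t, b t) * (Matrix.vandermonde y).det := by
    rw [e2, ← Matrix.det_mul_row, ← Matrix.det_mul_column]
    congr 1
    ext t n
    simp only [hM, Matrix.of_apply, Matrix.submatrix_apply, id, Fin.revPerm_apply, hV', mul_comm]
  rw [Matrix.det_permute', sign_revPerm_even] at d2
  push_cast at d2
  refine mul_right_cancel₀ h0 ?_
  linear_combination -(∏ n, α n) * d2 + (-1) ^ l * (∏ n, β n) * d1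

end

section
open Filter Topology Set

section Newton
variable {p : ℕ} [Fact p.Prime] {R : Type*} [CommRing R]

theorem sum_zmod_eq_sum_range {M : Type*} [AddCommMonoid M] (h : ZMod p → M) :
    ∑ r, h r = ∑ i ∈ Finset.range p, h (i : ZMod p) :=
  Finset.sum_nbij' (fun r => r.val) (fun i => (i : ZMod p)) (fun r _ => Finset.mem_range.2 r.val_lt)
    (fun _ _ => Finset.mem_univ _) (fun r _ => by simp)
    (fun i hi => ZMod.val_cast_of_lt (Finset.mem_range.1 hi)) (fun r _ => by simp)

theorem sum_range_eq_sum_fwdDiff (h : ZMod p → R) (n : ℕ) :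
    ∑ i ∈ Finset.range n, h (i : ZMod p) = ∑ i ∈ Finset.range n, (n.choose (i + 1) : R) * (fwdDiff 1)^[i] h 0 := by
  induction n with
  | zero => simp
  | succ n ih =>
    have h1 := shift_eq_sum_fwdDiff_iter (1 : ZMod p) h n 0
    rw [zero_add, nsmul_one] at h1
    have h2 : ∑ i ∈ Finset.range n, (n.choose (i + 1) : R) * (fwdDiff 1)^[i] h 0 =
        ∑ i ∈ Finset.range (n + 1), (n.choose (i + 1) : R) * (fwdDiff 1)^[i] h 0 := by
      rw [Finset.sum_range_succ]; simp
    rw [Finset.sum_range_succ, ih, h1, h2, ← Finset.sum_add_distrib]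
    refine Finset.sum_congr rfl fun i _ => ?_
    rw [Nat.choose_succ_succ, nsmul_eq_mul]
    push_cast
    ring

/-- A subalgebra of functions on `ℤ/p` whose differences are divisible by `x`. -/
def DiffClosed (x : R) (C : Subalgebra R (ZMod p → R)) : Prop :=
  ∀ h ∈ C, ∃ h' ∈ C, ∀ r, h (r + 1) = h r + x * h' r

variable {x : R} {C : Subalgebra R (ZMod p → R)}

theorem diffClosed_adjoin {s : Set (ZMod p → R)}
    (hs : ∀ h ∈ s, ∃ h' ∈ Algebra.adjoin R s, ∀ r, h (r + 1) = h r + x * h' r) :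
    DiffClosed x (Algebra.adjoin R s) := by
  intro h hh
  induction hh using Algebra.adjoin_induction with
  | mem h hh => exact hs h hh
  | algebraMap c => exact ⟨0, zero_mem _, fun r => by simp⟩
  | add h k _ _ ih ik =>
    obtain ⟨h', hm, h1⟩ := ih
    obtain ⟨k', km, k1⟩ := ik
    exact ⟨h' + k', add_mem hm km, fun r => by simp only [Pi.add_apply, h1, k1]; ring⟩
  | mul h k hC kC ih ik =>
    obtain ⟨h', hm, h1⟩ := ih
    obtain ⟨k', km, k1⟩ := ik
    refine ⟨h' * k + h * k' + x • (h' * k'), add_mem (add_mem (mul_mem hm kC) (mul_mem hC km))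
      (Subalgebra.smul_mem _ (mul_mem hm km) _), fun r => ?_⟩
    simp only [Pi.add_apply, Pi.mul_apply, Pi.smul_apply, smul_eq_mul, h1, k1]
    ring

theorem DiffClosed.exists_iter (hC : DiffClosed x C) {h : ZMod p → R} (hh : h ∈ C) (n : ℕ) :
    ∃ h' ∈ C, (fwdDiff 1)^[n] h = x ^ n • h' := by
  induction n with
  | zero => exact ⟨h, hh, by simp⟩
  | succ n ih =>
    obtain ⟨k, hk, e⟩ := ih
    obtain ⟨k', hk', e'⟩ := hC k hk
    refine ⟨k', hk', ?_⟩
    rw [Function.iterate_succ_apply', e]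
    funext r
    simp only [fwdDiff, Pi.smul_apply, smul_eq_mul, e']
    ring

theorem DiffClosed.dvd_sum (hC : DiffClosed x C) (hp : x ^ (p - 1) ∣ (p : R)) {h : ZMod p → R} (hh : h ∈ C) :
    x ^ (p - 1) ∣ ∑ r, h r := by
  have hp0 := (Fact.out : p.Prime)
  rw [sum_zmod_eq_sum_range, sum_range_eq_sum_fwdDiff]
  refine Finset.dvd_sum fun i hi => ?_
  rw [Finset.mem_range] at hi
  by_cases hi' : i + 1 = p
  · obtain ⟨h', -, e⟩ := hC.exists_iter hh i
    rw [e, show i = p - 1 by omega]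
    exact Dvd.dvd.mul_left (Dvd.intro _ rfl) _
  · exact ((hp.trans (Nat.cast_dvd_cast (hp0.dvd_choose_self (by omega) (by omega)))).mul_right _)

end Newton

section Residue
variable {p : ℕ} [Fact p.Prime] {R : Type*} [CommRing R] [IsDomain R] {F : Type*} [Field F]

open Classical in
/-- The residue of `x^{-(p-1)} ∑ h`. -/
def resSum (res : R →+* F) (x : R) (h : ZMod p → R) : F :=
  if H : ∃ c, ∑ r, h r = x ^ (p - 1) * c then res H.choose else 0

theorem resSum_eq (res : R →+* F) {x c : R} {h : ZMod p → R} (hx : x ≠ 0) (H : ∑ r, h r = x ^ (p - 1) * c) :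
    resSum res x h = res c := by
  have H' : ∃ c, ∑ r, h r = x ^ (p - 1) * c := ⟨c, H⟩
  rw [resSum, dif_pos H']
  congr 1
  exact mul_left_cancel₀ (pow_ne_zero (p - 1) hx) (H'.choose_spec.symm.trans H)

/-- Data for the calculus of differences modulo `x`. -/
structure DiffAlg (res : R →+* F) (x : R) (C : Subalgebra R (ZMod p → R)) : Prop where
  ne : x ≠ 0
  res_eq : res x = 0
  dvd : x ^ (p - 1) ∣ (p : R)
  closed : DiffClosed x C

/-- The difference quotient of `h` is congruent to `k`. -/
def Der (x : R) (C : Subalgebra R (ZMod p → R)) (h k : ZMod p → R) : Prop :=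
  h ∈ C ∧ k ∈ C ∧ ∃ u ∈ C, ∀ r, h (r + 1) = h r + x * (k r + x * u r)

variable {res : R →+* F} {x : R} {C : Subalgebra R (ZMod p → R)} {h k h₁ k₁ : ZMod p → R}

theorem Der.mul (H : Der x C h k) (H₁ : Der x C h₁ k₁) : Der x C (h * h₁) (k * h₁ + h * k₁) := by
  obtain ⟨a, b, u, hu, e⟩ := H
  obtain ⟨a₁, b₁, u₁, hu₁, e₁⟩ := H₁
  refine ⟨mul_mem a a₁, add_mem (mul_mem b a₁) (mul_mem a b₁),
    u * h₁ + h * u₁ + k * k₁ + x • (u * k₁ + k * u₁) + (x ^ 2) • (u * u₁), ?_, fun r => ?_⟩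
  · exact add_mem (add_mem (add_mem (add_mem (mul_mem hu a₁) (mul_mem a hu₁)) (mul_mem b b₁))
      (Subalgebra.smul_mem _ (add_mem (mul_mem hu b₁) (mul_mem b hu₁)) _)) (Subalgebra.smul_mem _ (mul_mem hu hu₁) _)
  · simp only [Pi.add_apply, Pi.mul_apply, Pi.smul_apply, smul_eq_mul, e, e₁]
    ring

theorem Der.pow (H : Der x C h k) (n : ℕ) : Der x C (h ^ (n + 1)) ((n + 1 : R) • (h ^ n * k)) := by
  induction n with
  | zero => simpa using H
  | succ n ih =>
    have := ih.mul H
    rw [← pow_succ] at this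
    convert this using 1
    funext r
    simp only [Pi.add_apply, Pi.mul_apply, Pi.smul_apply, smul_eq_mul, Pi.pow_apply]
    push_cast
    ring

namespace DiffAlg

theorem exists_sum (D : DiffAlg res x C) (hh : h ∈ C) : ∃ c, ∑ r, h r = x ^ (p - 1) * c ∧ resSum res x h = res c := by
  obtain ⟨c, hc⟩ := D.closed.dvd_sum D.dvd hh
  exact ⟨c, hc, resSum_eq res D.ne hc⟩

theorem resSum_add (D : DiffAlg res x C) (hh : h ∈ C) (hk : k ∈ C) :
    resSum res x (h + k) = resSum res x h + resSum res x k := by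
  obtain ⟨c, hc, e⟩ := D.exists_sum hh
  obtain ⟨c', hc', e'⟩ := D.exists_sum hk
  rw [e, e', ← map_add]
  refine resSum_eq res D.ne ?_
  simp only [Pi.add_apply, Finset.sum_add_distrib, hc, hc']
  ring

theorem resSum_smul (D : DiffAlg res x C) (hh : h ∈ C) (a : R) :
    resSum res x (a • h) = res a * resSum res x h := by
  obtain ⟨c, hc, e⟩ := D.exists_sum hh
  rw [e, ← map_mul]
  refine resSum_eq res D.ne ?_
  simp only [Pi.smul_apply, smul_eq_mul, ← Finset.mul_sum, hc]
  ring

theorem resSum_der (D : DiffAlg res x C) (H : Der x C h k) : resSum res x k = 0 := by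
  obtain ⟨-, -, u, hu, e⟩ := H
  obtain ⟨c, hc, -⟩ := D.exists_sum hu
  have h1 : ∑ r, h (r + 1) = ∑ r, h r := Equiv.sum_comp (Equiv.addRight (1 : ZMod p)) h
  simp_rw [e, Finset.sum_add_distrib, ← Finset.mul_sum, Finset.sum_add_distrib, ← Finset.mul_sum] at h1
  have h2 : x * (∑ r, k r + x * ∑ r, u r) = x * 0 := by linear_combination h1
  have h3 := mul_left_cancel₀ D.ne h2
  rw [resSum_eq res (c := -x * c) D.ne (by linear_combination h3 - x * hc), map_mul, map_neg, D.res_eq]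
  simp

end DiffAlg

/-- Elliptic and exponential functions modulo `x`. -/
structure LemnAlg (res : R →+* F) (κ : ZMod p →+* F) (x X : R) (C : Subalgebra R (ZMod p → R)) (f g e : ZMod p → R) : Prop
    extends DiffAlg res x C where
  df : Der x C f g
  dg : Der x C g (-2 * f ^ 3)
  de : Der x C e (X • e)
  sq : g ^ 2 = 1 - f ^ 4
  res_f : ∀ r, ∃ c, f r = x * c ∧ res c = κ r
  res_g : ∀ r, res (g r) = 1
  res_e : ∀ r, res (e r) = 1

namespace LemnAlg
variable {κ : ZMod p →+* F} {X : R} {f g e : ZMod p → R}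

theorem mem_f (D : LemnAlg res κ x X C f g e) (n : ℕ) : e * f ^ n ∈ C := mul_mem D.de.1 (pow_mem D.df.1 n)

theorem mem_fg (D : LemnAlg res κ x X C f g e) (n : ℕ) : e * f ^ n * g ∈ C := mul_mem (D.mem_f n) D.dg.1

theorem der_f (D : LemnAlg res κ x X C f g e) (n : ℕ) :
    res X * resSum res x (e * f ^ (n + 1)) + (n + 1) * resSum res x (e * f ^ n * g) = 0 := by
  have h := D.resSum_der (D.de.mul (D.df.pow n))
  have e1 : X • e * f ^ (n + 1) + e * ((n + 1 : R) • (f ^ n * g)) = X • (e * f ^ (n + 1)) + (n + 1 : R) • (e * f ^ n * g) := by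
    funext r
    simp only [Pi.add_apply, Pi.mul_apply, Pi.smul_apply, smul_eq_mul]
    ring
  rw [e1, D.resSum_add (Subalgebra.smul_mem _ (D.mem_f _) _) (Subalgebra.smul_mem _ (D.mem_fg _) _),
    D.resSum_smul (D.mem_f _), D.resSum_smul (D.mem_fg _)] at h
  simpa using h

theorem der_g (D : LemnAlg res κ x X C f g e) :
    res X * resSum res x (e * f ^ 0 * g) - 2 * resSum res x (e * f ^ 3) = 0 := by
  have h := D.resSum_der (D.de.mul D.dg)
  have e1 : X • e * g + e * (-2 * f ^ 3) = X • (e * f ^ 0 * g) + (-2 : R) • (e * f ^ 3) := by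
    funext r
    simp only [Pi.add_apply, Pi.mul_apply, Pi.smul_apply, smul_eq_mul, pow_zero, Pi.neg_apply, Pi.ofNat_apply]
    ring
  rw [e1, D.resSum_add (Subalgebra.smul_mem _ (D.mem_fg _) _) (Subalgebra.smul_mem _ (D.mem_f _) _),
    D.resSum_smul (D.mem_f _), D.resSum_smul (D.mem_fg _)] at h
  rw [map_neg, map_ofNat] at h
  linear_combination h

theorem der_fg (D : LemnAlg res κ x X C f g e) (n : ℕ) :
    res X * resSum res x (e * f ^ (n + 1) * g) + (n + 1) * resSum res x (e * f ^ n) -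
      (n + 3) * resSum res x (e * f ^ (n + 4)) = 0 := by
  have h := D.resSum_der ((D.de.mul (D.df.pow n)).mul D.dg)
  have e1 : (X • e * f ^ (n + 1) + e * ((n + 1 : R) • (f ^ n * g))) * g + e * f ^ (n + 1) * (-2 * f ^ 3) =
      X • (e * f ^ (n + 1) * g) + ((n + 1 : R) • (e * f ^ n) + (-(n + 3) : R) • (e * f ^ (n + 4))) := by
    funext r
    have := congrFun D.sq r
    simp only [Pi.add_apply, Pi.mul_apply, Pi.smul_apply, smul_eq_mul, Pi.pow_apply, Pi.neg_apply, Pi.ofNat_apply,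
      Pi.sub_apply] at this ⊢
    linear_combination (e r * (n + 1) * f r ^ n) * this
  rw [e1, D.resSum_add (Subalgebra.smul_mem _ (D.mem_fg _) _) (add_mem (Subalgebra.smul_mem _ (D.mem_f _) _)
    (Subalgebra.smul_mem _ (D.mem_f _) _)), D.resSum_add (Subalgebra.smul_mem _ (D.mem_f _) _)
    (Subalgebra.smul_mem _ (D.mem_f _) _), D.resSum_smul (D.mem_f _), D.resSum_smul (D.mem_f _), D.resSum_smul (D.mem_fg _)] at h
  simp only [map_neg, map_add, map_natCast, map_one, map_ofNat] at h
  linear_combination h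

theorem rec_one (D : LemnAlg res κ x X C f g e) :
    res X ^ 2 * resSum res x (e * f ^ 1) = -2 * resSum res x (e * f ^ 3) := by
  have h1 := D.der_f 0
  have h2 := D.der_g
  simp only [zero_add, Nat.cast_zero, one_mul] at h1
  linear_combination res X * h1 - h2

theorem rec_add_two (D : LemnAlg res κ x X C f g e) (n : ℕ) :
    res X ^ 2 * resSum res x (e * f ^ (n + 2)) =
      (n + 2) * ((n + 1) * resSum res x (e * f ^ n) - (n + 3) * resSum res x (e * f ^ (n + 4))) := by
  have h1 := D.der_f (n + 1)
  have h2 := D.der_fg n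
  push_cast at h1
  linear_combination res X * h1 - (n + 2) * h2

theorem resSum_pow (D : LemnAlg res κ x X C f g e) (n : ℕ) : resSum res x (e * f ^ (p + n)) = 0 := by
  choose c hc _ using D.res_f
  have hp := (Fact.out : p.Prime).one_lt
  rw [resSum_eq res (c := x ^ (n + 1) * ∑ r, e r * c r ^ (p + n)) D.ne, map_mul, map_pow, D.res_eq]
  · simp
  · rw [← mul_assoc, ← pow_add, Finset.mul_sum]
    refine Finset.sum_congr rfl fun r _ => ?_
    rw [Pi.mul_apply, Pi.pow_apply, hc, show p - 1 + (n + 1) = p + n by omega]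
    ring

theorem resSum_pow_mul (D : LemnAlg res κ x X C f g e) : resSum res x (e * f ^ (p - 1) * g) = -1 := by
  choose c hc hc' using D.res_f
  rw [resSum_eq res (c := ∑ r, e r * c r ^ (p - 1) * g r) D.ne]
  · simp only [map_sum, map_mul, map_pow, hc', D.res_e, D.res_g, one_mul, mul_one]
    have := sum_eval_of_monic (p := p) (P := Polynomial.X ^ (p - 1)) (Polynomial.monic_X_pow _) (Polynomial.natDegree_X_pow _)
    simpa using congrArg κ this
  · rw [Finset.mul_sum]
    refine Finset.sum_congr rfl fun r _ => ?_
    rw [Pi.mul_apply, Pi.mul_apply, Pi.pow_apply, hc]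
    ring

theorem resSum_sub_two (D : LemnAlg res κ x X C f g e) : resSum res x (e * f ^ (p - 2)) = -res X := by
  have hp := (Fact.out : p.Prime).two_le
  have h := D.der_fg (p - 2)
  have hp0 : (p : F) = 0 := by rw [← map_natCast κ, ZMod.natCast_self, map_zero]
  rw [show p - 2 + 1 = p - 1 by omega, show p - 2 + 4 = p + 2 by omega, D.resSum_pow, D.resSum_pow_mul,
    Nat.cast_sub hp, hp0] at h
  push_cast at h
  linear_combination -h

end LemnAlg
end Residue

end

section
open Filter Topology Set

theorem prod_factorial (k : ℕ) :
    (∏ n ∈ Finset.range k, (4 * n + 3).factorial) * 4 ^ k * k.factorial = (∏ n ∈ Finset.range k, (4 * n).factorial) * (4 * k).factorial := by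
  induction k with
  | zero => simp
  | succ k ih =>
    rw [Finset.prod_range_succ, Finset.prod_range_succ, show 4 * (k + 1) = 4 * k + 3 + 1 by ring, Nat.factorial_succ (4 * k + 3),
      Nat.factorial_succ k, pow_succ]
    linear_combination ((4 * k + 3).factorial * 4 * (k + 1)) * ih

namespace LemnAlg
variable {p : ℕ} [Fact p.Prime] {R : Type*} [CommRing R] [IsDomain R] {F : Type*} [Field F]
  {res : R →+* F} {κ : ZMod p →+* F} {x : R} {C : Subalgebra R (ZMod p → R)} {f g : ZMod p → R}
  {ι : Type*} {X : ι → R} {e : ι → ZMod p → R}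

open Polynomial in
theorem exists_monic (D : ∀ t, LemnAlg res κ x (X t) C f g (e t)) (n : ℕ) :
    ∃ q : F[X], q.Monic ∧ q.natDegree = n ∧ ∀ t, ((4 * n).factorial : F) * resSum res x (e t * f ^ (4 * n + 1)) =
      q.eval (res (X t) ^ 4) * resSum res x (e t * f ^ 1) := by
  obtain ⟨q, _, h1, h2, -, -, h⟩ := exists_monic_of_recurrence (z := fun t => res (X t) ^ 2)
    (u := fun m t => (-1) ^ m * ((2 * m).factorial : F) * resSum res x (e t * f ^ (2 * m + 1)))
    (c := fun m => (2 * m + 3) * (2 * m + 2) * (2 * m + 2) * (2 * m + 1)) (N := 2 * n + 1)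
    (fun t => by
      have key : ∀ a b Z : F, Z * a = -2 * b → (-1) ^ 1 * ((2 * 1).factorial : F) * b = Z * ((-1) ^ 0 * ((2 * 0).factorial : F) * a) := by
        intro a b Z h
        simp only [mul_zero, mul_one, Nat.factorial_zero, Nat.factorial_two]
        push_cast
        linear_combination -h
      exact key _ _ _ (D t).rec_one)
    (fun m _ t => by
      have := (D t).rec_add_two (2 * m + 1)
      simp only [show 2 * (m + 2) = 2 * m + 1 + 1 + 1 + 1 by ring, show 2 * (m + 1) = 2 * m + 1 + 1 by ring, Nat.factorial_succ]
      push_cast at this ⊢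
      rw [show 2 * m + 1 + 4 = 2 * m + 1 + 1 + 1 + 1 + 1 by ring, show 2 * m + 1 + 2 = 2 * m + 1 + 1 + 1 by ring] at this
      linear_combination ((-1) ^ m * (2 * m + 2) * (2 * m + 1) * ((2 * m).factorial : F)) * this) n le_rfl
  refine ⟨q, h1, h2, fun t => ?_⟩
  have := (h t).1
  simp only [mul_zero, zero_add, Nat.factorial_zero, pow_zero, pow_mul (-1 : F), neg_one_sq, one_pow, ← mul_assoc, ← pow_mul,
    Nat.cast_one, one_mul, Nat.reduceMul] at this
  exact this

open Polynomial in
theorem exists_monic_rev (D : ∀ t, LemnAlg res κ x (X t) C f g (e t)) (n : ℕ) (hn : 4 * n + 4 ≤ p) :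
    ∃ q : F[X], q.Monic ∧ q.natDegree = n ∧ ∀ t, ((4 * n + 3).factorial : F) * resSum res x (e t * f ^ (p - 4 - 4 * n)) =
      q.eval (res (X t) ^ 4) * (-res (X t) ^ 3) := by
  have hp0 : (p : F) = 0 := by rw [← map_natCast κ, ZMod.natCast_self, map_zero]
  have hc : ∀ i, i ≤ p → ((p - i : ℕ) : F) = -(i : F) := fun i hi => by rw [Nat.cast_sub hi, hp0]; ring
  obtain ⟨_, q, -, -, h1, h2, h⟩ := exists_monic_of_recurrence (z := fun t => res (X t) ^ 2)
    (u := fun m t => ((2 * m + 1).factorial : F) * resSum res x (e t * f ^ (p - 2 - 2 * m)))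
    (c := fun m => (2 * m + 4) * (2 * m + 3) * (2 * m + 3) * (2 * m + 2)) (N := 2 * n + 1)
    (fun t => by
      have := (D t).rec_add_two (p - 4)
      have h0 := (D t).resSum_pow 0
      rw [show p - 4 + 4 = p + 0 by omega, h0, hc 4 (by omega), show p - 4 + 2 = p - 2 by omega] at this
      simp only [mul_zero, mul_one, zero_add, Nat.factorial_one, tsub_zero]
      rw [show p - 2 - 2 = p - 4 by omega, show Nat.factorial (2 + 1) = 6 from rfl]
      push_cast at this ⊢
      linear_combination -this)
    (fun m hm t => by
      have := (D t).rec_add_two (p - (6 + 2 * m))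
      rw [show p - (6 + 2 * m) + 4 = p - 2 - 2 * m by omega, hc _ (by omega),
        show p - (6 + 2 * m) + 2 = p - 2 - 2 * (m + 1) by omega, show p - (6 + 2 * m) = p - 2 - 2 * (m + 2) by omega] at this
      simp only [show 2 * (m + 2) + 1 = 2 * m + 1 + 1 + 1 + 1 + 1 by ring, show 2 * (m + 1) + 1 = 2 * m + 1 + 1 + 1 by ring,
        Nat.factorial_succ (2 * m + 1 + 1 + 1 + 1), Nat.factorial_succ (2 * m + 1 + 1 + 1), Nat.factorial_succ (2 * m + 1 + 1),
        Nat.factorial_succ (2 * m + 1)]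
      push_cast at this ⊢
      linear_combination (-(2 * m + 3) * (2 * m + 2) * ((2 * m + 1).factorial : F)) * this) n le_rfl
  refine ⟨q, h1, h2, fun t => ?_⟩
  have := (h t).2
  simp only [mul_zero, zero_add, Nat.factorial_one, Nat.cast_one, one_mul, tsub_zero, (D t).resSum_sub_two, ← pow_mul, Nat.reduceMul] at this
  rw [show p - 2 - 2 * (2 * n + 1) = p - 4 - 4 * n by omega, show 2 * (2 * n + 1) + 1 = 4 * n + 3 by ring] at this
  rw [this]
  ring

theorem prod_resSum {l : ℕ} (hl : p = 8 * l + 1) {X : Fin (2 * l) → R} {e : Fin (2 * l) → ZMod p → R}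
    (D : ∀ t, LemnAlg res κ x (X t) C f g (e t)) (hy : Function.Injective fun t => res (X t) ^ 4) :
    ∏ t, resSum res x (e t * f ^ 1) = -(-1) ^ l * 4 ^ (2 * l) * ((2 * l).factorial : F) * ∏ t, res (X t) ^ 3 := by
  have hp := (Fact.out : p.Prime)
  have hp0 : (p : F) = 0 := by rw [← map_natCast κ, ZMod.natCast_self, map_zero]
  choose q hq hqn hqV using fun n : Fin (2 * l) => exists_monic D n
  choose r hr hrn hrV using fun n : Fin (2 * l) => exists_monic_rev D n (by have := n.2; omega)
  have h := prod_eq_of_monic hy (V := fun n t => resSum res x (e t * f ^ (4 * (n : ℕ) + 1))) hq hqn hr hrn hqV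
    (fun n t => by
      have := n.2
      rw [← hrV, Fin.val_rev, show 4 * (2 * l - (n + 1)) + 1 = p - 4 - 4 * (n : ℕ) by omega])
  have h4 : ∏ t, -res (X t) ^ 3 = ∏ t, res (X t) ^ 3 := by
    rw [Finset.prod_neg, Finset.card_univ, Fintype.card_fin, pow_mul]
    simp
  have hf := prod_factorial (2 * l)
  have hw : ((4 * (2 * l)).factorial : F) = -1 := by
    have := congrArg κ (ZMod.wilsons_lemma p)
    rwa [map_natCast, map_neg, map_one, show p - 1 = 4 * (2 * l) by omega] at this
  replace hf := congrArg (Nat.cast : ℕ → F) hf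
  push_cast [hw] at hf
  rw [Finset.prod_range (fun n => ((4 * n).factorial : F)), Finset.prod_range (fun n => ((4 * n + 3).factorial : F))] at hf
  have h0 : ∏ n : Fin (2 * l), ((4 * (n : ℕ)).factorial : F) ≠ 0 := by
    refine Finset.prod_ne_zero_iff.2 fun n _ => ?_
    rw [← map_natCast κ, ne_eq, map_eq_zero, ZMod.natCast_eq_zero_iff, hp.dvd_factorial]
    have := n.2
    omega
  have hs : ((-1 : F) ^ l) * (-1) ^ l = 1 := by rw [← mul_pow]; simp
  refine mul_left_cancel₀ h0 ?_
  rw [h4] at h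
  linear_combination ((-1) ^ l * 4 ^ (2 * l) * ((2 * l).factorial : F)) * h + (∏ t, resSum res x (e t * f ^ 1)) * hf +
    ((∏ n : Fin (2 * l), ((4 * (n : ℕ) + 3).factorial : F)) * 4 ^ (2 * l) * ((2 * l).factorial : F)) * (∏ t, resSum res x (e t * f ^ 1)) * hs

end LemnAlg

end

section
open Filter Topology Set

section
variable {p : ℕ} [Fact p.Prime] {R : Type*} [CommRing R] [IsDomain R] {F : Type*} [Field F]

/-- Values at `p`-torsion points of the lemniscate functions, reducing to those at the origin. -/
structure LemnTor (res : R →+* F) (κ : ZMod p →+* F) (f g : ZMod p → R) : Prop where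
  add : ∀ a b, f a * g b + g a * f b = f (a + b) * (1 + f a ^ 2 * f b ^ 2)
  add_cos : ∀ a b, g (a + b) * (1 + f a ^ 2 * f b ^ 2) ^ 2 =
    g a * g b * (1 - f a ^ 2 * f b ^ 2) - 2 * f a * f b * (f a ^ 2 + f b ^ 2)
  sq : ∀ a, g a ^ 2 = 1 - f a ^ 4
  neg : ∀ a, f (-a) = -f a
  neg_cos : ∀ a, g (-a) = g a
  zero : f 0 = 0
  ne : f 1 ≠ 0
  res_f : ∀ a, res (f a) = 0
  res_g : ∀ a, res (g a) = 1
  two_ne : (2 : F) ≠ 0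

namespace LemnTor
variable {res : R →+* F} [IsLocalHom res] {κ : ZMod p →+* F} {f g : ZMod p → R}

theorem exists_g_one (T : LemnTor res κ f g) : ∃ w, g 1 = 1 + f 1 ^ 4 * w := by
  have hu : IsUnit (g 1 + 1) := by
    refine isUnit_of_map_unit res _ (isUnit_iff_ne_zero.2 ?_)
    rw [map_add, T.res_g, map_one, one_add_one_eq_two]
    exact T.two_ne
  obtain ⟨v, hv⟩ := hu.exists_right_inv
  exact ⟨-v, by linear_combination v * (T.sq 1) - (g 1 - 1) * hv⟩

theorem exists_inv (_T : LemnTor res κ f g) {z : R} (hz : res z = 0) : ∃ D, (1 + z) * D = 1 :=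
  (isUnit_of_map_unit res (1 + z) (by rw [map_add, hz, map_one, add_zero]; exact isUnit_one)).exists_right_inv

/-- The algebra generated by the translates of `f`, `g` and a family `e`. -/
def alg (f g : ZMod p → R) (e : ZMod p → ZMod p → R) : Set (ZMod p → R) :=
  {h | ∃ a, h = (fun r => f (r + a)) ∨ h = (fun r => g (r + a)) ∨ h = e a}

variable {e : ZMod p → ZMod p → R}

theorem mem_f (a : ZMod p) : (fun r => f (r + a)) ∈ Algebra.adjoin R (alg f g e) :=
  Algebra.subset_adjoin ⟨a, Or.inl rfl⟩
theorem mem_g (a : ZMod p) : (fun r => g (r + a)) ∈ Algebra.adjoin R (alg f g e) :=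
  Algebra.subset_adjoin ⟨a, Or.inr (Or.inl rfl)⟩
theorem mem_e (a : ZMod p) : e a ∈ Algebra.adjoin R (alg f g e) :=
  Algebra.subset_adjoin ⟨a, Or.inr (Or.inr rfl)⟩

theorem exists_denom (T : LemnTor res κ f g) (e : ZMod p → ZMod p → R) (a : ZMod p) :
    ∃ D ∈ Algebra.adjoin R (alg f g e), ∀ r, (1 + f 1 ^ 2 * f (r + a) ^ 2) * D r = 1 := by
  obtain ⟨u, hu⟩ := T.exists_inv (z := f 1 ^ 4) (by rw [map_pow, T.res_f, zero_pow (by norm_num)])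
  refine ⟨u • (1 - f 1 ^ 2 • ((fun r => f (r + (a + 1))) * fun r => f (r + (a - 1)))),
    Subalgebra.smul_mem _ (sub_mem (one_mem _) (Subalgebra.smul_mem _ (mul_mem (mem_f _) (mem_f _)) _)) _, fun r => ?_⟩
  simp only [Pi.smul_apply, Pi.sub_apply, Pi.mul_apply, Pi.one_apply, smul_eq_mul]
  have h1 := T.add (r + a) 1
  have h2 := T.add (r + a) (-1)
  obtain ⟨D, hD⟩ := T.exists_inv (z := f 1 ^ 2 * f (r + a) ^ 2) (by rw [map_mul, map_pow, T.res_f, zero_pow (by norm_num), zero_mul])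
  have hD0 : (1 + f 1 ^ 2 * f (r + a) ^ 2) ≠ 0 := left_ne_zero_of_mul_eq_one hD
  rw [show r + (a + 1) = r + a + 1 by ring, show r + (a - 1) = r + a + -1 by ring]
  rw [T.neg, T.neg_cos] at h2
  have s1 := T.sq 1
  have s2 := T.sq (r + a)
  set y := f (r + a)
  set x := f 1
  have h3 : f (r + a + 1) * f (r + a + -1) * (1 + x ^ 2 * y ^ 2) ^ 2 = (y ^ 2 - x ^ 2) * (1 + x ^ 2 * y ^ 2) := by
    linear_combination -(y * g 1 - g (r + a) * x) * h1 - f (r + a + 1) * (1 + x ^ 2 * y ^ 2) * h2 + y ^ 2 * s1 - x ^ 2 * s2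
  have h4 : f (r + a + 1) * f (r + a + -1) * (1 + x ^ 2 * y ^ 2) = y ^ 2 - x ^ 2 :=
    mul_right_cancel₀ hD0 (by linear_combination h3)
  linear_combination hu - u * x ^ 2 * h4

theorem der_f (T : LemnTor res κ f g) (e : ZMod p → ZMod p → R) (a : ZMod p) :
    Der (f 1) (Algebra.adjoin R (alg f g e)) (fun r => f (r + a)) (fun r => g (r + a)) := by
  obtain ⟨w, hw⟩ := T.exists_g_one
  obtain ⟨D, hD, hD'⟩ := T.exists_denom e a
  have hf := mem_f (f := f) (g := g) (e := e) a
  have hg := mem_g (f := f) (g := g) (e := e) a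
  refine ⟨hf, hg, ((f 1 ^ 2 * w) • (fun r => f (r + a)) - (fun r => f (r + a)) ^ 3) * D -
    f 1 • ((fun r => f (r + a)) ^ 2 * D * fun r => g (r + a)), sub_mem (mul_mem (sub_mem (Subalgebra.smul_mem _ hf _) (pow_mem hf 3)) hD)
    (Subalgebra.smul_mem _ (mul_mem (mul_mem (pow_mem hf 2) hD) hg) _), fun r => ?_⟩
  have h1 := T.add (r + a) 1
  have h2 := hD' r
  simp only [show r + 1 + a = r + a + 1 by ring, Pi.smul_apply, Pi.sub_apply, Pi.mul_apply, Pi.pow_apply, smul_eq_mul]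
  set y := f (r + a)
  set x := f 1
  rw [hw] at h1
  linear_combination -D r * h1 + (-f (r + a + 1) + y + x * g (r + a)) * h2

theorem der_g (T : LemnTor res κ f g) (e : ZMod p → ZMod p → R) (a : ZMod p) :
    Der (f 1) (Algebra.adjoin R (alg f g e)) (fun r => g (r + a)) (-2 * (fun r => f (r + a)) ^ 3) := by
  obtain ⟨w, hw⟩ := T.exists_g_one
  obtain ⟨D, hD, hD'⟩ := T.exists_denom e a
  have hf := mem_f (f := f) (g := g) (e := e) a
  have hg := mem_g (f := f) (g := g) (e := e) a
  have h2m : (-2 : ZMod p → R) ∈ Algebra.adjoin R (alg f g e) := neg_mem (ofNat_mem _ 2)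
  refine ⟨hg, mul_mem h2m (pow_mem hf 3), D ^ 2 * ((f 1 ^ 2 * w) • (fun r => g (r + a)) - g 1 • ((fun r => g (r + a)) * (fun r => f (r + a)) ^ 2) +
    f 1 • (-2 * fun r => f (r + a))) - (fun r => f (r + a)) ^ 2 * D * (1 + D) * ((fun r => g (r + a)) + f 1 • (-2 * (fun r => f (r + a)) ^ 3)),
    sub_mem (mul_mem (pow_mem hD 2) (add_mem (sub_mem (Subalgebra.smul_mem _ hg _) (Subalgebra.smul_mem _ (mul_mem hg (pow_mem hf 2)) _))
      (Subalgebra.smul_mem _ (mul_mem h2m hf) _))) (mul_mem (mul_mem (mul_mem (pow_mem hf 2) hD) (add_mem (one_mem _) hD))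
      (add_mem hg (Subalgebra.smul_mem _ (mul_mem h2m (pow_mem hf 3)) _))), fun r => ?_⟩
  have h1 := T.add_cos (r + a) 1
  have h2 := hD' r
  simp only [show r + 1 + a = r + a + 1 by ring, Pi.smul_apply, Pi.sub_apply, Pi.mul_apply, Pi.pow_apply, Pi.add_apply, Pi.neg_apply, Pi.ofNat_apply, smul_eq_mul]
  set y := f (r + a)
  set x := f 1
  set G := g (r + a + 1)
  have e1 : D r ^ 2 = 1 - x ^ 2 * y ^ 2 * D r * (1 + D r) := by linear_combination (1 + D r) * h2
  have e2 : G = D r ^ 2 * (g (r + a) * g 1 * (1 - y ^ 2 * x ^ 2) - 2 * y * x * (y ^ 2 + x ^ 2)) := by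
    linear_combination (D r ^ 2) * h1 - G * ((1 + x ^ 2 * y ^ 2) * D r + 1) * h2
  rw [e2]
  have e3 : g (r + a) * g 1 * (1 - y ^ 2 * x ^ 2) - 2 * y * x * (y ^ 2 + x ^ 2) =
    (g (r + a) - 2 * x * y ^ 3) + x ^ 2 * (x ^ 2 * w * g (r + a) - g 1 * (g (r + a) * y ^ 2) + x * (-2 * y)) := by
    linear_combination g (r + a) * hw
  rw [e3]
  linear_combination (g (r + a) - 2 * x * y ^ 3) * e1

theorem exists_quot (T : LemnTor res κ f g) (r : ZMod p) : ∃ c, f r = f 1 * c ∧ res c = κ r := by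
  obtain ⟨-, -, u, -, h⟩ := T.der_f (e := fun _ _ => 1) 0
  simp only [add_zero] at h
  have key : ∀ n : ℕ, ∃ c, f (n : ZMod p) = f 1 * c ∧ res c = (n : F) := by
    intro n
    induction n with
    | zero => exact ⟨0, by simp [T.zero], by simp⟩
    | succ n ih =>
      obtain ⟨c, h1, h2⟩ := ih
      refine ⟨c + (g n + f 1 * u n), ?_, ?_⟩
      · rw [Nat.cast_succ, h n, h1]; ring
      · rw [map_add, map_add, map_mul, T.res_g, T.res_f, h2]; simp
  obtain ⟨c, h1, h2⟩ := key r.val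
  rw [ZMod.natCast_zmod_val] at h1
  exact ⟨c, h1, by rw [h2, ← map_natCast κ, ZMod.natCast_zmod_val]⟩

theorem lemnAlg (T : LemnTor res κ f g) {X : ZMod p → R} (hp : f 1 ^ (p - 1) ∣ (p : R))
    (he : ∀ a r, e a (r + 1) = e a r + f 1 * (X a * e a r)) (hr : ∀ a r, res (e a r) = 1) (a : ZMod p) :
    LemnAlg res κ (f 1) (X a) (Algebra.adjoin R (alg f g e)) f g (e a) := by
  have df := T.der_f e 0
  have dg := T.der_g e 0
  simp only [add_zero] at df dg
  have de : ∀ a, Der (f 1) (Algebra.adjoin R (alg f g e)) (e a) (X a • e a) := fun a =>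
    ⟨mem_e a, Subalgebra.smul_mem _ (mem_e a) _, 0, zero_mem _, fun r => by simp [he]⟩
  have hcl : ∀ h k, Der (f 1) (Algebra.adjoin R (alg f g e)) h k → ∃ h' ∈ Algebra.adjoin R (alg f g e), ∀ r, h (r + 1) = h r + f 1 * h' r := by
    rintro h k ⟨-, hk, u, hu, h1⟩
    exact ⟨k + f 1 • u, add_mem hk (Subalgebra.smul_mem _ hu _), h1⟩
  refine { ne := T.ne, res_eq := T.res_f 1, dvd := hp, closed := diffClosed_adjoin ?_, df := df, dg := dg, de := de a, sq := ?_, res_f := T.exists_quot, res_g := T.res_g, res_e := hr a }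
  · rintro h ⟨b, rfl | rfl | rfl⟩
    exacts [hcl _ _ (T.der_f e b), hcl _ _ (T.der_g e b), hcl _ _ (de b)]
  · funext r
    simpa using T.sq r

end LemnTor
end

end

section
open Filter Topology Set

namespace PrimaryPrime
variable {p : ℕ} {π d : ℂ} {j : ℤ} [Fact p.Prime] {T : Finset (ZMod p)} {X : MulChar (ZMod p) ℂ}

/-- The values of `φ` at `π`-torsion points, in a valuation ring. -/
def torA (H : PrimaryPrime p π d j) (A : ValuationSubring ℂ) (r : ZMod p) : A := ⟨tor π phi r, H.tor_mem A r⟩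

/-- The values of `φ'` at `π`-torsion points, in a valuation ring. -/
def tordA (H : PrimaryPrime p π d j) (A : ValuationSubring ℂ) (r : ZMod p) : A := ⟨tor π phid r, H.tord_mem A r⟩

theorem residue_eq_zero {A : ValuationSubring ℂ} {a : A} (h : A.valuation a < 1) : IsLocalRing.residue A a = 0 :=
  IsLocalRing.residue_eq_zero_iff _ |>.2 ((A.valuation_lt_one_iff a).2 h)

theorem exists_residueHom (H : PrimaryPrime p π d j) {A : ValuationSubring ℂ} (hv : A.valuation π < 1) :
    ∃ κ : ZMod p →+* IsLocalRing.ResidueField A, ∀ z (hz : IsLat z), IsLocalRing.residue A ⟨z, hz.mem A⟩ = κ (red p j z) := by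
  have h0 : IsLocalRing.residue A ⟨π, H.lat.mem A⟩ = 0 := residue_eq_zero hv
  have hp0 : (p : IsLocalRing.ResidueField A) = 0 := by
    rw [← map_natCast (IsLocalRing.residue A), show ((p : ℕ) : A) = ⟨π, H.lat.mem A⟩ * ⟨_, H.lat_conj.mem A⟩ from Subtype.ext (by simpa using H.norm),
      map_mul, h0, zero_mul]
  have : CharP (IsLocalRing.ResidueField A) p := (CharP.charP_iff_prime_eq_zero H.prime).2 hp0
  refine ⟨ZMod.castHom dvd_rfl _, ?_⟩
  obtain ⟨e, he, hj⟩ := H.cong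
  have hI : IsLocalRing.residue A ⟨I, I_mem A⟩ = (j : IsLocalRing.ResidueField A) := by
    rw [← map_intCast (IsLocalRing.residue A), show ((j : ℤ) : A) = ⟨I, I_mem A⟩ + ⟨π, H.lat.mem A⟩ * ⟨e, he.mem A⟩ from
      Subtype.ext (by push_cast; linear_combination hj), map_add, map_mul, h0, zero_mul, add_zero]
  rintro z ⟨m, n, rfl⟩
  rw [red_mk, show (⟨(m : ℂ) + n * I, IsLat.mem A ⟨m, n, rfl⟩⟩ : A) = (m : A) + (n : A) * ⟨I, I_mem A⟩ from Subtype.ext (by push_cast; rfl)]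
  simp [hI]

theorem valuation_tor_lt (H : PrimaryPrime p π d j) (hT : QuarterSet p j T) {A : ValuationSubring ℂ} (hv : A.valuation π < 1) (r : ZMod p) :
    A.valuation (tor π phi r) < 1 := by
  have h1 : ∃ t ∈ T, A.valuation (tor π phi t) < 1 := by
    by_contra! h
    have h2 := congrArg A.valuation (H.prod_tor_pow hT)
    rw [map_pow, map_prod, Finset.prod_eq_one fun t ht => le_antisymm ((A.valuation_le_one_iff _).2 (H.tor_mem A t)) (h t ht), one_pow] at h2
    exact absurd hv (by rw [← h2]; exact lt_irrefl 1)
  obtain ⟨t, ht, h⟩ := h1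
  have key : ∀ n : ℕ, A.valuation (tor π phi ((n : ZMod p) * t)) < 1 := by
    intro n
    induction n with
    | zero => simp [tor_zero]
    | succ n ih =>
      have h2 := congrArg A.valuation (H.tor_add ((n : ZMod p) * t) t)
      have h4 : A.valuation (tor π phi ((n : ZMod p) * t) ^ 2 * tor π phi t ^ 2) < 1 := by
        rw [map_mul, map_pow, map_pow]
        exact mul_lt_one_of_nonneg_of_lt_one_left zero_le (pow_lt_one₀ zero_le ih (by norm_num)) (pow_lt_one₀ zero_le h (by norm_num)).le
      rw [map_mul, Valuation.map_one_add_of_lt _ h4, mul_one] at h2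
      rw [show ((n + 1 : ℕ) : ZMod p) * t = (n : ZMod p) * t + t by push_cast; ring, ← h2]
      refine Valuation.map_add_lt _ ?_ ?_ <;> rw [map_mul]
      · exact mul_lt_one_of_nonneg_of_lt_one_left zero_le ih ((A.valuation_le_one_iff _).2 (H.tord_mem A _))
      · exact mul_lt_one_of_nonneg_of_lt_one_right ((A.valuation_le_one_iff _).2 (H.tord_mem A _)) zero_le h
  have h3 := key (r * t⁻¹).val
  rwa [ZMod.natCast_zmod_val, inv_mul_cancel_right₀ (hT.ne_zero t ht)] at h3

theorem lemnTor (H : PrimaryPrime p π d j) (hT : QuarterSet p j T) {A : ValuationSubring ℂ} (hv : A.valuation π < 1)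
    (κ : ZMod p →+* IsLocalRing.ResidueField A) : LemnTor (IsLocalRing.residue A) κ (H.torA A) (H.tordA A) := by
  have hf : ∀ a, IsLocalRing.residue A (H.torA A a) = 0 := fun a => residue_eq_zero (H.valuation_tor_lt hT hv a)
  have hadd : ∀ a b, H.tordA A (a + b) * (1 + H.torA A a ^ 2 * H.torA A b ^ 2) ^ 2 =
    H.tordA A a * H.tordA A b * (1 - H.torA A a ^ 2 * H.torA A b ^ 2) - 2 * H.torA A a * H.torA A b * (H.torA A a ^ 2 + H.torA A b ^ 2) :=
    fun a b => Subtype.ext (H.tord_add a b)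
  have hsq : ∀ a, H.tordA A a ^ 2 = 1 - H.torA A a ^ 4 := fun a => Subtype.ext (H.tord_sq a)
  have h2 : (2 : ZMod p) ≠ 0 := H.two_ne
  exact
  { add := fun a b => Subtype.ext (H.tor_add a b)
    add_cos := hadd
    sq := hsq
    neg := fun a => Subtype.ext (H.tor_neg a)
    neg_cos := fun a => Subtype.ext (H.tord_neg a)
    zero := Subtype.ext tor_zero
    ne := fun h => H.tor_ne_zero one_ne_zero (congrArg Subtype.val h)
    res_f := hf
    res_g := fun a => by
      have h3 := congrArg (IsLocalRing.residue A) (hadd (a / 2) (a / 2))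
      have h4 := congrArg (IsLocalRing.residue A) (hsq (a / 2))
      rw [← add_div, ← two_mul, mul_div_cancel_left₀ _ h2] at h3
      simp only [map_mul, map_sub, map_add, map_pow, map_one, hf] at h3 h4
      linear_combination h3 + h4
    two_ne := by rw [← map_ofNat κ, ne_eq, map_eq_zero]; exact h2 }

/-- The additive characters of `ℤ/p`, in a valuation ring. -/
def zetaA (A : ValuationSubring ℂ) (r : ZMod p) : A :=
  ⟨ZMod.stdAddChar r, mem_of_pow_mem A (n := p) (Fact.out : p.Prime).ne_zero (by
    rw [← AddChar.map_nsmul_eq_pow, nsmul_eq_mul, ZMod.natCast_self, zero_mul, AddChar.map_zero_eq_one]; exact A.one_mem)⟩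

theorem zetaA_add (A : ValuationSubring ℂ) (r s : ZMod p) : zetaA A (r + s) = zetaA A r * zetaA A s :=
  Subtype.ext (AddChar.map_add_eq_mul _ r s)

theorem zetaA_zero (A : ValuationSubring ℂ) : zetaA A (0 : ZMod p) = 1 := Subtype.ext (AddChar.map_zero_eq_one _)

theorem zetaA_nat (A : ValuationSubring ℂ) (n : ℕ) : zetaA A (n : ZMod p) = zetaA A (1 : ZMod p) ^ n := by
  induction n with
  | zero => simp [zetaA_zero]
  | succ n ih => rw [Nat.cast_succ, zetaA_add, ih, pow_succ]

theorem residue_zetaA {A : ValuationSubring ℂ} (κ : ZMod p →+* IsLocalRing.ResidueField A) (r : ZMod p) :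
    IsLocalRing.residue A (zetaA A r) = 1 := by
  have := charP_of_injective_ringHom κ.injective p
  have h : IsLocalRing.residue A (zetaA A r) ^ p = 1 := by
    rw [← map_pow, ← ZMod.natCast_zmod_val r, zetaA_nat, ← pow_mul, mul_comm, pow_mul, ← zetaA_nat, ZMod.natCast_self, zetaA_zero, one_pow, map_one]
  have h2 : (IsLocalRing.residue A (zetaA A r) - 1) ^ p = 0 := by rw [sub_pow_char, h, one_pow, sub_self]
  exact sub_eq_zero.1 (pow_eq_zero_iff (Fact.out : p.Prime).ne_zero |>.1 h2)

theorem exists_zetaA_sub_one {A : ValuationSubring ℂ} (κ : ZMod p →+* IsLocalRing.ResidueField A) (r : ZMod p) :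
    ∃ s, zetaA A r - 1 = (zetaA A (1 : ZMod p) - 1) * s ∧ IsLocalRing.residue A s = κ r := by
  refine ⟨∑ i ∈ Finset.range r.val, zetaA A (1 : ZMod p) ^ i, ?_, ?_⟩
  · rw [mul_geom_sum, ← zetaA_nat, ZMod.natCast_zmod_val]
  · simp only [map_sum, map_pow, residue_zetaA κ, one_pow, Finset.sum_const, Finset.card_range, nsmul_eq_mul, mul_one]
    rw [← map_natCast κ, ZMod.natCast_zmod_val]

theorem prod_erase_zero : ∏ a ∈ Finset.univ.erase (0 : ZMod p), a = -1 := by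
  have hp := (Fact.out : p.Prime).pos
  rw [← ZMod.wilsons_lemma p, ← Finset.prod_range_add_one_eq_factorial, Nat.cast_prod]
  symm
  refine Finset.prod_nbij' (fun k => ((k + 1 : ℕ) : ZMod p)) (fun a => a.val - 1) (fun k hk => ?_) (fun a ha => ?_) (fun k hk => ?_) (fun a ha => ?_)
    fun k _ => rfl
  · rw [Finset.mem_range] at hk
    rw [Finset.mem_erase, ne_eq, ZMod.natCast_eq_zero_iff]
    exact ⟨fun h => by have := Nat.le_of_dvd (by omega) h; omega, Finset.mem_univ _⟩
  · have := a.val_lt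
    have h0 := (ZMod.val_ne_zero a).2 (Finset.ne_of_mem_erase ha)
    rw [Finset.mem_range]; omega
  · rw [Finset.mem_range] at hk
    rw [ZMod.val_cast_of_lt (by omega)]; rfl
  · have h0 := (ZMod.val_ne_zero a).2 (Finset.ne_of_mem_erase ha)
    rw [Nat.sub_add_cancel (by omega), ZMod.natCast_zmod_val]

theorem exists_eq_pow_mul {A : ValuationSubring ℂ} (κ : ZMod p →+* IsLocalRing.ResidueField A) :
    ∃ w, (p : A) = (zetaA A (1 : ZMod p) - 1) ^ (p - 1) * w ∧ IsLocalRing.residue A w = -1 := by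
  have hp := (Fact.out : p.Prime).pos
  have hζ : IsPrimitiveRoot (ZMod.stdAddChar (1 : ZMod p)) p := by
    have h := Complex.isPrimitiveRoot_exp p hp.ne'
    rwa [show exp (2 * Real.pi * I / p) = ZMod.stdAddChar (1 : ZMod p) by simpa using (ZMod.stdAddChar_coe (N := p) 1).symm] at h
  choose s hs hs' using fun r => exists_zetaA_sub_one κ r
  have h1 := (show IsPrimitiveRoot (ZMod.stdAddChar (1 : ZMod p)) (p - 1 + 1) by
    generalize ZMod.stdAddChar (1 : ZMod p) = z at hζ; rwa [Nat.sub_add_cancel hp]).prod_one_sub_pow_eq_order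
  refine ⟨∏ k ∈ Finset.range (p - 1), -s ((k + 1 : ℕ) : ZMod p), ?_, ?_⟩
  · have h2 : (zetaA A (1 : ZMod p) - 1) ^ (p - 1) * ∏ k ∈ Finset.range (p - 1), -s ((k + 1 : ℕ) : ZMod p) =
        ∏ k ∈ Finset.range (p - 1), (1 - zetaA A (1 : ZMod p) ^ (k + 1)) := by
      rw [← Finset.card_range (p - 1), ← Finset.prod_const, Finset.card_range, ← Finset.prod_mul_distrib]
      refine Finset.prod_congr rfl fun k _ => ?_
      rw [← zetaA_nat]
      linear_combination hs ((k + 1 : ℕ) : ZMod p)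
    rw [h2]
    refine Subtype.ext ?_
    push_cast
    rw [Nat.cast_sub hp, Nat.cast_one, sub_add_cancel] at h1
    exact h1.symm
  · rw [map_prod]
    simp only [map_neg, hs', Finset.prod_neg, ← map_prod, Finset.card_range]
    rw [← Nat.cast_prod, Finset.prod_range_add_one_eq_factorial, ZMod.wilsons_lemma, map_neg, map_one]
    have h2 : ((-1 : ZMod p)) ^ (p - 1) = 1 := ZMod.pow_card_sub_one_eq_one (by simp)
    have h3 := congrArg κ h2
    rw [map_pow, map_neg, map_one] at h3
    rw [h3, one_mul]

theorem prod_quarter_pow (H : PrimaryPrime p π d j) (hT : QuarterSet p j T) : (∏ t ∈ T, t) ^ 4 = (-1 : ZMod p) := by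
  have h3 : ∏ t ∈ T, (-1 : ZMod p) = 1 := by
    rw [Finset.prod_const, hT.card_eq H, (H.even_div_four).neg_one_pow]
  rw [← prod_erase_zero (p := p), hT.prod_eq H, ← one_mul ((∏ t ∈ T, t) ^ 4), ← h3, ← Finset.prod_pow, ← Finset.prod_mul_distrib]
  refine Finset.prod_congr rfl fun t _ => ?_
  simp only [Finset.prod_range_succ, Finset.prod_range_zero]
  linear_combination (-(j : ZMod p) ^ 4 + j ^ 2 - 1) * t ^ 4 * H.sq_j

theorem exists_pi_eq (H : PrimaryPrime p π d j) (hT : QuarterSet p j T) {A : ValuationSubring ℂ}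
    (κ : ZMod p →+* IsLocalRing.ResidueField A) (h : ∀ r, ∃ c, H.torA A r = H.torA A 1 * c ∧ IsLocalRing.residue A c = κ r) :
    ∃ u, (⟨π, H.lat.mem A⟩ : A) = H.torA A 1 ^ (p - 1) * u ∧ IsLocalRing.residue A u = -1 := by
  choose c hc hc' using h
  have hk := hT.card_eq H
  have h8 := H.mod8
  refine ⟨(∏ t ∈ T, c t) ^ 4, ?_, ?_⟩
  · refine Subtype.ext ?_
    rw [show (p - 1) = (p - 1) / 4 * 4 by omega, pow_mul, ← mul_pow, ← hk, ← Finset.prod_const, ← Finset.prod_mul_distrib]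
    simp only [← hc]
    push_cast
    exact (H.prod_tor_pow hT).symm
  · rw [map_pow, map_prod]
    simp only [hc']
    rw [← map_prod, ← map_pow, H.prod_quarter_pow hT, map_neg, map_one]

end PrimaryPrime

end

section
open Filter Topology Set

theorem sum_pow_mul_choose {p : ℕ} [Fact p.Prime] (n i : ℕ) :
    (n + i < p - 1 → ∑ a : ZMod p, a ^ n * (i.factorial : ZMod p) * (a.val.choose i : ZMod p) = 0) ∧
    (n + i = p - 1 → ∑ a : ZMod p, a ^ n * (i.factorial : ZMod p) * (a.val.choose i : ZMod p) = -1) := by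
  have h : ∀ a : ZMod p, a ^ n * (i.factorial : ZMod p) * (a.val.choose i : ZMod p) =
      (Polynomial.X ^ n * descPochhammer (ZMod p) i).eval a := fun a => by
    have := descPochhammer_eval_eq_descFactorial (ZMod p) a.val i
    rw [ZMod.natCast_zmod_val] at this
    rw [Polynomial.eval_mul, this, Nat.descFactorial_eq_factorial_mul_choose]
    simp [mul_assoc]
  simp_rw [h]
  have hm : (Polynomial.X ^ n * descPochhammer (ZMod p) i).Monic := (Polynomial.monic_X_pow n).mul (monic_descPochhammer _ i)
  have hd : (Polynomial.X ^ n * descPochhammer (ZMod p) i).natDegree = n + i := by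
    rw [(Polynomial.monic_X_pow n).natDegree_mul (monic_descPochhammer _ i), Polynomial.natDegree_X_pow, descPochhammer_natDegree]
  exact ⟨fun h1 => sum_eval_of_natDegree_lt (by rwa [hd]), fun h1 => sum_eval_of_monic hm (by rw [hd, h1])⟩

theorem exists_one_add_pow {R : Type*} [CommRing R] (y : R) (k n : ℕ) :
    ∃ c, (1 + y) ^ n = ∑ i ∈ Finset.range (k + 1), (n.choose i : R) * y ^ i + y ^ (k + 1) * c := by
  refine ⟨∑ i ∈ Finset.range (n - k), (n.choose (k + 1 + i) : R) * y ^ i, ?_⟩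
  have h1 : (1 + y) ^ n = ∑ i ∈ Finset.range (k + 1 + (n - k)), (n.choose i : R) * y ^ i := by
    rw [add_comm, add_pow]
    simp only [one_pow, mul_one]
    rw [← Finset.sum_subset (Finset.range_subset_range.2 (show n + 1 ≤ k + 1 + (n - k) by omega))]
    · exact Finset.sum_congr rfl fun i _ => mul_comm _ _
    · intro i _ hi
      rw [Finset.mem_range, not_lt] at hi
      rw [Nat.choose_eq_zero_of_lt (by omega), Nat.cast_zero, zero_mul]
  rw [h1, Finset.sum_range_add, Finset.mul_sum]
  congr 1
  exact Finset.sum_congr rfl fun i _ => by ring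

/-- An eighth root of unity that reduces to `1` is `1`. -/
theorem eq_one_of_residue {R F : Type*} [CommRing R] [IsDomain R] [Field F] (res : R →+* F) (h2 : (2 : F) ≠ 0) {z : R}
    (hz : z ^ 8 = 1) (h : res z = 1) : z = 1 := by
  have h1 : (z - 1) * ((z + 1) * (z ^ 2 + 1) * (z ^ 4 + 1)) = 0 := by linear_combination hz
  rcases mul_eq_zero.1 h1 with h1 | h1
  · exact sub_eq_zero.1 h1
  · have := congrArg res h1
    simp only [map_mul, map_add, map_pow, map_one, map_zero, h, one_pow, one_add_one_eq_two] at this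
    exact absurd this (by simp [h2])

namespace PrimaryPrime
variable {p : ℕ} {π d : ℂ} {j : ℤ} [Fact p.Prime] {T : Finset (ZMod p)} {X : MulChar (ZMod p) ℂ} {A : ValuationSubring ℂ}

/-- The ratio of `ζ_p - 1` and `φ(1/π)` is integral at `π`. -/
theorem exists_scale (H : PrimaryPrime p π d j) (hT : QuarterSet p j T) (hv : A.valuation π < 1)
    {κ : ZMod p →+* IsLocalRing.ResidueField A} (hκ : ∀ z (hz : IsLat z), IsLocalRing.residue A ⟨z, hz.mem A⟩ = κ (red p j z)) :
    ∃ ρ : A, zetaA A (1 : ZMod p) - 1 = H.torA A 1 * ρ ∧ IsLocalRing.residue A ρ ^ (p - 1) = κ (red p j ((starRingEnd ℂ) π)) := by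
  have TT := H.lemnTor hT hv κ
  obtain ⟨u, hu, hu'⟩ := H.exists_pi_eq hT κ TT.exists_quot
  obtain ⟨w, hw, hw'⟩ := exists_eq_pow_mul (A := A) κ
  have hx : tor π phi (1 : ZMod p) ≠ 0 := fun h => TT.ne (Subtype.ext h)
  have hp1 : p - 1 ≠ 0 := by have := H.prime.two_le; omega
  have hwu : IsUnit w := isUnit_of_map_unit (IsLocalRing.residue A) w (by rw [hw']; exact isUnit_one.neg)
  obtain ⟨w₁, hw₁⟩ := hwu.exists_right_inv
  have hpp : (p : A) = ⟨π, H.lat.mem A⟩ * ⟨_, H.lat_conj.mem A⟩ := Subtype.ext (by simpa using H.norm)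
  have hy : ((ZMod.stdAddChar (1 : ZMod p) - 1) / tor π phi (1 : ZMod p)) ^ (p - 1) = (u * ⟨_, H.lat_conj.mem A⟩ * w₁ : A) := by
    have h1 : (zetaA A (1 : ZMod p) - 1) ^ (p - 1) = H.torA A 1 ^ (p - 1) * (u * ⟨_, H.lat_conj.mem A⟩ * w₁) := by
      rw [hu] at hpp
      linear_combination -(zetaA A (1 : ZMod p) - 1) ^ (p - 1) * hw₁ - w₁ * hw + w₁ * hpp
    rw [div_pow, div_eq_iff (pow_ne_zero _ hx), mul_comm]
    exact congrArg Subtype.val h1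
  have hm : (ZMod.stdAddChar (1 : ZMod p) - 1) / tor π phi (1 : ZMod p) ∈ A :=
    mem_of_pow_mem A hp1 (by rw [hy]; exact Subtype.property _)
  refine ⟨⟨_, hm⟩, Subtype.ext (mul_div_cancel₀ _ hx).symm, ?_⟩
  rw [← map_pow, show (⟨_, hm⟩ : A) ^ (p - 1) = u * ⟨_, H.lat_conj.mem A⟩ * w₁ from Subtype.ext hy, map_mul, map_mul, hu', hκ _ H.lat_conj]
  have := congrArg (IsLocalRing.residue A) hw₁
  rw [map_mul, hw', map_one] at this
  linear_combination κ (red p j ((starRingEnd ℂ) π)) * this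

/-- Stickelberger's congruence for the quartic Gauss sum. -/
theorem gaussSum_eq (H : PrimaryPrime p π d j) (hT : QuarterSet p j T) (hX : QuarticChar p j X) (hv : A.valuation π < 1)
    {κ : ZMod p →+* IsLocalRing.ResidueField A} (hκ : ∀ z (hz : IsLat z), IsLocalRing.residue A ⟨z, hz.mem A⟩ = κ (red p j z))
    {ρ : A} (hρ : zetaA A (1 : ZMod p) - 1 = H.torA A 1 * ρ) :
    ∃ c : A, gaussSum X⁻¹ ZMod.stdAddChar = tor π phi (1 : ZMod p) ^ ((p - 1) / 4) * c ∧
      ((((p - 1) / 4).factorial : ℕ) : IsLocalRing.ResidueField A) * IsLocalRing.residue A c = -IsLocalRing.residue A ρ ^ ((p - 1) / 4) := by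
  have TT := H.lemnTor hT hv κ
  obtain ⟨u, hu, hu'⟩ := H.exists_pi_eq hT κ TT.exists_quot
  have h8 := H.mod8
  have hp := H.prime.two_le
  set k := (p - 1) / 4 with hk
  have hpk : p - 1 = 4 * k := by omega
  have hXl : ∀ a, IsLat (X⁻¹ a) := fun a => by rw [← conj_mulChar]; exact isLat_conj (hX.lat a)
  have hXr : ∀ a, red p j (X⁻¹ a) = a ^ (3 * k) := fun a => by
    by_cases ha : a = 0
    · rw [ha, MulChar.map_zero, red_zero, zero_pow (by omega)]
    · have h1 : X⁻¹ a = X a ^ 3 := by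
        have h2 : X⁻¹ a * X a = 1 := by
          rw [← MulChar.mul_apply, inv_mul_cancel, MulChar.one_apply (isUnit_iff_ne_zero.2 ha)]
        linear_combination -X⁻¹ a * hX.pow_four a ha + X a ^ 3 * h2
      rw [h1, H.red_pow (hX.lat a), H.red_X hX, ← pow_mul, mul_comm]
  have hSl : ∀ i, IsLat (∑ a : ZMod p, X⁻¹ a * (a.val.choose i : ℂ)) := fun i => isLat_sum fun a _ => (hXl a).mul (isLat_nat _)
  have hSr : ∀ i, (i.factorial : ZMod p) * red p j (∑ a : ZMod p, X⁻¹ a * (a.val.choose i : ℂ)) =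
      ∑ a : ZMod p, a ^ (3 * k) * (i.factorial : ZMod p) * (a.val.choose i : ZMod p) := fun i => by
    rw [red_sum fun a _ => (hXl a).mul (isLat_nat _), Finset.mul_sum]
    refine Finset.sum_congr rfl fun a _ => ?_
    rw [H.red_mul (hXl a) (isLat_nat _), hXr, red_nat]; ring
  set S : ℕ → A := fun i => ⟨_, (hSl i).mem A⟩ with hS
  set x := H.torA A 1
  have hSpi : ∀ i < k, ∃ s, S i = x ^ (4 * k) * s := fun i hi => by
    have h1 := (sum_pow_mul_choose (p := p) (3 * k) i).1 (by omega)
    rw [← hSr] at h1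
    have h2 : (i.factorial : ZMod p) ≠ 0 := by
      rw [ne_eq, ZMod.natCast_eq_zero_iff, H.prime.dvd_factorial]; omega
    obtain ⟨e, he, h3⟩ := (H.red_eq_zero_iff (hSl i)).1 ((mul_eq_zero.1 h1).resolve_left h2)
    refine ⟨u * ⟨e, he.mem A⟩, ?_⟩
    rw [← mul_assoc, ← hpk, ← hu]
    exact Subtype.ext h3
  have hSk : (k.factorial : IsLocalRing.ResidueField A) * IsLocalRing.residue A (S k) = -1 := by
    have h1 := (sum_pow_mul_choose (p := p) (3 * k) k).2 (by omega)
    rw [← hSr] at h1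
    rw [hκ _ (hSl k), ← map_natCast κ, ← map_mul, h1, map_neg, map_one]
  choose s hs using fun i : ℕ => (if h : i < k then ⟨(hSpi i h).choose, fun _ => (hSpi i h).choose_spec⟩ else ⟨0, fun h' => absurd h' h⟩ :
    ∃ s, i < k → S i = x ^ (4 * k) * s)
  choose R hR using fun a : ZMod p => exists_one_add_pow (zetaA A (1 : ZMod p) - 1) k a.val
  let XA : ZMod p → A := fun a => ⟨_, (hXl a).mem A⟩
  have hg : ∑ a, XA a * zetaA A a = ∑ i ∈ Finset.range (k + 1), S i * (x * ρ) ^ i + (x * ρ) ^ (k + 1) * ∑ a, XA a * R a := by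
    have h1 : ∀ a : ZMod p, zetaA A a = ∑ i ∈ Finset.range (k + 1), (a.val.choose i : A) * (x * ρ) ^ i + (x * ρ) ^ (k + 1) * R a := fun a => by
      rw [← hρ, ← hR a, add_sub_cancel, ← zetaA_nat, ZMod.natCast_zmod_val]
    have h2 : ∀ i, S i = ∑ a, XA a * (a.val.choose i : A) := fun i => Subtype.ext (by simp [hS, XA])
    simp only [h1, h2, mul_add, Finset.sum_add_distrib, Finset.mul_sum, Finset.sum_mul]
    rw [Finset.sum_comm]
    refine congrArg₂ _ ?_ ?_
    · exact Finset.sum_congr rfl fun i _ => Finset.sum_congr rfl fun a _ => by ring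
    · exact Finset.sum_congr rfl fun a _ => by ring
  refine ⟨x * (x ^ (3 * k - 1) * ∑ i ∈ Finset.range k, s i * (x * ρ) ^ i) + S k * ρ ^ k + x * (ρ ^ (k + 1) * ∑ a, XA a * R a), ?_, ?_⟩
  · have h1 : gaussSum X⁻¹ ZMod.stdAddChar = ((∑ a, XA a * zetaA A a : A) : ℂ) := by
      simp [gaussSum, XA, zetaA]
    rw [h1]
    refine congrArg Subtype.val (a₂ := x ^ k * (_ : A)) ?_
    have h2 : ∑ i ∈ Finset.range k, S i * (x * ρ) ^ i = x ^ (4 * k) * ∑ i ∈ Finset.range k, s i * (x * ρ) ^ i := by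
      rw [Finset.mul_sum]
      exact Finset.sum_congr rfl fun i hi => by rw [hs i (Finset.mem_range.1 hi)]; ring
    have h3 : x ^ (4 * k) = x ^ k * (x * x ^ (3 * k - 1)) := by
      rw [← pow_succ', ← pow_add]; congr 1; omega
    rw [hg, Finset.sum_range_succ, h2, h3]
    ring
  · rw [map_add, map_add, map_mul, map_mul _ x, TT.res_f 1, zero_mul, zero_mul, zero_add, add_zero, map_mul, map_pow]
    linear_combination IsLocalRing.residue A ρ ^ k * hSk

end PrimaryPrime

end

section
open Filter Topology Set

namespace PrimaryPrime
variable {p : ℕ} {π d : ℂ} {j : ℤ} [Fact p.Prime] {T : Finset (ZMod p)} {X : MulChar (ZMod p) ℂ} {A : ValuationSubring ℂ}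

theorem conj_tor_mem (H : PrimaryPrime p π d j) (A : ValuationSubring ℂ) (a : ZMod p) : (starRingEnd ℂ) (tor π phi a) ∈ A :=
  H.tor_mem (A.comap (starRingEnd ℂ)) a

theorem four_pow_div_four (H : PrimaryPrime p π d j) : (4 : ZMod p) ^ ((p - 1) / 4) = 1 := by
  have h8 := H.mod8
  have h1 : (4 : ZMod p) = -(1 - j) ^ 4 := by linear_combination (-4 * (j : ZMod p) + 5 + j ^ 2) * H.sq_j
  rw [h1, neg_pow, (H.even_div_four).neg_one_pow, one_mul, ← pow_mul, show 4 * ((p - 1) / 4) = p - 1 by omega]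
  exact ZMod.pow_card_sub_one_eq_one H.one_sub_j_ne

theorem injOn_pow_four (H : PrimaryPrime p π d j) (hT : QuarterSet p j T) {s t : ZMod p} (hs : s ∈ T) (ht : t ∈ T) (h : s ^ 4 = t ^ 4) : s = t := by
  have h1 : (s - t) * ((s - j ^ 2 * t) * ((s - j * t) * (s - j ^ 3 * t))) = 0 := by
    have e := H.sq_j
    have e3 : (j : ZMod p) ^ 3 = -j := by linear_combination (j : ZMod p) * e
    rw [e, e3]
    linear_combination h + (s ^ 2 * t ^ 2 - t ^ 4) * (-1) * e
  have key : ∀ e < 4, s - (j : ZMod p) ^ e * t = 0 → s = t := fun e he h2 =>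
    (hT.unique s hs t ht 0 (by norm_num) e he (by linear_combination h2)).1
  rcases mul_eq_zero.1 h1 with h2 | h2
  · exact sub_eq_zero.1 h2
  · rcases mul_eq_zero.1 h2 with h2 | h2
    · exact key 2 (by norm_num) h2
    · rcases mul_eq_zero.1 h2 with h2 | h2
      · exact key 1 (by norm_num) (by simpa using h2)
      · exact key 3 (by norm_num) h2

/-- The congruence for the complex conjugate of a product over a quarter set. -/
theorem residue_prod_conj (H : PrimaryPrime p π d j) (hT : QuarterSet p j T) (hX : QuarticChar p j X) (hv : A.valuation π < 1)
    {κ : ZMod p →+* IsLocalRing.ResidueField A}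
    {ρ : A} (hρ : zetaA A (1 : ZMod p) - 1 = H.torA A 1 * ρ)
    (hρ' : IsLocalRing.residue A ρ ^ (p - 1) = κ (red p j ((starRingEnd ℂ) π))) {Φ M : A}
    (hΦ : (Φ : ℂ) = (starRingEnd ℂ) (∏ t ∈ T, tor π phi t)) (hM : (M : ℂ) = (starRingEnd ℂ) (X (red p j ((starRingEnd ℂ) π))⁻¹)) :
    IsLocalRing.residue A M * IsLocalRing.residue A Φ = -(-1) ^ ((p - 1) / 8) * ((((p - 1) / 4).factorial : ℕ) : IsLocalRing.ResidueField A) *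
      κ (∏ t ∈ T, t) ^ 3 * IsLocalRing.residue A ρ ^ (3 * ((p - 1) / 4)) := by
  have TT := H.lemnTor hT hv κ
  obtain ⟨u, hu, hu'⟩ := H.exists_pi_eq hT κ TT.exists_quot
  have h8 := H.mod8
  have hp2 := H.prime.two_le
  set l := (p - 1) / 8 with hl
  have hpl : p = 8 * l + 1 := by omega
  rw [show (p - 1) / 4 = 2 * l by omega]
  set μ := (red p j ((starRingEnd ℂ) π))⁻¹ with hμ
  have hρ0 : IsLocalRing.residue A ρ ≠ 0 := by
    intro h0
    rw [h0, zero_pow (by omega)] at hρ'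
    exact H.red_conj_ne ((map_eq_zero κ).1 hρ'.symm)
  choose s hs hs' using fun r => exists_zetaA_sub_one (A := A) κ r
  have hpd : H.torA A 1 ^ (p - 1) ∣ (p : A) := by
    refine ⟨u * ⟨_, H.lat_conj.mem A⟩, ?_⟩
    rw [← mul_assoc, ← hu]
    exact Subtype.ext (by simpa using H.norm)
  have D : ∀ a, LemnAlg (IsLocalRing.residue A) κ (H.torA A 1) (ρ * s a) (Algebra.adjoin A (LemnTor.alg (H.torA A) (H.tordA A) fun a r => zetaA A (a * r)))
      (H.torA A) (H.tordA A) (fun r => zetaA A (a * r)) := fun a =>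
    TT.lemnAlg (X := fun a => ρ * s a) (e := fun a r => zetaA A (a * r)) hpd (fun a r => by
      rw [mul_add, mul_one, zetaA_add]
      linear_combination zetaA A (a * r) * (hs a + s a * hρ)) (fun a r => residue_zetaA κ _) a
  have hsum : ∀ a, resSum (IsLocalRing.residue A) (H.torA A 1) ((fun r => zetaA A (a * r)) * H.torA A ^ 1) =
      IsLocalRing.residue A ⟨_, H.conj_tor_mem A (a * μ)⟩ := fun a => by
    have h1 : ∑ r, ((fun r => zetaA A (a * r)) * H.torA A ^ 1 : ZMod p → A) r = H.torA A 1 ^ (p - 1) * (-u * ⟨_, H.conj_tor_mem A (a * μ)⟩) := by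
      rw [← mul_assoc, mul_neg, ← hu]
      refine Subtype.ext ?_
      have := H.tor_dual a
      simpa [zetaA, torA] using this
    rw [resSum_eq _ TT.ne h1, map_mul, map_neg, hu', neg_neg, one_mul]
  have hcard : T.card = 2 * l := by rw [hT.card_eq H]; omega
  let ε : Fin (2 * l) ≃ T := (T.equivFinOfCardEq hcard).symm
  have hprod : ∀ {M : Type} [CommMonoid M] (F : ZMod p → M), ∏ t : Fin (2 * l), F (ε t) = ∏ t ∈ T, F t := fun F => by
    rw [← Finset.prod_coe_sort T F]
    exact Equiv.prod_comp ε fun t => F t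
  have key := LemnAlg.prod_resSum hpl (fun t => D (ε t)) (fun t t' h => by
    beta_reduce at h
    rw [map_mul, map_mul, hs', hs', mul_pow, mul_pow, ← map_pow κ, ← map_pow κ] at h
    have h2 := κ.injective (mul_left_cancel₀ (pow_ne_zero 4 hρ0) h)
    exact ε.injective (Subtype.ext (H.injOn_pow_four hT (ε t).2 (ε t').2 h2)))
  simp only [hsum] at key
  rw [hprod fun t => IsLocalRing.residue A ⟨_, H.conj_tor_mem A (t * μ)⟩, hprod fun t => IsLocalRing.residue A (ρ * s t) ^ 3] at key
  have hlhs : M * Φ = ∏ t ∈ T, (⟨_, H.conj_tor_mem A (t * μ)⟩ : A) := by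
    refine Subtype.ext ?_
    push_cast
    rw [hM, hΦ, ← map_mul, ← H.gauss hT hX (inv_ne_zero H.red_conj_ne) (tor π phi) H.tor_j_mul, map_prod]
    exact Finset.prod_congr rfl fun t _ => by rw [mul_comm]
  rw [← map_mul, hlhs, map_prod, key]
  have h4 := congrArg κ H.four_pow_div_four
  rw [show (p - 1) / 4 = 2 * l by omega, map_pow, map_ofNat, map_one] at h4
  simp only [map_mul, hs', mul_pow, Finset.prod_mul_distrib, Finset.prod_const, hcard, ← pow_mul, h4, map_prod, Finset.prod_pow]
  ring

end PrimaryPrime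

end

section
open Filter Topology Set

namespace PrimaryPrime
variable {p : ℕ} {π d : ℂ} {j : ℤ} [Fact p.Prime] {T : Finset (ZMod p)} {X : MulChar (ZMod p) ℂ} {A : ValuationSubring ℂ}

/-- The Gauss sum in terms of products over a quarter set. -/
theorem gaussSum_mul_prod (H : PrimaryPrime p π d j) (hT : QuarterSet p j T) (hX : QuarticChar p j X) (hv : A.valuation π < 1)
    {γ g : ℂ} (hγ : γ ^ 4 = -1) (hg : IsLat g) (hgT : red p j g = ∏ t ∈ T, t) (hgγ : A.valuation (γ - g) < 1) :
    gaussSum X⁻¹ ZMod.stdAddChar * (∏ t ∈ T, tor π phi t) ^ 3 =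
      (-1) ^ ((p - 1) / 8) * X (red p j ((starRingEnd ℂ) π))⁻¹ * γ ^ 2 * π * (starRingEnd ℂ) (∏ t ∈ T, tor π phi t) ^ 3 := by
  obtain ⟨κ, hκ⟩ := H.exists_residueHom hv
  have TT := H.lemnTor hT hv κ
  obtain ⟨ρ, hρ, hρ'⟩ := H.exists_scale hT hv hκ
  obtain ⟨τ, hτ, hτ'⟩ := H.gaussSum_eq hT hX hv hκ hρ
  obtain ⟨u, hu, hu'⟩ := H.exists_pi_eq hT κ TT.exists_quot
  choose c hc hc' using TT.exists_quot
  have h8 := H.mod8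
  have hp2 := H.prime.two_le
  set μ := (red p j ((starRingEnd ℂ) π))⁻¹ with hμ
  have hμ0 : μ ≠ 0 := inv_ne_zero H.red_conj_ne
  set Φ := ∏ t ∈ T, tor π phi t with hΦ
  have hΦ4 : Φ ^ 4 = π := H.prod_tor_pow hT
  have hΦ0 : Φ ≠ 0 := fun h => H.ne (by rw [← hΦ4, h]; norm_num)
  have hcΦ4 : (starRingEnd ℂ) Φ ^ 4 = (starRingEnd ℂ) π := by rw [← map_pow, hΦ4]
  have hcΦ0 : (starRingEnd ℂ) Φ ≠ 0 := by simpa using hΦ0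
  have hcπ0 : (starRingEnd ℂ) π ≠ 0 := by simpa using H.ne
  have hγA : γ ∈ A := mem_of_pow_mem A (n := 4) (by norm_num) (by rw [hγ]; exact A.neg_mem _ A.one_mem)
  have hk4 : p - 1 = 4 * ((p - 1) / 4) := by omega
  have hX4 : X μ ^ 4 = 1 := hX.pow_four μ hμ0
  have hXM : X μ * (starRingEnd ℂ) (X μ) = 1 := by
    rw [conj_mulChar, ← MulChar.mul_apply, mul_inv_cancel, MulChar.one_apply (isUnit_iff_ne_zero.2 hμ0)]
  let ΦA : A := ⟨(starRingEnd ℂ) Φ, mem_of_pow_mem A (n := 4) (by norm_num) (by rw [hcΦ4]; exact H.lat_conj.mem A)⟩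
  let γA : A := ⟨γ, hγA⟩
  let XA : A := ⟨X μ, (hX.lat μ).mem A⟩
  let MA : A := ⟨(starRingEnd ℂ) (X μ), (isLat_conj (hX.lat μ)).mem A⟩
  have r1 := H.residue_prod_conj hT hX hv hρ hρ' (Φ := ΦA) (M := MA) rfl rfl
  have rX : IsLocalRing.residue A XA * IsLocalRing.residue A MA = 1 := by
    rw [← map_mul, show XA * MA = 1 from Subtype.ext hXM, map_one]
  have rγ : IsLocalRing.residue A γA = κ (∏ t ∈ T, t) := by
    rw [← hgT, ← hκ g hg, ← sub_eq_zero, ← map_sub]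
    exact residue_eq_zero hgγ
  have rΦ : IsLocalRing.residue A ΦA ^ 4 = IsLocalRing.residue A ρ ^ (4 * ((p - 1) / 4)) := by
    rw [← hk4, hρ', ← hκ _ H.lat_conj, ← map_pow]
    exact congrArg _ (Subtype.ext hcΦ4)
  have rG : κ (∏ t ∈ T, t) ^ 4 = -1 := by rw [← map_pow, H.prod_quarter_pow hT, map_neg, map_one]
  have hρ0 : IsLocalRing.residue A ρ ≠ 0 := fun h0 => by
    rw [h0, zero_pow (by omega)] at hρ'
    exact H.red_conj_ne ((map_eq_zero κ).1 hρ'.symm)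
  have hfac : ((((p - 1) / 4).factorial : ℕ) : IsLocalRing.ResidueField A) ≠ 0 := by
    rw [← map_natCast κ, ne_eq, map_eq_zero, ZMod.natCast_eq_zero_iff, H.prime.dvd_factorial]; omega
  obtain ⟨e, he, hτ4⟩ := H.exists_gaussSum_pow hX
  set θ := gaussSum X⁻¹ ZMod.stdAddChar * Φ ^ 3 / (π * (starRingEnd ℂ) Φ ^ 3) with hθ
  have hθ' : gaussSum X⁻¹ ZMod.stdAddChar * Φ ^ 3 = θ * (π * (starRingEnd ℂ) Φ ^ 3) :=
    (div_mul_cancel₀ _ (mul_ne_zero H.ne (pow_ne_zero 3 hcΦ0))).symm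
  have hθ8 : θ ^ 8 = 1 := by
    have h1 : θ ^ 4 = e ^ 2 := by
      refine mul_right_cancel₀ (mul_ne_zero (pow_ne_zero 4 H.ne) (pow_ne_zero 3 hcπ0)) ?_
      calc θ ^ 4 * (π ^ 4 * (starRingEnd ℂ) π ^ 3) = (θ * (π * (starRingEnd ℂ) Φ ^ 3)) ^ 4 := by rw [← hcΦ4]; ring
        _ = gaussSum X⁻¹ ZMod.stdAddChar ^ 4 * (Φ ^ 4) ^ 3 := by rw [← hθ']; ring
        _ = e ^ 2 * (π ^ 4 * (starRingEnd ℂ) π ^ 3) := by rw [hτ4, hΦ4]; ring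
    linear_combination (θ ^ 4 + e ^ 2) * h1 + he
  let θA : A := ⟨θ, mem_of_pow_mem A (n := 8) (by norm_num) (by rw [hθ8]; exact A.one_mem)⟩
  have hΦc : Φ = (H.torA A 1 ^ ((p - 1) / 4) * ∏ t ∈ T, c t : A) := by
    rw [← hT.card_eq H, ← Finset.prod_const, ← Finset.prod_mul_distrib]
    simp only [← hc]
    push_cast
    rfl
  have hx0 : H.torA A 1 ^ (4 * ((p - 1) / 4)) ≠ 0 := pow_ne_zero _ TT.ne
  have hA : θA * (u * ΦA ^ 3) = τ * (∏ t ∈ T, c t) ^ 3 := by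
    refine mul_left_cancel₀ hx0 ?_
    have h1 : τ * H.torA A 1 ^ ((p - 1) / 4) * (H.torA A 1 ^ ((p - 1) / 4) * ∏ t ∈ T, c t) ^ 3 = θA * (H.torA A 1 ^ (p - 1) * u * ΦA ^ 3) := by
      rw [← hu]
      refine Subtype.ext ?_
      have h2 : gaussSum X⁻¹ ZMod.stdAddChar * Φ ^ 3 = ((τ * H.torA A 1 ^ ((p - 1) / 4) * (H.torA A 1 ^ ((p - 1) / 4) * ∏ t ∈ T, c t) ^ 3 : A) : ℂ) := by
        rw [hτ, hΦc]
        push_cast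
        simp only [torA]
        ring
      exact h2.symm.trans hθ'
    have h2 : H.torA A 1 ^ (p - 1) = H.torA A 1 ^ (4 * ((p - 1) / 4)) := by rw [← hk4]
    linear_combination -h1 - θA * u * ΦA ^ 3 * h2
  have rA := congrArg (IsLocalRing.residue A) hA
  simp only [map_mul, map_pow, map_prod, hu', hc'] at rA
  rw [← map_prod] at rA

  have rθ : IsLocalRing.residue A θA = (-1) ^ ((p - 1) / 8) * IsLocalRing.residue A XA * IsLocalRing.residue A γA ^ 2 := by
    rw [rγ]
    refine mul_left_cancel₀ (mul_ne_zero hfac (pow_ne_zero (4 * ((p - 1) / 4)) hρ0)) ?_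
    generalize IsLocalRing.residue A θA = t at *
    generalize IsLocalRing.residue A ΦA = y at *
    generalize IsLocalRing.residue A XA = z at *
    generalize IsLocalRing.residue A MA = m at *
    generalize IsLocalRing.residue A ρ = q at *
    generalize κ (∏ t ∈ T, t) = w at *
    generalize IsLocalRing.residue A τ = v at *
    generalize ((((p - 1) / 4).factorial : ℕ) : IsLocalRing.ResidueField A) = f at *
    generalize (-1 : IsLocalRing.ResidueField A) ^ ((p - 1) / 8) = s at *
    generalize (p - 1) / 4 = k at *
    rw [← rΦ]
    linear_combination (exp := 1) (-f * y) * rA - y * w ^ 3 * hτ' - q ^ k * w ^ 3 * y * rX + q ^ k * w ^ 3 * z * r1 - f * w ^ 2 * z * s * rΦ - f * w ^ 2 * z * s * q ^ (4 * k) * rG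
  have hq8 : ((-1) ^ ((p - 1) / 8) * X μ * γ ^ 2) ^ 8 = 1 := by
    have h1 : ((-1 : ℂ) ^ ((p - 1) / 8)) ^ 8 = 1 := by rw [← pow_mul, mul_comm, pow_mul]; norm_num
    rw [mul_pow, mul_pow, h1, show X μ ^ 8 = (X μ ^ 4) ^ 2 by ring, hX4, show (γ ^ 2) ^ 8 = (γ ^ 4) ^ 4 by ring, hγ]
    norm_num
  have hone := eq_one_of_residue (IsLocalRing.residue A) TT.two_ne (z := θA * ((-1) ^ ((p - 1) / 8) * XA * γA ^ 2) ^ 7) ?_ ?_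
  · have h1 : θ * ((-1) ^ ((p - 1) / 8) * X μ * γ ^ 2) ^ 7 = 1 := by simpa using congrArg Subtype.val hone
    rw [hθ', show θ = (-1) ^ ((p - 1) / 8) * X μ * γ ^ 2 by
      linear_combination ((-1) ^ ((p - 1) / 8) * X μ * γ ^ 2) * h1 - θ * hq8]
    ring
  · refine Subtype.ext ?_
    push_cast
    rw [mul_pow, ← pow_mul, mul_comm 7 8, pow_mul, hθ8, one_mul]
    exact (congrArg (· ^ 7) hq8).trans (one_pow 7)
  · have h1 := congrArg (IsLocalRing.residue A) (show ((-1) ^ ((p - 1) / 8) * XA * γA ^ 2) ^ 8 = 1 from Subtype.ext (by simpa using hq8))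
    rw [map_one] at h1
    rw [← h1]
    simp only [map_mul, map_pow, map_neg, map_one, rθ]
    ring

/-- The functional equation for the coefficient of the elliptic Gauss sum. -/
theorem coeff_eq (H : PrimaryPrime p π d j) (hT : QuarterSet p j T) (hX : QuarticChar p j X) (hv : A.valuation π < 1)
    {γ g : ℂ} (hγ : γ ^ 4 = -1) (hg : IsLat g) (hgT : red p j g = ∏ t ∈ T, t) (hgγ : A.valuation (γ - g) < 1) :
    γ ^ 2 * X (1 - (j : ZMod p)) * (ellSum π X / (∏ t ∈ T, tor π phi t) ^ 3) =
      (starRingEnd ℂ) ((1 + I) / 2 + (1 - I) / 2 * X j) * (starRingEnd ℂ) (ellSum π X / (∏ t ∈ T, tor π phi t) ^ 3) := by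
  have h1 := H.gaussSum_mul_prod hT hX hv hγ hg hgT hgγ
  set μ := (red p j ((starRingEnd ℂ) π))⁻¹ with hμ
  have hμ0 : μ ≠ 0 := inv_ne_zero H.red_conj_ne
  have hm0 : (1 - (j : ZMod p))⁻¹ * μ ≠ 0 := mul_ne_zero (inv_ne_zero H.one_sub_j_ne) hμ0
  have h2 := H.ellSum_dual hX (m := (1 - (j : ZMod p))⁻¹ * μ) (by
    rw [hμ]
    field_simp [H.red_conj_ne, H.one_sub_j_ne])
  have h3 : X μ = X ((1 - (j : ZMod p))⁻¹ * μ) * X (1 - (j : ZMod p)) := by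
    rw [← map_mul, mul_right_comm, inv_mul_cancel₀ H.one_sub_j_ne, one_mul]
  have hXm : X ((1 - (j : ZMod p))⁻¹ * μ) ≠ 0 := fun h => by
    have := hX.pow_four _ hm0
    rw [h] at this
    norm_num at this
  set Φ := ∏ t ∈ T, tor π phi t with hΦ
  have hΦ0 : Φ ≠ 0 := fun h => H.ne (by rw [← H.prod_tor_pow hT, ← hΦ, h]; norm_num)
  have hcΦ0 : (starRingEnd ℂ) Φ ≠ 0 := by simpa using hΦ0
  set b := ellSum π X / Φ ^ 3 with hb
  have hE : ellSum π X = b * Φ ^ 3 := (div_mul_cancel₀ _ (pow_ne_zero 3 hΦ0)).symm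
  rw [hE, map_mul (starRingEnd ℂ) b, map_pow] at h2
  rw [← H.X_j hX, h3] at h1
  have hj : X (j : ZMod p) ^ 2 = 1 := by rcases H.X_j_cases hX with h | h <;> rw [h] <;> norm_num
  refine mul_left_cancel₀ (mul_ne_zero (mul_ne_zero H.ne hXm) (pow_ne_zero 3 hcΦ0)) ?_
  linear_combination h2 - X j * b * h1 - π * X ((1 - (j : ZMod p))⁻¹ * μ) * (starRingEnd ℂ) Φ ^ 3 * γ ^ 2 * X (1 - (j : ZMod p)) * b * hj

end PrimaryPrime

end

section
open Filter Topology Set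

theorem zeta8_mul_sqrt : zeta8 * ((Real.sqrt 2 : ℝ) : ℂ) = 1 + I := by
  have h : zeta8 = ((Real.cos (Real.pi / 4) : ℝ) : ℂ) + ((Real.sin (Real.pi / 4) : ℝ) : ℂ) * I := by
    rw [ofReal_cos, ofReal_sin, ← exp_mul_I, zeta8]
    congr 1
    push_cast
    ring
  have h2 : ((Real.sqrt 2 : ℝ) : ℂ) ^ 2 = 2 := by
    rw [← ofReal_pow, Real.sq_sqrt (by norm_num)]; norm_num
  rw [h, Real.cos_pi_div_four, Real.sin_pi_div_four]
  push_cast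
  linear_combination (1 + I) / 2 * h2

theorem zeta8_sq : zeta8 ^ 2 = I := by
  rw [zeta8, ← exp_nat_mul, show ((2 : ℕ) : ℂ) * (2 * Real.pi * I / 8) = Real.pi / 2 * I by push_cast; ring, exp_pi_div_two_mul_I]

theorem zeta8_mul_conj : zeta8 * (starRingEnd ℂ) zeta8 = 1 := by
  rw [zeta8, ← exp_conj, ← exp_add]
  simp [Complex.conj_ofNat, map_div₀]
  ring_nf
  simp

theorem eq_of_conj_eq {b k : ℂ} (hb : IsLat b) (hk : (starRingEnd ℂ) b = k * b) (hk4 : k ^ 4 = 1) :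
    ∃ a : ℤ, (k = -I → zeta8 * b = a * I * ((Real.sqrt 2 : ℝ) : ℂ)) ∧ (k = I → zeta8 * b = a * ((Real.sqrt 2 : ℝ) : ℂ)) ∧
      (k = 1 → zeta8 * b = a * zeta8) ∧ (k = -1 → zeta8 * b = a * I * zeta8) ∧
      (k ^ 2 = -1 → normSq (zeta8 * b) = 2 * (a : ℝ) ^ 2) ∧ (k ^ 2 = 1 → normSq (zeta8 * b) = (a : ℝ) ^ 2) := by
  obtain ⟨m, n, rfl⟩ := hb
  have hz : normSq zeta8 = 1 := by
    have := zeta8_mul_conj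
    rw [mul_conj] at this
    exact_mod_cast this
  have hs := zeta8_mul_sqrt
  have hq := zeta8_sq
  have hs2 : ((Real.sqrt 2 : ℝ) : ℂ) ^ 2 = 2 := by
    rw [← ofReal_pow, Real.sq_sqrt (by norm_num)]; norm_num
  have hn : normSq (zeta8 * (m + n * I)) = (m : ℝ) ^ 2 + (n : ℝ) ^ 2 := by
    rw [map_mul, hz, one_mul]
    simp [normSq_apply]; ring
  have hI : (I : ℂ) ≠ 1 := fun h => by simpa using congrArg Complex.re h
  have hI' : (I : ℂ) ≠ -1 := fun h => by simpa using congrArg Complex.re h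
  have hI2 : (I : ℂ) ≠ -I := fun h => by have := congrArg Complex.im h; norm_num at this
  have h1 : (1 : ℂ) ≠ -1 := by norm_num
  have hc : k = 1 ∨ k = -1 ∨ k = I ∨ k = -I := by
    have : (k - 1) * ((k + 1) * ((k - I) * (k + I))) = 0 := by linear_combination hk4 + (1 - k ^ 2) * I_sq
    simpa only [mul_eq_zero, sub_eq_zero, add_eq_zero_iff_eq_neg] using this
  rcases hc with rfl | rfl | rfl | rfl
  all_goals
    have hre := congrArg Complex.re hk
    have him := congrArg Complex.im hk
    simp at hre him
    rw [hn]
  · have h0 : (n : ℝ) = 0 := by linarith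
    have h0' : (n : ℂ) = 0 := by exact_mod_cast h0
    refine ⟨m, fun h => ?_, fun h => ?_, fun _ => ?_, fun h => ?_, fun h => ?_, fun _ => ?_⟩
    · exact absurd (by linear_combination h) hI'
    · exact absurd h.symm hI
    · rw [h0']; ring
    · exact absurd h h1
    · norm_num at h
    · rw [h0]; ring
  · have h0 : (m : ℝ) = 0 := by linarith
    have h0' : (m : ℂ) = 0 := by exact_mod_cast h0
    refine ⟨n, fun h => ?_, fun h => ?_, fun h => ?_, fun _ => ?_, fun h => ?_, fun _ => ?_⟩
    · exact absurd (by linear_combination h) hI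
    · exact absurd h.symm hI'
    · exact absurd h.symm h1
    · rw [h0']; ring
    · norm_num at h
    · rw [h0]; ring
  · have h0 : (n : ℝ) = -m := by linarith
    have h0' : (n : ℂ) = -m := by exact_mod_cast h0
    refine ⟨m, fun h => ?_, fun _ => ?_, fun h => ?_, fun h => ?_, fun _ => ?_, fun h => ?_⟩
    · exact absurd h hI2
    · rw [h0']
      linear_combination (m : ℂ) * (((Real.sqrt 2 : ℝ) : ℂ) * (1 - I) / 2 * hs - zeta8 * (1 - I) / 2 * hs2 - ((Real.sqrt 2 : ℝ) : ℂ) / 2 * I_sq)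
    · exact absurd h hI
    · exact absurd h hI'
    · rw [h0]; ring
    · norm_num at h
  · have h0 : (n : ℝ) = m := by rw [hre]
    have h0' : (n : ℂ) = m := by exact_mod_cast h0
    refine ⟨m, fun _ => ?_, fun h => ?_, fun h => ?_, fun h => ?_, fun _ => ?_, fun h => ?_⟩
    · rw [h0']
      linear_combination (m : ℂ) * (((Real.sqrt 2 : ℝ) : ℂ) * (1 + I) / 2 * hs - zeta8 * (1 + I) / 2 * hs2 + ((Real.sqrt 2 : ℝ) : ℂ) / 2 * I_sq)
    · exact absurd h.symm hI2
    · exact absurd (by linear_combination -h) hI'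
    · exact absurd (by linear_combination -h) hI
    · rw [h0]; ring
    · norm_num at h

theorem mem_O4_iff {z : ℂ} : z ∈ O4 ↔ IsLat z := by
  refine ⟨fun h => ?_, ?_⟩
  · rw [O4] at h
    induction h using Subring.closure_induction with
    | mem x hx => rw [Set.mem_singleton_iff.mp hx]; exact isLat_I
    | zero => exact isLat_zero
    | one => exact isLat_one
    | add x y _ _ hx hy => exact hx.add hy
    | neg x _ hx => exact hx.neg
    | mul x y _ _ hx hy => exact hx.mul hy
  · rintro ⟨m, n, rfl⟩
    exact add_mem (intCast_mem _ m) (mul_mem (intCast_mem _ n) (Subring.subset_closure rfl))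

theorem exists_valuationSubring {P : O8} (hP : Prime P) : ∃ A : ValuationSubring ℂ, ∀ d : O8, A.valuation ((P : ℂ) * d) < 1 := by
  obtain ⟨B, -, h⟩ := Ideal.image_subset_nonunits_valuationSubring (K := ℂ) (A := O8) (Ideal.span {P})
    (fun h => hP.not_isUnit (Ideal.span_singleton_eq_top.mp h))
  refine ⟨B, fun d => ?_⟩
  rw [← ValuationSubring.mem_nonunits_iff]
  exact h ⟨P * d, Ideal.mul_mem_right _ _ (Ideal.mem_span_singleton_self P), rfl⟩

theorem exists_primaryPrime {p : ℕ} (hp : p.Prime) (hp8 : p % 8 = 1) {π : ℂ} (hπ : π ∈ O4)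
    (hprimary : GCong π 1 ((1 + I) ^ 3)) (hnorm : (p : ℂ) = π * (starRingEnd ℂ) π) :
    ∃ d j, PrimaryPrime p π d j := by
  obtain ⟨d, hd, e⟩ := hprimary
  obtain ⟨a, b, hab⟩ := mem_O4_iff.mp hπ
  have hn : (p : ℤ) = a ^ 2 + b ^ 2 := by
    have : ((p : ℤ) : ℂ) = ((a ^ 2 + b ^ 2 : ℤ) : ℂ) := by
      push_cast
      rw [hnorm, hab]
      simp
      linear_combination -(b : ℂ) ^ 2 * I_sq
    exact_mod_cast this
  have := Fact.mk hp
  have hp0 : (p : ℂ) ≠ 0 := by exact_mod_cast hp.ne_zero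
  have hb : (b : ZMod p) ≠ 0 := fun h => by
    have hb := (ZMod.intCast_zmod_eq_zero_iff_dvd b p).mp h
    have ha : (p : ℤ) ∣ a := (Nat.prime_iff_prime_int.mp hp).dvd_of_dvd_pow
      (n := 2) (by rw [show a ^ 2 = p - b * b by rw [hn]; ring]; exact dvd_sub dvd_rfl (hb.mul_right b))
    obtain ⟨a', rfl⟩ := ha
    obtain ⟨b', rfl⟩ := hb
    have h1 : (p : ℤ) * (p * (a' ^ 2 + b' ^ 2)) = p * 1 := by linear_combination -hn
    have h2 := mul_left_cancel₀ (by exact_mod_cast hp.ne_zero) h1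
    exact hp.one_lt.ne' (by exact_mod_cast Int.eq_one_of_mul_eq_one_right (Int.natCast_nonneg p) h2)
  obtain ⟨j, hj⟩ := ZMod.intCast_surjective (-(a : ZMod p) / (b : ZMod p))
  obtain ⟨s, hs⟩ : (p : ℤ) ∣ a + j * b := by
    rw [← ZMod.intCast_zmod_eq_zero_iff_dvd]
    push_cast
    rw [hj]; field_simp; ring
  obtain ⟨t, ht⟩ : (p : ℤ) ∣ j * a - b := by
    have : ((j * a - b : ℤ) : ZMod p) = 0 := by
      have h := congrArg (Int.cast : ℤ → ZMod p) hn
      have h' : ((a ^ 2 + b ^ 2 : ℤ) : ZMod p) = 0 := by rw [← h]; simp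
      push_cast at h' ⊢
      rw [hj]; field_simp; linear_combination -h'
    exact (ZMod.intCast_zmod_eq_zero_iff_dvd _ p).mp this
  refine ⟨d, j, hp, hp8, mem_O4_iff.mp hπ, mem_O4_iff.mp hd, ?_, hnorm, (t : ℂ) + ((-s : ℤ) : ℂ) * I, ⟨t, -s, rfl⟩, ?_⟩
  · linear_combination e + d * (3 + I) * I_sq
  · have ht' := congrArg (Int.cast : ℤ → ℂ) ht
    have hs' := congrArg (Int.cast : ℤ → ℂ) hs
    push_cast at ht' hs' ⊢
    have hc : (starRingEnd ℂ) π = a - b * I := by rw [hab]; simp; ring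
    apply mul_left_cancel₀ hp0
    rw [hc] at hnorm
    linear_combination ((j : ℂ) - I) * hnorm + π * ht' - π * I * hs' + π * b * I_sq

end

section
open Filter Topology Set

theorem mem_units_iff {ε : ℂ} : ε ∈ ({1, -1, I, -I} : Set ℂ) ↔ ∃ e < 4, ε = I ^ e := by
  constructor
  · rintro (rfl | rfl | rfl | rfl)
    · exact ⟨0, by norm_num, by simp⟩
    · exact ⟨2, by norm_num, by simp⟩
    · exact ⟨1, by norm_num, by simp⟩
    · exact ⟨3, by norm_num, by rw [I_pow_three]⟩
  · rintro ⟨e, he, rfl⟩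
    interval_cases e <;> simp [I_pow_three]

namespace PrimaryPrime
variable {p : ℕ} {π d : ℂ} {j : ℤ} [Fact p.Prime] {χ : ℂ → ℂ} {S : Finset ℂ}

theorem gCong_iff (H : PrimaryPrime p π d j) {a b : ℂ} (ha : IsLat a) (hb : IsLat b) :
    GCong a b π ↔ red p j a = red p j b := by
  rw [← sub_eq_zero, ← red_sub ha hb, H.red_eq_zero_iff (ha.sub hb)]
  simp only [GCong, mem_O4_iff]

theorem gCoprime_iff (H : PrimaryPrime p π d j) {ν : ℂ} (hν : IsLat ν) : GCoprime ν π ↔ red p j ν ≠ 0 := by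
  constructor
  · rintro ⟨u, hu, v, hv, h⟩ h0
    have hu := mem_O4_iff.mp hu
    have hv := mem_O4_iff.mp hv
    have := congrArg (red p j) h
    rw [red_add (hu.mul hν) (hv.mul H.lat), H.red_mul hu hν, H.red_mul hv H.lat, h0, H.red_pi, red_one] at this
    simp at this
  · intro h
    have hu := isLat_nat (red p j ν)⁻¹.val
    have : red p j (1 - (red p j ν)⁻¹.val * ν) = 0 := by
      rw [red_sub isLat_one (hu.mul hν), H.red_mul hu hν, red_one, red_val, inv_mul_cancel₀ h, sub_self]
    obtain ⟨l, hl, e⟩ := (H.red_eq_zero_iff (isLat_one.sub (hu.mul hν))).mp this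
    exact ⟨_, mem_O4_iff.mpr hu, l, mem_O4_iff.mpr hl, by linear_combination -e⟩

theorem exists_mulChar (H : PrimaryPrime p π d j) (hχ : IsQuarticChar π p χ) :
    ∃ X : MulChar (ZMod p) ℂ, QuarticChar p j X ∧ ∀ z, IsLat z → χ z = X (red p j z) := by
  have hper : ∀ {z w : ℂ}, IsLat z → IsLat w → red p j z = red p j w → χ z = χ w := fun hz hw h =>
    hχ.resChar.periodic _ (mem_O4_iff.mpr hz) _ (mem_O4_iff.mpr hw) ((H.gCong_iff hz hw).mpr h)
  have hval := fun a : ZMod p => isLat_nat a.val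
  let X : MulChar (ZMod p) ℂ :=
    { toFun := fun a => χ a.val
      map_one' := by
        rw [← hχ.resChar.map_one]
        exact hper (hval _) isLat_one (by rw [red_val, red_one])
      map_mul' := fun a b => by
        rw [← hχ.resChar.map_mul _ (mem_O4_iff.mpr (hval a)) _ (mem_O4_iff.mpr (hval b))]
        exact hper (hval _) ((hval a).mul (hval b)) (by rw [H.red_mul (hval a) (hval b)]; simp only [red_val])
      map_nonunit' := fun a ha => hχ.resChar.vanish _ (mem_O4_iff.mpr (hval a)) fun h => by
        rw [H.gCoprime_iff (hval a), red_val] at h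
        exact ha h.isUnit }
  have hX : ∀ a, X a = χ a.val := fun a => rfl
  have hcop : ∀ a : ZMod p, a ≠ 0 → GCoprime a.val π := fun a ha => (H.gCoprime_iff (hval a)).mpr (by rwa [red_val])
  have hlat : ∀ a, IsLat (X a) := fun a => by
    by_cases ha : a = 0
    · rw [ha, MulChar.map_zero]; exact isLat_zero
    obtain ⟨l, hl, e⟩ := hχ.euler _ (mem_O4_iff.mpr (hval a)) (hcop a ha)
    rw [hX, eq_add_of_sub_eq e]
    exact (H.lat.mul (mem_O4_iff.mp hl)).add ((hval a).pow _)
  refine ⟨X, ⟨hlat, fun a ha => hχ.quart _ (mem_O4_iff.mpr (hval a)) (hcop a ha), fun a ha => ?_⟩, fun z hz => ?_⟩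
  · rw [(H.gCong_iff (hlat a) ((hval a).pow _)).mp (hχ.euler _ (mem_O4_iff.mpr (hval a)) (hcop a ha)),
      H.red_pow (hval a), red_val]
  · exact hper hz (hval _) (by rw [red_val])

theorem red_ne_zero_of_mem (H : PrimaryPrime p π d j) (hS : IsQuarterSet π S) {ν : ℂ} (hν : ν ∈ S) :
    IsLat ν ∧ red p j ν ≠ 0 := by
  have h := hS.1 ν hν
  have hl := mem_O4_iff.mp h.1
  exact ⟨hl, (H.gCoprime_iff hl).mp h.2⟩

theorem quarterSet_image (H : PrimaryPrime p π d j) (hS : IsQuarterSet π S) : QuarterSet p j (S.image (red p j)) := by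
  have hu : ∀ {ν : ℂ} (e : ℕ), IsLat ν → red p j (I ^ e * ν) = (j : ZMod p) ^ e * red p j ν := fun e hν => by
    rw [H.red_mul (isLat_I.pow e) hν, H.red_pow isLat_I, red_I]
  refine ⟨fun t ht => ?_, fun a ha => ?_, fun s hs t ht e he e' he' h => ?_⟩
  · obtain ⟨ν, hν, rfl⟩ := Finset.mem_image.mp ht
    exact (H.red_ne_zero_of_mem hS hν).2
  · have hl := isLat_nat a.val
    obtain ⟨ν, hν, ε, hε, h⟩ := hS.2.1 a.val (mem_O4_iff.mpr hl) ((H.gCoprime_iff hl).mpr (by rwa [red_val]))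
    obtain ⟨e, he, rfl⟩ := mem_units_iff.mp hε
    have hνl := (H.red_ne_zero_of_mem hS hν).1
    refine ⟨_, Finset.mem_image_of_mem _ hν, e, he, ?_⟩
    rw [← hu e hνl, ← (H.gCong_iff hl ((isLat_I.pow e).mul hνl)).mp h, red_val]
  · obtain ⟨ν, hν, rfl⟩ := Finset.mem_image.mp hs
    obtain ⟨μ, hμ, rfl⟩ := Finset.mem_image.mp ht
    have hνl := (H.red_ne_zero_of_mem hS hν).1
    have hμl := (H.red_ne_zero_of_mem hS hμ).1
    rw [← hu e hνl, ← hu e' hμl, ← H.gCong_iff ((isLat_I.pow e).mul hνl) ((isLat_I.pow e').mul hμl)] at h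
    obtain ⟨h1, h2⟩ := hS.2.2 ν hν μ hμ _ (mem_units_iff.mpr ⟨e, he, rfl⟩) _ (mem_units_iff.mpr ⟨e', he', rfl⟩) h
    refine ⟨by rw [h1], ?_⟩
    have hI : (I : ℂ) ≠ 1 := fun h => by simpa using congrArg Complex.re h
    have hI' : (I : ℂ) ≠ -1 := fun h => by simpa using congrArg Complex.re h
    have hI2 : (I : ℂ) ≠ -I := fun h => by have := congrArg Complex.im h; norm_num at this
    have hI3 : (1 : ℂ) ≠ -I := fun h => by simpa using congrArg Complex.re h
    have h1 : (1 : ℂ) ≠ -1 := by norm_num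
    interval_cases e <;> interval_cases e' <;> simp_all [I_pow_three, neg_eq_iff_eq_neg, eq_comm]

theorem injOn_red (H : PrimaryPrime p π d j) (hS : IsQuarterSet π S) : Set.InjOn (red p j) S := fun ν hν μ hμ h => by
  refine (hS.2.2 ν hν μ hμ 1 (by simp) 1 (by simp) ?_).1
  rw [one_mul, one_mul]
  exact (H.gCong_iff (H.red_ne_zero_of_mem hS hν).1 (H.red_ne_zero_of_mem hS hμ).1).mpr h

theorem isLat_prod_set (H : PrimaryPrime p π d j) (hS : IsQuarterSet π S) :
    IsLat (∏ ν ∈ S, ν) ∧ red p j (∏ ν ∈ S, ν) = ∏ t ∈ S.image (red p j), t := by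
  classical
  rw [Finset.prod_image (H.injOn_red hS)]
  have h := fun ν (hν : ν ∈ S) => (H.red_ne_zero_of_mem hS hν).1
  clear hS
  induction S using Finset.induction_on with
  | empty => simpa using ⟨isLat_one, red_one⟩
  | insert a s ha ih =>
    obtain ⟨h1, h2⟩ := ih fun ν hν => h ν (Finset.mem_insert_of_mem hν)
    have h0 := h a (Finset.mem_insert_self a s)
    rw [Finset.prod_insert ha, Finset.prod_insert ha, H.red_mul h0 h1, h2]
    exact ⟨h0.mul h1, rfl⟩

theorem not_isLat_four_mul_div (H : PrimaryPrime p π d j) {ν : ℂ} (hν : IsLat ν) (h : red p j ν ≠ 0) :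
    ¬ IsLat (4 * (ν / π)) := by
  rw [show 4 * (ν / π) = (2 * (2 * ν)) / π by ring, H.isLat_div_iff (isLat_two.mul (isLat_two.mul hν)),
    H.red_mul isLat_two (isLat_two.mul hν), H.red_mul isLat_two hν, red_two]
  exact mul_ne_zero H.two_ne (mul_ne_zero H.two_ne h)

theorem prod_phi4 (H : PrimaryPrime p π d j) (hS : IsQuarterSet π S) :
    ∏ ν ∈ S, phi4 (ν / π) = ∏ t ∈ S.image (red p j), tor π phi t := by
  rw [Finset.prod_image (H.injOn_red hS)]
  refine Finset.prod_congr rfl fun ν hν => ?_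
  obtain ⟨hl, h0⟩ := H.red_ne_zero_of_mem hS hν
  rw [H.tor_red phi_add_lat hl, phi4_eq (H.not_isLat_four_mul_div hl h0)]

theorem EGS4_eq (H : PrimaryPrime p π d j) {X : MulChar (ZMod p) ℂ} (hX : ∀ z, IsLat z → χ z = X (red p j z)) :
    EGS4 p χ psi4 π = ellSum π X := by
  have hp := H.prime.pos
  rw [EGS4, ellSum, sum_zmod_eq_sum_range, Finset.range_eq_Ico, Finset.sum_eq_sum_Ico_succ_bot hp]
  simp only [Nat.cast_zero, MulChar.map_zero, zero_mul, zero_add]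
  congr 1
  have hs : Finset.Icc 1 (p - 1) = Finset.Ico 1 p := by ext; simp; omega
  rw [hs]
  refine Finset.sum_congr rfl fun r hr => ?_
  rw [Finset.mem_Ico] at hr
  have hl := isLat_nat r
  have h0 : red p j (r : ℂ) ≠ 0 := by
    rw [red_nat, Ne, ZMod.natCast_eq_zero_iff]
    exact fun h => absurd (Nat.le_of_dvd hr.1 h) (by omega)
  rw [hX _ hl, psi4_eq (H.not_isLat_four_mul_div hl h0), ← red_nat (p := p) (j := j) r, H.tor_red psi_add_lat hl]

end PrimaryPrime

theorem exists_coeff {γ b c δ k : ℂ} (hb : IsLat b) (hγ : γ ^ 4 = -1)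
    (h : γ ^ 2 * (δ * c) * b = (starRingEnd ℂ) ((1 + I) / 2 + (1 - I) / 2 * δ) * (starRingEnd ℂ) b)
    (hk : δ = 1 ∧ k = -(c * I) ∨ δ = -1 ∧ k = -c) :
    ∃ b', IsLat b' ∧ γ ^ 3 * b = zeta8 * b' ∧ (starRingEnd ℂ) b' = k * b' := by
  have h8 : zeta8 ^ 4 = -1 := by rw [show zeta8 ^ 4 = (zeta8 ^ 2) ^ 2 by ring, zeta8_sq, I_sq]
  have hz0 : zeta8 ≠ 0 := fun h => by rw [h] at h8; norm_num at h8
  have hg0 : γ ≠ 0 := fun h => by rw [h] at hγ; norm_num at hγ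
  obtain ⟨u, hu⟩ : ∃ u, γ ^ 3 = zeta8 * u := ⟨γ ^ 3 / zeta8, by field_simp⟩
  have hu4 : u ^ 4 = 1 := by
    have := congrArg (· ^ 4) hu
    beta_reduce at this
    rw [mul_pow, h8, show (γ ^ 3) ^ 4 = (γ ^ 4) ^ 3 by ring, hγ] at this
    linear_combination this
  have hc : u = 1 ∨ u = -1 ∨ u = I ∨ u = -I := by
    have : (u - 1) * ((u + 1) * ((u - I) * (u + I))) = 0 := by linear_combination hu4 + (1 - u ^ 2) * I_sq
    simpa only [mul_eq_zero, sub_eq_zero, add_eq_zero_iff_eq_neg] using this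
  have hul : IsLat u := by
    rcases hc with rfl | rfl | rfl | rfl
    exacts [isLat_one, isLat_one.neg, isLat_I, isLat_I.neg]
  have huc : u * (starRingEnd ℂ) u = 1 := by rcases hc with rfl | rfl | rfl | rfl <;> simp
  have h' : (starRingEnd ℂ) b * I = -(γ ^ 2 * k * b) := by
    rcases hk with ⟨rfl, rfl⟩ | ⟨rfl, rfl⟩
    · simp [Complex.conj_ofNat, map_div₀] at h
      linear_combination -I * h
    · simp [Complex.conj_ofNat, map_div₀] at h
      linear_combination h
  refine ⟨u * b, hul.mul hb, by rw [hu]; ring, ?_⟩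
  have hu2 : γ ^ 2 = -I * u ^ 2 := by
    have e : γ ^ 2 * γ ^ 4 = I * u ^ 2 := by
      rw [← zeta8_sq]; linear_combination (γ ^ 3 + zeta8 * u) * hu
    rw [hγ] at e
    linear_combination -e
  rw [map_mul]
  rw [hu2] at h'
  have hI : (I : ℂ) ≠ 0 := I_ne_zero
  have h3 : (starRingEnd ℂ) b = u ^ 2 * k * b := mul_right_cancel₀ hI (by linear_combination h')
  rw [h3]
  linear_combination u * k * b * huc

end

/-- **Corollary II.2.** Let `π ∈ ℤ[i]` be a primary prime with `p = π·π̄ ≡ 1 (mod 8)`.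
Then there exists a rational integer `a_π` such that the coefficient
`α_π = π̃⁻³·G_π(χ_π, ψ)` of the elliptic Gauss sum satisfies: if `p ≡ 1 (mod 16)`,
`α_π = a_π·i√2, a_π·√2, a_π·ζ₈, a_π·i·ζ₈` according as `χ_π(1+i) = 1, −1, i, −i`;
and if `p ≡ 9 (mod 16)`, `α_π = a_π·i·ζ₈, a_π·ζ₈, a_π·i√2, a_π·√2` according as
`χ_π(1+i) = 1, −1, i, −i`. In particular `|α_π|² = 2·a_π²` if `χ_π(2) = 1` and
`|α_π|² = a_π²` if `χ_π(2) = −1`. -/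
theorem stmt_16
    (p : ℕ) (hp : p.Prime) (hp8 : p % 8 = 1)
    (π : ℂ) (hπ : π ∈ O4) (hprimary : GCong π 1 ((1 + Complex.I) ^ 3))
    (hnorm : (p : ℂ) = π * (starRingEnd ℂ) π)
    (χ : ℂ → ℂ) (hχ : IsQuarticChar π p χ)
    (S : Finset ℂ) (hS : IsQuarterSet π S)
    (γ : ℂ) (hγ : IsGamma4 π p S γ)
    (πt : ℂ) (hπt : πt = γ⁻¹ * ∏ ν ∈ S, phi4 (ν / π))
    (α : ℂ) (hα : α = (πt ^ 3)⁻¹ * EGS4 p χ psi4 π) :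
    ∃ a : ℤ,
      (p % 16 = 1 →
        (χ (1 + Complex.I) = 1 →
          α = (a : ℂ) * Complex.I * ((Real.sqrt 2 : ℝ) : ℂ)) ∧
        (χ (1 + Complex.I) = -1 → α = (a : ℂ) * ((Real.sqrt 2 : ℝ) : ℂ)) ∧
        (χ (1 + Complex.I) = Complex.I → α = (a : ℂ) * zeta8) ∧
        (χ (1 + Complex.I) = -Complex.I → α = (a : ℂ) * Complex.I * zeta8)) ∧
      (p % 16 = 9 →
        (χ (1 + Complex.I) = 1 → α = (a : ℂ) * Complex.I * zeta8) ∧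
        (χ (1 + Complex.I) = -1 → α = (a : ℂ) * zeta8) ∧
        (χ (1 + Complex.I) = Complex.I →
          α = (a : ℂ) * Complex.I * ((Real.sqrt 2 : ℝ) : ℂ)) ∧
        (χ (1 + Complex.I) = -Complex.I → α = (a : ℂ) * ((Real.sqrt 2 : ℝ) : ℂ))) ∧
      (χ 2 = 1 → Complex.normSq α = 2 * (a : ℝ) ^ 2) ∧
      (χ 2 = -1 → Complex.normSq α = (a : ℝ) ^ 2) := by
  have := Fact.mk hp
  obtain ⟨d, j, H⟩ := exists_primaryPrime hp hp8 hπ hprimary hnorm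
  obtain ⟨X, hX, hχX⟩ := H.exists_mulChar hχ
  have hT := H.quarterSet_image hS
  obtain ⟨hγ4, P, hP, ⟨Q, hPQ⟩, D, hD, hγP⟩ := hγ.2 hp8
  obtain ⟨A, hA⟩ := exists_valuationSubring hP
  obtain ⟨hg, hgT⟩ := H.isLat_prod_set hS
  have key := H.coeff_eq hT hX (by rw [hPQ]; exact hA Q) hγ4 hg hgT (by rw [hγP]; exact hA ⟨D, hD⟩)
  have hb := H.isLat_ellSum_div hT hX
  rw [hπt, H.prod_phi4 hS, H.EGS4_eq hχX, mul_pow, mul_inv, inv_pow, inv_inv, mul_assoc, mul_comm _ (ellSum π X),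
    ← div_eq_mul_inv] at hα
  have hc : χ (1 + I) = X j * X (1 - (j : ZMod p)) := by
    rw [hχX _ (isLat_one.add isLat_I), red_add isLat_one isLat_I, red_one, red_I, ← map_mul]
    congr 1
    linear_combination H.sq_j
  have h2 : χ 2 = X j * (X (1 - (j : ZMod p))) ^ 2 := by
    rw [hχX _ isLat_two, red_two, ← map_pow, ← map_mul]
    congr 1
    linear_combination (2 - (j : ZMod p)) * H.sq_j
  have hc4 : χ (1 + I) ^ 4 = 1 := by
    rw [hc, mul_pow, hX.pow_four _ H.j_ne, hX.pow_four _ H.one_sub_j_ne, one_mul]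
  have hδ2 : X j ^ 2 = 1 := by rcases H.X_j_cases hX with h | h <;> rw [h] <;> norm_num
  have hX1 : X (1 - (j : ZMod p)) = X j * χ (1 + I) := by
    rw [hc]; linear_combination -X (1 - (j : ZMod p)) * hδ2
  have h2' : χ 2 = X j * χ (1 + I) ^ 2 := by
    rw [h2, hX1]; linear_combination X j * χ (1 + I) ^ 2 * hδ2
  rw [hX1] at key
  have hcase : (p % 16 = 1 ∧ X j = 1) ∨ (p % 16 = 9 ∧ X j = -1) := by
    rw [H.X_j hX]
    rcases (by omega : p % 16 = 1 ∨ p % 16 = 9) with h | h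
    · exact Or.inl ⟨h, Even.neg_one_pow (Nat.even_iff.mpr (by omega))⟩
    · exact Or.inr ⟨h, Odd.neg_one_pow (Nat.odd_iff.mpr (by omega))⟩
  rcases hcase with ⟨h16, hδ⟩ | ⟨h16, hδ⟩
  · obtain ⟨b, hbl, hbα, hbc⟩ := exists_coeff hb hγ4 key (Or.inl ⟨hδ, rfl⟩)
    rw [hbα] at hα
    obtain ⟨a, a1, a2, a3, a4, a5, a6⟩ := eq_of_conj_eq hbl hbc
      (by linear_combination I ^ 4 * hc4 + I_pow_four)
    rw [hδ, one_mul] at h2'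
    rw [hα, h2']
    refine ⟨a, fun _ => ⟨fun h => a1 ?_, fun h => a2 ?_, fun h => a3 ?_, fun h => a4 ?_⟩, fun h => by omega,
      fun h => a5 ?_, fun h => a6 ?_⟩
    · rw [h]; ring
    · rw [h]; ring
    · rw [h]; linear_combination -I_sq
    · rw [h]; linear_combination I_sq
    · linear_combination I ^ 2 * h + I_sq
    · linear_combination I ^ 2 * h - I_sq
  · obtain ⟨b, hbl, hbα, hbc⟩ := exists_coeff hb hγ4 key (Or.inr ⟨hδ, rfl⟩)
    rw [hbα] at hα
    obtain ⟨a, a1, a2, a3, a4, a5, a6⟩ := eq_of_conj_eq hbl hbc (by linear_combination hc4)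
    rw [hδ, neg_one_mul] at h2'
    rw [hα, h2']
    refine ⟨a, fun h => by omega, fun _ => ⟨fun h => a4 ?_, fun h => a3 ?_, fun h => a1 ?_, fun h => a2 ?_⟩,
      fun h => a5 ?_, fun h => a6 ?_⟩
    · rw [h]
    · rw [h]; ring
    · rw [h]
    · rw [h]; ring
    · linear_combination -h
    · linear_combination -h

end
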